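/- Let a₁, a₂, a₃ > 0 with 2a₂ = a₃, let I ⊂ ℝ be a bounded interval containing 0, and let φ ∈ C^∞(I) satisfy φ(0) ≠ 0 and φ′(0) ≠ 0. Let 1 < p, q < ∞ satisfy 1/(2p) < 1/q ≤ 1/p and 1/q > 3/p − 1. Then there exists a neighborhood U of the origin of ℝ² such that for every cutoff η ∈ C₀^∞(ℝ²) supported in U there exists a constant C = C(p, q, φ, η, a₁, a₂) with ‖Mf‖_{L^q(ℝ³)} ≤ C ‖f‖_{L^p(ℝ³)} for all f ∈ C₀^∞(ℝ³), where Mf(y) = sup_{t∈[1,2]} |∫_{ℝ²} f(y − δ_t(x₁, x₂, x₂² φ(x₂))) η(x) dx|. -/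

import Mathlib

open MeasureTheory Set
open scoped ENNReal

/-- The maximal operator associated with the hypersurface `(x₁, x₂, x₂² φ(x₂))` in `ℝ³` and
the nonisotropic dilations `δ_t(x) = (t^{a₁}x₁, t^{a₂}x₂, t^{a₃}x₃)`, with supremum over
`t ∈ [1,2]`:
`M f (y) = sup_{t ∈ [1,2]} |∫_{ℝ²} f(y - δ_t(x₁, x₂, x₂² φ(x₂))) η(x) dx|`. -/
noncomputable def maxOpSurfCurve (a₁ a₂ a₃ : ℝ) (φ : ℝ → ℝ) (η : ℝ × ℝ → ℝ)
    (f : ℝ × ℝ × ℝ → ℝ) (y : ℝ × ℝ × ℝ) : ℝ :=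
  ⨆ t : Set.Icc (1 : ℝ) 2,
    |∫ x : ℝ × ℝ, f (y.1 - (t : ℝ) ^ a₁ * x.1, y.2.1 - (t : ℝ) ^ a₂ * x.2,
        y.2.2 - (t : ℝ) ^ a₃ * (x.2 ^ 2 * φ x.2)) * η x|

open ENNReal (ofReal ofReal_le_ofReal ofReal_ne_top ofReal_mul)

namespace MS

/-- Cauchy–Schwarz in `ENNReal` form. -/
theorem cs_lintegral {T : Type*} [MeasurableSpace T] (ν : Measure T) (f h : T → ℝ)
    (hf : AEMeasurable f ν) (hh : AEMeasurable h ν) :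
    ofReal ((∫ t, f t * h t ∂ν) ^ 2) ≤
      (∫⁻ t, ofReal (f t ^ 2) ∂ν) * ∫⁻ t, ofReal (h t ^ 2) ∂ν := by
  have h1 : ofReal |∫ t, f t * h t ∂ν| ≤
      ∫⁻ t, (fun t => ofReal |f t|) t * (fun t => ofReal |h t|) t ∂ν := by
    have := enorm_integral_le_lintegral_enorm (μ := ν) (fun t => f t * h t)
    rw [Real.enorm_eq_ofReal_abs] at this
    refine this.trans (le_of_eq (lintegral_congr fun t => ?_))
    rw [Real.enorm_eq_ofReal_abs, abs_mul, ofReal_mul (abs_nonneg _)]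
  have h2 := ENNReal.lintegral_mul_le_Lp_mul_Lq ν (p := 2) (q := 2)
    (by exact (Real.HolderConjugate.two_two)) (f := fun t => ofReal |f t|)
    (g := fun t => ofReal |h t|) (by fun_prop) (by fun_prop)
  have h3 := h1.trans h2
  have e : ∀ x : ℝ, ofReal |x| ^ (2:ℝ) = ofReal (x ^ 2) := by
    intro x
    rw [ENNReal.ofReal_rpow_of_nonneg (abs_nonneg _) (by norm_num)]
    norm_num
  simp only [e] at h3
  have h4 : ofReal ((∫ t, f t * h t ∂ν) ^ 2) = ofReal |∫ t, f t * h t ∂ν| ^ (2:ℝ) := (e _).symm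
  rw [h4]
  calc _ ≤ _ := ENNReal.rpow_le_rpow h3 (by norm_num : (0:ℝ) ≤ 2)
    _ = _ := by
      rw [ENNReal.mul_rpow_of_nonneg _ _ (by norm_num), ← ENNReal.rpow_mul, ← ENNReal.rpow_mul]
      norm_num

theorem tt_bilinear {Ω T : Type*} [MeasurableSpace Ω] [MeasurableSpace T]
    (μ : Measure Ω) [IsFiniteMeasure μ] (ν : Measure T) [SigmaFinite ν]
    (K : Ω → T → ℝ) (hK : Measurable (Function.uncurry K)) (B C1 : ℝ)
    (hB : ∀ ω t, |K ω t| ≤ B) (hC : ∀ ω, ∫⁻ t, ofReal |K ω t| ∂ν ≤ ofReal C1)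
    (f : T → ℝ) (hf : Measurable f) (F : ℝ) (hF : ∀ t, |f t| ≤ F)
    (g : Ω → ℝ) (hg : Measurable g) (A : ℝ) (hA : ∀ ω, |g ω| ≤ A) :
    ofReal ((∫ ω, g ω * ∫ t, K ω t * f t ∂ν ∂μ) ^ 2) ≤
      (∫⁻ t, ofReal (f t ^ 2) ∂ν) *
        ∫⁻ ω, ∫⁻ ω', ofReal (|g ω| * |g ω'| * |∫ t, K ω t * K ω' t ∂ν|) ∂μ ∂μ := by
  rcases isEmpty_or_nonempty Ω with hΩ | ⟨⟨ω0⟩⟩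
  · have : μ = 0 := by exact Measure.eq_zero_of_isEmpty μ
    simp [this]
  rcases isEmpty_or_nonempty T with hT | ⟨⟨t0⟩⟩
  · have : ν = 0 := by exact Measure.eq_zero_of_isEmpty ν
    simp [this]
  have hB0 : 0 ≤ B := (abs_nonneg _).trans (hB ω0 t0)
  have hF0 : 0 ≤ F := (abs_nonneg _).trans (hF t0)
  have hA0 : 0 ≤ A := (abs_nonneg _).trans (hA ω0)
  have hK' : Measurable fun z : Ω × T => K z.1 z.2 := hK
  -- integrability of K on the product
  have hKint : Integrable (fun z : Ω × T => K z.1 z.2) (μ.prod ν) := by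
    refine ⟨hK'.aestronglyMeasurable, ?_⟩
    rw [HasFiniteIntegral, lintegral_prod _ (by fun_prop)]
    simp only [Real.enorm_eq_ofReal_abs]
    calc _ ≤ ∫⁻ ω, ofReal C1 ∂μ := lintegral_mono fun ω => hC ω
      _ < ∞ := by
        rw [lintegral_const]; exact ENNReal.mul_lt_top ENNReal.ofReal_lt_top (measure_lt_top _ _)
  have hgKf : Integrable (fun z : Ω × T => g z.1 * (K z.1 z.2 * f z.2)) (μ.prod ν) := by
    refine (hKint.norm.const_mul (A * F)).mono' (by
      exact ((hg.comp measurable_fst).mul (hK'.mul (hf.comp measurable_snd))).aestronglyMeasurable) ?_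
    refine Filter.Eventually.of_forall fun z => ?_
    rw [norm_mul, norm_mul]
    calc ‖g z.1‖ * (‖K z.1 z.2‖ * ‖f z.2‖) ≤ A * (‖K z.1 z.2‖ * F) := by
          gcongr
          · exact hA _
          · exact hF _
      _ = _ := by ring
  set H : T → ℝ := fun t => ∫ ω, g ω * K ω t ∂μ with hH
  have hHm : Measurable H := by
    refine (StronglyMeasurable.integral_prod_right (f := fun t ω => g ω * K ω t) ?_).measurable
    refine Measurable.stronglyMeasurable ?_
    exact (hg.comp measurable_snd).mul (hK'.comp measurable_swap)
  have e1 : (∫ ω, g ω * ∫ t, K ω t * f t ∂ν ∂μ) = ∫ t, f t * H t ∂ν := by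
    have := integral_integral_swap (f := fun ω t => g ω * (K ω t * f t)) hgKf
    simp only [integral_const_mul] at this
    rw [this]
    refine integral_congr_ae (Filter.Eventually.of_forall fun t => ?_)
    simp only [hH]
    rw [← integral_const_mul]
    exact integral_congr_ae (Filter.Eventually.of_forall fun ω => by simp only; ring)
  rw [e1]
  refine (cs_lintegral ν f H hf.aemeasurable hHm.aemeasurable).trans ?_
  gcongr
  -- now the square of H
  have hP : Integrable (fun w : T × (Ω × Ω) => (g w.2.1 * K w.2.1 w.1) * (g w.2.2 * K w.2.2 w.1))
      (ν.prod (μ.prod μ)) := by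
    have hm : Measurable (fun w : T × (Ω × Ω) => (g w.2.1 * K w.2.1 w.1) * (g w.2.2 * K w.2.2 w.1)) := by
      have a1 : Measurable fun w : T × (Ω × Ω) => K w.2.1 w.1 :=
        hK'.comp (f := fun w : T × (Ω × Ω) => (w.2.1, w.1)) (by fun_prop)
      have a2 : Measurable fun w : T × (Ω × Ω) => K w.2.2 w.1 :=
        hK'.comp (f := fun w : T × (Ω × Ω) => (w.2.2, w.1)) (by fun_prop)
      fun_prop
    refine ⟨hm.aestronglyMeasurable, ?_⟩
    rw [HasFiniteIntegral, lintegral_prod_symm _ (by fun_prop)]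
    calc _ ≤ ∫⁻ w : Ω × Ω, ofReal (A * A * B) * ofReal C1 ∂(μ.prod μ) := by
          refine lintegral_mono fun w => ?_
          calc _ ≤ ∫⁻ t, ofReal (A * A * B) * ofReal |K w.1 t| ∂ν := by
                refine lintegral_mono fun t => ?_
                simp only [Real.enorm_eq_ofReal_abs]
                rw [← ofReal_mul (by positivity)]
                apply ofReal_le_ofReal
                rw [abs_mul, abs_mul, abs_mul]
                calc _ ≤ A * |K w.1 t| * (A * B) := by
                      gcongr
                      · exact hA _
                      · exact hA _
                      · exact hB _ _
                  _ = _ := by ring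
            _ ≤ _ := by
                rw [lintegral_const_mul' _ _ ofReal_ne_top]
                gcongr
                exact hC _
      _ < ∞ := by
        rw [lintegral_const]
        exact ENNReal.mul_lt_top (ENNReal.mul_lt_top ENNReal.ofReal_lt_top ENNReal.ofReal_lt_top) (measure_lt_top _ _)
  have e2 : ∀ t, H t ^ 2 = ∫ w : Ω × Ω, (g w.1 * K w.1 t) * (g w.2 * K w.2 t) ∂(μ.prod μ) := by
    intro t
    rw [integral_prod_mul (fun ω => g ω * K ω t) (fun ω => g ω * K ω t), sq]
  have hi : Integrable (fun t => H t ^ 2) ν := by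
    simp only [e2]
    exact hP.integral_prod_left
  rw [← ofReal_integral_eq_lintegral_ofReal hi (Filter.Eventually.of_forall fun t => sq_nonneg _)]
  have e3 : (∫ t, H t ^ 2 ∂ν) = ∫ w : Ω × Ω, g w.1 * g w.2 * ∫ t, K w.1 t * K w.2 t ∂ν ∂(μ.prod μ) := by
    simp only [e2]
    rw [integral_integral_swap (f := fun t (w : Ω × Ω) => (g w.1 * K w.1 t) * (g w.2 * K w.2 t)) hP]
    refine integral_congr_ae (Filter.Eventually.of_forall fun w => ?_)
    simp only
    rw [← integral_const_mul]
    exact integral_congr_ae (Filter.Eventually.of_forall fun ω => by simp only; ring)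
  rw [e3]
  have hk2 : Measurable fun w : Ω × Ω => ∫ t, K w.1 t * K w.2 t ∂ν := by
    refine (StronglyMeasurable.integral_prod_right (f := fun (w : Ω × Ω) t => K w.1 t * K w.2 t) ?_).measurable
    refine Measurable.stronglyMeasurable ?_
    have a1 : Measurable fun w : (Ω × Ω) × T => K w.1.1 w.2 :=
        hK'.comp (f := fun w : (Ω × Ω) × T => (w.1.1, w.2)) (by fun_prop)
    have a2 : Measurable fun w : (Ω × Ω) × T => K w.1.2 w.2 :=
        hK'.comp (f := fun w : (Ω × Ω) × T => (w.1.2, w.2)) (by fun_prop)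
    exact a1.mul a2
  calc _ ≤ ofReal |∫ w : Ω × Ω, g w.1 * g w.2 * ∫ t, K w.1 t * K w.2 t ∂ν ∂(μ.prod μ)| :=
        ofReal_le_ofReal (le_abs_self _)
    _ ≤ ∫⁻ w : Ω × Ω, ofReal (|g w.1| * |g w.2| * |∫ t, K w.1 t * K w.2 t ∂ν|) ∂(μ.prod μ) := by
        have := enorm_integral_le_lintegral_enorm (μ := μ.prod μ) (fun w : Ω × Ω => g w.1 * g w.2 * ∫ t, K w.1 t * K w.2 t ∂ν)
        rw [Real.enorm_eq_ofReal_abs] at this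
        refine this.trans (le_of_eq (lintegral_congr fun t => ?_))
        rw [Real.enorm_eq_ofReal_abs, abs_mul, abs_mul]
    _ = _ := by
        rw [lintegral_prod _ (by fun_prop)]

theorem tt_kernel_meas {Ω T : Type*} [MeasurableSpace Ω] [MeasurableSpace T]
    (ν : Measure T) [SigmaFinite ν]
    (K : Ω → T → ℝ) (hK : Measurable (Function.uncurry K)) :
    Measurable fun w : Ω × Ω => ∫ t, K w.1 t * K w.2 t ∂ν := by
  have hK' : Measurable fun z : Ω × T => K z.1 z.2 := hK
  refine (StronglyMeasurable.integral_prod_right (f := fun (w : Ω × Ω) t => K w.1 t * K w.2 t) ?_).measurable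
  refine Measurable.stronglyMeasurable ?_
  have a1 : Measurable fun w : (Ω × Ω) × T => K w.1.1 w.2 :=
      hK'.comp (f := fun w : (Ω × Ω) × T => (w.1.1, w.2)) (by fun_prop)
  have a2 : Measurable fun w : (Ω × Ω) × T => K w.1.2 w.2 :=
      hK'.comp (f := fun w : (Ω × Ω) × T => (w.1.2, w.2)) (by fun_prop)
  exact a1.mul a2

theorem tt_u_meas {Ω T : Type*} [MeasurableSpace Ω] [MeasurableSpace T]
    (ν : Measure T) [SigmaFinite ν]
    (K : Ω → T → ℝ) (hK : Measurable (Function.uncurry K)) (f : T → ℝ) (hf : Measurable f) :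
    Measurable fun ω => ∫ t, K ω t * f t ∂ν := by
  refine (StronglyMeasurable.integral_prod_right (f := fun ω t => K ω t * f t) ?_).measurable
  refine Measurable.stronglyMeasurable ?_
  have hK' : Measurable fun z : Ω × T => K z.1 z.2 := hK
  exact hK'.mul (hf.comp measurable_snd)

theorem tt_u_bound {Ω T : Type*} [MeasurableSpace Ω] [MeasurableSpace T]
    (ν : Measure T)
    (K : Ω → T → ℝ) (C1 : ℝ) (hC1 : 0 ≤ C1)
    (hC : ∀ ω, ∫⁻ t, ofReal |K ω t| ∂ν ≤ ofReal C1)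
    (f : T → ℝ) (F : ℝ) (hF0 : 0 ≤ F) (hF : ∀ t, |f t| ≤ F) (ω : Ω) :
    |∫ t, K ω t * f t ∂ν| ≤ C1 * F := by
  have := enorm_integral_le_lintegral_enorm (μ := ν) (fun t => K ω t * f t)
  rw [Real.enorm_eq_ofReal_abs] at this
  have h2 : ∫⁻ t, ‖K ω t * f t‖ₑ ∂ν ≤ ofReal (C1 * F) := by
    calc _ ≤ ∫⁻ t, ofReal |K ω t| * ofReal F ∂ν := by
          refine lintegral_mono fun t => ?_
          rw [Real.enorm_eq_ofReal_abs, abs_mul, ofReal_mul (abs_nonneg _)]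
          gcongr
          exact hF t
      _ ≤ _ := by
          rw [lintegral_mul_const' _ _ ofReal_ne_top, ofReal_mul hC1]
          gcongr
          exact hC ω
  exact (ENNReal.ofReal_le_ofReal_iff (by positivity)).1 (this.trans h2)

set_option maxHeartbeats 800000 in
theorem schur {Ω T : Type*} [MeasurableSpace Ω] [MeasurableSpace T]
    (μ : Measure Ω) [IsFiniteMeasure μ] (ν : Measure T) [SigmaFinite ν]
    (K : Ω → T → ℝ) (hK : Measurable (Function.uncurry K)) (B C1 : ℝ) (hC1 : 0 ≤ C1)
    (hB : ∀ ω t, |K ω t| ≤ B) (hC : ∀ ω, ∫⁻ t, ofReal |K ω t| ∂ν ≤ ofReal C1)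
    (f : T → ℝ) (hf : Measurable f) (F : ℝ) (hF0 : 0 ≤ F) (hF : ∀ t, |f t| ≤ F)
    (S : ℝ≥0∞)
    (hS : ∀ᵐ ω ∂μ, ∫⁻ ω', ofReal |∫ t, K ω t * K ω' t ∂ν| ∂μ ≤ S) :
    ∫⁻ ω, ofReal ((∫ t, K ω t * f t ∂ν) ^ 2) ∂μ ≤
      (∫⁻ t, ofReal (f t ^ 2) ∂ν) * S := by
  set u : Ω → ℝ := fun ω => ∫ t, K ω t * f t ∂ν with hu
  have hum : Measurable u := tt_u_meas ν K hK f hf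
  have hub : ∀ ω, |u ω| ≤ C1 * F := tt_u_bound ν K C1 hC1 hC f F hF0 hF
  set N := (∫⁻ t, ofReal (f t ^ 2) ∂ν) with hN
  set X := ∫⁻ ω, ofReal (u ω ^ 2) ∂μ with hX
  have hui : Integrable (fun ω => u ω * u ω) μ := by
    refine Integrable.of_bound (by fun_prop) ((C1*F)*(C1*F)) (Filter.Eventually.of_forall fun ω => ?_)
    rw [norm_mul]; exact mul_le_mul (hub ω) (hub ω) (norm_nonneg _) (by positivity)
  have hXe : X = ofReal (∫ ω, u ω * u ω ∂μ) := by
    rw [ofReal_integral_eq_lintegral_ofReal hui (Filter.Eventually.of_forall fun t => mul_self_nonneg _)]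
    simp only [hX, sq]
  have hXt : X ≠ ∞ := by rw [hXe]; exact ofReal_ne_top
  have key := tt_bilinear μ ν K hK B C1 hB hC f hf F hF u hum (C1*F) hub
  have hk2 := tt_kernel_meas ν K hK
  set k : Ω → Ω → ℝ := fun ω ω' => ∫ t, K ω t * K ω' t ∂ν with hk
  have hk2' : Measurable fun w : Ω × Ω => k w.1 w.2 := hk2
  have hsym : ∀ ω ω', k ω ω' = k ω' ω := by
    intro ω ω'; simp only [hk]; congr 1; ext t; ring
  replace key : ofReal ((∫ ω, u ω * u ω ∂μ) ^ 2) ≤ N *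
      ∫⁻ ω, ∫⁻ ω', ofReal (|u ω| * |u ω'| * |k ω ω'|) ∂μ ∂μ := key
  replace hS : ∀ᵐ ω ∂μ, ∫⁻ ω', ofReal |k ω ω'| ∂μ ≤ S := hS
  clear_value u k N
  have hX2 : X * X ≤ N * (S * X) := by
    have : ofReal ((∫ ω, u ω * u ω ∂μ)^2) = X * X := by
      rw [sq, ofReal_mul (integral_nonneg fun ω => mul_self_nonneg _), ← hXe]
    rw [← this]
    refine key.trans ?_
    gcongr
    have hm1 : Measurable fun w : Ω × Ω => ofReal (u w.1 ^2 /2 * |k w.1 w.2|) := by fun_prop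
    calc _ ≤ ∫⁻ ω, ∫⁻ ω', (ofReal (u ω ^2 /2 * |k ω ω'|) + ofReal (u ω' ^2/2 * |k ω' ω|)) ∂μ ∂μ := by
          refine lintegral_mono fun ω => lintegral_mono fun ω' => ?_
          simp only
          rw [← ENNReal.ofReal_add (by positivity) (by positivity), ← hsym ω ω']
          apply ofReal_le_ofReal
          show |u ω| * |u ω'| * |k ω ω'| ≤ _
          have e : u ω ^ 2 / 2 * |k ω ω'| + u ω' ^ 2 / 2 * |k ω ω'| = (|u ω| ^ 2 + |u ω'| ^ 2) / 2 * |k ω ω'| := by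
            rw [sq_abs, sq_abs]; ring
          rw [e]
          have e2 : |u ω| * |u ω'| ≤ (|u ω| ^ 2 + |u ω'| ^ 2) / 2 := by
            linarith [two_mul_le_add_sq (|u ω|) (|u ω'|)]
          exact mul_le_mul_of_nonneg_right e2 (abs_nonneg _)
      _ = (∫⁻ ω, ∫⁻ ω', ofReal (u ω ^2 /2 * |k ω ω'|) ∂μ ∂μ) +
          ∫⁻ ω, ∫⁻ ω', ofReal (u ω' ^2/2 * |k ω' ω|) ∂μ ∂μ := by
          have hm2 : Measurable fun ω => ∫⁻ ω', ofReal (u ω ^2 /2 * |k ω ω'|) ∂μ :=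
            Measurable.lintegral_prod_right' (f := fun w : Ω × Ω => ofReal (u w.1 ^2 /2 * |k w.1 w.2|)) hm1
          rw [← lintegral_add_left hm2]
          refine lintegral_congr fun ω => ?_
          have hm3 : Measurable fun ω' => ofReal (u ω ^2 /2 * |k ω ω'|) :=
            hm1.comp (measurable_prodMk_left (x := ω))
          exact lintegral_add_left hm3 _
      _ = (∫⁻ ω, ∫⁻ ω', ofReal (u ω ^2 /2 * |k ω ω'|) ∂μ ∂μ) +
          ∫⁻ ω, ∫⁻ ω', ofReal (u ω ^2 /2 * |k ω ω'|) ∂μ ∂μ := by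
          congr 1
          rw [lintegral_lintegral_swap]
          exact (hm1.comp measurable_swap).aemeasurable
      _ = ∫⁻ ω, ofReal (u ω ^ 2) * ∫⁻ ω', ofReal |k ω ω'| ∂μ ∂μ := by
          rw [← two_mul, ← lintegral_const_mul' _ _ (by norm_num)]
          refine lintegral_congr fun ω => ?_
          rw [← lintegral_const_mul' _ _ (by norm_num), ← lintegral_const_mul' _ _ ofReal_ne_top]
          refine lintegral_congr fun ω' => ?_
          rw [← ofReal_mul (by positivity)]
          have : (2:ℝ≥0∞) = ofReal 2 := by norm_num
          rw [this, ← ofReal_mul (by positivity)]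
          congr 1; ring
      _ ≤ ∫⁻ ω, ofReal (u ω ^ 2) * S ∂μ := by
          refine lintegral_mono_ae ?_
          filter_upwards [hS] with ω hω
          gcongr
      _ = S * X := by
          have hm4 : Measurable fun ω => ofReal (u ω ^ 2) := by fun_prop
          rw [lintegral_mul_const _ hm4, mul_comm]
  rcases eq_or_ne X 0 with h0 | h0
  · rw [h0]; exact zero_le
  · have : X * X ≤ (N * S) * X := by rw [mul_assoc]; exact hX2
    exact (ENNReal.mul_le_mul_iff_left h0 hXt).1 this

theorem schur_vec {ι Ω T : Type*} [Fintype ι] [MeasurableSpace ι] [DiscreteMeasurableSpace ι]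
    [MeasurableSpace Ω] [MeasurableSpace T]
    (μ : Measure Ω) [IsFiniteMeasure μ] (ν : Measure T) [SigmaFinite ν]
    (K : ι → Ω → T → ℝ) (hK : ∀ i, Measurable (Function.uncurry (K i))) (B C1 : ℝ) (hC1 : 0 ≤ C1)
    (hB : ∀ i ω t, |K i ω t| ≤ B)
    (hC : ∀ i ω, ∫⁻ t, ofReal |K i ω t| ∂ν ≤ ofReal C1)
    (f : T → ℝ) (hf : Measurable f) (F : ℝ) (hF0 : 0 ≤ F) (hF : ∀ t, |f t| ≤ F)
    (S : ℝ≥0∞)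
    (hS : ∀ i, ∀ᵐ ω ∂μ, ∑ j, ∫⁻ ω', ofReal |∫ t, K i ω t * K j ω' t ∂ν| ∂μ ≤ S) :
    ∑ i, ∫⁻ ω, ofReal ((∫ t, K i ω t * f t ∂ν) ^ 2) ∂μ ≤
      (∫⁻ t, ofReal (f t ^ 2) ∂ν) * S := by
  have hmeas : Measurable (Function.uncurry (fun (w : ι × Ω) t => K w.1 w.2 t)) := by
    have : Measurable fun z : ι × (Ω × T) => K z.1 z.2.1 z.2.2 :=
      measurable_from_prod_countable_right (fun i => hK i)
    exact this.comp (f := fun z : (ι × Ω) × T => (z.1.1, (z.1.2, z.2))) (by fun_prop)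
  have h := schur (Ω := ι × Ω) ((Measure.count : Measure ι).prod μ) ν (fun w t => K w.1 w.2 t) hmeas
    B C1 hC1 (fun w t => hB _ _ _) (fun w => hC _ _) f hf F hF0 hF S ?_
  · rw [lintegral_prod] at h
    · rwa [lintegral_count, tsum_fintype] at h
    · exact (((tt_u_meas ν (fun (w : ι × Ω) t => K w.1 w.2 t) hmeas f hf).pow_const 2).ennreal_ofReal).aemeasurable
  · have hk := tt_kernel_meas ν (fun (w : ι × Ω) t => K w.1 w.2 t) hmeas
    have h1 : ∀ w : ι × Ω, ∫⁻ w' : ι × Ω, ofReal |∫ t, K w.1 w.2 t * K w'.1 w'.2 t ∂ν| ∂((Measure.count : Measure ι).prod μ)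
      = ∑ j, ∫⁻ ω', ofReal |∫ t, K w.1 w.2 t * K j ω' t ∂ν| ∂μ := by
      intro w
      rw [lintegral_prod, lintegral_count, tsum_fintype]
      have := (hk.comp (measurable_prodMk_left (x := w)))
      exact (this.abs.ennreal_ofReal).aemeasurable
    simp only [h1]
    have hms : MeasurableSet {w : ι × Ω | ∑ j, ∫⁻ ω', ofReal |∫ t, K w.1 w.2 t * K j ω' t ∂ν| ∂μ ≤ S} := by
      simp only [← h1]
      refine measurableSet_le ?_ measurable_const
      exact Measurable.lintegral_prod_right' (f := fun z : (ι × Ω) × (ι × Ω) => ofReal |∫ t, K z.1.1 z.1.2 t * K z.2.1 z.2.2 t ∂ν|) (hk.abs.ennreal_ofReal)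
    rw [Measure.ae_prod_iff_ae_ae hms]
    exact Filter.Eventually.of_forall fun i => hS i

/-- separated indices -/
def far (i j : ℕ) : Prop := i + 4 ≤ j ∨ j + 4 ≤ i

instance : DecidableRel far := fun i j => by unfold far; infer_instance

theorem bn_aux (N : ℕ) (u c : ℕ → ℝ) (hc : ∀ i, |c i| ≤ 1) (hN : 0 < N) :
    (∃ i ∈ Finset.range N, |∑ i ∈ Finset.range N, c i * u i| ≤ 8 * |u i|) ∨
    ∃ i ∈ Finset.range N, ∃ j ∈ Finset.range N, far i j ∧
      |∑ i ∈ Finset.range N, c i * u i| ^ 4 ≤ N ^ 6 * (u i * u j) ^ 2 := by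
  have hne : (Finset.range N).Nonempty := Finset.nonempty_range_iff.2 hN.ne'
  obtain ⟨i0, hi0, hmax⟩ := Finset.exists_max_image (Finset.range N) (fun i => |u i|) hne
  set S := ∑ i ∈ Finset.range N, c i * u i with hS
  have hSabs : |S| ≤ ∑ i ∈ Finset.range N, |u i| := by
    refine (Finset.abs_sum_le_sum_abs _ _).trans (Finset.sum_le_sum fun i _ => ?_)
    rw [abs_mul]; nlinarith [hc i, abs_nonneg (u i), abs_nonneg (c i)]
  set Fr := (Finset.range N).filter (fun j => far i0 j) with hFr
  set Nr := (Finset.range N).filter (fun j => ¬ far i0 j) with hNr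
  have hsplit : ∑ i ∈ Finset.range N, |u i| = (∑ i ∈ Fr, |u i|) + ∑ i ∈ Nr, |u i| :=
    (Finset.sum_filter_add_sum_filter_not _ _ _).symm
  have hnear : ∑ i ∈ Nr, |u i| ≤ 7 * |u i0| := by
    have hcard : Nr.card ≤ 7 := by
      have : Nr ⊆ Finset.Icc (i0 - 3) (i0 + 3) := by
        intro j hj
        simp only [hNr, Finset.mem_filter, far, not_or, not_le] at hj
        simp only [Finset.mem_Icc]; omega
      refine (Finset.card_le_card this).trans ?_
      simp only [Nat.card_Icc]; omega
    calc _ ≤ ∑ i ∈ Nr, |u i0| := Finset.sum_le_sum fun i hi => hmax i (Finset.mem_filter.1 hi).1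
      _ = Nr.card * |u i0| := by simp
      _ ≤ _ := by gcongr; exact_mod_cast hcard
  by_cases hcase : ∑ i ∈ Fr, |u i| ≤ |u i0|
  · left; exact ⟨i0, hi0, by linarith⟩
  · right
    push Not at hcase
    have hFne : Fr.Nonempty := by
      rw [Finset.nonempty_iff_ne_empty]; intro h
      rw [h] at hcase; simp at hcase; linarith [abs_nonneg (u i0)]
    obtain ⟨j0, hj0, hjmax⟩ := Finset.exists_max_image Fr (fun i => |u i|) hFne
    have hcF : (Fr.card : ℝ) ≤ N := by
      have := Finset.card_le_card (Finset.filter_subset (fun j => far i0 j) (Finset.range N))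
      rw [Finset.card_range] at this
      exact_mod_cast this
    have h1 : |u i0| ≤ N * |u j0| := by
      calc |u i0| ≤ ∑ i ∈ Fr, |u i| := hcase.le
        _ ≤ ∑ i ∈ Fr, |u j0| := Finset.sum_le_sum hjmax
        _ = Fr.card * |u j0| := by simp
        _ ≤ _ := by gcongr
    have h2 : |S| ≤ N * |u i0| := by
      calc |S| ≤ ∑ i ∈ Finset.range N, |u i| := hSabs
        _ ≤ ∑ i ∈ Finset.range N, |u i0| := Finset.sum_le_sum hmax
        _ = _ := by simp
    have hj0' := Finset.mem_filter.1 hj0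
    refine ⟨i0, hi0, j0, hj0'.1, hj0'.2, ?_⟩
    have a0 := abs_nonneg (u i0)
    have a1 := abs_nonneg (u j0)
    have aS := abs_nonneg S
    have n0 : (0:ℝ) ≤ N := Nat.cast_nonneg _
    calc |S| ^ 4 ≤ (N * |u i0|) ^ 4 := pow_le_pow_left₀ aS h2 4
      _ = N ^ 4 * |u i0| ^ 2 * |u i0| ^ 2 := by ring
      _ ≤ N ^ 4 * |u i0| ^ 2 * (N * |u j0|) ^ 2 := by gcongr
      _ = N ^ 6 * (|u i0| * |u j0|) ^ 2 := by ring
      _ = _ := by rw [← abs_mul, sq_abs]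

theorem bn4 (N : ℕ) (u c : ℕ → ℝ) (hc : ∀ i, |c i| ≤ 1) :
    |∑ i ∈ Finset.range N, c i * u i| ^ 4 ≤ 8 ^ 4 * ∑ i ∈ Finset.range N, |u i| ^ 4 +
      N ^ 6 * ∑ i ∈ Finset.range N, ∑ j ∈ Finset.range N, if far i j then (u i * u j) ^ 2 else 0 := by
  have p1 : ∀ i ∈ Finset.range N, 0 ≤ |u i| ^ 4 := fun i _ => by positivity
  have p2 : ∀ i, ∀ j ∈ Finset.range N, 0 ≤ (if far i j then (u i * u j) ^ 2 else 0) := by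
    intro i j _; split_ifs <;> positivity
  have p3 : ∀ i ∈ Finset.range N, 0 ≤ ∑ j ∈ Finset.range N, if far i j then (u i * u j) ^ 2 else 0 :=
    fun i _ => Finset.sum_nonneg (p2 i)
  have q1 := Finset.sum_nonneg p1
  have q2 := Finset.sum_nonneg p3
  rcases Nat.eq_zero_or_pos N with h | hN
  · subst h; simp
  rcases bn_aux N u c hc hN with ⟨i, hi, h⟩ | ⟨i, hi, j, hj, hf, h⟩
  · calc _ ≤ (8 * |u i|) ^ 4 := pow_le_pow_left₀ (abs_nonneg _) h 4
      _ = 8 ^ 4 * |u i| ^ 4 := by ring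
      _ ≤ 8 ^ 4 * ∑ i ∈ Finset.range N, |u i| ^ 4 := by
          gcongr; exact Finset.single_le_sum p1 hi
      _ ≤ _ := le_add_of_nonneg_right (by positivity)
  · calc _ ≤ _ := h
      _ = N ^ 6 * (if far i j then (u i * u j) ^ 2 else 0) := by rw [if_pos hf]
      _ ≤ N ^ 6 * ∑ i ∈ Finset.range N, ∑ j ∈ Finset.range N, if far i j then (u i * u j) ^ 2 else 0 := by
          gcongr
          exact (Finset.single_le_sum (p2 i) hj).trans (Finset.single_le_sum p3 hi)
      _ ≤ _ := le_add_of_nonneg_left (by positivity)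

theorem bn5 (N : ℕ) (u c : ℕ → ℝ) (hc : ∀ i, |c i| ≤ 1) (B : ℝ) (hB : ∀ i, |u i| ≤ B) :
    |∑ i ∈ Finset.range N, c i * u i| ^ 5 ≤ 8 ^ 5 * ∑ i ∈ Finset.range N, |u i| ^ 5 +
      N ^ 7 * B * ∑ i ∈ Finset.range N, ∑ j ∈ Finset.range N, if far i j then (u i * u j) ^ 2 else 0 := by
  have hB0 : 0 ≤ B := (abs_nonneg _).trans (hB 0)
  have p1 : ∀ i ∈ Finset.range N, 0 ≤ |u i| ^ 5 := fun i _ => by positivity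
  have p2 : ∀ i, ∀ j ∈ Finset.range N, 0 ≤ (if far i j then (u i * u j) ^ 2 else 0) := by
    intro i j _; split_ifs <;> positivity
  have p3 : ∀ i ∈ Finset.range N, 0 ≤ ∑ j ∈ Finset.range N, if far i j then (u i * u j) ^ 2 else 0 :=
    fun i _ => Finset.sum_nonneg (p2 i)
  have q1 := Finset.sum_nonneg p1
  have q2 := Finset.sum_nonneg p3
  rcases Nat.eq_zero_or_pos N with h | hN
  · subst h; simp
  rcases bn_aux N u c hc hN with ⟨i, hi, h⟩ | ⟨i, hi, j, hj, hf, h⟩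
  · calc _ ≤ (8 * |u i|) ^ 5 := pow_le_pow_left₀ (abs_nonneg _) h 5
      _ = 8 ^ 5 * |u i| ^ 5 := by ring
      _ ≤ 8 ^ 5 * ∑ i ∈ Finset.range N, |u i| ^ 5 := by
          gcongr; exact Finset.single_le_sum p1 hi
      _ ≤ _ := le_add_of_nonneg_right (by positivity)
  · have hS : |∑ i ∈ Finset.range N, c i * u i| ≤ N * B := by
      calc _ ≤ ∑ i ∈ Finset.range N, |c i * u i| := Finset.abs_sum_le_sum_abs _ _
        _ ≤ ∑ i ∈ Finset.range N, B := Finset.sum_le_sum fun i _ => by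
            rw [abs_mul]; nlinarith [hc i, abs_nonneg (u i), abs_nonneg (c i), hB i]
        _ = _ := by simp
    calc _ = |∑ i ∈ Finset.range N, c i * u i| * |∑ i ∈ Finset.range N, c i * u i| ^ 4 := by ring
      _ ≤ (N * B) * (N ^ 6 * (u i * u j) ^ 2) := by gcongr
      _ = N ^ 7 * B * (if far i j then (u i * u j) ^ 2 else 0) := by rw [if_pos hf]; ring
      _ ≤ N ^ 7 * B * ∑ i ∈ Finset.range N, ∑ j ∈ Finset.range N, if far i j then (u i * u j) ^ 2 else 0 := by
          gcongr
          exact (Finset.single_le_sum (p2 i) hj).trans (Finset.single_le_sum p3 hi)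
      _ ≤ _ := le_add_of_nonneg_left (by positivity)

/-! B-spline -/
noncomputable def bp (x : ℝ) : ℝ := (max x 0) ^ 2
noncomputable def bs (x : ℝ) : ℝ := (bp x - 3 * bp (x-1) + 3 * bp (x-2) - bp (x-3)) / 2
noncomputable def bs' (x : ℝ) : ℝ := max x 0 - 3 * max (x-1) 0 + 3 * max (x-2) 0 - max (x-3) 0

theorem bp_hasDeriv (x : ℝ) : HasDerivAt bp (2 * max x 0) x := by
  rcases lt_trichotomy x 0 with h | h | h
  · have : bp =ᶠ[nhds x] fun _ => 0 := by
      filter_upwards [Iio_mem_nhds h] with y hy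
      simp [bp, max_eq_right (le_of_lt (mem_Iio.1 hy))]
    rw [max_eq_right h.le, mul_zero]
    exact (hasDerivAt_const x (0:ℝ)).congr_of_eventuallyEq this
  · subst h
    rw [max_self, mul_zero, hasDerivAt_iff_isLittleO]
    simp only [bp, max_self, smul_eq_mul, mul_zero, sub_zero]
    have : (fun x : ℝ => (max x 0)^2 - 0^2) =O[nhds 0] fun x => x ^ 2 := by
      refine Asymptotics.IsBigO.of_bound 1 (Filter.Eventually.of_forall fun x => ?_)
      simp only [Real.norm_eq_abs, one_mul]
      rcases le_total x 0 with h | h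
      · rw [max_eq_right h]; norm_num; positivity
      · rw [max_eq_left h]; norm_num
    exact this.trans_isLittleO (Asymptotics.isLittleO_pow_id (by norm_num))
  · have : bp =ᶠ[nhds x] fun y => y ^ 2 := by
      filter_upwards [Ioi_mem_nhds h] with y hy
      simp [bp, max_eq_left (le_of_lt (mem_Ioi.1 hy))]
    rw [max_eq_left h.le]
    have h2 := (hasDerivAt_pow 2 x).congr_of_eventuallyEq this
    simpa using h2

theorem bs_hasDeriv (x : ℝ) : HasDerivAt bs (bs' x) x := by
  have h0 := bp_hasDeriv x
  have h1 : HasDerivAt (fun x => bp (x-1)) (2 * max (x-1) 0) x := (bp_hasDeriv (x-1)).comp_sub_const x 1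
  have h2 : HasDerivAt (fun x => bp (x-2)) (2 * max (x-2) 0) x := (bp_hasDeriv (x-2)).comp_sub_const x 2
  have h3 : HasDerivAt (fun x => bp (x-3)) (2 * max (x-3) 0) x := (bp_hasDeriv (x-3)).comp_sub_const x 3
  have h := (((h0.sub (h1.const_mul 3)).add (h2.const_mul 3)).sub h3).div_const 2
  refine h.congr_deriv ?_
  unfold bs'; ring

@[fun_prop] theorem bs_cont : Continuous bs := by unfold bs bp; fun_prop
@[fun_prop] theorem bs'_cont : Continuous bs' := by unfold bs'; fun_prop

theorem bs_cases (x : ℝ) : (x ≤ 0 ∧ bs x = 0 ∧ bs' x = 0) ∨ (0 ≤ x ∧ x ≤ 1 ∧ bs x = x^2/2 ∧ bs' x = x) ∨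
    (1 ≤ x ∧ x ≤ 2 ∧ bs x = (x^2 - 3*(x-1)^2)/2 ∧ bs' x = x - 3*(x-1)) ∨
    (2 ≤ x ∧ x ≤ 3 ∧ bs x = (3-x)^2/2 ∧ bs' x = x - 3) ∨ (3 ≤ x ∧ bs x = 0 ∧ bs' x = 0) := by
  unfold bs bs' bp
  rcases le_total x 0 with h | h
  · left
    rw [max_eq_right h, max_eq_right (by linarith), max_eq_right (by linarith), max_eq_right (by linarith)]
    norm_num [h]
  rcases le_total x 1 with h1 | h1
  · right; left
    rw [max_eq_left h, max_eq_right (by linarith), max_eq_right (by linarith), max_eq_right (by linarith)]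
    norm_num [h, h1]
  rcases le_total x 2 with h2 | h2
  · right; right; left
    rw [max_eq_left h, max_eq_left (by linarith), max_eq_right (by linarith), max_eq_right (by linarith)]
    norm_num [h1, h2]
  rcases le_total x 3 with h3 | h3
  · right; right; right; left
    rw [max_eq_left h, max_eq_left (by linarith), max_eq_left (by linarith), max_eq_right (by linarith)]
    exact ⟨h2, h3, by ring, by ring⟩
  · right; right; right; right
    rw [max_eq_left h, max_eq_left (by linarith), max_eq_left (by linarith), max_eq_left (by linarith)]
    exact ⟨h3, by ring, by ring⟩

theorem bs_nonneg (x : ℝ) : 0 ≤ bs x := by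
  rcases bs_cases x with ⟨_, h, _⟩ | ⟨_, _, h, _⟩ | ⟨_, _, h, _⟩ | ⟨_, _, h, _⟩ | ⟨_, h, _⟩ <;> rw [h] <;> nlinarith
theorem bs_le_one (x : ℝ) : bs x ≤ 1 := by
  rcases bs_cases x with ⟨_, h, _⟩ | ⟨_, _, h, _⟩ | ⟨_, _, h, _⟩ | ⟨_, _, h, _⟩ | ⟨_, h, _⟩ <;> rw [h] <;> nlinarith
theorem bs'_abs_le (x : ℝ) : |bs' x| ≤ 1 := by
  rw [abs_le]
  rcases bs_cases x with ⟨_, _, h⟩ | ⟨_, _, _, h⟩ | ⟨_, _, _, h⟩ | ⟨_, _, _, h⟩ | ⟨_, _, h⟩ <;> rw [h] <;>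
    constructor <;> linarith
theorem bs_eq_zero (x : ℝ) (h : ¬ (0 ≤ x ∧ x ≤ 3)) : bs x = 0 ∧ bs' x = 0 := by
  rcases bs_cases x with h1 | ⟨h1, h2, _⟩ | ⟨h1, h2, _⟩ | ⟨h1, h2, _⟩ | ⟨h1, h2⟩
  · exact h1.2
  · exact absurd ⟨h1, by linarith⟩ h
  · exact absurd ⟨by linarith, by linarith⟩ h
  · exact absurd ⟨by linarith, by linarith⟩ h
  · exact h2
theorem bs_lower (x : ℝ) (h1 : 1/2 ≤ x) (h2 : x ≤ 5/2) : 1/8 ≤ bs x := by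
  rcases bs_cases x with ⟨_, h, _⟩ | ⟨_, _, h, _⟩ | ⟨_, _, h, _⟩ | ⟨_, _, h, _⟩ | ⟨_, h, _⟩
  · linarith
  · rw [h]; nlinarith
  · rw [h]; nlinarith
  · rw [h]; nlinarith
  · linarith

theorem bs_refine (x : ℝ) : bs x = 1/4 * bs (2*x) + 3/4 * bs (2*x-1) + 3/4 * bs (2*x-2) + 1/4 * bs (2*x-3) := by
  have e : ∀ y : ℝ, bp (2*y) = 4 * bp y := by
    intro y; unfold bp
    have : max (2*y) 0 = 2 * max y 0 := by
      rw [mul_max_of_nonneg _ _ (by norm_num : (0:ℝ) ≤ 2), mul_zero]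
    rw [this]; ring
  have e0 := e x
  have e1 := e (x-1)
  have e2 := e (x-2)
  have e3 := e (x-3)
  rw [show 2*(x-1) = 2*x-2 by ring] at e1
  rw [show 2*(x-2) = 2*x-4 by ring] at e2
  rw [show 2*(x-3) = 2*x-6 by ring] at e3
  unfold bs
  rw [show 2*x-1-1=2*x-2 by ring, show 2*x-1-2=2*x-3 by ring, show 2*x-1-3=2*x-4 by ring,
    show 2*x-2-1=2*x-3 by ring, show 2*x-2-2=2*x-4 by ring, show 2*x-2-3=2*x-5 by ring,
    show 2*x-3-1=2*x-4 by ring, show 2*x-3-2=2*x-5 by ring, show 2*x-3-3=2*x-6 by ring,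
    e0, e1, e2, e3]
  ring

theorem sum_range_even_odd (F : ℕ → ℝ) (n : ℕ) :
    ∑ l ∈ Finset.range (2*n), F l = ∑ i ∈ Finset.range n, (F (2*i) + F (2*i+1)) := by
  induction n with
  | zero => simp
  | succ n ih =>
    rw [show 2*(n+1) = 2*n+1+1 by ring, Finset.sum_range_succ, Finset.sum_range_succ, ih, Finset.sum_range_succ]
    ring

theorem bs_multi (m : ℕ) : ∃ c : ℕ → ℝ, (∀ i, 0 ≤ c i ∧ c i ≤ 1) ∧
    ∀ x, bs x = ∑ i ∈ Finset.range (3*2^m-2), c i * bs (2^m * x - i) := by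
  suffices h : ∃ c : ℕ → ℝ, (∀ i, 0 ≤ c i ∧ c i ≤ 1) ∧ (∀ i, 3*2^m-2 ≤ i → c i = 0) ∧
    ∀ x, bs x = ∑ i ∈ Finset.range (3*2^m-2), c i * bs (2^m * x - i) by
    obtain ⟨c, h1, _, h3⟩ := h; exact ⟨c, h1, h3⟩
  induction m with
  | zero => exact ⟨fun i => if i = 0 then 1 else 0, fun i => by simp only; split_ifs <;> norm_num,
      fun i hi => by simp only; rw [if_neg]; omega, fun x => by norm_num⟩
  | succ m ih =>
    obtain ⟨c, h1, h2, h3⟩ := ih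
    set d : ℕ → ℝ := fun i => if i = 0 then 0 else c (i-1) with hd
    have hd1 : ∀ i, 0 ≤ d i ∧ d i ≤ 1 := by
      intro i; simp only [hd]; split_ifs
      · norm_num
      · exact h1 _
    set n := 3*2^m-2 with hn
    have hpow : 1 ≤ 2^m := Nat.one_le_two_pow
    have hn' : 3*2^(m+1)-2 = 2*(n+1) := by rw [hn, pow_succ]; omega
    refine ⟨fun l => if l % 2 = 0 then 1/4 * c (l/2) + 3/4 * d (l/2) else 3/4 * c (l/2) + 1/4 * d (l/2), ?_, ?_, ?_⟩
    · intro i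
      have a := h1 (i/2)
      have b := hd1 (i/2)
      simp only
      split_ifs <;> constructor <;> linarith
    · intro i hi
      rw [hn'] at hi
      have a : c (i/2) = 0 := h2 _ (by omega)
      have b : d (i/2) = 0 := by
        simp only [hd]; rw [if_neg (by omega)]; exact h2 _ (by omega)
      simp [a, b]
    · intro x
      rw [hn', sum_range_even_odd, h3 x]
      have key : ∀ i ∈ Finset.range (n+1), ((if (2*i)%2 = 0 then 1/4 * c ((2*i)/2) + 3/4 * d ((2*i)/2) else 3/4 * c ((2*i)/2) + 1/4 * d ((2*i)/2)) * bs (2^(m+1) * x - ((2*i : ℕ):ℝ)) +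
          (if (2*i+1)%2 = 0 then 1/4 * c ((2*i+1)/2) + 3/4 * d ((2*i+1)/2) else 3/4 * c ((2*i+1)/2) + 1/4 * d ((2*i+1)/2)) * bs (2^(m+1) * x - ((2*i+1 : ℕ):ℝ)))
          = c i * (1/4 * bs (2^(m+1)*x-2*i) + 3/4 * bs (2^(m+1)*x-2*i-1)) + d i * (3/4 * bs (2^(m+1)*x-2*i) + 1/4 * bs (2^(m+1)*x-2*i-1)) := by
        intro i _
        rw [if_pos (by omega), if_neg (by omega), show (2*i)/2 = i by omega, show (2*i+1)/2 = i by omega]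
        push_cast
        rw [show (2:ℝ)^(m+1)*x - (2*i+1) = 2^(m+1)*x-2*i-1 by ring]
        ring
      rw [Finset.sum_congr rfl key, Finset.sum_add_distrib, Finset.sum_range_succ, Finset.sum_range_succ' (fun i => d i * _)]
      have z1 : c n = 0 := h2 n le_rfl
      have z2 : d 0 = 0 := by simp [hd]
      rw [z1, z2, zero_mul, zero_mul, add_zero, add_zero, ← Finset.sum_add_distrib]
      refine Finset.sum_congr rfl fun i _ => ?_
      have z3 : d (i+1) = c i := by simp [hd]
      rw [z3, bs_refine, pow_succ]
      push_cast
      rw [show (2:ℝ)^m * 2 * x - 2 * (i+1) = 2 * (2^m*x - i) - 2 by ring, show (2:ℝ)^m * 2 * x - 2 * i = 2 * (2^m*x - i) by ring]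
      rw [show 2 * ((2:ℝ)^m*x - i) - 2 - 1 = 2 * (2^m*x - i) - 3 by ring]
      ring

theorem sumL (q γ : ℝ) (hq : 0 < q) (hγ : 0 < γ) : ∃ C : ℝ≥0∞, C ≠ ∞ ∧ ∀ a : ℕ → ℝ≥0∞,
    (∑' i, a i) ^ q ≤ C * ∑' i : ℕ, ofReal (2 ^ (γ * i)) * a i ^ q := by
  set ρ : ℝ := 2 ^ (-(γ/q)) with hρ
  have hρ1 : ρ < 1 := Real.rpow_lt_one_of_one_lt_of_neg (by norm_num) (by have := div_pos hγ hq; linarith)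
  have hρ0 : 0 < ρ := by positivity
  refine ⟨(∑' i : ℕ, ofReal (ρ ^ i)) ^ q, ?_, fun a => ?_⟩
  · refine ENNReal.rpow_ne_top_of_nonneg hq.le ?_
    rw [← ENNReal.ofReal_tsum_of_nonneg (fun i => by positivity) (summable_geometric_of_lt_one hρ0.le hρ1)]
    exact ofReal_ne_top
  · set S := ∑' i : ℕ, ofReal (2 ^ (γ * i)) * a i ^ q with hS
    have h1 : ∀ i, a i ≤ ofReal (ρ ^ i) * S ^ (1/q) := by
      intro i
      have h2 : ofReal (2 ^ (γ * i)) * a i ^ q ≤ S := ENNReal.le_tsum i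
      have h3 : (ofReal (2 ^ (γ * i)) * a i ^ q) ^ (1/q) ≤ S ^ (1/q) := ENNReal.rpow_le_rpow h2 (by positivity)
      rw [ENNReal.mul_rpow_of_nonneg _ _ (by positivity), ← ENNReal.rpow_mul, mul_one_div_cancel hq.ne', ENNReal.rpow_one,
        ENNReal.ofReal_rpow_of_nonneg (by positivity) (by positivity)] at h3
      calc a i = ofReal (ρ ^ i) * (ofReal ((2 ^ (γ * i)) ^ (1/q)) * a i) := by
            rw [← mul_assoc, ← ofReal_mul (by positivity)]
            have : ρ ^ i * ((2:ℝ) ^ (γ * i)) ^ (1/q) = 1 := by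
              rw [hρ, ← Real.rpow_natCast, ← Real.rpow_mul (by norm_num), ← Real.rpow_mul (by norm_num), ← Real.rpow_add (by norm_num)]
              rw [show -(γ/q) * (i:ℝ) + γ * i * (1/q) = 0 by ring, Real.rpow_zero]
            rw [this]; simp
        _ ≤ _ := by gcongr
    calc (∑' i, a i) ^ q ≤ (∑' i : ℕ, ofReal (ρ ^ i) * S ^ (1/q)) ^ q := by
          gcongr with i
          exact h1 i
      _ = _ := by
          rw [ENNReal.tsum_mul_right, ENNReal.mul_rpow_of_nonneg _ _ hq.le, ← ENNReal.rpow_mul, one_div_mul_cancel hq.ne', ENNReal.rpow_one]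

theorem cont_int {f : ℝ → ℝ} (hf : Continuous f) (a b : ℝ) (h : ∀ x, f x ≠ 0 → a ≤ x ∧ x ≤ b) :
    Integrable f := by
  refine hf.integrable_of_hasCompactSupport (HasCompactSupport.of_support_subset_isCompact (isCompact_Icc (a := a) (b := b)) ?_)
  intro x hx; exact h x hx

noncomputable def wt (L Δ a h1 h2 : ℝ) : ℝ := L*Δ^2/(Δ^2+h1^2) + (a*|h1|+|h2|)/(Δ^2+h1^2)

theorem ibp (L Δ a0 a1 : ℝ) (hL : 0 < L) (hΔ : 0 < Δ) (ha0 : 0 ≤ a0) (ha1 : 0 ≤ a1)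
    (h h1 h2 A A' ψ Ψ : ℝ → ℝ)
    (hh : ∀ v, HasDerivAt h (h1 v) v) (hh1 : ∀ v, HasDerivAt h1 (h2 v) v) (hh2 : Continuous h2)
    (hA : ∀ v, HasDerivAt A (A' v) v) (hA' : Continuous A')
    (hΨ : ∀ v, HasDerivAt Ψ (ψ v) v) (hψ : Continuous ψ)
    (bψ : ∀ t, |ψ t| ≤ 2) (bΨ : ∀ t, |Ψ t| ≤ 2) (sψ : ∀ t, 2 < |t| → ψ t = 0) (sΨ : ∀ t, 2 < |t| → Ψ t = 0)
    (bA : ∀ v, |A v| ≤ a0) (bA' : ∀ v, |A' v| ≤ a0 * a1) (s : Set ℝ) (a b : ℝ) (hs : s ⊆ Icc a b)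
    (sA : ∀ v, v ∉ s → A v = 0 ∧ A' v = 0) :
    ofReal |∫ v, L * ψ (L * h v) * A v| ≤
      ∫⁻ v, indicator {v | v ∈ s ∧ |L * h v| ≤ 2} (fun v => ofReal (2 * a0 * wt L Δ a1 (h1 v) (h2 v))) v := by
  have ch : Continuous h := continuous_iff_continuousAt.2 fun v => (hh v).continuousAt
  have ch1 : Continuous h1 := continuous_iff_continuousAt.2 fun v => (hh1 v).continuousAt
  have cA : Continuous A := continuous_iff_continuousAt.2 fun v => (hA v).continuousAt
  have cΨ : Continuous Ψ := continuous_iff_continuousAt.2 fun v => (hΨ v).continuousAt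
  have dpos : ∀ v, 0 < Δ^2 + h1 v ^2 := fun v => by positivity
  have dne : ∀ v, Δ^2 + h1 v ^2 ≠ 0 := fun v => (dpos v).ne'
  set V : ℝ → ℝ := fun v => A v * h1 v / (Δ^2 + h1 v ^2) with hV
  set V' : ℝ → ℝ := fun v => ((A' v * h1 v + A v * h2 v) * (Δ^2 + h1 v ^2) - A v * h1 v * (2 * h1 v * h2 v)) / (Δ^2 + h1 v ^2)^2 with hV'
  have dV : ∀ v, HasDerivAt V (V' v) v := by
    intro v
    have e1 := (hA v).mul (hh1 v)
    have e2 : HasDerivAt (fun v => Δ^2 + h1 v ^2) (2 * h1 v * h2 v) v := by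
      have := ((hh1 v).pow 2).const_add (Δ^2)
      simpa using this
    exact e1.div e2 (dne v)
  have cV' : Continuous V' := by
    simp only [hV']
    refine Continuous.div (by fun_prop) (by fun_prop) (fun v => pow_ne_zero 2 (dne v))
  set U : ℝ → ℝ := fun v => Ψ (L * h v)
  have dU : ∀ v, HasDerivAt U (ψ (L * h v) * (L * h1 v)) v := by
    intro v
    exact (hΨ (L * h v)).comp v ((hh v).const_mul L)
  have cV : Continuous V := continuous_iff_continuousAt.2 fun v => (dV v).continuousAt
  have cU : Continuous U := by fun_prop
  have inS : ∀ v, (A v ≠ 0 ∨ A' v ≠ 0) → v ∈ s := by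
    intro v hv; by_contra hc; have := sA v hc; tauto
  have VS : ∀ v, V v ≠ 0 → v ∈ s := by
    intro v hv; apply inS; left; intro hc; apply hv; simp [hV, hc]
  have V'S : ∀ v, V' v ≠ 0 → v ∈ s := by
    intro v hv; apply inS; by_contra hc; push Not at hc; apply hv; simp [hV', hc.1, hc.2]
  have i1 : Integrable (fun v => U v * V' v) := cont_int (by fun_prop) a b fun x hx =>
    hs (V'S x (right_ne_zero_of_mul hx))
  have i2 : Integrable (fun v => (ψ (L * h v) * (L * h1 v)) * V v) := cont_int (by fun_prop) a b fun x hx =>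
    hs (VS x (right_ne_zero_of_mul hx))
  have i3 : Integrable (fun v => U v * V v) := cont_int (by fun_prop) a b fun x hx =>
    hs (VS x (right_ne_zero_of_mul hx))
  have hibp := integral_mul_deriv_eq_deriv_mul_of_integrable (fun v _ => dU v) (fun v _ => dV v) i1 i2 i3
  have i4 : Integrable (fun v => L * ψ (L * h v) * A v * (Δ^2 / (Δ^2 + h1 v^2))) := by
    refine cont_int ?_ a b fun x hx => hs (inS x (Or.inl (right_ne_zero_of_mul (left_ne_zero_of_mul hx))))
    refine Continuous.mul (by fun_prop) (Continuous.div (by fun_prop) (by fun_prop) dne)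
  have e : (∫ v, L * ψ (L * h v) * A v) =
      ∫ v, (L * ψ (L * h v) * A v * (Δ^2 / (Δ^2 + h1 v^2)) - U v * V' v) := by
    rw [integral_sub i4 i1, hibp, sub_neg_eq_add, ← integral_add i4 i2]
    refine integral_congr_ae (Filter.Eventually.of_forall fun v => ?_)
    simp only [hV]
    have := dne v
    field_simp
  rw [e]
  have := enorm_integral_le_lintegral_enorm (μ := volume) (fun v => (L * ψ (L * h v) * A v * (Δ^2 / (Δ^2 + h1 v^2)) - U v * V' v))
  rw [Real.enorm_eq_ofReal_abs] at this
  refine this.trans (lintegral_mono fun v => ?_)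
  rw [Real.enorm_eq_ofReal_abs]
  by_cases hv : v ∈ s ∧ |L * h v| ≤ 2
  · rw [indicator_of_mem (by exact hv)]
    apply ofReal_le_ofReal
    have D := dpos v
    have b1 : |L * ψ (L * h v) * A v * (Δ^2 / (Δ^2 + h1 v^2))| ≤ 2 * a0 * (L*Δ^2/(Δ^2+h1 v^2)) := by
      rw [abs_mul, abs_mul, abs_mul, abs_of_pos hL, abs_of_nonneg (by positivity : 0 ≤ Δ^2 / (Δ^2 + h1 v^2))]
      calc _ ≤ L * 2 * a0 * (Δ^2 / (Δ^2 + h1 v^2)) := by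
            gcongr
            · exact bψ _
            · exact bA _
        _ = _ := by ring
    have b2 : |V' v| ≤ a0 * ((a1*|h1 v|+|h2 v|)/(Δ^2+h1 v^2)) := by
      have e1 : V' v = A' v * h1 v / (Δ^2 + h1 v^2) + A v * h2 v / (Δ^2 + h1 v^2) * ((Δ^2 - h1 v^2)/(Δ^2 + h1 v^2)) := by
        simp only [hV']
        have := dne v
        field_simp
        ring
      have e2 : |(Δ^2 - h1 v^2)/(Δ^2 + h1 v^2)| ≤ 1 := by
        rw [abs_div, abs_of_pos D, div_le_one D, abs_le]
        constructor <;> nlinarith [sq_nonneg (h1 v), sq_nonneg Δ]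
      rw [e1]
      calc _ ≤ |A' v * h1 v / (Δ^2 + h1 v^2)| + |A v * h2 v / (Δ^2 + h1 v^2) * ((Δ^2 - h1 v^2)/(Δ^2 + h1 v^2))| := abs_add_le _ _
        _ ≤ (a0 * a1) * |h1 v| / (Δ^2 + h1 v^2) + a0 * |h2 v| / (Δ^2 + h1 v^2) * 1 := by
            rw [abs_mul (A v * h2 v / (Δ^2 + h1 v^2)), abs_div, abs_div, abs_mul, abs_mul, abs_of_pos D]
            gcongr
            · exact bA' v
            · exact bA v
        _ = _ := by ring
    calc _ ≤ |L * ψ (L * h v) * A v * (Δ^2 / (Δ^2 + h1 v^2))| + |U v * V' v| := abs_sub _ _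
      _ ≤ 2 * a0 * (L*Δ^2/(Δ^2+h1 v^2)) + 2 * (a0 * ((a1*|h1 v|+|h2 v|)/(Δ^2+h1 v^2))) := by
          rw [abs_mul (U v)]
          gcongr
          exact bΨ _
      _ = _ := by unfold wt; ring
  · rw [indicator_of_notMem (by exact hv)]
    have : L * ψ (L * h v) * A v * (Δ^2 / (Δ^2 + h1 v^2)) - U v * V' v = 0 := by
      by_cases hvs : v ∈ s
      · have h3 : 2 < |L * h v| := by by_contra hc; exact hv ⟨hvs, not_lt.1 hc⟩
        have e1 := sψ _ h3
        have e2 : U v = 0 := sΨ _ h3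
        rw [e1, e2]; ring
      · have e1 := (sA v hvs).1
        have e2 : V' v = 0 := by by_contra hc; exact hvs (V'S v hc)
        rw [e1, e2]; ring
    rw [this]; simp

theorem triv_bd (L a0 : ℝ) (hL : 0 < L) (ha0 : 0 ≤ a0)
    (h A ψ : ℝ → ℝ) (bψ : ∀ t, |ψ t| ≤ 2) (sψ : ∀ t, 2 < |t| → ψ t = 0)
    (bA : ∀ v, |A v| ≤ a0) (s : Set ℝ)
    (sA : ∀ v, v ∉ s → A v = 0) :
    ofReal |∫ v, L * ψ (L * h v) * A v| ≤
      ∫⁻ v, indicator {v | v ∈ s ∧ |L * h v| ≤ 2} (fun _ => ofReal (2 * a0 * L)) v := by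
  have := enorm_integral_le_lintegral_enorm (μ := volume) (fun v => L * ψ (L * h v) * A v)
  rw [Real.enorm_eq_ofReal_abs] at this
  refine this.trans (lintegral_mono fun v => ?_)
  rw [Real.enorm_eq_ofReal_abs]
  by_cases hv : v ∈ s ∧ |L * h v| ≤ 2
  · rw [indicator_of_mem (by exact hv)]
    apply ofReal_le_ofReal
    rw [abs_mul, abs_mul, abs_of_pos hL]
    calc _ ≤ L * 2 * a0 := by
          gcongr
          · exact bψ _
          · exact bA _
      _ = _ := by ring
  · rw [indicator_of_notMem (by exact hv)]
    have : L * ψ (L * h v) * A v = 0 := by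
      by_cases hvs : v ∈ s
      · have h3 : 2 < |L * h v| := by by_contra hc; exact hv ⟨hvs, not_lt.1 hc⟩
        rw [sψ _ h3]; ring
      · rw [sA v hvs]; ring
    rw [this]; simp

/-- The family of curves together with the kernel data. -/
structure Op (c B : ℝ) where
  G : ℝ → ℝ → ℝ
  Gv : ℝ → ℝ → ℝ
  Gr : ℝ → ℝ → ℝ
  Gvv : ℝ → ℝ → ℝ
  Gvr : ℝ → ℝ → ℝ
  Grr : ℝ → ℝ → ℝ
  Gvvv : ℝ → ℝ → ℝ
  Gvvr : ℝ → ℝ → ℝ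
  Gvrr : ℝ → ℝ → ℝ
  am : ℝ → ℝ → ℝ
  am' : ℝ → ℝ → ℝ
  ψ : ℝ → ℝ
  Ψ : ℝ → ℝ
  hc : 0 < c
  hc1 : c ≤ 1
  hB : 13 ≤ B
  dGv : ∀ v r, HasDerivAt (fun v => G v r) (Gv v r) v
  dGr : ∀ v r, HasDerivAt (fun r => G v r) (Gr v r) r
  dGvv : ∀ v r, HasDerivAt (fun v => Gv v r) (Gvv v r) v
  dGvr : ∀ v r, HasDerivAt (fun r => Gv v r) (Gvr v r) r
  dGrv : ∀ v r, HasDerivAt (fun v => Gr v r) (Gvr v r) v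
  dGrr : ∀ v r, HasDerivAt (fun r => Gr v r) (Grr v r) r
  dGvvv : ∀ v r, HasDerivAt (fun v => Gvv v r) (Gvvv v r) v
  dGvvr : ∀ v r, HasDerivAt (fun r => Gvv v r) (Gvvr v r) r
  dGvrv : ∀ v r, HasDerivAt (fun v => Gvr v r) (Gvvr v r) v
  dGvrr : ∀ v r, HasDerivAt (fun r => Gvr v r) (Gvrr v r) r
  cG : Continuous (Function.uncurry G)
  cGv : Continuous (Function.uncurry Gv)
  cGvv : Continuous (Function.uncurry Gvv)
  cam : Continuous (Function.uncurry am)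
  cam' : ∀ r, Continuous (fun v => am' v r)
  dam : ∀ v r, HasDerivAt (fun v => am v r) (am' v r) v
  bGvv : ∀ v r, |r| ≤ c → 1 ≤ Gvv v r ∧ Gvv v r ≤ 3
  bGvvv : ∀ v r, |r| ≤ c → |Gvvv v r| ≤ 1/100
  bG : ∀ v r, v ∈ Icc (1/2:ℝ) 2 → |r| ≤ c → |G v r| ≤ 13
  bGv : ∀ v r, v ∈ Icc (1/2:ℝ) 2 → |r| ≤ c → |Gv v r| ≤ 13
  bGr : ∀ v r, v ∈ Icc (1/2:ℝ) 2 → |r| ≤ c → |Gr v r| ≤ 13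
  bGvr : ∀ v r, v ∈ Icc (1/2:ℝ) 2 → |r| ≤ c → |Gvr v r| ≤ 13
  bGvvr : ∀ v r, v ∈ Icc (1/2:ℝ) 2 → |r| ≤ c → 2 ≤ Gvvr v r ∧ Gvvr v r ≤ 13
  bGrr : ∀ v r, v ∈ Icc (1/2:ℝ) 2 → |r| ≤ c → |Grr v r| ≤ B
  bGvrr : ∀ v r, v ∈ Icc (1/2:ℝ) 2 → |r| ≤ c → |Gvrr v r| ≤ B
  bam : ∀ v r, v ∈ Icc (1/2:ℝ) 2 → |r| ≤ c → |am v r| ≤ 13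
  bam' : ∀ v r, v ∈ Icc (1/2:ℝ) 2 → |r| ≤ c → |am' v r| ≤ 13
  dΨ : ∀ t, HasDerivAt Ψ (ψ t) t
  cψ : Continuous ψ
  bψ : ∀ t, |ψ t| ≤ 1
  bΨ : ∀ t, |Ψ t| ≤ 1
  sψ : ∀ t, 1 < |t| → ψ t = 0
  sΨ : ∀ t, 1 < |t| → Ψ t = 0

namespace Op
variable {c B : ℝ} (O : Op c B)

/-- the dyadic interval of an atom -/
def Sn (j n : ℕ) : Set ℝ := {v | (n:ℝ) ≤ 2^j * v ∧ 2^j * v ≤ n + 3}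

/-- admissible atoms -/
def adm (j n : ℕ) : Prop := 2^j ≤ 2*n ∧ n + 3 ≤ 2*2^j

noncomputable def chi (j n : ℕ) (v : ℝ) : ℝ := bs (2^j * v - n)

noncomputable def K (L : ℝ) (j n : ℕ) (z : ℝ × ℝ × ℝ) (t : ℝ × ℝ) : ℝ :=
  L * O.ψ (L * (z.2.1 - t.2 - O.G (z.1 - t.1) z.2.2)) * (chi j n (z.1 - t.1) * O.am (z.1 - t.1) z.2.2)

noncomputable def u (L : ℝ) (j n : ℕ) (f : ℝ × ℝ → ℝ) (z : ℝ × ℝ × ℝ) : ℝ := ∫ t, O.K L j n z t * f t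

noncomputable def ψ2 (t : ℝ) : ℝ := ∫ s, O.ψ (t + s) * O.ψ s
noncomputable def Ψ2 (t : ℝ) : ℝ := ∫ s, O.Ψ (t + s) * O.ψ s

theorem Sn_sub {j n : ℕ} (h : adm j n) : Sn j n ⊆ Icc (1/2:ℝ) 2 := by
  intro v hv
  obtain ⟨h1, h2⟩ := h
  obtain ⟨h3, h4⟩ := hv
  have h1' : (2:ℝ)^j ≤ 2*n := by exact_mod_cast h1
  have h2' : (n:ℝ) + 3 ≤ 2*2^j := by exact_mod_cast h2
  have hp : (0:ℝ) < 2^j := by positivity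
  constructor
  · by_contra hc; push Not at hc; nlinarith
  · by_contra hc; push Not at hc; nlinarith

theorem chi_zero {j n : ℕ} {v : ℝ} (h : v ∉ Sn j n) : chi j n v = 0 ∧ bs' (2^j * v - n) = 0 := by
  apply bs_eq_zero
  intro h2; apply h
  exact ⟨by linarith [h2.1], by linarith [h2.2]⟩

theorem chi_deriv (j n : ℕ) (v : ℝ) : HasDerivAt (chi j n) (2^j * bs' (2^j * v - n)) v := by
  have h1 : HasDerivAt (fun v : ℝ => (2:ℝ)^j * v - n) ((2:ℝ)^j) v := by
    simpa using ((hasDerivAt_id v).const_mul ((2:ℝ)^j)).sub_const (n:ℝ)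
  have := (bs_hasDeriv ((2:ℝ)^j * v - n)).comp v h1
  rw [mul_comm]; exact this

@[fun_prop] theorem chi_cont (j n : ℕ) : Continuous (chi j n) := by unfold chi; fun_prop

theorem chi_abs (j n : ℕ) (v : ℝ) : |chi j n v| ≤ 1 := by
  unfold chi; rw [abs_of_nonneg (bs_nonneg _)]; exact bs_le_one _

theorem ψ2_bd_aux (g : ℝ → ℝ) (hg : ∀ t, |g t| ≤ 1) (t : ℝ) : |∫ s, g (t+s) * O.ψ s| ≤ 2 := by
  have : ‖∫ s, g (t+s) * O.ψ s‖ ≤ ∫ s, indicator (Icc (-1:ℝ) 1) (fun _ => (1:ℝ)) s := by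
    refine norm_integral_le_of_norm_le ?_ (Filter.Eventually.of_forall fun s => ?_)
    · rw [integrable_indicator_iff measurableSet_Icc]
      exact integrableOn_const (by simp)
    · by_cases hs : s ∈ Icc (-1:ℝ) 1
      · rw [indicator_of_mem hs, norm_mul]
        exact mul_le_one₀ (hg _) (norm_nonneg _) (O.bψ s)
      · rw [indicator_of_notMem hs, O.sψ s]
        · simp
        · by_contra hc; exact hs (abs_le.1 (not_lt.1 hc))
  rw [integral_indicator measurableSet_Icc] at this
  simp at this
  norm_num at this
  exact this

theorem ψ2_supp_aux (g : ℝ → ℝ) (hg : ∀ t, 1 < |t| → g t = 0) (t : ℝ) (ht : 2 < |t|) : (∫ s, g (t+s) * O.ψ s) = 0 := by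
  have : ∀ s, g (t+s) * O.ψ s = 0 := by
    intro s
    by_cases hs : 1 < |s|
    · rw [O.sψ s hs, mul_zero]
    · rw [hg, zero_mul]
      push Not at hs
      have := abs_sub_abs_le_abs_sub t (-s)
      rw [abs_neg, sub_neg_eq_add] at this
      linarith
  simp [this]

theorem bψ2 (t : ℝ) : |O.ψ2 t| ≤ 2 := O.ψ2_bd_aux _ O.bψ t
theorem bΨ2 (t : ℝ) : |O.Ψ2 t| ≤ 2 := O.ψ2_bd_aux _ O.bΨ t
theorem sψ2 (t : ℝ) (ht : 2 < |t|) : O.ψ2 t = 0 := O.ψ2_supp_aux _ O.sψ t ht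
theorem sΨ2 (t : ℝ) (ht : 2 < |t|) : O.Ψ2 t = 0 := O.ψ2_supp_aux _ O.sΨ t ht

theorem ψ_int : Integrable O.ψ := by
  refine cont_int O.cψ (-1) 1 fun x hx => ?_
  by_contra hc
  apply hx; apply O.sψ
  by_contra hc2; exact hc (abs_le.1 (not_lt.1 hc2))

theorem cΨ : Continuous O.Ψ := continuous_iff_continuousAt.2 fun v => (O.dΨ v).continuousAt

theorem dΨ2 (t : ℝ) : HasDerivAt O.Ψ2 (O.ψ2 t) t := by
  have hi := O.ψ_int
  have cψ := O.cψ
  have cΨ := O.cΨ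
  refine (hasDerivAt_integral_of_dominated_loc_of_deriv_le (F := fun t s => O.Ψ (t+s) * O.ψ s)
    (F' := fun t s => O.ψ (t+s) * O.ψ s) (bound := fun s => |O.ψ s|) (s := univ) Filter.univ_mem
    (Filter.Eventually.of_forall fun t => ?_) ?_ ?_ ?_ hi.norm ?_).2
  · exact Continuous.aestronglyMeasurable (by fun_prop)
  · exact hi.bdd_mul (c := 1) (Continuous.aestronglyMeasurable (by fun_prop)) (Filter.Eventually.of_forall fun s => O.bΨ _)
  · exact Continuous.aestronglyMeasurable (by fun_prop)
  · refine Filter.Eventually.of_forall fun s t _ => ?_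
    rw [norm_mul]
    exact mul_le_of_le_one_left (norm_nonneg _) (O.bψ _)
  · refine Filter.Eventually.of_forall fun s t _ => ?_
    exact ((O.dΨ (t+s)).comp_add_const t s).mul_const _

theorem cψ2 : Continuous O.ψ2 := by
  have cψ := O.cψ
  refine continuous_of_dominated (bound := fun s => |O.ψ s|) (fun t => ?_) (fun t => ?_) O.ψ_int.norm ?_
  · exact Continuous.aestronglyMeasurable (by fun_prop)
  · refine Filter.Eventually.of_forall fun s => ?_
    rw [norm_mul]
    exact mul_le_of_le_one_left (norm_nonneg _) (O.bψ _)
  · refine Filter.Eventually.of_forall fun s => ?_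
    fun_prop

end Op
end MS

namespace MS
namespace Op
variable {c B : ℝ} (O : Op c B)

theorem K_cont (L : ℝ) (j n : ℕ) : Continuous (fun w : (ℝ × ℝ × ℝ) × (ℝ × ℝ) => O.K L j n w.1 w.2) := by
  have cψ := O.cψ
  have cG : Continuous (fun w : (ℝ × ℝ × ℝ) × (ℝ × ℝ) => O.G (w.1.1 - w.2.1) w.1.2.2) :=
    O.cG.comp (f := fun w : (ℝ × ℝ × ℝ) × (ℝ × ℝ) => (w.1.1 - w.2.1, w.1.2.2)) (by fun_prop)
  have ca : Continuous (fun w : (ℝ × ℝ × ℝ) × (ℝ × ℝ) => O.am (w.1.1 - w.2.1) w.1.2.2) :=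
    O.cam.comp (f := fun w : (ℝ × ℝ × ℝ) × (ℝ × ℝ) => (w.1.1 - w.2.1, w.1.2.2)) (by fun_prop)
  unfold K
  fun_prop

theorem K_meas (L : ℝ) (j n : ℕ) : Measurable (Function.uncurry (O.K L j n)) := (O.K_cont L j n).measurable

theorem K_supp {L : ℝ} {j n : ℕ} {z : ℝ × ℝ × ℝ} {t : ℝ × ℝ} (h : O.K L j n z t ≠ 0) :
    z.1 - t.1 ∈ Sn j n ∧ |L * (z.2.1 - t.2 - O.G (z.1 - t.1) z.2.2)| ≤ 1 := by
  constructor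
  · by_contra hc; apply h; unfold K; rw [(chi_zero hc).1]; ring
  · by_contra hc; apply h; unfold K; rw [O.sψ _ (not_le.1 hc)]; ring

theorem K_abs {L : ℝ} (hL : 0 < L) {j n : ℕ} (hn : adm j n) {z : ℝ × ℝ × ℝ} (hz : |z.2.2| ≤ c) (t : ℝ × ℝ) :
    |O.K L j n z t| ≤ 13 * L := by
  by_cases h : O.K L j n z t = 0
  · rw [h]; simp; positivity
  · have hs := Sn_sub hn (O.K_supp h).1
    unfold K
    rw [abs_mul, abs_mul, abs_mul, abs_of_pos hL]
    calc _ ≤ L * 1 * (1 * 13) := by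
          gcongr
          · exact O.bψ _
          · exact chi_abs _ _ _
          · exact O.bam _ _ hs hz
      _ = _ := by ring

theorem K_hcs {L : ℝ} (hL : 1 ≤ L) {j n : ℕ} (hn : adm j n) {z : ℝ × ℝ × ℝ} (hz : |z.2.2| ≤ c) :
    HasCompactSupport (O.K L j n z) := by
  refine HasCompactSupport.of_support_subset_isCompact
    (isCompact_Icc (a := ((z.1 - 2, z.2.1 - 14) : ℝ × ℝ)) (b := (z.1, z.2.1 + 14))) ?_
  intro t ht
  obtain ⟨h1, h2⟩ := O.K_supp ht
  have h1 := Sn_sub hn h1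
  have h3 := abs_le.1 (O.bG _ _ h1 hz)
  rw [abs_mul, abs_of_pos (by linarith)] at h2
  have h4 : |z.2.1 - t.2 - O.G (z.1 - t.1) z.2.2| ≤ 1 := by
    nlinarith [abs_nonneg (z.2.1 - t.2 - O.G (z.1 - t.1) z.2.2)]
  have h4 := abs_le.1 h4
  have h1 := mem_Icc.1 h1
  exact ⟨⟨by simp only; linarith [h1.2], by simp only; linarith⟩, ⟨by simp only; linarith [h1.1], by simp only; linarith⟩⟩

theorem K_cont2 (L : ℝ) (j n : ℕ) (z : ℝ × ℝ × ℝ) : Continuous (O.K L j n z) :=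
  (O.K_cont L j n).comp (Continuous.prodMk_right z)

theorem K_int {L : ℝ} (hL : 1 ≤ L) {j n : ℕ} (hn : adm j n) {z : ℝ × ℝ × ℝ} (hz : |z.2.2| ≤ c) :
    Integrable (O.K L j n z) :=
  (O.K_cont2 L j n z).integrable_of_hasCompactSupport (O.K_hcs hL hn hz)

theorem Sn_eq (j n : ℕ) : Sn j n = Icc ((n:ℝ)/2^j) ((n+3)/2^j) := by
  ext v
  have hp : (0:ℝ) < 2^j := by positivity
  simp only [Sn, mem_setOf_eq, mem_Icc, div_le_iff₀ hp, le_div_iff₀ hp, mul_comm v]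

theorem Sn_meas (j n : ℕ) : MeasurableSet (Sn j n) := by rw [Sn_eq]; exact measurableSet_Icc

theorem Sn_vol (j n : ℕ) : volume (Sn j n) = ofReal (3 / 2^j) := by
  rw [Sn_eq, Real.volume_Icc]; congr 1; ring

/-- measure of an interval of size `a/L` -/
theorem vol_abs_le (L a y : ℝ) (hL : 0 < L) : volume {q : ℝ | |L * (y - q)| ≤ a} ≤ ofReal (2*a/L) := by
  have : {q : ℝ | |L * (y - q)| ≤ a} ⊆ Icc (y - a/L) (y + a/L) := by
    intro q hq
    simp only [mem_setOf_eq] at hq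
    rw [abs_mul, abs_of_pos hL, mul_comm, ← le_div_iff₀ hL] at hq
    have := abs_le.1 hq
    exact ⟨by linarith, by linarith⟩
  refine (measure_mono this).trans ?_
  rw [Real.volume_Icc]
  apply ofReal_le_ofReal; apply le_of_eq; ring

theorem K_lint {L : ℝ} (hL : 1 ≤ L) {j n : ℕ} (hn : adm j n) {z : ℝ × ℝ × ℝ} (hz : |z.2.2| ≤ c) :
    ∫⁻ t, ofReal |O.K L j n z t| ≤ ofReal (78 / 2^j) := by
  have hL0 : 0 < L := by linarith
  rw [Measure.volume_eq_prod]
  refine (lintegral_prod_le _).trans ?_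
  calc _ ≤ ∫⁻ p : ℝ, indicator {p | z.1 - p ∈ Sn j n} (fun _ => ofReal 26) p := by
        refine lintegral_mono fun p => ?_
        by_cases hp : z.1 - p ∈ Sn j n
        · rw [indicator_of_mem (by exact hp)]
          calc _ ≤ ∫⁻ q : ℝ, indicator {q | |L * ((z.2.1 - O.G (z.1 - p) z.2.2) - q)| ≤ 1} (fun _ => ofReal (13 * L)) q := by
                refine lintegral_mono fun q => ?_
                by_cases hk : O.K L j n z (p, q) = 0
                · simp only [hk]; simp
                · have := (O.K_supp hk).2
                  rw [indicator_of_mem]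
                  · exact ofReal_le_ofReal (O.K_abs hL0 hn hz _)
                  · simp only [mem_setOf_eq]; convert this using 3; ring
            _ ≤ _ := by
                refine (lintegral_indicator_const_le _ _).trans ?_
                refine (mul_le_mul_right (vol_abs_le L 1 _ hL0) _).trans ?_
                rw [← ofReal_mul (by positivity)]
                apply ofReal_le_ofReal
                apply le_of_eq; field_simp; norm_num
        · rw [indicator_of_notMem (by exact hp)]
          have : ∀ q, O.K L j n z (p, q) = 0 := by
            intro q; by_contra hk; exact hp (O.K_supp hk).1
          simp [this]
    _ ≤ ofReal 26 * volume {p | z.1 - p ∈ Sn j n} := lintegral_indicator_const_le _ _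
    _ = ofReal 26 * ofReal (3 / 2^j) := by
        congr 1
        rw [← Sn_vol j n]
        exact (Measure.measurePreserving_sub_left volume z.1).measure_preimage (Sn_meas j n).nullMeasurableSet
    _ = _ := by rw [← ofReal_mul (by norm_num)]; congr 1; ring

noncomputable def kap (L : ℝ) (j n l : ℕ) (z z' : ℝ × ℝ × ℝ) : ℝ := ∫ t, O.K L j n z t * O.K L j l z' t

noncomputable def h (z z' : ℝ × ℝ × ℝ) (v : ℝ) : ℝ := z.2.1 - z'.2.1 - O.G v z.2.2 + O.G (v - (z.1 - z'.1)) z'.2.2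
noncomputable def h1 (z z' : ℝ × ℝ × ℝ) (v : ℝ) : ℝ := - O.Gv v z.2.2 + O.Gv (v - (z.1 - z'.1)) z'.2.2
noncomputable def h2 (z z' : ℝ × ℝ × ℝ) (v : ℝ) : ℝ := - O.Gvv v z.2.2 + O.Gvv (v - (z.1 - z'.1)) z'.2.2

theorem h_d (z z' : ℝ × ℝ × ℝ) (v : ℝ) : HasDerivAt (O.h z z') (O.h1 z z' v) v := by
  have a := (O.dGv v z.2.2).const_sub (z.2.1 - z'.2.1)
  have b := (O.dGv (v - (z.1 - z'.1)) z'.2.2).comp_sub_const v (z.1 - z'.1)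
  exact a.add b

theorem h1_d (z z' : ℝ × ℝ × ℝ) (v : ℝ) : HasDerivAt (O.h1 z z') (O.h2 z z' v) v := by
  have a := (O.dGvv v z.2.2).neg
  have b := (O.dGvv (v - (z.1 - z'.1)) z'.2.2).comp_sub_const v (z.1 - z'.1)
  exact a.add b

theorem h2_c (z z' : ℝ × ℝ × ℝ) : Continuous (O.h2 z z') := by
  have a : Continuous fun v => O.Gvv v z.2.2 := O.cGvv.comp (f := fun v : ℝ => (v, z.2.2)) (by fun_prop)
  have b : Continuous fun v => O.Gvv (v - (z.1 - z'.1)) z'.2.2 :=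
    O.cGvv.comp (f := fun v : ℝ => (v - (z.1 - z'.1), z'.2.2)) (by fun_prop)
  unfold h2; fun_prop

noncomputable def A (j n l : ℕ) (z z' : ℝ × ℝ × ℝ) (v : ℝ) : ℝ :=
  (chi j n v * O.am v z.2.2) * (chi j l (v - (z.1 - z'.1)) * O.am (v - (z.1 - z'.1)) z'.2.2)

theorem kap_formula {L : ℝ} (hL : 1 ≤ L) {j n l : ℕ} (hn : adm j n) (hl : adm j l) {z z' : ℝ × ℝ × ℝ}
    (hz : |z.2.2| ≤ c) (hz' : |z'.2.2| ≤ c) :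
    O.kap L j n l z z' = ∫ v, L * O.ψ2 (L * O.h z z' v) * O.A j n l z z' v := by
  have hL0 : 0 < L := by linarith
  have hi : Integrable (fun t => O.K L j n z t * O.K L j l z' t) :=
    ((O.K_cont2 L j n z).mul (O.K_cont2 L j l z')).integrable_of_hasCompactSupport ((O.K_hcs hL hn hz).mul_right)
  unfold kap
  rw [Measure.volume_eq_prod] at hi ⊢
  rw [integral_prod _ hi]
  rw [← integral_sub_left_eq_self (fun v => L * O.ψ2 (L * O.h z z' v) * O.A j n l z z' v) volume z.1]
  refine integral_congr_ae (Filter.Eventually.of_forall fun p => ?_)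
  simp only
  set v := z.1 - p with hv
  have hv' : z'.1 - p = v - (z.1 - z'.1) := by rw [hv]; ring
  set g1 := O.G v z.2.2
  set g2 := O.G (v - (z.1 - z'.1)) z'.2.2 with hg2
  have e1 : ∀ q, O.K L j n z (p,q) * O.K L j l z' (p,q) =
      (L * L * O.A j n l z z' v) * (fun s => O.ψ (L * O.h z z' v + s) * O.ψ s) (L * (z'.2.1 - g2 - q)) := by
    intro q
    unfold K A
    simp only [hv']
    rw [show L * O.h z z' v + L * (z'.2.1 - g2 - q) = L * (z.2.1 - q - O.G (z.1 - p) z.2.2) by unfold h; rw [← hg2, ← hv]; ring]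
    rw [show L * (z'.2.1 - g2 - q) = L * (z'.2.1 - q - O.G (v - (z.1 - z'.1)) z'.2.2) by rw [← hg2]; ring]
    ring
  simp only [e1]
  rw [integral_const_mul]
  rw [integral_sub_left_eq_self (fun q => (fun s => O.ψ (L * O.h z z' v + s) * O.ψ s) (L * q)) volume (z'.2.1 - g2)]
  rw [Measure.integral_comp_mul_left (fun s => O.ψ (L * O.h z z' v + s) * O.ψ s) L]
  rw [abs_of_pos (by positivity), smul_eq_mul]
  unfold ψ2
  field_simp

noncomputable def A' (j n l : ℕ) (z z' : ℝ × ℝ × ℝ) (v : ℝ) : ℝ :=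
  ((2^j * bs' (2^j * v - n)) * O.am v z.2.2 + chi j n v * O.am' v z.2.2) * (chi j l (v - (z.1 - z'.1)) * O.am (v - (z.1 - z'.1)) z'.2.2)
  + (chi j n v * O.am v z.2.2) * ((2^j * bs' (2^j * (v - (z.1 - z'.1)) - l)) * O.am (v - (z.1 - z'.1)) z'.2.2 + chi j l (v - (z.1 - z'.1)) * O.am' (v - (z.1 - z'.1)) z'.2.2)

theorem A_d (j n l : ℕ) (z z' : ℝ × ℝ × ℝ) (v : ℝ) : HasDerivAt (O.A j n l z z') (O.A' j n l z z' v) v := by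
  have a := (chi_deriv j n v).mul (O.dam v z.2.2)
  have b := ((chi_deriv j l (v - (z.1 - z'.1))).mul (O.dam (v - (z.1 - z'.1)) z'.2.2)).comp_sub_const v (z.1 - z'.1)
  exact a.mul b

theorem A'_c (j n l : ℕ) (z z' : ℝ × ℝ × ℝ) : Continuous (O.A' j n l z z') := by
  have a0 : Continuous fun v => O.am v z.2.2 := O.cam.comp (f := fun v : ℝ => (v, z.2.2)) (by fun_prop)
  have a1 : Continuous fun v => O.am (v - (z.1 - z'.1)) z'.2.2 := O.cam.comp (f := fun v : ℝ => (v - (z.1 - z'.1), z'.2.2)) (by fun_prop)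
  have b0 := O.cam' z.2.2
  have b1 : Continuous fun v => O.am' (v - (z.1 - z'.1)) z'.2.2 := (O.cam' z'.2.2).comp (f := fun v : ℝ => v - (z.1 - z'.1)) (by fun_prop)
  unfold A'
  fun_prop

/-- the set of `v` which matter for the kernel -/
def V (j n l : ℕ) (z z' : ℝ × ℝ × ℝ) : Set ℝ := {v | v ∈ Sn j n ∧ v - (z.1 - z'.1) ∈ Sn j l}

theorem A_zero {j n l : ℕ} {z z' : ℝ × ℝ × ℝ} {v : ℝ} (hv : v ∉ V j n l z z') :
    O.A j n l z z' v = 0 ∧ O.A' j n l z z' v = 0 := by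
  unfold A A'
  by_cases h1 : v ∈ Sn j n
  · have h2 : v - (z.1 - z'.1) ∉ Sn j l := fun h2 => hv ⟨h1, h2⟩
    rw [(chi_zero h2).1, (chi_zero h2).2]; simp
  · rw [(chi_zero h1).1, (chi_zero h1).2]; simp

theorem A_bd {j n l : ℕ} (hn : adm j n) (hl : adm j l) {z z' : ℝ × ℝ × ℝ}
    (hz : |z.2.2| ≤ c) (hz' : |z'.2.2| ≤ c) (v : ℝ) : |O.A j n l z z' v| ≤ 676 ∧ |O.A' j n l z z' v| ≤ 676 * 2^j := by
  by_cases hv : v ∈ V j n l z z'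
  · have a0 := O.bam _ _ (Sn_sub hn hv.1) hz
    have a1 := O.bam _ _ (Sn_sub hl hv.2) hz'
    have b0 := O.bam' _ _ (Sn_sub hn hv.1) hz
    have b1 := O.bam' _ _ (Sn_sub hl hv.2) hz'
    have c0 := chi_abs j n v
    have c1 := chi_abs j l (v - (z.1 - z'.1))
    have d0 := bs'_abs_le (2^j * v - n)
    have d1 := bs'_abs_le (2^j * (v - (z.1 - z'.1)) - l)
    have hp : (1:ℝ) ≤ 2^j := one_le_pow₀ (by norm_num)
    have e0 : |chi j n v * O.am v z.2.2| ≤ 13 := by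
      rw [abs_mul]; nlinarith [abs_nonneg (chi j n v), abs_nonneg (O.am v z.2.2)]
    have e1 : |chi j l (v - (z.1 - z'.1)) * O.am (v - (z.1 - z'.1)) z'.2.2| ≤ 13 := by
      rw [abs_mul]; nlinarith [abs_nonneg (chi j l (v - (z.1 - z'.1))), abs_nonneg (O.am (v - (z.1 - z'.1)) z'.2.2)]
    have f0 : |(2^j * bs' (2^j * v - n)) * O.am v z.2.2 + chi j n v * O.am' v z.2.2| ≤ 26 * 2^j := by
      refine (abs_add_le _ _).trans ?_
      rw [abs_mul, abs_mul, abs_mul, abs_of_pos (by positivity : (0:ℝ) < 2^j)]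
      calc _ ≤ (2:ℝ)^j * 1 * 13 + 1 * 13 := by gcongr
        _ ≤ _ := by linarith
    have f1 : |(2^j * bs' (2^j * (v - (z.1 - z'.1)) - l)) * O.am (v - (z.1 - z'.1)) z'.2.2 + chi j l (v - (z.1 - z'.1)) * O.am' (v - (z.1 - z'.1)) z'.2.2| ≤ 26 * 2^j := by
      refine (abs_add_le _ _).trans ?_
      rw [abs_mul, abs_mul, abs_mul, abs_of_pos (by positivity : (0:ℝ) < 2^j)]
      calc _ ≤ (2:ℝ)^j * 1 * 13 + 1 * 13 := by gcongr
        _ ≤ _ := by linarith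
    unfold A A'
    constructor
    · rw [abs_mul]
      calc _ ≤ (13:ℝ) * 13 := by gcongr
        _ ≤ _ := by norm_num
    · refine (abs_add_le _ _).trans ?_
      rw [abs_mul, abs_mul (chi j n v * O.am v z.2.2)]
      calc _ ≤ (26 * 2^j) * 13 + 13 * (26 * (2:ℝ)^j) := by gcongr
        _ = _ := by ring
  · rw [(O.A_zero hv).1, (O.A_zero hv).2]; simp

theorem kap_ibp {L Δ : ℝ} (hL : 1 ≤ L) (hΔ : 0 < Δ) {j n l : ℕ} (hn : adm j n) (hl : adm j l) {z z' : ℝ × ℝ × ℝ}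
    (hz : |z.2.2| ≤ c) (hz' : |z'.2.2| ≤ c) :
    ofReal |O.kap L j n l z z'| ≤
      ∫⁻ v, indicator {v | v ∈ V j n l z z' ∧ |L * O.h z z' v| ≤ 2}
        (fun v => ofReal (2 * 676 * wt L Δ (2^j) (O.h1 z z' v) (O.h2 z z' v))) v := by
  rw [O.kap_formula hL hn hl hz hz']
  refine ibp L Δ 676 (2^j) (by linarith) hΔ (by norm_num) (by positivity) (O.h z z') (O.h1 z z') (O.h2 z z')
    (O.A j n l z z') (O.A' j n l z z') O.ψ2 O.Ψ2 (O.h_d z z') (O.h1_d z z') (O.h2_c z z') (O.A_d j n l z z') (O.A'_c j n l z z')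
    O.dΨ2 O.cψ2 O.bψ2 O.bΨ2 O.sψ2 O.sΨ2 (fun v => (O.A_bd hn hl hz hz' v).1) (fun v => (O.A_bd hn hl hz hz' v).2)
    (V j n l z z') (1/2) 2 (fun v hv => Sn_sub hn hv.1) (fun v hv => O.A_zero hv)

theorem kap_triv {L : ℝ} (hL : 1 ≤ L) {j n l : ℕ} (hn : adm j n) (hl : adm j l) {z z' : ℝ × ℝ × ℝ}
    (hz : |z.2.2| ≤ c) (hz' : |z'.2.2| ≤ c) :
    ofReal |O.kap L j n l z z'| ≤
      ∫⁻ v, indicator {v | v ∈ V j n l z z' ∧ |L * O.h z z' v| ≤ 2}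
        (fun _ => ofReal (2 * 676 * L)) v := by
  rw [O.kap_formula hL hn hl hz hz']
  exact triv_bd L 676 (by linarith) (by norm_num) (O.h z z') (O.A j n l z z') O.ψ2 O.bψ2 O.sψ2
    (fun v => (O.A_bd hn hl hz hz' v).1) (V j n l z z') (fun v hv => (O.A_zero hv).1)

end Op
theorem exhaust {Ω : Type*} [MeasurableSpace Ω] (μ : Measure Ω) [SigmaFinite μ] (s : Set Ω) (F : Ω → ℝ≥0∞) :
    Filter.Tendsto (fun k => ∫⁻ ω in s ∩ spanningSets μ k, F ω ∂μ) Filter.atTop (nhds (∫⁻ ω in s, F ω ∂μ)) := by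
  have hm : Monotone fun k => s ∩ spanningSets μ k := fun a b hab =>
    inter_subset_inter_right _ (monotone_spanningSets μ hab)
  have h1 : s = ⋃ k, s ∩ spanningSets μ k := by
    rw [← inter_iUnion, iUnion_spanningSets, inter_univ]
  have h2 := setLIntegral_iUnion_of_directed (μ := μ) F hm.directed_le
  rw [← h1] at h2
  rw [h2]
  exact tendsto_atTop_iSup fun a b hab => lintegral_mono_set (hm hab)

theorem schur_vec_on {ι Ω T : Type*} [Fintype ι] [MeasurableSpace ι] [DiscreteMeasurableSpace ι]
    [MeasurableSpace Ω] [MeasurableSpace T]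
    (μ : Measure Ω) [SigmaFinite μ] (ν : Measure T) [SigmaFinite ν] (s : Set Ω) (hs : MeasurableSet s)
    (K : ι → Ω → T → ℝ) (hK : ∀ i, Measurable (Function.uncurry (K i))) (B C1 : ℝ) (hB0 : 0 ≤ B) (hC1 : 0 ≤ C1)
    (hB : ∀ i, ∀ ω ∈ s, ∀ t, |K i ω t| ≤ B)
    (hC : ∀ i, ∀ ω ∈ s, ∫⁻ t, ofReal |K i ω t| ∂ν ≤ ofReal C1)
    (f : T → ℝ) (hf : Measurable f) (F : ℝ) (hF0 : 0 ≤ F) (hF : ∀ t, |f t| ≤ F)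
    (S : ℝ≥0∞)
    (hS : ∀ i, ∀ ω ∈ s, ∑ j, ∫⁻ ω' in s, ofReal |∫ t, K i ω t * K j ω' t ∂ν| ∂μ ≤ S) :
    ∑ i, ∫⁻ ω in s, ofReal ((∫ t, K i ω t * f t ∂ν) ^ 2) ∂μ ≤
      (∫⁻ t, ofReal (f t ^ 2) ∂ν) * S := by
  classical
  refine le_of_tendsto' (tendsto_finsetSum _ fun i _ => exhaust μ s (fun ω => ofReal ((∫ t, K i ω t * f t ∂ν) ^ 2))) fun k => ?_
  have hsk : MeasurableSet (s ∩ spanningSets μ k) := hs.inter (measurableSet_spanningSets μ k)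
  have : IsFiniteMeasure (μ.restrict (s ∩ spanningSets μ k)) :=
    ⟨by rw [Measure.restrict_apply_univ]; exact (measure_mono inter_subset_right).trans_lt (measure_spanningSets_lt_top μ k)⟩
  set K' : ι → Ω → T → ℝ := fun i ω t => if ω ∈ s then K i ω t else 0 with hK'
  have h := schur_vec (μ.restrict (s ∩ spanningSets μ k)) ν K' ?_ B C1 hC1 ?_ ?_ f hf F hF0 hF S ?_
  · refine le_trans (le_of_eq ?_) h
    refine Finset.sum_congr rfl fun i _ => setLIntegral_congr_fun hsk fun ω hω => ?_
    simp only [hK', if_pos hω.1]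
  · intro i
    exact Measurable.ite (hs.preimage measurable_fst) (hK i) measurable_const
  · intro i ω t
    by_cases h : ω ∈ s
    · simp only [hK', if_pos h]; exact hB i ω h t
    · simp only [hK', if_neg h]; simpa using hB0
  · intro i ω
    by_cases h : ω ∈ s
    · simp only [hK', if_pos h]; exact hC i ω h
    · simp only [hK', if_neg h]; simp
  · intro i
    refine (ae_restrict_mem hsk).mono fun ω hω => ?_
    refine le_trans (Finset.sum_le_sum fun j _ => ?_) (hS i ω hω.1)
    calc _ = ∫⁻ ω' in s ∩ spanningSets μ k, ofReal |∫ t, K i ω t * K j ω' t ∂ν| ∂μ := by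
          refine setLIntegral_congr_fun hsk fun ω' hω' => ?_
          simp only [hK', if_pos hω.1, if_pos hω'.1]
      _ ≤ _ := lintegral_mono_set inter_subset_left

theorem bilin_on {Ω T : Type*} [MeasurableSpace Ω] [MeasurableSpace T]
    (μ : Measure Ω) [SigmaFinite μ] (ν : Measure T) [SigmaFinite ν] (s : Set Ω) (hs : MeasurableSet s)
    (K : Ω → T → ℝ) (hK : Measurable (Function.uncurry K)) (B C1 : ℝ) (hB0 : 0 ≤ B) (hC1 : 0 ≤ C1)
    (hB : ∀ ω ∈ s, ∀ t, |K ω t| ≤ B)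
    (hC : ∀ ω ∈ s, ∫⁻ t, ofReal |K ω t| ∂ν ≤ ofReal C1)
    (f : T → ℝ) (hf : Measurable f) (hF : ∀ t, |f t| ≤ 1)
    (E : Ω → ℝ) (hE : Measurable E) (hE0 : ∀ ω, 0 ≤ E ω) (E1 : ℝ) (hE1 : ∀ ω ∈ s, E ω ≤ E1)
    (W : ℝ≥0∞)
    (hW : ∀ ω ∈ s, ∫⁻ ω' in s, ofReal (E ω' * |∫ t, K ω t * K ω' t ∂ν|) ∂μ ≤ W) :
    (∫⁻ ω in s, ofReal (E ω * (∫ t, K ω t * f t ∂ν) ^ 2) ∂μ) ^ 2 ≤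
      (∫⁻ t, ofReal (f t ^ 2) ∂ν) * (ofReal (C1^2) * (∫⁻ ω in s, ofReal (E ω) ∂μ) * W) := by
  classical
  refine le_of_tendsto' (ENNReal.Tendsto.pow (exhaust μ s _)) fun k => ?_
  have hsk : MeasurableSet (s ∩ spanningSets μ k) := hs.inter (measurableSet_spanningSets μ k)
  set s' := s ∩ spanningSets μ k with hs'
  have : IsFiniteMeasure (μ.restrict s') :=
    ⟨by rw [Measure.restrict_apply_univ]; exact (measure_mono inter_subset_right).trans_lt (measure_spanningSets_lt_top μ k)⟩
  set K' : Ω → T → ℝ := fun ω t => if ω ∈ s then K ω t else 0 with hK'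
  have hK'm : Measurable (Function.uncurry K') := Measurable.ite (hs.preimage measurable_fst) hK measurable_const
  have hK'B : ∀ ω t, |K' ω t| ≤ B := by
    intro ω t
    by_cases h : ω ∈ s
    · simp only [hK', if_pos h]; exact hB ω h t
    · simp only [hK', if_neg h]; simpa using hB0
  have hK'C : ∀ ω, ∫⁻ t, ofReal |K' ω t| ∂ν ≤ ofReal C1 := by
    intro ω
    by_cases h : ω ∈ s
    · simp only [hK', if_pos h]; exact hC ω h
    · simp only [hK', if_neg h]; simp
  set u : Ω → ℝ := fun ω => ∫ t, K' ω t * f t ∂ν with hu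
  have hum : Measurable u := tt_u_meas ν K' hK'm f hf
  have hub : ∀ ω, |u ω| ≤ C1 := fun ω => by
    simpa using tt_u_bound ν K' C1 hC1 hK'C f 1 (by norm_num) hF ω
  set E' : Ω → ℝ := fun ω => if ω ∈ s then E ω else 0 with hE'
  have hE'm : Measurable E' := Measurable.ite hs hE measurable_const
  have hE'0 : ∀ ω, 0 ≤ E' ω := by intro ω; simp only [hE']; split_ifs; exact hE0 _; exact le_rfl
  have hE'1 : ∀ ω, E' ω ≤ |E1| := by
    intro ω; simp only [hE']; split_ifs with h
    exact (hE1 ω h).trans (le_abs_self _); exact abs_nonneg _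
  have hgb : ∀ ω, |E' ω * u ω| ≤ E' ω * C1 := by
    intro ω; rw [abs_mul, abs_of_nonneg (hE'0 ω)]; exact mul_le_mul_of_nonneg_left (hub ω) (hE'0 ω)
  have h := tt_bilinear (μ.restrict s') ν K' hK'm B C1 hK'B hK'C f hf 1 hF (fun ω => E' ω * u ω) (hE'm.mul hum)
    (|E1| * C1) (fun ω => (hgb ω).trans (mul_le_mul_of_nonneg_right (hE'1 ω) hC1))
  have e1 : (∫⁻ ω in s', ofReal (E ω * (∫ t, K ω t * f t ∂ν) ^ 2) ∂μ) = ofReal (∫ ω in s', E' ω * u ω * u ω ∂μ) := by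
    rw [ofReal_integral_eq_lintegral_ofReal]
    · refine setLIntegral_congr_fun hsk fun ω hω => ?_
      simp only [hu, hE', hK', if_pos hω.1]; congr 1; ring
    · refine Integrable.of_bound ((hE'm.mul hum).mul hum).aestronglyMeasurable (|E1| * C1 * C1) (Filter.Eventually.of_forall fun ω => ?_)
      rw [norm_mul]
      refine mul_le_mul ((hgb ω).trans (mul_le_mul_of_nonneg_right (hE'1 ω) hC1)) (hub ω) (norm_nonneg _) (by positivity)
    · refine Filter.Eventually.of_forall fun ω => ?_
      have : 0 ≤ E' ω * (u ω * u ω) := mul_nonneg (hE'0 ω) (mul_self_nonneg _)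
      simpa [mul_assoc] using this
  rw [e1, ← ENNReal.ofReal_pow (by
    refine integral_nonneg fun ω => ?_
    have : 0 ≤ E' ω * (u ω * u ω) := mul_nonneg (hE'0 ω) (mul_self_nonneg _)
    simpa [mul_assoc] using this)]
  refine h.trans ?_
  gcongr
  calc _ ≤ ∫⁻ ω in s', ofReal (C1^2) * (ofReal (E ω) * W) ∂μ := by
        refine setLIntegral_mono' hsk fun ω hω => ?_
        calc _ ≤ ∫⁻ ω' in s', ofReal (C1^2) * (ofReal (E ω) * ofReal (E ω' * |∫ t, K ω t * K ω' t ∂ν|)) ∂μ := by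
              refine setLIntegral_mono' hsk fun ω' hω' => ?_
              rw [← ofReal_mul (hE0 ω), ← ofReal_mul (by positivity)]
              apply ofReal_le_ofReal
              have a1 := hgb ω
              have a2 := hgb ω'
              simp only [hE', if_pos hω.1, if_pos hω'.1] at a1 a2
              simp only [hE', hK', if_pos hω.1, if_pos hω'.1]
              calc _ ≤ (E ω * C1) * (E ω' * C1) * |∫ t, K ω t * K ω' t ∂ν| := by
                    gcongr
                    exact mul_nonneg (hE0 ω) hC1
                _ = _ := by ring
          _ ≤ _ := by
              rw [lintegral_const_mul' _ _ ofReal_ne_top, lintegral_const_mul' _ _ ofReal_ne_top]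
              gcongr
              exact (lintegral_mono_set inter_subset_left).trans (hW ω hω.1)
    _ = ofReal (C1^2) * (∫⁻ ω in s', ofReal (E ω) ∂μ) * W := by
        rw [lintegral_const_mul' _ _ ofReal_ne_top, lintegral_mul_const _ hE.ennreal_ofReal, mul_assoc]
    _ ≤ _ := by
        gcongr
        exact inter_subset_left

theorem mv (f f' : ℝ → ℝ) (h : ∀ x, HasDerivAt f (f' x) x) (a b : ℝ) :
    ∃ ξ ∈ uIcc a b, f b - f a = f' ξ * (b - a) := by
  rcases lt_trichotomy a b with hab | hab | hab
  · obtain ⟨ξ, hξ, h1⟩ := exists_hasDerivAt_eq_slope f f' hab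
      (fun x _ => (h x).continuousAt.continuousWithinAt) (fun x _ => h x)
    refine ⟨ξ, by rw [uIcc_of_le hab.le]; exact Ioo_subset_Icc_self hξ, ?_⟩
    rw [h1]; field_simp [sub_ne_zero.2 hab.ne']
  · subst hab; exact ⟨a, by simp, by simp⟩
  · obtain ⟨ξ, hξ, h1⟩ := exists_hasDerivAt_eq_slope f f' hab
      (fun x _ => (h x).continuousAt.continuousWithinAt) (fun x _ => h x)
    refine ⟨ξ, by rw [uIcc_of_ge hab.le]; exact Ioo_subset_Icc_self hξ, ?_⟩
    rw [h1]
    have := sub_ne_zero.2 hab.ne'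
    field_simp; ring

theorem mem_uIcc_conv {a b x lo hi : ℝ} (ha : a ∈ Icc lo hi) (hb : b ∈ Icc lo hi) (hx : x ∈ uIcc a b) : x ∈ Icc lo hi :=
  (uIcc_subset_Icc ha hb) hx

theorem abs_conv {a b x C : ℝ} (ha : |a| ≤ C) (hb : |b| ≤ C) (hx : x ∈ uIcc a b) : |x| ≤ C :=
  abs_le.2 ((uIcc_subset_Icc (abs_le.1 ha) (abs_le.1 hb)) hx)

theorem wt_bd {L D a κ C h1 h2 : ℝ} (hL : 0 < L) (hD : 0 < D) (ha : 1 ≤ a) (hκ : 0 < κ) (hC : 1 ≤ C)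
    (b1 : κ * D ≤ |h1|) (b2 : |h1| ≤ C * D) (b3 : |h2| ≤ C * D) :
    wt L (Real.sqrt (D/L)) a h1 h2 ≤ 3 * C * a / κ^2 / D := by
  unfold wt
  rw [Real.sq_sqrt (by positivity)]
  have e1 : κ^2 * D^2 ≤ D/L + h1^2 := by
    have : (κ * D)^2 ≤ |h1|^2 := by gcongr
    rw [sq_abs] at this
    have : 0 < D/L := by positivity
    nlinarith
  have p : 0 < κ^2 * D^2 := by positivity
  calc _ ≤ L * (D/L) / (κ^2 * D^2) + (a * (C * D) + C * D) / (κ^2 * D^2) := by gcongr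
    _ = (1 + a * C + C) / κ^2 / D := by field_simp; ring
    _ ≤ _ := by
      gcongr
      nlinarith [mul_le_mul ha hC (by norm_num) (by linarith)]

/-- logarithmic weight with an epsilon loss -/
noncomputable def lw (η L X : ℝ) : ℝ := if X = 0 then L else L^η * |X|^(η-1)

theorem lw_nonneg {η L X : ℝ} (hL : 0 ≤ L) : 0 ≤ lw η L X := by
  unfold lw; split_ifs; exact hL; positivity

theorem lw_spec {η L X : ℝ} (hL : 1 ≤ L) (hη : 0 < η) (hη1 : η < 1) :
    L ≤ lw η L X ∨ (X ≠ 0 ∧ 1/|X| ≤ lw η L X) := by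
  unfold lw
  split_ifs with hX
  · left; exact le_rfl
  · have hp : 0 < |X| := abs_pos.2 hX
    by_cases h : 1 ≤ L * |X|
    · right
      refine ⟨hX, ?_⟩
      have e1 : |X|^(η-1) = |X|^η / |X| := by rw [Real.rpow_sub hp, Real.rpow_one]
      rw [e1, ← mul_div_assoc, ← Real.mul_rpow (by linarith) hp.le]
      gcongr
      exact Real.one_le_rpow h hη.le
    · left
      push Not at h
      have hL0 : 0 < L := by linarith
      have e1 : L = L^η * L^(1-η) := by rw [← Real.rpow_add hL0]; simp
      nth_rw 1 [e1]
      gcongr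
      rw [show η - 1 = -(1-η) by ring, Real.rpow_neg hp.le, ← Real.inv_rpow hp.le]
      refine Real.rpow_le_rpow hL0.le ?_ (by linarith)
      rw [← one_div, le_div_iff₀ hp]; exact h.le

noncomputable def Il (η : ℝ) : ℝ≥0∞ := ∫⁻ X in Icc (-2:ℝ) 2, ofReal (|X|^(η-1))

theorem Il_ne_top {η : ℝ} (hη : 0 < η) : Il η ≠ ∞ := by
  have h1 : IntervalIntegrable (fun x : ℝ => x^(η-1)) volume 0 2 := intervalIntegral.intervalIntegrable_rpow' (by linarith)
  have h2 : IntegrableOn (fun x : ℝ => |x|^(η-1)) (Ioc 0 2) := by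
    have := (intervalIntegrable_iff_integrableOn_Ioc_of_le (by norm_num)).1 h1
    refine this.congr_fun (fun x hx => ?_) measurableSet_Ioc
    simp only [abs_of_pos hx.1]
  have h3 : IntegrableOn (fun x : ℝ => |x|^(η-1)) (Ico (-2) 0) := by
    have h4 := (Measure.measurePreserving_neg (volume : Measure ℝ)).integrableOn_comp_preimage (MeasurableEquiv.neg ℝ).measurableEmbedding (f := fun x : ℝ => |x|^(η-1)) (s := Ioc 0 2)
    have h5 := h4.2 h2
    have e : (fun x : ℝ => |x|^(η-1)) ∘ Neg.neg = fun x : ℝ => |x|^(η-1) := by ext x; simp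
    rw [e] at h5
    refine h5.mono_set ?_
    intro x hx; simp only [mem_preimage, mem_Ioc]; exact ⟨by linarith [hx.2], by linarith [hx.1]⟩
  have h6 : IntegrableOn (fun x : ℝ => |x|^(η-1)) (Icc (-2) 2) := by
    have h7 := (h3.union h2).union (integrableOn_singleton (μ := volume) (f := fun x : ℝ => |x|^(η-1)) (x := (0:ℝ)) (by simp) (hx := by simp))
    refine h7.mono_set ?_
    intro x hx
    rcases lt_trichotomy x 0 with h | h | h
    · left; left; exact ⟨hx.1, h⟩
    · right; exact h
    · left; right; exact ⟨h, hx.2⟩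
  exact (Integrable.lintegral_lt_top h6).ne

theorem lw_int (η L : ℝ) (hL : 0 ≤ L) : ∫⁻ X in Icc (-2:ℝ) 2, ofReal (lw η L X) = ofReal (L^η) * Il η := by
  unfold Il
  rw [← lintegral_const_mul' _ _ ofReal_ne_top]
  refine lintegral_congr_ae ?_
  have : ∀ᵐ X ∂(volume.restrict (Icc (-2:ℝ) 2)), X ≠ 0 := by
    refine ae_restrict_of_ae ?_
    exact Measure.ae_ne volume 0
  filter_upwards [this] with X hX
  unfold lw
  rw [if_neg hX, ofReal_mul (by positivity)]

theorem lw_meas (η L : ℝ) : Measurable (lw η L) := by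
  unfold lw
  refine Measurable.ite (measurableSet_singleton 0) measurable_const ?_
  fun_prop

namespace Op
variable {c B : ℝ} (O : Op c B)

theorem Sn_count (s : Finset ℕ) (j : ℕ) (w : ℝ) : ∑ l ∈ s, (Sn j l).indicator (fun _ => (1:ℝ≥0∞)) w ≤ 4 := by
  classical
  have h1 : ∑ l ∈ s, (Sn j l).indicator (fun _ => (1:ℝ≥0∞)) w = ((s.filter (fun l => w ∈ Sn j l)).card : ℝ≥0∞) := by
    rw [Finset.card_filter]; push_cast
    refine Finset.sum_congr rfl fun l _ => ?_
    by_cases h : w ∈ Sn j l <;> simp [h]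
  rw [h1]
  have h2 : s.filter (fun l => w ∈ Sn j l) ⊆ Finset.Icc (⌊2^j * w⌋₊ - 3) ⌊2^j * w⌋₊ := by
    intro l hl
    obtain ⟨h3, h4⟩ := (Finset.mem_filter.1 hl).2
    have h5 : l ≤ ⌊2^j * w⌋₊ := Nat.le_floor h3
    have h6 : ⌊2^j * w⌋₊ ≤ l + 3 := Nat.floor_le_of_le (by push_cast; exact h4)
    rw [Finset.mem_Icc]; omega
  have h3 := Finset.card_le_card h2
  rw [Nat.card_Icc] at h3
  have : (s.filter (fun l => w ∈ Sn j l)).card ≤ 4 := by omega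
  exact_mod_cast this

theorem kap_w {L w : ℝ} (hL : 1 ≤ L) {j n l : ℕ} (hn : adm j n) (hl : adm j l) {z z' : ℝ × ℝ × ℝ}
    (hz : |z.2.2| ≤ c) (hz' : |z'.2.2| ≤ c)
    (hw : L ≤ w ∨ ∃ Δ, 0 < Δ ∧ ∀ v ∈ V j n l z z', |L * O.h z z' v| ≤ 2 → wt L Δ (2^j) (O.h1 z z' v) (O.h2 z z' v) ≤ w) :
    ofReal |O.kap L j n l z z'| ≤
      ∫⁻ v, indicator {v | v ∈ V j n l z z' ∧ |L * O.h z z' v| ≤ 2}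
        (fun _ => ofReal (1352 * w)) v := by
  rcases hw with hw | ⟨Δ, hΔ, hw⟩
  · refine (O.kap_triv hL hn hl hz hz').trans (lintegral_mono fun v => ?_)
    refine indicator_le_indicator ?_
    apply ofReal_le_ofReal; linarith
  · refine (O.kap_ibp hL hΔ hn hl hz hz').trans (lintegral_mono fun v => ?_)
    by_cases hv : v ∈ {v | v ∈ V j n l z z' ∧ |L * O.h z z' v| ≤ 2}
    · rw [indicator_of_mem hv, indicator_of_mem hv]
      apply ofReal_le_ofReal
      have := hw v hv.1 hv.2
      linarith
    · rw [indicator_of_notMem hv, indicator_of_notMem hv]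

/-- geometry of `h1`, `h2` -/
theorem h1_up {z z' : ℝ × ℝ × ℝ} (hz : |z.2.2| ≤ c) (hz' : |z'.2.2| ≤ c) {v : ℝ} (hv : v ∈ Icc (1/2:ℝ) 2) :
    |O.h1 z z' v| ≤ 3 * |z.1 - z'.1| + 13 * |z.2.2 - z'.2.2| ∧ |z.1 - z'.1| - 13 * |z.2.2 - z'.2.2| ≤ |O.h1 z z' v| := by
  obtain ⟨ξ, h1, h2⟩ := mv _ _ (fun x => O.dGvv x z'.2.2) v (v - (z.1 - z'.1))
  obtain ⟨ρ, h3, h4⟩ := mv _ _ (fun x => O.dGvr v x) z.2.2 z'.2.2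
  have b1 := O.bGvv ξ _ hz'
  have b2 := O.bGvr v ρ hv (abs_conv hz hz' h3)
  have e : O.h1 z z' v = -(O.Gvv ξ z'.2.2 * (z.1 - z'.1)) + O.Gvr v ρ * (z'.2.2 - z.2.2) := by
    unfold Op.h1; linarith
  have e1 : |O.Gvv ξ z'.2.2 * (z.1 - z'.1)| ≤ 3 * |z.1 - z'.1| ∧ |z.1 - z'.1| ≤ |O.Gvv ξ z'.2.2 * (z.1 - z'.1)| := by
    rw [abs_mul, abs_of_pos (by linarith : 0 < O.Gvv ξ z'.2.2)]
    constructor <;> nlinarith [abs_nonneg (z.1 - z'.1)]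
  have e2 : |O.Gvr v ρ * (z'.2.2 - z.2.2)| ≤ 13 * |z.2.2 - z'.2.2| := by
    rw [abs_mul, abs_sub_comm z'.2.2]; gcongr
  rw [e]
  constructor
  · refine (abs_add_le _ _).trans ?_; rw [abs_neg]; linarith
  · have := abs_sub_abs_le_abs_sub (O.Gvr v ρ * (z'.2.2 - z.2.2)) (O.Gvv ξ z'.2.2 * (z.1 - z'.1))
    have := abs_sub_abs_le_abs_sub (O.Gvv ξ z'.2.2 * (z.1 - z'.1)) (O.Gvr v ρ * (z'.2.2 - z.2.2))
    rw [abs_sub_comm] at this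
    rw [neg_add_eq_sub]; linarith

theorem h2_form {z z' : ℝ × ℝ × ℝ} (hz : |z.2.2| ≤ c) (hz' : |z'.2.2| ≤ c) {v : ℝ} (hv : v ∈ Icc (1/2:ℝ) 2) :
    ∃ g e : ℝ, 2 ≤ g ∧ g ≤ 13 ∧ |e| ≤ |z.1 - z'.1| / 100 ∧ O.h2 z z' v = - g * (z.2.2 - z'.2.2) + e := by
  obtain ⟨ξ, h1, h2⟩ := mv _ _ (fun x => O.dGvvv x z'.2.2) v (v - (z.1 - z'.1))
  obtain ⟨ρ, h3, h4⟩ := mv _ _ (fun x => O.dGvvr v x) z.2.2 z'.2.2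
  have b1 := O.bGvvv ξ _ hz'
  have b2 := O.bGvvr v ρ hv (abs_conv hz hz' h3)
  refine ⟨_, O.Gvvv ξ z'.2.2 * (-(z.1 - z'.1)), b2.1, b2.2, ?_, ?_⟩
  · rw [abs_mul, abs_neg]
    have := abs_nonneg (z.1 - z'.1)
    nlinarith
  · unfold Op.h2; linarith

theorem h2_up {z z' : ℝ × ℝ × ℝ} (hz : |z.2.2| ≤ c) (hz' : |z'.2.2| ≤ c) {v : ℝ} (hv : v ∈ Icc (1/2:ℝ) 2) :
    |O.h2 z z' v| ≤ |z.1 - z'.1| / 100 + 13 * |z.2.2 - z'.2.2| := by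
  obtain ⟨g, e, h1, h2, h3, h4⟩ := O.h2_form hz hz' hv
  rw [h4]
  refine (abs_add_le _ _).trans ?_
  rw [abs_mul, abs_neg, abs_of_pos (by linarith : 0 < g)]
  have := abs_nonneg (z.2.2 - z'.2.2)
  nlinarith

end Op
theorem sum_lint_le {ι α : Type*} [MeasurableSpace α] (μ : Measure α) (s : Finset ι) (f : ι → α → ℝ≥0∞) :
    ∑ i ∈ s, ∫⁻ a, f i a ∂μ ≤ ∫⁻ a, ∑ i ∈ s, f i a ∂μ := by
  classical
  induction s using Finset.induction_on with
  | empty => simp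
  | insert i s hi ih =>
    simp only [Finset.sum_insert hi]
    refine le_trans ?_ (le_lintegral_add _ _)
    gcongr

namespace Op
variable {c B : ℝ} (O : Op c B)

theorem h_cont : Continuous (fun w : ((ℝ × ℝ × ℝ) × (ℝ × ℝ × ℝ)) × ℝ => O.h w.1.1 w.1.2 w.2) := by
  have a : Continuous (fun w : ((ℝ × ℝ × ℝ) × (ℝ × ℝ × ℝ)) × ℝ => O.G w.2 w.1.1.2.2) :=
    O.cG.comp (f := fun w : ((ℝ × ℝ × ℝ) × (ℝ × ℝ × ℝ)) × ℝ => (w.2, w.1.1.2.2)) (by fun_prop)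
  have b : Continuous (fun w : ((ℝ × ℝ × ℝ) × (ℝ × ℝ × ℝ)) × ℝ => O.G (w.2 - (w.1.1.1 - w.1.2.1)) w.1.2.2.2) :=
    O.cG.comp (f := fun w : ((ℝ × ℝ × ℝ) × (ℝ × ℝ × ℝ)) × ℝ => (w.2 - (w.1.1.1 - w.1.2.1), w.1.2.2.2)) (by fun_prop)
  unfold h; fun_prop

/-- the relevant set -/
def Dset (L : ℝ) (j n l : ℕ) : Set (((ℝ × ℝ × ℝ) × (ℝ × ℝ × ℝ)) × ℝ) :=
  {w | w.2 ∈ V j n l w.1.1 w.1.2 ∧ |L * O.h w.1.1 w.1.2 w.2| ≤ 2}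

theorem Dset_meas (L : ℝ) (j n l : ℕ) : MeasurableSet (O.Dset L j n l) := by
  have h1 : MeasurableSet {w : ((ℝ × ℝ × ℝ) × (ℝ × ℝ × ℝ)) × ℝ | w.2 ∈ Sn j n} := (Sn_meas j n).preimage measurable_snd
  have h2 : MeasurableSet {w : ((ℝ × ℝ × ℝ) × (ℝ × ℝ × ℝ)) × ℝ | w.2 - (w.1.1.1 - w.1.2.1) ∈ Sn j l} :=
    (Sn_meas j l).preimage (by fun_prop)
  have h3 : MeasurableSet {w : ((ℝ × ℝ × ℝ) × (ℝ × ℝ × ℝ)) × ℝ | |L * O.h w.1.1 w.1.2 w.2| ≤ 2} :=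
    measurableSet_le ((continuous_const.mul O.h_cont).abs.measurable) measurable_const
  exact (h1.inter h2).inter h3

theorem yint {L : ℝ} (hL : 0 < L) (z : ℝ × ℝ × ℝ) (x' r' v : ℝ) :
    volume {y' : ℝ | |L * O.h z (x', y', r') v| ≤ 2} ≤ ofReal (4/L) := by
  have := vol_abs_le L 2 (z.2.1 - O.G v z.2.2 + O.G (v - (z.1 - x')) r') hL
  refine le_trans (le_of_eq ?_) (this.trans (le_of_eq (by norm_num)))
  congr 1; ext y'; simp only [mem_setOf_eq]; unfold h; simp only
  rw [show z.2.1 - y' - O.G v z.2.2 + O.G (v - (z.1 - x')) r' = z.2.1 - O.G v z.2.2 + O.G (v - (z.1 - x')) r' - y' by ring]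

/-- integrating the kernel majorant in the second variable -/
theorem yint2 {L : ℝ} (hL : 0 < L) (j n l : ℕ) (z : ℝ × ℝ × ℝ) (x' r' : ℝ) (w : ℝ≥0∞) :
    ∫⁻ y' : ℝ, ∫⁻ v, indicator {v | v ∈ V j n l z (x', y', r') ∧ |L * O.h z (x', y', r') v| ≤ 2} (fun _ => w) v ≤
      ∫⁻ v, (Sn j n).indicator (fun _ => 1) v * (Sn j l).indicator (fun _ => 1) (v - (z.1 - x')) * (w * ofReal (4/L)) := by
  have hm : MeasurableSet {p : ℝ × ℝ | p.2 ∈ V j n l z (x', p.1, r') ∧ |L * O.h z (x', p.1, r') p.2| ≤ 2} := by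
    have := (O.Dset_meas L j n l).preimage (f := fun p : ℝ × ℝ => ((z, (x', p.1, r')), p.2)) (by fun_prop)
    exact this
  rw [lintegral_lintegral_swap]
  · refine lintegral_mono fun v => ?_
    by_cases h1 : v ∈ Sn j n
    · by_cases h2 : v - (z.1 - x') ∈ Sn j l
      · rw [indicator_of_mem h1, indicator_of_mem h2, one_mul, one_mul]
        calc _ ≤ ∫⁻ y' : ℝ, indicator {y' : ℝ | |L * O.h z (x', y', r') v| ≤ 2} (fun _ => w) y' := by
              refine lintegral_mono fun y' => ?_
              by_cases h3 : |L * O.h z (x', y', r') v| ≤ 2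
              · rw [indicator_of_mem (a := y') (by exact h3)]
                exact indicator_le_self' (fun _ _ => by simp) _
              · rw [indicator_of_notMem]; exact zero_le; exact fun hc => h3 hc.2
          _ ≤ _ := by
              refine (lintegral_indicator_const_le _ _).trans ?_
              gcongr
              exact O.yint hL z x' r' v
      · refine le_trans (le_of_eq ?_) zero_le
        rw [lintegral_eq_zero_of_ae_eq_zero]
        refine Filter.Eventually.of_forall fun y' => ?_
        exact indicator_of_notMem (fun hc => h2 hc.1.2) _
    · refine le_trans (le_of_eq ?_) zero_le
      rw [lintegral_eq_zero_of_ae_eq_zero]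
      refine Filter.Eventually.of_forall fun y' => ?_
      exact indicator_of_notMem (fun hc => h1 hc.1.1) _
  · have : Measurable (indicator {p : ℝ × ℝ | p.2 ∈ V j n l z (x', p.1, r') ∧ |L * O.h z (x', p.1, r') p.2| ≤ 2} (fun _ => w)) :=
      measurable_const.indicator hm
    exact this.aemeasurable

theorem J2_kernel {L η : ℝ} (hL : 1 ≤ L) (hη : 0 < η) (hη1 : η < 1) {j : ℕ} (s : Finset ℕ) (hs : ∀ n ∈ s, adm j n)
    {n : ℕ} (hn : adm j n) (x y r : ℝ) (hr : |r| ≤ c) :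
    ∑ l ∈ s, ∫⁻ ω : ℝ × ℝ, ofReal |O.kap L j n l (x,y,r) (ω.1,ω.2,r)| ≤
      ofReal (12000000 * L^(η-1)) * Il η := by
  have hL0 : 0 < L := by linarith
  have hp : (1:ℝ) ≤ 2^j := one_le_pow₀ (by norm_num)
  set W : ℝ → ℝ≥0∞ := fun X => (Icc (-2:ℝ) 2).indicator (fun X => ofReal (1352 * (9 * 2^j * lw η L X))) X with hW
  have step1 : ∀ l ∈ s, ∫⁻ ω : ℝ × ℝ, ofReal |O.kap L j n l (x,y,r) (ω.1,ω.2,r)| ≤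
      ∫⁻ x', ∫⁻ v, (Sn j n).indicator (fun _ => 1) v * (Sn j l).indicator (fun _ => 1) (v - (x - x')) * (W (x - x') * ofReal (4/L)) := by
    intro l hl
    rw [Measure.volume_eq_prod]
    refine (lintegral_prod_le _).trans (lintegral_mono fun x' => ?_)
    refine le_trans ?_ (O.yint2 hL0 j n l (x,y,r) x' r (W (x-x')))
    refine lintegral_mono fun y' => ?_
    by_cases hX : x - x' ∈ Icc (-2:ℝ) 2
    · simp only [hW, indicator_of_mem hX]
      refine O.kap_w hL hn (hs l hl) (z := (x,y,r)) (z' := (x',y',r)) hr hr ?_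
      rcases lw_spec (X := x - x') hL hη hη1 with h | ⟨h0, h⟩
      · left
        have := lw_nonneg (η := η) (X := x - x') hL0.le
        nlinarith
      · right
        have hX0 : 0 < |x - x'| := abs_pos.2 h0
        refine ⟨Real.sqrt (|x - x'| / L), Real.sqrt_pos.2 (by positivity), fun v hv _ => ?_⟩
        have g1 := O.h1_up (z := (x,y,r)) (z' := (x',y',r)) hr hr (Sn_sub hn hv.1)
        have g2 := O.h2_up (z := (x,y,r)) (z' := (x',y',r)) hr hr (Sn_sub hn hv.1)
        simp only [sub_self, abs_zero, mul_zero, add_zero, sub_zero] at g1 g2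
        refine (wt_bd (C := 3) (κ := 1) hL0 hX0 hp one_pos (by norm_num) (by linarith) (by linarith) (by linarith)).trans ?_
        calc _ = 9 * 2^j * (1/|x-x'|) := by ring
          _ ≤ _ := by gcongr
    · refine (O.kap_triv hL hn (hs l hl) (z := (x,y,r)) (z' := (x',y',r)) hr hr).trans (lintegral_mono fun v => ?_)
      rw [indicator_of_notMem]
      · exact zero_le
      · intro hc
        apply hX
        have a1 := Sn_sub hn hc.1.1
        have a2 := Sn_sub (hs l hl) hc.1.2
        simp only [mem_Icc] at a1 a2 ⊢
        constructor <;> linarith [a1.1, a1.2, a2.1, a2.2]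
  calc _ ≤ ∑ l ∈ s, ∫⁻ x', ∫⁻ v, (Sn j n).indicator (fun _ => 1) v * (Sn j l).indicator (fun _ => 1) (v - (x - x')) * (W (x - x') * ofReal (4/L)) :=
        Finset.sum_le_sum step1
    _ ≤ ∫⁻ x', ∫⁻ v, ∑ l ∈ s, (Sn j n).indicator (fun _ => 1) v * (Sn j l).indicator (fun _ => 1) (v - (x - x')) * (W (x - x') * ofReal (4/L)) := by
        refine (sum_lint_le _ _ _).trans (lintegral_mono fun x' => ?_)
        exact sum_lint_le _ _ _
    _ ≤ ∫⁻ x', ∫⁻ v, (Sn j n).indicator (fun _ => 1) v * (4 * (W (x - x') * ofReal (4/L))) := by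
        refine lintegral_mono fun x' => lintegral_mono fun v => ?_
        simp only
        rw [← Finset.sum_mul, ← Finset.mul_sum, mul_assoc]
        gcongr
        exact Sn_count _ _ _
    _ = ∫⁻ x', ofReal (3/2^j) * (4 * (W (x - x') * ofReal (4/L))) := by
        refine lintegral_congr fun x' => ?_
        rw [lintegral_mul_const _ (measurable_const.indicator (Sn_meas j n)), lintegral_indicator_const (Sn_meas j n), Sn_vol, one_mul]
    _ = ofReal (3/2^j) * (4 * ((∫⁻ X, W X) * ofReal (4/L))) := by
        rw [lintegral_const_mul' _ _ ofReal_ne_top, lintegral_const_mul' _ _ (by simp), lintegral_mul_const' _ _ ofReal_ne_top]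
        rw [lintegral_sub_left_eq_self (fun X => W X) x]
    _ = ofReal (3/2^j) * (4 * ((ofReal (1352 * (9 * 2^j)) * (ofReal (L^η) * Il η)) * ofReal (4/L))) := by
        congr 3
        simp only [hW]
        rw [lintegral_indicator measurableSet_Icc, ← lw_int η L hL0.le, ← lintegral_const_mul' _ _ ofReal_ne_top]
        refine lintegral_congr fun X => ?_
        rw [← ofReal_mul (by positivity)]; congr 1; ring
    _ = ofReal (3/2^j * (4 * ((1352 * (9 * 2^j)) * L^η * (4/L)))) * Il η := by
        rw [show (4:ℝ≥0∞) = ofReal 4 by simp]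
        have E : ∀ a b : ℝ, 0 ≤ a → ofReal (a*b) = ofReal a * ofReal b := fun a b h => ofReal_mul h
        rw [E (3/2^j) _ (by positivity), E 4 _ (by positivity), E _ (4/L) (by positivity), E (1352 * (9*2^j)) (L^η) (by positivity)]
        ring
    _ ≤ _ := by
        refine mul_le_mul_left (ofReal_le_ofReal ?_) _
        rw [Real.rpow_sub hL0, Real.rpow_one]
        have : 3/2^j * (4 * ((1352 * (9 * 2^j)) * L^η * (4/L))) = 584064 * (L^η/L) := by field_simp; norm_num
        rw [this]
        have : 0 ≤ L^η/L := by positivity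
        linarith

theorem J2r {L η : ℝ} (hL : 1 ≤ L) (hη : 0 < η) (hη1 : η < 1) {j : ℕ} (s : Finset ℕ) (hs : ∀ n ∈ s, adm j n)
    (f : ℝ × ℝ → ℝ) (hf : Measurable f) (hF : ∀ t, |f t| ≤ 1) (r : ℝ) (hr : |r| ≤ c) :
    ∑ n ∈ s, ∫⁻ ω : ℝ × ℝ, ofReal ((O.u L j n f (ω.1,ω.2,r))^2) ≤
      (∫⁻ t, ofReal (f t ^ 2)) * (ofReal (12000000 * L^(η-1)) * Il η) := by
  have hL0 : 0 < L := by linarith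
  have h := schur_vec_on (ι := s) (Ω := ℝ × ℝ) (T := ℝ × ℝ) volume volume univ MeasurableSet.univ
    (fun n ω t => O.K L j n (ω.1,ω.2,r) t) (fun n => ?_) (13*L) (78/2^j) (by positivity) (by positivity)
    (fun n ω _ t => O.K_abs hL0 (hs n n.2) hr t) (fun n ω _ => O.K_lint hL (hs n n.2) hr) f hf 1 (by norm_num) hF
    (ofReal (12000000 * L^(η-1)) * Il η) (fun n ω _ => ?_)
  · rw [← Finset.sum_coe_sort]
    simp only [Measure.restrict_univ] at h
    exact h
  · exact (O.K_meas L j n).comp (g := Function.uncurry (O.K L j n)) (f := fun p : (ℝ × ℝ) × (ℝ × ℝ) => ((p.1.1, p.1.2, r), p.2)) (by fun_prop)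
  · have := O.J2_kernel hL hη hη1 s hs (hs n n.2) ω.1 ω.2 r hr
    rw [← Finset.sum_coe_sort] at this
    simp only [Measure.restrict_univ]
    exact this

/-- the slab -/
def Sl (c : ℝ) : Set (ℝ × ℝ × ℝ) := {z | |z.2.2| ≤ c}

theorem Sl_meas (c : ℝ) : MeasurableSet (Sl c) := measurableSet_le (by fun_prop) measurable_const

/-- integrate over the slab by slices `r` -/
theorem slab_lint (c : ℝ) (F : ℝ × ℝ × ℝ → ℝ≥0∞) (hF : Measurable F) :
    ∫⁻ z in Sl c, F z = ∫⁻ r in Icc (-c) c, ∫⁻ ω : ℝ × ℝ, F (ω.1, ω.2, r) := by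
  rw [← lintegral_indicator (Sl_meas c), ← lintegral_indicator measurableSet_Icc]
  have hm : Measurable ((Sl c).indicator F) := hF.indicator (Sl_meas c)
  have h1 := (volume_preserving_prodAssoc (α₁ := ℝ) (β₁ := ℝ) (γ₁ := ℝ)).lintegral_comp hm
  rw [← h1, Measure.volume_eq_prod, lintegral_prod_symm (fun a : (ℝ × ℝ) × ℝ => (Sl c).indicator F (MeasurableEquiv.prodAssoc a)) (hm.comp (MeasurableEquiv.measurable _)).aemeasurable]
  refine lintegral_congr fun r => ?_
  by_cases hr : r ∈ Icc (-c) c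
  · rw [indicator_of_mem hr]
    refine lintegral_congr fun ω => ?_
    exact indicator_of_mem (s := Sl c) (a := (ω.1, ω.2, r)) (abs_le.2 hr) F
  · rw [indicator_of_notMem hr]
    refine (lintegral_congr fun ω => ?_).trans lintegral_zero
    exact indicator_of_notMem (s := Sl c) (a := (ω.1, ω.2, r)) (fun hc => hr (abs_le.1 hc)) F

theorem u_meas (L : ℝ) (j n : ℕ) (f : ℝ × ℝ → ℝ) (hf : Measurable f) : Measurable (O.u L j n f) :=
  tt_u_meas volume (O.K L j n) (O.K_meas L j n) f hf

theorem J2 {L η : ℝ} (hL : 1 ≤ L) (hη : 0 < η) (hη1 : η < 1) {j : ℕ} (s : Finset ℕ) (hs : ∀ n ∈ s, adm j n)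
    (f : ℝ × ℝ → ℝ) (hf : Measurable f) (hF : ∀ t, |f t| ≤ 1) :
    ∑ n ∈ s, ∫⁻ z in Sl c, ofReal ((O.u L j n f z)^2) ≤
      (∫⁻ t, ofReal (f t ^ 2)) * (ofReal (24000000 * L^(η-1)) * Il η) := by
  have hm : ∀ n, Measurable fun z => ofReal ((O.u L j n f z)^2) := fun n => ((O.u_meas L j n f hf).pow_const 2).ennreal_ofReal
  simp only [slab_lint c _ (hm _)]
  refine (sum_lint_le _ _ _).trans ?_
  calc _ ≤ ∫⁻ r in Icc (-c) c, (∫⁻ t, ofReal (f t ^ 2)) * (ofReal (12000000 * L^(η-1)) * Il η) :=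
        setLIntegral_mono' measurableSet_Icc fun r hr => O.J2r hL hη hη1 s hs f hf hF r (abs_le.2 hr)
    _ ≤ (∫⁻ t, ofReal (f t ^ 2)) * (ofReal (12000000 * L^(η-1)) * Il η) * 2 := by
        rw [setLIntegral_const, Real.volume_Icc]
        gcongr
        rw [show (2:ℝ≥0∞) = ofReal 2 by simp]
        apply ofReal_le_ofReal
        linarith [O.hc1]
    _ = _ := by
        rw [show (24000000 * L^(η-1)) = 12000000 * L^(η-1) * 2 by ring, ofReal_mul (p := 12000000 * L^(η-1)) (by positivity)]
        rw [show ofReal 2 = (2:ℝ≥0∞) by simp]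
        ring

end Op
theorem wt_bd2 {L D a κ C h1 h2 : ℝ} (hL : 0 < L) (hD : 0 < D) (ha : 0 ≤ a) (hκ : 0 < κ)
    (b1 : κ * D ≤ |h1|) (b3 : |h2| ≤ C * D) :
    wt L (Real.sqrt (D/L)) a h1 h2 ≤ ((1 + C) / κ^2 + a / κ) / D := by
  have hC : 0 ≤ C := by
    by_contra hc; push Not at hc
    have : C * D < 0 := mul_neg_of_neg_of_pos hc hD
    linarith [abs_nonneg h2]
  unfold wt
  rw [Real.sq_sqrt (by positivity)]
  have e0 : (κ * D)^2 ≤ h1^2 := by rw [← sq_abs h1]; gcongr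
  have e1 : (κ * D)^2 ≤ D/L + h1^2 := by
    have : 0 < D/L := by positivity
    linarith
  have p : 0 < (κ * D)^2 := by positivity
  have hp : 0 < κ * D := by positivity
  have e2 : a * |h1| / (D/L + h1^2) ≤ a / (κ * D) := by
    have : 0 < D/L + h1^2 := by positivity
    rw [div_le_div_iff₀ this hp]
    have : κ * D * |h1| ≤ D/L + h1^2 := by
      rw [← sq_abs h1]
      have : 0 < D/L := by positivity
      nlinarith [abs_nonneg h1]
    nlinarith
  calc _ = L * (D/L) / (D/L + h1^2) + |h2| / (D/L + h1^2) + a * |h1| / (D/L + h1^2) := by ring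
    _ ≤ L * (D/L) / (κ*D)^2 + C * D / (κ*D)^2 + a / (κ * D) := by gcongr
    _ = _ := by field_simp

theorem taylor2 (f f' f'' : ℝ → ℝ) (h : ∀ x, HasDerivAt f (f' x) x) (h' : ∀ x, HasDerivAt f' (f'' x) x) (a b : ℝ) :
    ∃ ξ ∈ uIcc a b, f b = f a + f' a * (b - a) + f'' ξ * (b - a)^2 / 2 := by
  by_cases hab : a = b
  · subst hab; exact ⟨a, by simp, by simp⟩
  have hd : b - a ≠ 0 := sub_ne_zero.2 (Ne.symm hab)
  set Cc := (f b - f a - f' a * (b - a)) / (b-a)^2 with hCc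
  set g : ℝ → ℝ := fun x => f x - f a - f' a * (x - a) - Cc * (x - a)^2 with hg
  have dg : ∀ x, HasDerivAt g (f' x - f' a - Cc * (2 * (x - a))) x := by
    intro x
    have e1 := ((h x).sub_const (f a)).sub (((hasDerivAt_id x).sub_const a).const_mul (f' a))
    have e2 := (((hasDerivAt_id x).sub_const a).pow 2).const_mul Cc
    have := e1.sub e2
    refine HasDerivAt.congr_deriv (f := g) this ?_
    simp
  have ga : g a = 0 := by simp [hg]
  have gb : g b = 0 := by simp only [hg, hCc]; field_simp; ring
  have r1 : ∃ x ∈ uIoo a b, f' x - f' a - Cc * (2 * (x - a)) = 0 := by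
    rcases lt_or_gt_of_ne hab with hlt | hlt
    · obtain ⟨x, hx, h1⟩ := exists_hasDerivAt_eq_zero hlt (fun x _ => (dg x).continuousAt.continuousWithinAt) (by rw [ga, gb]) (fun x _ => dg x)
      exact ⟨x, by rw [uIoo_of_lt hlt]; exact hx, h1⟩
    · obtain ⟨x, hx, h1⟩ := exists_hasDerivAt_eq_zero hlt (fun x _ => (dg x).continuousAt.continuousWithinAt) (by rw [ga, gb]) (fun x _ => dg x)
      exact ⟨x, by rw [uIoo_of_gt hlt]; exact hx, h1⟩
  obtain ⟨x, hx, h1⟩ := r1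
  obtain ⟨ξ, hξ, h2⟩ := mv f' f'' h' a x
  have hxa : x - a ≠ 0 := by
    intro hc; have : x = a := by linarith
    subst this; simp [uIoo] at hx; exact absurd (hx.1.trans hx.2) (lt_irrefl _)
  refine ⟨ξ, uIcc_subset_uIcc_left (Ioo_subset_Icc_self hx) hξ, ?_⟩
  have h3 : f'' ξ = 2 * Cc := by
    have : (f'' ξ - 2 * Cc) * (x - a) = 0 := by linarith
    rcases mul_eq_zero.1 this with h | h
    · linarith
    · exact absurd h hxa
  rw [h3, hCc]; field_simp; ring

theorem vol_diam (s : Set ℝ) (d : ℝ) (h : ∀ a ∈ s, ∀ b ∈ s, |a - b| ≤ d) : volume s ≤ ofReal (2*d) := by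
  rcases s.eq_empty_or_nonempty with rfl | ⟨a, ha⟩
  · simp
  · have : s ⊆ Icc (a - d) (a + d) := by
      intro b hb
      have := abs_le.1 (h a ha b hb)
      exact ⟨by linarith, by linarith⟩
    refine (measure_mono this).trans ?_
    rw [Real.volume_Icc]; apply ofReal_le_ofReal; linarith

namespace Op
variable {c B : ℝ} (O : Op c B)

theorem far_sep {j n n' : ℕ} (hf : far n n') {v1 v2 : ℝ} (h1 : v1 ∈ Sn j n) (h2 : v2 ∈ Sn j n') : 1 ≤ 2^j * |v1 - v2| := by
  obtain ⟨a1, a2⟩ := h1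
  obtain ⟨b1, b2⟩ := h2
  have hp : (0:ℝ) < 2^j := by positivity
  rw [← abs_of_pos hp, ← abs_mul, mul_sub]
  rcases hf with h | h
  · have : (n:ℝ) + 4 ≤ n' := by exact_mod_cast h
    rw [abs_sub_comm]; refine le_trans ?_ (le_abs_self _); linarith
  · have : (n':ℝ) + 4 ≤ n := by exact_mod_cast h
    refine le_trans ?_ (le_abs_self _); linarith

noncomputable def wσ (L : ℝ) (j : ℕ) (σ : ℝ) : ℝ := 2 * L / Real.sqrt (1 + (L / (100 * 4^j) * σ)^2)

theorem wσ_spec {L : ℝ} (hL : 1 ≤ L) (j : ℕ) (σ : ℝ) :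
    L ≤ wσ L j σ ∨ (100 * 4^j ≤ L * |σ| ∧ 100 * 4^j / |σ| ≤ wσ L j σ) := by
  have hL0 : 0 < L := by linarith
  have hp : (0:ℝ) < 100 * 4^j := by positivity
  unfold wσ
  have hs : 0 < Real.sqrt (1 + (L / (100 * 4^j) * σ)^2) := Real.sqrt_pos.2 (by positivity)
  by_cases h : L * |σ| < 100 * 4^j
  · left
    rw [le_div_iff₀ hs]
    have : Real.sqrt (1 + (L / (100 * 4^j) * σ)^2) ≤ 2 := by
      rw [Real.sqrt_le_left (by norm_num)]
      have h2 : |L / (100 * 4^j) * σ| ≤ 1 := by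
        rw [abs_mul, abs_of_pos (by positivity), div_mul_eq_mul_div, div_le_one hp]; exact h.le
      have := sq_le_one_iff_abs_le_one (L / (100 * 4^j) * σ)
      have := this.2 h2
      linarith
    nlinarith
  · right
    push Not at h
    refine ⟨h, ?_⟩
    have hσ : 0 < |σ| := by by_contra hc; push Not at hc; nlinarith
    rw [div_le_div_iff₀ hσ hs]
    have h2 : 1 ≤ L / (100 * 4^j) * |σ| := by
        rw [div_mul_eq_mul_div, one_le_div hp]; exact h
    have : Real.sqrt (1 + (L / (100 * 4^j) * σ)^2) ≤ 2 * (L / (100 * 4^j) * |σ|) := by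
      rw [Real.sqrt_le_left (by positivity)]
      have e : (L / (100 * 4^j) * σ)^2 = (L / (100 * 4^j) * |σ|)^2 := by rw [mul_pow, mul_pow, sq_abs]
      rw [e]; nlinarith
    calc _ ≤ 100 * 4^j * (2 * (L / (100 * 4^j) * |σ|)) := by gcongr
      _ = _ := by field_simp

theorem wσ_nonneg {L : ℝ} (hL : 1 ≤ L) (j : ℕ) (σ : ℝ) : 0 ≤ wσ L j σ := by unfold wσ; positivity

theorem wσ_int {L : ℝ} (hL : 1 ≤ L) (j : ℕ) (r : ℝ) : ∫⁻ σ, ofReal ((wσ L j (r - σ))^2) ≤ ofReal (1600 * L * 4^j) := by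
  have hL0 : 0 < L := by linarith
  have hp : (0:ℝ) < 100 * 4^j := by positivity
  have ha : 0 < L / (100 * 4^j) := by positivity
  rw [lintegral_sub_left_eq_self (fun σ => ofReal ((wσ L j σ)^2)) r]
  have e : ∀ σ, (wσ L j σ)^2 = 4 * L^2 * (1 + (L / (100 * 4^j) * σ)^2)⁻¹ := by
    intro σ; unfold wσ; rw [div_pow, Real.sq_sqrt (by positivity)]; ring
  simp only [e]
  have hi := (integrable_inv_one_add_sq.comp_mul_left' ha.ne').const_mul (4 * L^2)
  rw [← ofReal_integral_eq_lintegral_ofReal hi (Filter.Eventually.of_forall fun σ => by positivity)]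
  apply ofReal_le_ofReal
  rw [integral_const_mul]
  rw [Measure.integral_comp_mul_left (fun s => (1 + s^2)⁻¹) (L / (100 * 4^j)), integral_univ_inv_one_add_sq, abs_of_pos (by positivity), smul_eq_mul]
  have : 4 * L^2 * ((L / (100 * 4^j))⁻¹ * Real.pi) = 400 * Real.pi * (L * 4^j) := by field_simp; ring
  rw [this]
  have := Real.pi_lt_four
  have h3 : 0 < L * 4^j := by positivity
  nlinarith

set_option maxHeartbeats 1000000 in
/-- weight for two transversal pieces -/
theorem far_weight {L : ℝ} (hL : 1 ≤ L) {j n n' l l' : ℕ} (hn : adm j n) (hn' : adm j n') (hf : far n n')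
    {z z' : ℝ × ℝ × ℝ} (hz : |z.2.2| ≤ c) (hz' : |z'.2.2| ≤ c)
    {v2 : ℝ} (hv2 : v2 ∈ V j n' l' z z') (hh2 : |L * O.h z z' v2| ≤ 2) :
    L ≤ wσ L j (z.2.2 - z'.2.2) ∨ ∃ Δ, 0 < Δ ∧ ∀ v ∈ V j n l z z', |L * O.h z z' v| ≤ 2 →
      wt L Δ (2^j) (O.h1 z z' v) (O.h2 z z' v) ≤ wσ L j (z.2.2 - z'.2.2) := by
  rcases wσ_spec hL j (z.2.2 - z'.2.2) with h | ⟨hσL, h⟩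
  · left; exact h
  right
  have hL0 : 0 < L := by linarith
  have hp : (1:ℝ) ≤ 2^j := one_le_pow₀ (by norm_num)
  have h4 : (4:ℝ)^j = 2^j * 2^j := by rw [← mul_pow]; norm_num
  set σ := z.2.2 - z'.2.2 with hσ
  set X := z.1 - z'.1 with hX
  have hσ0 : 0 < |σ| := by
    by_contra hc; push Not at hc
    have : 0 < (100:ℝ) * 4^j := by positivity
    nlinarith
  by_cases hXσ : 20 * |σ| < |X|
  · have hX0 : 0 < |X| := by linarith
    refine ⟨Real.sqrt (|X| / L), Real.sqrt_pos.2 (by positivity), fun v hv _ => ?_⟩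
    have g1 := (O.h1_up hz hz' (Sn_sub hn hv.1)).2
    have g2 := O.h2_up hz hz' (Sn_sub hn hv.1)
    rw [← hσ, ← hX] at g1 g2
    refine (wt_bd2 (C := 1) (κ := 7/20) hL0 hX0 (by positivity) (by norm_num) (by linarith) (by linarith)).trans (le_trans ?_ h)
    rw [h4]
    calc _ ≤ (100 * 2^j) / |X| := by gcongr; norm_num; linarith
      _ ≤ (100 * (2^j * 2^j)) / |σ| := div_le_div₀ (by positivity) (by nlinarith) hσ0 (by linarith)
  · push Not at hXσ
    refine ⟨Real.sqrt (|σ| / L), Real.sqrt_pos.2 (by positivity), fun v hv hh => ?_⟩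
    have hvI := Sn_sub hn hv.1
    have hv2I := Sn_sub hn' hv2.1
    have g2 := O.h2_up hz hz' hvI
    rw [← hσ, ← hX] at g2
    have hsep := far_sep hf hv.1 hv2.1
    set d := |v - v2| with hd
    have hd0 : 0 < d := by by_contra hc; push Not at hc; nlinarith
    obtain ⟨ξ, hξ, ht⟩ := taylor2 _ _ _ (O.h_d z z') (O.h1_d z z') v v2
    have hξI := mem_uIcc_conv hvI hv2I hξ
    obtain ⟨g, e, q1, q2, q3, q4⟩ := O.h2_form hz hz' hξI
    rw [← hX] at q3
    rw [← hσ] at q4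
    have k1 : 1.8 * |σ| ≤ |O.h2 z z' ξ| := by
      rw [q4]
      have := abs_sub_abs_le_abs_sub (g * σ) e
      rw [abs_mul, abs_of_pos (by linarith : 0 < g)] at this
      have e' : -g*σ+e = -(g*σ-e) := by ring
      rw [e', abs_neg]
      have : 2 * |σ| ≤ g * |σ| := mul_le_mul_of_nonneg_right q1 hσ0.le
      linarith
    have k2 : |O.h z z' v| ≤ 2 / L ∧ |O.h z z' v2| ≤ 2 / L := by
      rw [abs_mul, abs_of_pos hL0] at hh hh2
      constructor <;> rw [le_div_iff₀ hL0] <;> linarith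
    have k3 : 0.9 * |σ| * d^2 ≤ |O.h1 z z' v| * d + 4 / L := by
      have e1 : O.h2 z z' ξ * (v2 - v)^2 / 2 = O.h z z' v2 - O.h z z' v - O.h1 z z' v * (v2 - v) := by linarith
      have e2 : |O.h2 z z' ξ * (v2 - v)^2 / 2| = |O.h2 z z' ξ| * d^2 / 2 := by
        rw [abs_div, abs_mul, abs_two, abs_pow, abs_sub_comm v2 v]
      have e3 : |O.h z z' v2 - O.h z z' v - O.h1 z z' v * (v2 - v)| ≤ 2/L + 2/L + |O.h1 z z' v| * d := by
        refine (abs_sub _ _).trans ?_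
        rw [abs_mul, abs_sub_comm v2 v]
        have := abs_sub (O.h z z' v2) (O.h z z' v)
        linarith [k2.1, k2.2]
      rw [← e1, e2] at e3
      have e4 : 2/L + 2/L = 4/L := by ring
      have := mul_le_mul_of_nonneg_right k1 (sq_nonneg d)
      linarith
    have k4 : 4 / L ≤ 0.1 * |σ| * d^2 := by
      rw [div_le_iff₀ hL0]
      have : 1 ≤ 4^j * d^2 := by
        have e : 4^j * d^2 = (2^j * d)^2 := by rw [h4]; ring
        rw [e]; exact one_le_pow₀ hsep
      have h5 : (100 * 4^j) * d^2 ≤ L * |σ| * d^2 := mul_le_mul_of_nonneg_right hσL (sq_nonneg d)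
      linarith
    have k5 : 1/2 * (2^j)⁻¹ * |σ| ≤ |O.h1 z z' v| := by
      have a1 : 0.8 * |σ| * d ≤ |O.h1 z z' v| := by
        have : 0.8 * |σ| * d * d ≤ |O.h1 z z' v| * d := by linarith
        exact le_of_mul_le_mul_right this hd0
      have a2 : (2^j)⁻¹ ≤ d := by rw [inv_le_iff_one_le_mul₀ (by positivity)]; linarith
      have a3 := mul_le_mul_of_nonneg_left a2 hσ0.le
      have a4 : 0 ≤ |σ| * (2^j)⁻¹ := by positivity
      linarith
    refine (wt_bd2 (C := 14) (κ := 1/2 * (2^j)⁻¹) hL0 hσ0 (by positivity) (by positivity) k5 (by linarith)).trans (le_trans ?_ h)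
    gcongr
    rw [h4]
    have hp0 : (0:ℝ) < 2^j := by positivity
    have : (1 + 14) / (1 / 2 * ((2:ℝ) ^ j)⁻¹) ^ 2 + 2 ^ j / (1 / 2 * (2 ^ j)⁻¹) = 62 * (2^j * 2^j) := by field_simp; norm_num
    rw [this]; nlinarith

end Op
end MS

namespace MS
namespace Op
variable {c B : ℝ} (O : Op c B)

theorem kap_meas (L : ℝ) (j n l : ℕ) (z : ℝ × ℝ × ℝ) : Measurable (fun z' => O.kap L j n l z z') := by
  have h : Measurable (Function.uncurry fun (z' : ℝ × ℝ × ℝ) (t : ℝ × ℝ) => O.K L j n z t * O.K L j l z' t) :=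
    ((O.K_cont2 L j n z).measurable.comp measurable_snd).mul (O.K_meas L j l)
  exact (h.stronglyMeasurable.integral_prod_right (ν := volume)).measurable

/-- indicator of the relevant values -/
noncomputable def ind (L : ℝ) (j n : ℕ) (z z' : ℝ × ℝ × ℝ) (v : ℝ) : ℝ≥0∞ :=
  indicator {v | v ∈ Sn j n ∧ |L * O.h z z' v| ≤ 2} (fun _ => 1) v

theorem ind_meas (L : ℝ) (j n : ℕ) : Measurable (fun w : ((ℝ × ℝ × ℝ) × (ℝ × ℝ × ℝ)) × ℝ => O.ind L j n w.1.1 w.1.2 w.2) := by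
  have h1 : MeasurableSet {w : ((ℝ × ℝ × ℝ) × (ℝ × ℝ × ℝ)) × ℝ | w.2 ∈ Sn j n} := (Sn_meas j n).preimage measurable_snd
  have h3 : MeasurableSet {w : ((ℝ × ℝ × ℝ) × (ℝ × ℝ × ℝ)) × ℝ | |L * O.h w.1.1 w.1.2 w.2| ≤ 2} :=
    measurableSet_le ((continuous_const.mul O.h_cont).abs.measurable) measurable_const
  exact (measurable_const (a := (1:ℝ≥0∞))).indicator (h1.inter h3)

theorem sum_V_le (L : ℝ) (j n : ℕ) (s : Finset ℕ) (z z' : ℝ × ℝ × ℝ) (w : ℝ≥0∞) :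
    ∑ l ∈ s, ∫⁻ v, indicator {v | v ∈ V j n l z z' ∧ |L * O.h z z' v| ≤ 2} (fun _ => w) v ≤
      4 * w * ∫⁻ v, O.ind L j n z z' v := by
  have hm : Measurable (fun v => O.ind L j n z z' v) := (O.ind_meas L j n).comp (f := fun v => ((z,z'),v)) (by fun_prop)
  refine (sum_lint_le _ _ _).trans ?_
  rw [← lintegral_const_mul _ hm]
  refine lintegral_mono fun v => ?_
  simp only
  calc _ ≤ ∑ l ∈ s, (w * O.ind L j n z z' v) * (Sn j l).indicator (fun _ => 1) (v - (z.1 - z'.1)) := by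
        refine Finset.sum_le_sum fun l _ => ?_
        by_cases hv : v ∈ V j n l z z' ∧ |L * O.h z z' v| ≤ 2
        · rw [indicator_of_mem (by exact hv), indicator_of_mem hv.1.2]
          unfold ind
          rw [indicator_of_mem (by exact ⟨hv.1.1, hv.2⟩)]; simp
        · rw [indicator_of_notMem (by exact hv)]; exact zero_le
    _ = (w * O.ind L j n z z' v) * ∑ l ∈ s, (Sn j l).indicator (fun _ => 1) (v - (z.1 - z'.1)) := by rw [Finset.mul_sum]
    _ ≤ (w * O.ind L j n z z' v) * 4 := by gcongr; exact Sn_count _ _ _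
    _ = _ := by ring

/-- area of the intersection of two transversal strips -/
theorem area {L : ℝ} (hL : 0 < L) {j : ℕ} (z : ℝ × ℝ × ℝ) {r' : ℝ} (hr' : |r'| ≤ c) {v1 v2 : ℝ} (hv : 1 ≤ 2^j * |v1 - v2|) :
    ∫⁻ x', ∫⁻ y', {p : ℝ × ℝ | |L * O.h z (p.1,p.2,r') v1| ≤ 2 ∧ |L * O.h z (p.1,p.2,r') v2| ≤ 2}.indicator (fun _ => (1:ℝ≥0∞)) (x',y') ≤
      ofReal (64 * 2^j / L^2) := by
  set g : ℝ → ℝ := fun x' => O.G (v1 - (z.1 - x')) r' - O.G (v2 - (z.1 - x')) r' - O.G v1 z.2.2 + O.G v2 z.2.2 with hg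
  have dg : ∀ x', HasDerivAt g (O.Gv (v1 - (z.1 - x')) r' - O.Gv (v2 - (z.1 - x')) r') x' := by
    intro x'
    have a : ∀ v, HasDerivAt (fun x' => O.G (v - (z.1 - x')) r') (O.Gv (v - (z.1 - x')) r') x' := by
      intro v
      have h1 : HasDerivAt (fun x' => v - (z.1 - x')) 1 x' := by
        simpa using ((hasDerivAt_id x').const_sub z.1).const_sub v
      exact ((O.dGv (v - (z.1 - x')) r').comp x' h1).congr_deriv (mul_one _)
    exact (((a v1).sub (a v2)).sub_const _).add_const _
  set T : Set ℝ := {x' | |g x'| ≤ 4 / L} with hT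
  have hTm : MeasurableSet T := by
    have : Continuous g := continuous_iff_continuousAt.2 fun x => (dg x).continuousAt
    exact measurableSet_le this.abs.measurable measurable_const
  have hp : (0:ℝ) < 2^j := by positivity
  have hTv : volume T ≤ ofReal (2 * (8 * 2^j / L)) := by
    refine vol_diam T _ fun a ha b hb => ?_
    obtain ⟨ξ, -, h1⟩ := mv g _ dg b a
    obtain ⟨ζ, -, h2⟩ := mv (fun v => O.Gv v r') _ (fun v => O.dGvv v r') (v2 - (z.1 - ξ)) (v1 - (z.1 - ξ))
    rw [h2] at h1
    have h3 := (O.bGvv ζ r' hr').1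
    have h4 : |g a - g b| ≤ 8 / L := by
      refine (abs_sub _ _).trans ?_
      have : (8:ℝ)/L = 4/L + 4/L := by ring
      rw [this]; exact add_le_add ha hb
    rw [h1, abs_mul, abs_mul, abs_of_pos (by linarith : 0 < O.Gvv ζ r'), show v1 - (z.1 - ξ) - (v2 - (z.1 - ξ)) = v1 - v2 by ring] at h4
    have h5 : |v1 - v2| * |a - b| ≤ 8 / L := by
      refine le_trans ?_ h4
      gcongr
      nlinarith [abs_nonneg (v1 - v2)]
    calc |a - b| ≤ (2^j * |v1 - v2|) * |a - b| := by nlinarith [abs_nonneg (a - b)]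
      _ = 2^j * (|v1 - v2| * |a - b|) := by ring
      _ ≤ 2^j * (8/L) := by gcongr
      _ = _ := by ring
  calc _ ≤ ∫⁻ x', T.indicator (fun _ => ofReal (4/L)) x' := by
        refine lintegral_mono fun x' => ?_
        by_cases hx : x' ∈ T
        · rw [indicator_of_mem hx]
          refine le_trans ?_ (O.yint hL z x' r' v1)
          rw [← one_mul (volume _)]
          refine le_trans (lintegral_mono fun y' => ?_) (lintegral_indicator_const_le _ 1)
          by_cases h3 : |L * O.h z (x', y', r') v1| ≤ 2
          · rw [indicator_of_mem (a := y') (by exact h3)]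
            exact indicator_le_self' (fun _ _ => by simp) _
          · rw [indicator_of_notMem]; exact zero_le; exact fun hc => h3 hc.1
        · rw [indicator_of_notMem hx]
          refine le_of_eq (lintegral_eq_zero_of_ae_eq_zero (Filter.Eventually.of_forall fun y' => ?_))
          refine indicator_of_notMem (fun hc => hx ?_) _
          have hk1 : |O.h z (x', y', r') v1| ≤ 2 / L := by
            have := hc.1; rw [abs_mul, abs_of_pos hL] at this; rw [le_div_iff₀ hL]; linarith
          have hk2 : |O.h z (x', y', r') v2| ≤ 2 / L := by
            have := hc.2; rw [abs_mul, abs_of_pos hL] at this; rw [le_div_iff₀ hL]; linarith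
          have : g x' = O.h z (x', y', r') v1 - O.h z (x', y', r') v2 := by
            simp only [hg]; unfold h; simp only; ring
          show |g x'| ≤ 4/L
          rw [this]
          refine (abs_sub _ _).trans ?_
          have : (4:ℝ)/L = 2/L + 2/L := by ring
          linarith
    _ ≤ ofReal (4/L) * ofReal (2 * (8 * 2^j / L)) := by
        rw [lintegral_indicator_const hTm]; gcongr
    _ = _ := by rw [← ofReal_mul (by positivity)]; congr 1; field_simp; norm_num

theorem far_kk {L : ℝ} (hL : 1 ≤ L) {j n n' l l' : ℕ} (hn : adm j n) (hn' : adm j n') (hl : adm j l) (hl' : adm j l') (hf : far n n')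
    {z z' : ℝ × ℝ × ℝ} (hz : |z.2.2| ≤ c) (hz' : |z'.2.2| ≤ c) :
    ofReal |O.kap L j n l z z' * O.kap L j n' l' z z'| ≤
      (∫⁻ v, indicator {v | v ∈ V j n l z z' ∧ |L * O.h z z' v| ≤ 2} (fun _ => ofReal (1352 * wσ L j (z.2.2 - z'.2.2))) v) *
      (∫⁻ v, indicator {v | v ∈ V j n' l' z z' ∧ |L * O.h z z' v| ≤ 2} (fun _ => ofReal (1352 * wσ L j (z.2.2 - z'.2.2))) v) := by
  have hf' : far n' n := hf.symm
  have zero : ∀ n l, adm j n → adm j l → (¬ ∃ v, v ∈ V j n l z z' ∧ |L * O.h z z' v| ≤ 2) → O.kap L j n l z z' = 0 := by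
    intro n l hn hl h
    have := O.kap_triv hL hn hl hz hz'
    have e : {v | v ∈ V j n l z z' ∧ |L * O.h z z' v| ≤ 2} = ∅ := by
      ext v; simp only [mem_setOf_eq, mem_empty_iff_false, iff_false]; exact fun hc => h ⟨v, hc⟩
    rw [e] at this
    simpa using this
  by_cases h1 : ∃ v, v ∈ V j n l z z' ∧ |L * O.h z z' v| ≤ 2
  · by_cases h2 : ∃ v, v ∈ V j n' l' z z' ∧ |L * O.h z z' v| ≤ 2
    · obtain ⟨v1, a1, b1⟩ := h1
      obtain ⟨v2, a2, b2⟩ := h2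
      rw [abs_mul, ofReal_mul (abs_nonneg _)]
      exact mul_le_mul' (O.kap_w hL hn hl hz hz' (O.far_weight hL hn hn' hf hz hz' a2 b2))
        (O.kap_w hL hn' hl' hz hz' (O.far_weight hL hn' hn hf' hz hz' a1 b1))
    · rw [zero _ _ hn' hl' h2]; simp
  · rw [zero _ _ hn hl h1]; simp

theorem J4_kernel {L : ℝ} (hL : 1 ≤ L) {j : ℕ} (s : Finset ℕ) (hs : ∀ n ∈ s, adm j n)
    {n n' : ℕ} (hn : adm j n) (hn' : adm j n') (hf : far n n') (z : ℝ × ℝ × ℝ) (hz : |z.2.2| ≤ c) :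
    ∑ p ∈ s ×ˢ s, ∫⁻ z' in Sl c, ofReal |O.kap L j n p.1 z z' * O.kap L j n' p.2 z z'| ≤
      ofReal (30000000000000 * 2^j / L) := by
  have hL0 : 0 < L := by linarith
  have hp : (0:ℝ) < 2^j := by positivity
  have hm : ∀ p : ℕ × ℕ, Measurable fun z' => ofReal |O.kap L j n p.1 z z' * O.kap L j n' p.2 z z'| := fun p =>
    ((O.kap_meas L j n p.1 z).mul (O.kap_meas L j n' p.2 z)).norm.ennreal_ofReal
  simp only [slab_lint c _ (hm _)]
  refine (sum_lint_le _ _ _).trans ?_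
  have key : ∀ r' ∈ Icc (-c) c, ∑ p ∈ s ×ˢ s, ∫⁻ ω : ℝ × ℝ, ofReal |O.kap L j n p.1 z (ω.1,ω.2,r') * O.kap L j n' p.2 z (ω.1,ω.2,r')| ≤
      ofReal (16 * 1352^2 * (9 / 4^j) * (64 * 2^j / L^2)) * ofReal ((wσ L j (z.2.2 - r'))^2) := by
    intro r' hr
    have hr' : |r'| ≤ c := abs_le.2 hr
    set w := ofReal (1352 * wσ L j (z.2.2 - r')) with hw
    refine (sum_lint_le _ _ _).trans ?_
    have hi : ∀ n, Measurable fun q : (ℝ × ℝ) × ℝ => O.ind L j n z (q.1.1, q.1.2, r') q.2 := fun n =>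
      (O.ind_meas L j n).comp (f := fun q : (ℝ × ℝ) × ℝ => ((z, (q.1.1, q.1.2, r')), q.2)) (by fun_prop)
    have hi2 : Measurable fun q : (ℝ × ℝ) × (ℝ × ℝ) => O.ind L j n z (q.1.1, q.1.2, r') q.2.1 * O.ind L j n' z (q.1.1, q.1.2, r') q.2.2 :=
      ((hi n).comp (f := fun q : (ℝ × ℝ) × (ℝ × ℝ) => (q.1, q.2.1)) (by fun_prop)).mul
        ((hi n').comp (f := fun q : (ℝ × ℝ) × (ℝ × ℝ) => (q.1, q.2.2)) (by fun_prop))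
    have st : ∀ vv : ℝ × ℝ, ∫⁻ ω : ℝ × ℝ, O.ind L j n z (ω.1, ω.2, r') vv.1 * O.ind L j n' z (ω.1, ω.2, r') vv.2 ≤
        (Sn j n).indicator (fun _ => 1) vv.1 * (Sn j n').indicator (fun _ => 1) vv.2 * ofReal (64 * 2^j / L^2) := by
      rintro ⟨v1, v2⟩
      by_cases h1 : v1 ∈ Sn j n
      · by_cases h2 : v2 ∈ Sn j n'
        · simp only [indicator_of_mem h1, indicator_of_mem h2, one_mul]
          rw [Measure.volume_eq_prod]
          refine (lintegral_prod_le _).trans (le_trans ?_ (O.area hL0 z hr' (far_sep hf h1 h2)))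
          refine lintegral_mono fun x' => lintegral_mono fun y' => ?_
          simp only
          by_cases h3 : |L * O.h z (x', y', r') v1| ≤ 2 ∧ |L * O.h z (x', y', r') v2| ≤ 2
          · rw [indicator_of_mem (by exact h3)]
            unfold ind
            rw [indicator_of_mem (by exact ⟨h1, h3.1⟩), indicator_of_mem (by exact ⟨h2, h3.2⟩)]; simp
          · refine le_trans (le_of_eq ?_) zero_le
            unfold ind
            rw [mul_eq_zero]
            by_contra hc; push Not at hc
            apply h3
            constructor
            · by_contra h4; exact hc.1 (indicator_of_notMem (fun h5 => h4 h5.2) _)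
            · by_contra h4; exact hc.2 (indicator_of_notMem (fun h5 => h4 h5.2) _)
        · refine le_trans (le_of_eq ?_) zero_le
          refine lintegral_eq_zero_of_ae_eq_zero (Filter.Eventually.of_forall fun ω => ?_)
          simp only; unfold ind
          rw [indicator_of_notMem (s := {v | v ∈ Sn j n' ∧ _}) (fun h5 => h2 h5.1)]; simp
      · refine le_trans (le_of_eq ?_) zero_le
        refine lintegral_eq_zero_of_ae_eq_zero (Filter.Eventually.of_forall fun ω => ?_)
        simp only; unfold ind
        rw [indicator_of_notMem (s := {v | v ∈ Sn j n ∧ _}) (fun h5 => h1 h5.1)]; simp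
    calc _ ≤ ∫⁻ ω : ℝ × ℝ, (4 * w * ∫⁻ v, O.ind L j n z (ω.1,ω.2,r') v) * (4 * w * ∫⁻ v, O.ind L j n' z (ω.1,ω.2,r') v) := by
          refine lintegral_mono fun ω => ?_
          simp only
          calc _ ≤ ∑ p ∈ s ×ˢ s, (∫⁻ v, indicator {v | v ∈ V j n p.1 z (ω.1,ω.2,r') ∧ |L * O.h z (ω.1,ω.2,r') v| ≤ 2} (fun _ => w) v) *
                  (∫⁻ v, indicator {v | v ∈ V j n' p.2 z (ω.1,ω.2,r') ∧ |L * O.h z (ω.1,ω.2,r') v| ≤ 2} (fun _ => w) v) := by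
                refine Finset.sum_le_sum fun p hp => ?_
                rw [Finset.mem_product] at hp
                exact O.far_kk hL hn hn' (hs _ hp.1) (hs _ hp.2) hf (z := z) (z' := (ω.1,ω.2,r')) hz hr'
            _ = _ := by rw [Finset.sum_mul_sum, Finset.sum_product]
            _ ≤ _ := mul_le_mul' (O.sum_V_le L j n s z _ w) (O.sum_V_le L j n' s z _ w)
      _ = 16 * w^2 * ∫⁻ ω : ℝ × ℝ, ∫⁻ vv : ℝ × ℝ, O.ind L j n z (ω.1, ω.2, r') vv.1 * O.ind L j n' z (ω.1, ω.2, r') vv.2 := by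
          rw [← lintegral_const_mul _ (hi2.lintegral_prod_right')]
          refine lintegral_congr fun ω => ?_
          have := lintegral_prod_mul (μ := (volume : Measure ℝ)) (ν := (volume : Measure ℝ)) (f := fun v => O.ind L j n z (ω.1,ω.2,r') v) (g := fun v => O.ind L j n' z (ω.1,ω.2,r') v)
            ((hi n).comp (f := fun v => (ω, v)) (by fun_prop)).aemeasurable ((hi n').comp (f := fun v => (ω, v)) (by fun_prop)).aemeasurable
          rw [Measure.volume_eq_prod, this]; ring
      _ = 16 * w^2 * ∫⁻ vv : ℝ × ℝ, ∫⁻ ω : ℝ × ℝ, O.ind L j n z (ω.1, ω.2, r') vv.1 * O.ind L j n' z (ω.1, ω.2, r') vv.2 := by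
          rw [lintegral_lintegral_swap]; exact hi2.aemeasurable
      _ ≤ 16 * w^2 * ∫⁻ vv : ℝ × ℝ, (Sn j n).indicator (fun _ => 1) vv.1 * (Sn j n').indicator (fun _ => 1) vv.2 * ofReal (64 * 2^j / L^2) := by
          gcongr with vv; exact st vv
      _ = 16 * w^2 * ((ofReal (3/2^j) * ofReal (3/2^j)) * ofReal (64 * 2^j / L^2)) := by
          rw [lintegral_mul_const' _ _ ofReal_ne_top, Measure.volume_eq_prod,
            lintegral_prod_mul (f := (Sn j n).indicator (fun _ => 1)) (g := (Sn j n').indicator (fun _ => 1)) (measurable_const.indicator (Sn_meas j n)).aemeasurable (measurable_const.indicator (Sn_meas j n')).aemeasurable,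
            lintegral_indicator_const (Sn_meas j n), lintegral_indicator_const (Sn_meas j n'), Sn_vol, Sn_vol]; simp
      _ = _ := by
          have hwn := wσ_nonneg hL j (z.2.2 - r')
          rw [hw, ← ENNReal.ofReal_pow (by positivity), show (16:ℝ≥0∞) = ofReal 16 by simp]
          rw [← ofReal_mul (by positivity), ← ofReal_mul (by positivity), ← ofReal_mul (by positivity), ← ofReal_mul (by positivity), ← ofReal_mul (by positivity)]
          congr 1
          rw [show (4:ℝ)^j = 2^j * 2^j by rw [← mul_pow]; norm_num]
          field_simp
          norm_num
  calc _ ≤ ∫⁻ r' in Icc (-c) c, ofReal (16 * 1352^2 * (9 / 4^j) * (64 * 2^j / L^2)) * ofReal ((wσ L j (z.2.2 - r'))^2) :=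
        setLIntegral_mono' measurableSet_Icc key
    _ ≤ ∫⁻ r', ofReal (16 * 1352^2 * (9 / 4^j) * (64 * 2^j / L^2)) * ofReal ((wσ L j (z.2.2 - r'))^2) := setLIntegral_le_lintegral _ _
    _ ≤ ofReal (16 * 1352^2 * (9 / 4^j) * (64 * 2^j / L^2)) * ofReal (1600 * L * 4^j) := by
        rw [lintegral_const_mul' _ _ ofReal_ne_top]
        gcongr
        exact wσ_int hL j z.2.2
    _ ≤ _ := by
        rw [← ofReal_mul (by positivity)]
        apply ofReal_le_ofReal
        have : 16 * 1352^2 * (9 / 4^j) * (64 * 2^j / L^2) * (1600 * L * 4^j) = (16 * 1352^2 * 9 * 64 * 1600) * (2^j / L) := by field_simp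
        rw [this, mul_div_assoc]
        have : 0 ≤ 2^j / L := by positivity
        nlinarith

theorem sum_sub_le {ι : Type*} (S T : Finset ι) (h : S ⊆ T) (F : ι → ℝ≥0∞) : ∑ p : S, F p.1 ≤ ∑ p ∈ T, F p := by
  rw [Finset.sum_coe_sort S F]; exact Finset.sum_le_sum_of_subset h

theorem J4far {L : ℝ} (hL : 1 ≤ L) {j : ℕ} (s : Finset ℕ) (hs : ∀ n ∈ s, adm j n)
    (f : ℝ × ℝ → ℝ) (hf : Measurable f) (hF : ∀ t, |f t| ≤ 1) :
    ∑ p ∈ (s ×ˢ s).filter (fun p => far p.1 p.2), ∫⁻ z in Sl c, ofReal ((O.u L j p.1 f z * O.u L j p.2 f z)^2) ≤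
      (∫⁻ t, ofReal (f t ^ 2))^2 * ofReal (30000000000000 * 2^j / L) := by
  classical
  have hL0 : 0 < L := by linarith
  set S := (s ×ˢ s).filter (fun p => far p.1 p.2) with hS
  have hS1 : ∀ p : S, adm j p.1.1 ∧ adm j p.1.2 ∧ far p.1.1 p.1.2 := by
    rintro ⟨p, hp⟩
    rw [hS, Finset.mem_filter, Finset.mem_product] at hp
    exact ⟨hs _ hp.1.1, hs _ hp.1.2, hp.2⟩
  have h := schur_vec_on (ι := S) (Ω := ℝ × ℝ × ℝ) (T := (ℝ × ℝ) × (ℝ × ℝ)) volume (volume.prod volume) (Sl c) (Sl_meas c)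
    (fun p z t => O.K L j p.1.1 z t.1 * O.K L j p.1.2 z t.2) (fun p => ?_) ((13*L) * (13*L)) ((78/2^j)*(78/2^j)) (by positivity) (by positivity)
    (fun p z hz t => ?_) (fun p z hz => ?_) (fun t => f t.1 * f t.2) ((hf.comp measurable_fst).mul (hf.comp measurable_snd)) 1 (by norm_num) (fun t => ?_)
    (ofReal (30000000000000 * 2^j / L)) (fun p z hz => ?_)
  · rw [← Finset.sum_coe_sort]
    have e1 : ∀ (p : S) z, ∫ t : (ℝ × ℝ) × (ℝ × ℝ), O.K L j p.1.1 z t.1 * O.K L j p.1.2 z t.2 * (f t.1 * f t.2) ∂(volume.prod volume) = O.u L j p.1.1 f z * O.u L j p.1.2 f z := by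
      intro p z
      have := integral_prod_mul (μ := (volume : Measure (ℝ × ℝ))) (ν := (volume : Measure (ℝ × ℝ))) (fun t => O.K L j p.1.1 z t * f t) (fun t => O.K L j p.1.2 z t * f t)
      unfold u
      rw [← this]
      refine integral_congr_ae (Filter.Eventually.of_forall fun t => ?_)
      simp only; ring
    have e2 : ∫⁻ t : (ℝ × ℝ) × (ℝ × ℝ), ofReal ((f t.1 * f t.2)^2) ∂(volume.prod volume) = (∫⁻ t, ofReal (f t ^ 2))^2 := by
      have hfm : AEMeasurable (fun t => ofReal (f t ^ 2)) volume := (hf.pow_const 2).ennreal_ofReal.aemeasurable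
      rw [pow_two, ← lintegral_prod_mul hfm hfm]
      refine lintegral_congr fun t => ?_
      rw [mul_pow, ofReal_mul (sq_nonneg _)]
    simp only [e1] at h
    rw [e2] at h
    exact h
  · exact ((O.K_meas L j p.1.1).comp (g := Function.uncurry (O.K L j p.1.1)) (f := fun q : (ℝ × ℝ × ℝ) × ((ℝ × ℝ) × (ℝ × ℝ)) => (q.1, q.2.1)) (by fun_prop)).mul
      ((O.K_meas L j p.1.2).comp (g := Function.uncurry (O.K L j p.1.2)) (f := fun q : (ℝ × ℝ × ℝ) × ((ℝ × ℝ) × (ℝ × ℝ)) => (q.1, q.2.2)) (by fun_prop))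
  · rw [abs_mul]
    exact mul_le_mul (O.K_abs hL0 (hS1 p).1 hz _) (O.K_abs hL0 (hS1 p).2.1 hz _) (abs_nonneg _) (by positivity)
  · simp only [abs_mul, ofReal_mul (abs_nonneg _)]
    have m1 : ∀ n, AEMeasurable (fun t => ofReal |O.K L j n z t|) volume := fun n => (O.K_cont2 L j n z).measurable.norm.ennreal_ofReal.aemeasurable
    rw [lintegral_prod_mul (m1 p.1.1) (m1 p.1.2), ofReal_mul (by positivity)]
    exact mul_le_mul' (O.K_lint hL (hS1 p).1 hz) (O.K_lint hL (hS1 p).2.1 hz)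
  · rw [abs_mul]; exact mul_le_one₀ (hF _) (abs_nonneg _) (hF _)
  · refine le_trans ?_ (O.J4_kernel hL s hs (hS1 p).1 (hS1 p).2.1 (hS1 p).2.2 z hz)
    refine le_trans ?_ (sum_sub_le S (s ×ˢ s) (Finset.filter_subset _ _) _)
    refine Finset.sum_le_sum fun p' _ => ?_
    refine lintegral_mono fun z' => ?_
    have := integral_prod_mul (μ := (volume : Measure (ℝ × ℝ))) (ν := (volume : Measure (ℝ × ℝ))) (fun t => O.K L j p.1.1 z t * O.K L j p'.1.1 z' t) (fun t => O.K L j p.1.2 z t * O.K L j p'.1.2 z' t)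
    unfold kap
    rw [← this]
    refine le_of_eq ?_
    congr 2
    refine integral_congr_ae (Filter.Eventually.of_forall fun t => ?_)
    simp only; ring

end Op
end MS

namespace MS
namespace Op
variable {c B : ℝ} (O : Op c B)

theorem tayG {v X r r' : ℝ} (hv : v ∈ Icc (1/2:ℝ) 2) (hr : |r| ≤ c) (hr' : |r'| ≤ c) :
    |O.G (v - X) r' - O.G v r + O.Gv v r * X + O.Gr v r * (r - r')| ≤ B * (|X| + |r - r'|)^2 := by
  obtain ⟨ξ1, -, h1⟩ := taylor2 _ _ _ (fun v => O.dGv v r') (fun v => O.dGvv v r') v (v - X)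
  obtain ⟨ξ2, k2, h2⟩ := mv _ _ (fun r => O.dGvr v r) r r'
  obtain ⟨ξ3, k3, h3⟩ := taylor2 _ _ _ (fun r => O.dGr v r) (fun r => O.dGrr v r) r r'
  have b1 := O.bGvv ξ1 r' hr'
  have b2 := O.bGvr v ξ2 hv (abs_conv hr hr' k2)
  have b3 := O.bGrr v ξ3 hv (abs_conv hr hr' k3)
  have hB := O.hB
  have e : O.G (v - X) r' - O.G v r + O.Gv v r * X + O.Gr v r * (r - r') =
      O.Gvv ξ1 r' * X^2 / 2 + O.Gvr v ξ2 * ((r - r') * X) + O.Grr v ξ3 * (r - r')^2 / 2 := by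
    have h2' : O.Gv v r' = O.Gv v r + O.Gvr v ξ2 * (r' - r) := by linarith
    rw [h1, h3, h2']; ring
  rw [e]
  have c1 : |O.Gvv ξ1 r' * X^2 / 2| ≤ 3 * |X|^2 / 2 := by
    rw [abs_div, abs_mul, abs_two, abs_pow, abs_of_pos (by linarith : 0 < O.Gvv ξ1 r')]
    gcongr; exact b1.2
  have c2 : |O.Gvr v ξ2 * ((r - r') * X)| ≤ 13 * (|r - r'| * |X|) := by
    rw [abs_mul, abs_mul]; gcongr
  have c3 : |O.Grr v ξ3 * (r - r')^2 / 2| ≤ B * |r - r'|^2 / 2 := by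
    rw [abs_div, abs_mul, abs_two, abs_pow]; gcongr
  have := abs_add_three (O.Gvv ξ1 r' * X^2 / 2) (O.Gvr v ξ2 * ((r - r') * X)) (O.Grr v ξ3 * (r - r')^2 / 2)
  have d1 : 0 ≤ |X|^2 := by positivity
  have d2 : 0 ≤ |r - r'| * |X| := by positivity
  have d3 : 0 ≤ |r - r'|^2 := by positivity
  nlinarith

theorem tayGv {v X r r' : ℝ} (hv : v ∈ Icc (1/2:ℝ) 2) (hr : |r| ≤ c) (hr' : |r'| ≤ c) :
    |O.Gv (v - X) r' - O.Gv v r + O.Gvv v r * X + O.Gvr v r * (r - r')| ≤ B * (|X| + |r - r'|)^2 := by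
  obtain ⟨ξ1, -, h1⟩ := taylor2 _ _ _ (fun v => O.dGvv v r') (fun v => O.dGvvv v r') v (v - X)
  obtain ⟨ξ2, k2, h2⟩ := mv _ _ (fun r => O.dGvvr v r) r r'
  obtain ⟨ξ3, k3, h3⟩ := taylor2 _ _ _ (fun r => O.dGvr v r) (fun r => O.dGvrr v r) r r'
  have b1 := O.bGvvv ξ1 r' hr'
  have b2 := O.bGvvr v ξ2 hv (abs_conv hr hr' k2)
  have b3 := O.bGvrr v ξ3 hv (abs_conv hr hr' k3)
  have hB := O.hB
  have e : O.Gv (v - X) r' - O.Gv v r + O.Gvv v r * X + O.Gvr v r * (r - r') =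
      O.Gvvv ξ1 r' * X^2 / 2 + O.Gvvr v ξ2 * ((r - r') * X) + O.Gvrr v ξ3 * (r - r')^2 / 2 := by
    have h2' : O.Gvv v r' = O.Gvv v r + O.Gvvr v ξ2 * (r' - r) := by linarith
    rw [h1, h3, h2']; ring
  rw [e]
  have c1 : |O.Gvvv ξ1 r' * X^2 / 2| ≤ 1/100 * |X|^2 / 2 := by
    rw [abs_div, abs_mul, abs_two, abs_pow]; gcongr
  have c2 : |O.Gvvr v ξ2 * ((r - r') * X)| ≤ 13 * (|r - r'| * |X|) := by
    rw [abs_mul, abs_mul]; gcongr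
    rw [abs_of_pos (by linarith)]; exact b2.2
  have c3 : |O.Gvrr v ξ3 * (r - r')^2 / 2| ≤ B * |r - r'|^2 / 2 := by
    rw [abs_div, abs_mul, abs_two, abs_pow]; gcongr
  have := abs_add_three (O.Gvvv ξ1 r' * X^2 / 2) (O.Gvvr v ξ2 * ((r - r') * X)) (O.Gvrr v ξ3 * (r - r')^2 / 2)
  have d1 : 0 ≤ |X|^2 := by positivity
  have d2 : 0 ≤ |r - r'| * |X| := by positivity
  have d3 : 0 ≤ |r - r'|^2 := by positivity
  nlinarith

theorem J_lower {v w r : ℝ} (hv : v ∈ Icc (1/2:ℝ) 2) (hw : w ∈ Icc (1/2:ℝ) 2) (hr : |r| ≤ c) :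
    (w - v)^2 / 2 ≤ O.Gvv v r * (O.Gr w r - O.Gr v r) - O.Gvr v r * (O.Gv w r - O.Gv v r) := by
  obtain ⟨ξ, hξ, h⟩ := taylor2 (fun w => O.Gvv v r * (O.Gr w r - O.Gr v r) - O.Gvr v r * (O.Gv w r - O.Gv v r))
    (fun w => O.Gvv v r * O.Gvr w r - O.Gvr v r * O.Gvv w r)
    (fun w => O.Gvv v r * O.Gvvr w r - O.Gvr v r * O.Gvvv w r)
    (fun w => (((O.dGrv w r).sub_const _).const_mul _).sub (((O.dGvv w r).sub_const _).const_mul _))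
    (fun w => ((O.dGvrv w r).const_mul _).sub ((O.dGvvv w r).const_mul _)) v w
  have hξI := mem_uIcc_conv hv hw hξ
  have b1 := O.bGvv v r hr
  have b2 := O.bGvvr ξ r hξI hr
  have b3 := O.bGvr v r hv hr
  have b4 := O.bGvvv ξ r hr
  have : |O.Gvr v r * O.Gvvv ξ r| ≤ 13 * (1/100) := by rw [abs_mul]; gcongr
  have h5 := (abs_le.1 this).2
  have h6 : 1 ≤ O.Gvv v r * O.Gvvr ξ r - O.Gvr v r * O.Gvvv ξ r := by nlinarith
  rw [h]
  nlinarith [sq_nonneg (w - v)]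

set_option maxHeartbeats 1000000 in
theorem flux_key {v w θ e : ℝ} {z z' : ℝ × ℝ × ℝ} (hv : v ∈ Icc (1/2:ℝ) 2) (hw : w ∈ Icc (1/2:ℝ) 2)
    (hz : |z.2.2| ≤ c) (hz' : |z'.2.2| ≤ c) (hθ : 0 < θ) (hvw : θ ≤ |w - v|) (he : e ≤ θ^2 / 1798)
    (hD : B * (|z.1 - z'.1| + |z.2.2 - z'.2.2|) ≤ e)
    (hY : |z.2.1 - z'.2.1 - (O.Gv w z.2.2 * (z.1 - z'.1) + O.Gr w z.2.2 * (z.2.2 - z'.2.2))| ≤ e * (|z.1 - z'.1| + |z.2.2 - z'.2.2|)) :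
    θ^2 * (|z.1 - z'.1| + |z.2.2 - z'.2.2|) ≤ 1500 * (|O.h z z' v| + |O.h1 z z' v|) := by
  have tg := O.tayG (X := z.1 - z'.1) hv hz hz'
  have tgv := O.tayGv (X := z.1 - z'.1) hv hz hz'
  have hJ := O.J_lower hv hw hz
  have bA := O.bGvv v z.2.2 hz
  have bW : |O.Gv w z.2.2 - O.Gv v z.2.2| ≤ 26 := by
    have := abs_sub (O.Gv w z.2.2) (O.Gv v z.2.2)
    linarith [O.bGv w z.2.2 hw hz, O.bGv v z.2.2 hv hz]
  have bg := O.bGvr v z.2.2 hv hz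
  have hh : O.h z z' v = z.2.1 - z'.2.1 - O.G v z.2.2 + O.G (v - (z.1 - z'.1)) z'.2.2 := rfl
  have hh1 : O.h1 z z' v = - O.Gv v z.2.2 + O.Gv (v - (z.1 - z'.1)) z'.2.2 := rfl
  generalize O.h z z' v = H at *
  generalize O.h1 z z' v = H1 at *
  generalize O.Gvv v z.2.2 = A at *
  generalize O.G (v - (z.1 - z'.1)) z'.2.2 = g1 at *
  generalize O.Gv (v - (z.1 - z'.1)) z'.2.2 = g2 at *
  generalize O.G v z.2.2 = g3 at *
  generalize O.Gv v z.2.2 = g4 at *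
  generalize O.Gv w z.2.2 = g5 at *
  generalize O.Gr v z.2.2 = g6 at *
  generalize O.Gr w z.2.2 = g7 at *
  generalize O.Gvr v z.2.2 = g8 at *
  generalize z.1 - z'.1 = X at *
  generalize z.2.2 - z'.2.2 = σ at *
  generalize z.2.1 - z'.2.1 = Y at *
  set D := |X| + |σ| with hDd
  have hD0 : 0 ≤ D := by positivity
  have he0 : 0 ≤ e := le_trans (mul_nonneg (by linarith [O.hB]) hD0) hD
  have hBD : B * D^2 ≤ e * D := by
    have := mul_le_mul_of_nonneg_right hD hD0
    linarith
  have hθ2 : θ^2 ≤ 3 := by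
    have : |w - v| ≤ 3/2 := by rw [abs_le]; constructor <;> linarith [hv.1, hv.2, hw.1, hw.2]
    nlinarith
  set J := A * (g7 - g6) - g8 * (g5 - g4) with hJd
  set E1 := (Y - (g5 * X + g7 * σ)) + (g1 - g3 + g4 * X + g6 * σ) with hE1
  set E2 := g2 - g4 + A * X + g8 * σ with hE2
  have bE1 : |E1| ≤ 2 * e * D := by
    have := abs_add_le (Y - (g5 * X + g7 * σ)) (g1 - g3 + g4 * X + g6 * σ)
    rw [hE1]; linarith
  have bE2 : |E2| ≤ e * D := by linarith
  have id1 : σ * J = A * H + (g5 - g4) * H1 - (A * E1 + (g5 - g4) * E2) := by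
    rw [hh, hh1, hJd, hE1, hE2]; ring
  have s1 : |σ| * J ≤ 3 * |H| + 26 * |H1| + 32 * e * D := by
    have hJ0 : 0 ≤ J := le_trans (by positivity) hJ
    rw [← abs_of_nonneg hJ0, ← abs_mul, id1]
    have a1 : |A * H| ≤ 3 * |H| := by rw [abs_mul, abs_of_pos (by linarith)]; gcongr; exact bA.2
    have a2 : |(g5 - g4) * H1| ≤ 26 * |H1| := by rw [abs_mul]; gcongr
    have a3 : |A * E1| ≤ 3 * (2 * e * D) := by rw [abs_mul, abs_of_pos (by linarith : 0 < A)]; gcongr; exact bA.2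
    have a4 : |(g5 - g4) * E2| ≤ 26 * (e * D) := by rw [abs_mul]; gcongr
    have a5 := abs_sub (A * H + (g5 - g4) * H1) (A * E1 + (g5 - g4) * E2)
    have a6 := abs_add_le (A * H) ((g5 - g4) * H1)
    have a7 := abs_add_le (A * E1) ((g5 - g4) * E2)
    linarith
  have s2 : θ^2 / 2 * |σ| ≤ |σ| * J := by
    have : θ^2 ≤ (w - v)^2 := by rw [← sq_abs (w - v)]; gcongr
    have h9 : θ^2 / 2 ≤ J := by linarith
    have := mul_le_mul_of_nonneg_left h9 (abs_nonneg σ)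
    linarith
  have s3 : |X| ≤ |H1| + 13 * |σ| + e * D := by
    have e3 : A * X = - H1 - g8 * σ + E2 := by rw [hh1, hE2]; ring
    have a1 : |X| ≤ |A * X| := by rw [abs_mul, abs_of_pos (by linarith : 0 < A)]; exact le_mul_of_one_le_left (abs_nonneg X) bA.1
    have a2 : |g8 * σ| ≤ 13 * |σ| := by rw [abs_mul]; gcongr
    rw [e3] at a1
    have a3 := abs_add_le (- H1 - g8 * σ) E2
    have a4 := abs_sub (-H1) (g8 * σ)
    rw [abs_neg] at a4
    linarith
  have s4 : θ^2 * D ≤ θ^2 * |H1| + 14 * (θ^2 * |σ|) + θ^2 * (e * D) := by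
    have : D ≤ |H1| + 14 * |σ| + e * D := by linarith
    have := mul_le_mul_of_nonneg_left this (sq_nonneg θ)
    linarith
  have s5 : θ^2 * |H1| ≤ 3 * |H1| := by gcongr
  have s6 : θ^2 * (e * D) ≤ 3 * (e * D) := by gcongr
  have s7 : 1798 * (e * D) ≤ θ^2 * D := by
    have : 1798 * e ≤ θ^2 := by linarith
    have := mul_le_mul_of_nonneg_right this hD0
    linarith
  have := abs_nonneg H
  have := abs_nonneg H1
  linarith

theorem flux_w {L η : ℝ} (hL : 1 ≤ L) (hη : 0 < η) (hη1 : η < 1) {j n n' : ℕ} (hn : adm j n) (hn' : adm j n') (hf : far n n')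
    {w e : ℝ} {z z' : ℝ × ℝ × ℝ} (hw : w ∈ Sn j n)
    (hz : |z.2.2| ≤ c) (hz' : |z'.2.2| ≤ c) (he : e ≤ 1 / 4^j / 1798)
    (hD : B * (|z.1 - z'.1| + |z.2.2 - z'.2.2|) ≤ e)
    (hY : |z.2.1 - z'.2.1 - (O.Gv w z.2.2 * (z.1 - z'.1) + O.Gr w z.2.2 * (z.2.2 - z'.2.2))| ≤ e * (|z.1 - z'.1| + |z.2.2 - z'.2.2|)) :
    ofReal |O.kap L j n' n' z z'| ≤ ∫⁻ v, indicator {v | v ∈ V j n' n' z z' ∧ |L * O.h z z' v| ≤ 2}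
        (fun _ => ofReal (1352 * (130000000 * 16^j * lw η L (z.2.2 - z'.2.2)))) v := by
  refine O.kap_w hL hn' hn' hz hz' ?_
  have hL0 : 0 < L := by linarith
  have hp : (1:ℝ) ≤ 2^j := one_le_pow₀ (by norm_num)
  have h4 : (4:ℝ)^j = 2^j * 2^j := by rw [← mul_pow]; norm_num
  have h16 : (16:ℝ)^j = 4^j * 4^j := by rw [← mul_pow]; norm_num
  have hp4 : (1:ℝ) ≤ 4^j := one_le_pow₀ (by norm_num)
  have hp16 : (4:ℝ)^j ≤ 16^j := by rw [h16]; exact le_mul_of_one_le_left (by positivity) hp4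
  have hp24 : (2:ℝ)^j ≤ 4^j := by rw [h4]; exact le_mul_of_one_le_left (by positivity) hp
  have hlw := lw_nonneg (η := η) (X := z.2.2 - z'.2.2) hL0.le
  rcases lw_spec (X := z.2.2 - z'.2.2) hL hη hη1 with h | ⟨h0, h⟩
  · left
    refine h.trans (le_mul_of_one_le_left hlw ?_)
    linarith
  set D := |z.1 - z'.1| + |z.2.2 - z'.2.2| with hDd
  have hσ0 : 0 < |z.2.2 - z'.2.2| := abs_pos.2 h0
  have hσD : |z.2.2 - z'.2.2| ≤ D := by rw [hDd]; linarith [abs_nonneg (z.1 - z'.1)]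
  have hD0 : 0 < D := lt_of_lt_of_le hσ0 hσD
  have hlD : 1 / D ≤ lw η L (z.2.2 - z'.2.2) := (one_div_le_one_div_of_le hσ0 hσD).trans h
  by_cases hc : L * D ≤ 6000 * 4^j
  · left
    calc L ≤ 6000 * 4^j * (1/D) := by rw [mul_one_div, le_div_iff₀ hD0]; exact hc
      _ ≤ _ := by gcongr; linarith
  · push Not at hc
    right
    refine ⟨Real.sqrt (D / L), Real.sqrt_pos.2 (by positivity), fun v hv hh => ?_⟩
    have hvI := Sn_sub hn' hv.1
    have hwI := Sn_sub hn hw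
    have hsep : 1 / 2^j ≤ |w - v| := by
      rw [div_le_iff₀ (by positivity)]; linarith [far_sep hf hw hv.1]
    have e4 : (1 / 2^j : ℝ)^2 = 1 / 4^j := by rw [h4]; field_simp
    have key := O.flux_key hvI hwI hz hz' (by positivity) hsep (by rw [e4]; exact he) hD hY
    rw [e4, ← hDd] at key
    have k2 : |O.h z z' v| ≤ 2 / L := by
      rw [abs_mul, abs_of_pos hL0] at hh
      rw [le_div_iff₀ hL0]; linarith
    have k3 : 2 / L ≤ 1 / 4^j * D / 3000 := by
      rw [div_le_iff₀ hL0]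
      have : 1 / 4^j * D / 3000 * L = (L * D) / (4^j * 3000) := by field_simp
      rw [this, le_div_iff₀ (by positivity)]; linarith
    have k4 : 1 / (3000 * 4^j) * D ≤ |O.h1 z z' v| := by
      have : 1 / (3000 * 4^j) * D = 1 / 4^j * D / 3000 := by field_simp
      rw [this]; linarith
    have g2 := O.h2_up hz hz' hvI
    refine (wt_bd2 (C := 13) (κ := 1 / (3000 * 4^j)) hL0 hD0 (by positivity) (by positivity) k4 ?_).trans ?_
    · rw [hDd]; linarith [abs_nonneg (z.1 - z'.1)]
    · calc _ = (14 * 9000000 * 16^j + 3000 * (2^j * 4^j)) * (1 / D) := by rw [h16]; field_simp; ring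
        _ ≤ (130000000 * 16^j) * lw η L (z.2.2 - z'.2.2) := by
          gcongr
          have : (2:ℝ)^j * 4^j ≤ 16^j := by rw [h16]; gcongr
          nlinarith

theorem flux {L η : ℝ} (hL : 1 ≤ L) (hη : 0 < η) (hη1 : η < 1) {j n n' : ℕ} (hn : adm j n) (hn' : adm j n') (hf : far n n')
    (Q : Set (ℝ × ℝ)) (hQ : MeasurableSet Q) (x y w : ℝ × ℝ → ℝ) (hx : Measurable x) (hy : Measurable y)
    (hQ1 : ∀ ω ∈ Q, |ω.2| ≤ c ∧ w ω ∈ Sn j n) {e c1 : ℝ} (hc1 : 0 < c1) (he : e ≤ 1 / 4^j / 1798)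
    (H : ∀ ω ∈ Q, ∀ ω' ∈ Q, B * (|x ω - x ω'| + |ω.2 - ω'.2|) ≤ e ∧
      |y ω - y ω' - (O.Gv (w ω) ω.2 * (x ω - x ω') + O.Gr (w ω) ω.2 * (ω.2 - ω'.2))| ≤ e * (|x ω - x ω'| + |ω.2 - ω'.2|) ∧
      c1 * |ω.1 - ω'.1| ≤ |x ω - x ω'| + |ω.2 - ω'.2|)
    (f : ℝ × ℝ → ℝ) (hfm : Measurable f) (hF : ∀ t, |f t| ≤ 1) :
    ∫⁻ ω in Q, ofReal ((O.u L j n' f (x ω, y ω, ω.2))^2) ≤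
      (∫⁻ t, ofReal (f t ^ 2)) * (ofReal (10000000000000 * 16^j * L^(η-1) / c1) * Il η) := by
  have hL0 : 0 < L := by linarith
  have hp : (0:ℝ) < 2^j := by positivity
  have hzm : Measurable fun ω : ℝ × ℝ => (x ω, y ω, ω.2) := hx.prodMk (hy.prodMk measurable_snd)
  have h := schur_vec_on (ι := Unit) (Ω := ℝ × ℝ) (T := ℝ × ℝ) volume volume Q hQ
    (fun _ ω t => O.K L j n' (x ω, y ω, ω.2) t) (fun _ => ?_) (13*L) (78/2^j) (by positivity) (by positivity)
    (fun _ ω hω t => O.K_abs hL0 hn' (hQ1 ω hω).1 t) (fun _ ω hω => O.K_lint hL hn' (hQ1 ω hω).1) f hfm 1 (by norm_num) hF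
    (ofReal (10000000000000 * 16^j * L^(η-1) / c1) * Il η) (fun _ ω hω => ?_)
  · simp only [Finset.univ_unique, Finset.sum_singleton] at h
    exact h
  · exact (O.K_meas L j n').comp (g := Function.uncurry (O.K L j n')) (f := fun p : (ℝ × ℝ) × (ℝ × ℝ) => ((x p.1, y p.1, p.1.2), p.2))
      ((hzm.comp measurable_fst).prodMk measurable_snd)
  · simp only [Finset.univ_unique, Finset.sum_singleton]
    set z : ℝ × ℝ × ℝ := (x ω, y ω, ω.2) with hz
    have hzc : |z.2.2| ≤ c := (hQ1 ω hω).1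
    set W : ℝ → ℝ≥0∞ := fun σ => ofReal (1352 * (130000000 * 16^j * lw η L σ)) with hW
    have hWm : Measurable W := (((lw_meas η L).const_mul _).const_mul _).ennreal_ofReal
    set F : (ℝ × ℝ) → ℝ → ℝ≥0∞ := fun ω' v => indicator {q : (ℝ × ℝ) × ℝ | q.1 ∈ Q ∧ q.2 ∈ V j n' n' z (x q.1, y q.1, q.1.2) ∧ |L * O.h z (x q.1, y q.1, q.1.2) q.2| ≤ 2}
      (fun q => W (ω.2 - q.1.2)) (ω', v) with hFd
    have hFset : MeasurableSet {q : (ℝ × ℝ) × ℝ | q.1 ∈ Q ∧ q.2 ∈ V j n' n' z (x q.1, y q.1, q.1.2) ∧ |L * O.h z (x q.1, y q.1, q.1.2) q.2| ≤ 2} := by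
      refine (hQ.preimage measurable_fst).inter ?_
      exact (O.Dset_meas L j n' n').preimage (f := fun q : (ℝ × ℝ) × ℝ => ((z, (x q.1, y q.1, q.1.2)), q.2))
        ((measurable_const.prodMk (hzm.comp measurable_fst)).prodMk measurable_snd)
    have hFm : Measurable (Function.uncurry F) := by
      have : Measurable fun q : (ℝ × ℝ) × ℝ => W (ω.2 - q.1.2) := hWm.comp (by fun_prop)
      exact this.indicator hFset
    have step1 : ∫⁻ ω' in Q, ofReal |O.kap L j n' n' z (x ω', y ω', ω'.2)| ≤ ∫⁻ ω', ∫⁻ v, F ω' v := by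
      refine le_trans (setLIntegral_mono' hQ fun ω' hω' => ?_) (setLIntegral_le_lintegral _ _)
      obtain ⟨H1, H2, -⟩ := H ω hω ω' hω'
      refine (O.flux_w hL hη hη1 hn hn' hf (z := z) (z' := (x ω', y ω', ω'.2)) (hQ1 ω hω).2 hzc (hQ1 ω' hω').1 he H1 H2).trans ?_
      refine lintegral_mono fun v => ?_
      by_cases hv : v ∈ V j n' n' z (x ω', y ω', ω'.2) ∧ |L * O.h z (x ω', y ω', ω'.2) v| ≤ 2
      · rw [indicator_of_mem (by exact hv)]
        simp only [hFd]
        rw [indicator_of_mem (by exact ⟨hω', hv⟩)]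
      · rw [indicator_of_notMem (by exact hv)]; exact zero_le
    have step2 : ∀ r' v, ∫⁻ a, F (a, r') v ≤ (Icc (-2:ℝ) 2).indicator W (ω.2 - r') * (Sn j n').indicator (fun _ => ofReal (16 * 2^j / (L * c1))) v := by
      intro r' v
      set T : Set ℝ := {a | (a, r') ∈ Q ∧ v ∈ V j n' n' z (x (a,r'), y (a,r'), r') ∧ |L * O.h z (x (a,r'), y (a,r'), r') v| ≤ 2} with hT
      have eF : ∀ a, F (a, r') v = T.indicator (fun _ => W (ω.2 - r')) a := by
        intro a
        simp only [hFd]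
        by_cases ha : a ∈ T
        · rw [indicator_of_mem ha, indicator_of_mem (by exact ha)]
        · rw [indicator_of_notMem ha, indicator_of_notMem (by exact ha)]
      simp only [eF]
      rcases T.eq_empty_or_nonempty with hTe | ⟨a0, ha0⟩
      · rw [hTe]; simp
      have hr' : |r'| ≤ c := (hQ1 _ ha0.1).1
      have i1 : ω.2 - r' ∈ Icc (-2:ℝ) 2 := by
        have := abs_le.1 hr'
        have := abs_le.1 (hQ1 ω hω).1
        have := O.hc1
        constructor <;> linarith
      rw [indicator_of_mem i1, indicator_of_mem ha0.2.1.1]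
      refine (lintegral_indicator_const_le _ _).trans ?_
      gcongr
      refine (vol_diam T (8 * 2^j / (L * c1)) fun a ha b hb => ?_).trans (ofReal_le_ofReal (le_of_eq (by ring)))
      obtain ⟨-, H2, H3⟩ := H _ ha.1 _ hb.1
      simp only [sub_self, abs_zero, add_zero, mul_zero] at H2 H3
      set X := x (a,r') - x (b,r') with hX
      obtain ⟨ξ, hξ, hm⟩ := mv _ _ (fun v => O.dGv v r') (v - (z.1 - x (b,r'))) (v - (z.1 - x (a,r')))
      have hξS : ξ ∈ Sn j n' := by
        have h1 := ha.2.1.2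
        have h2 := hb.2.1.2
        rw [Sn_eq] at h1 h2 ⊢
        exact mem_uIcc_conv h2 h1 hξ
      have hwS := (hQ1 _ ha.1).2
      obtain ⟨ζ, -, hm2⟩ := mv _ _ (fun v => O.dGvv v r') (w (a,r')) ξ
      have hsep := far_sep hf hwS hξS
      have bζ := (O.bGvv ζ r' hr').1
      have q1 : |O.Gv ξ r' - O.Gv (w (a,r')) r'| * 2^j ≥ 1 := by
        rw [hm2, abs_mul, abs_of_pos (by linarith : 0 < O.Gvv ζ r'), abs_sub_comm]
        have := le_mul_of_one_le_left (abs_nonneg (w (a,r') - ξ)) bζ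
        nlinarith
      have q2 : |O.h z (x (a,r'), y (a,r'), r') v - O.h z (x (b,r'), y (b,r'), r') v| ≤ 4 / L := by
        have k1 := ha.2.2
        have k2 := hb.2.2
        rw [abs_mul, abs_of_pos hL0] at k1 k2
        refine (abs_sub _ _).trans ?_
        rw [le_div_iff₀ hL0]; linarith
      have q3 : O.h z (x (a,r'), y (a,r'), r') v - O.h z (x (b,r'), y (b,r'), r') v =
          (O.Gv ξ r' - O.Gv (w (a,r')) r') * X - (y (a,r') - y (b,r') - O.Gv (w (a,r')) r' * X) := by
        have : O.G (v - (z.1 - x (a,r'))) r' - O.G (v - (z.1 - x (b,r'))) r' = O.Gv ξ r' * X := by rw [hm, hX]; ring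
        unfold Op.h; simp only
        linarith
      have q4 : |O.Gv ξ r' - O.Gv (w (a,r')) r'| * |X| - e * |X| ≤ 4 / L := by
        rw [q3] at q2
        have := abs_sub_abs_le_abs_sub ((O.Gv ξ r' - O.Gv (w (a,r')) r') * X) (y (a,r') - y (b,r') - O.Gv (w (a,r')) r' * X)
        rw [abs_mul] at this
        linarith
      have q5 : e * 2^j ≤ 1/2 := by
        have h4 : (4:ℝ)^j = 2^j * 2^j := by rw [← mul_pow]; norm_num
        have h1 : (1:ℝ) ≤ 2^j := one_le_pow₀ (by norm_num)
        have : e * 2^j ≤ 1 / 4^j / 1798 * 2^j := by gcongr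
        have e5 : (1:ℝ) / 4^j / 1798 * 2^j = 1 / (1798 * 2^j) := by rw [h4]; field_simp
        rw [e5] at this
        refine this.trans ?_
        rw [div_le_div_iff₀ (by positivity) (by norm_num)]; linarith
      have q6 : |X| ≤ 8 * 2^j / L := by
        have a1 : (|O.Gv ξ r' - O.Gv (w (a,r')) r'| * |X| - e * |X|) * 2^j ≤ 4 / L * 2^j := by gcongr
        have a2 : 8 * 2^j / L = 2 * (4 / L * 2^j) := by ring
        have a3 := mul_le_mul_of_nonneg_right q1 (abs_nonneg X)
        have a4 := mul_le_mul_of_nonneg_right q5 (abs_nonneg X)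
        rw [a2]; nlinarith
      rw [le_div_iff₀ (by positivity)]
      rw [le_div_iff₀ hL0] at q6
      nlinarith
    calc _ ≤ ∫⁻ ω', ∫⁻ v, F ω' v := step1
      _ = ∫⁻ r', ∫⁻ a, ∫⁻ v, F (a, r') v := by
          have hFi : Measurable (fun ω' => ∫⁻ v, F ω' v) := hFm.lintegral_prod_right'
          rw [Measure.volume_eq_prod, lintegral_prod_symm (fun ω' => ∫⁻ v, F ω' v) hFi.aemeasurable]
      _ = ∫⁻ r', ∫⁻ v, ∫⁻ a, F (a, r') v := by
          refine lintegral_congr fun r' => ?_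
          rw [lintegral_lintegral_swap]
          exact (hFm.comp (f := fun q : ℝ × ℝ => ((q.1, r'), q.2)) (by fun_prop)).aemeasurable
      _ ≤ ∫⁻ r', ∫⁻ v, (Icc (-2:ℝ) 2).indicator W (ω.2 - r') * (Sn j n').indicator (fun _ => ofReal (16 * 2^j / (L * c1))) v :=
          lintegral_mono fun r' => lintegral_mono fun v => step2 r' v
      _ = (∫⁻ σ, (Icc (-2:ℝ) 2).indicator W σ) * (ofReal (16 * 2^j / (L * c1)) * ofReal (3/2^j)) := by
          have : ∀ r', ∫⁻ v, (Icc (-2:ℝ) 2).indicator W (ω.2 - r') * (Sn j n').indicator (fun _ => ofReal (16 * 2^j / (L * c1))) v =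
              (Icc (-2:ℝ) 2).indicator W (ω.2 - r') * (ofReal (16 * 2^j / (L * c1)) * ofReal (3/2^j)) := by
            intro r'
            rw [lintegral_const_mul _ (measurable_const.indicator (Sn_meas j n')), lintegral_indicator_const (Sn_meas j n'), Sn_vol]
          simp only [this]
          rw [lintegral_mul_const' _ _ (ENNReal.mul_ne_top ofReal_ne_top ofReal_ne_top)]
          rw [lintegral_sub_left_eq_self (fun σ => (Icc (-2:ℝ) 2).indicator W σ) ω.2]
      _ = (ofReal (1352 * (130000000 * 16^j)) * (ofReal (L^η) * Il η)) * (ofReal (16 * 2^j / (L * c1)) * ofReal (3/2^j)) := by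
          congr 1
          rw [lintegral_indicator measurableSet_Icc, ← lw_int η L hL0.le, ← lintegral_const_mul' _ _ ofReal_ne_top]
          refine lintegral_congr fun X => ?_
          rw [← ofReal_mul (by positivity)]; simp only [hW]; congr 1; ring
      _ = ofReal ((1352 * (130000000 * 16^j)) * (L^η * ((16 * 2^j / (L * c1)) * (3/2^j)))) * Il η := by
          have E : ∀ a b : ℝ, 0 ≤ a → ofReal (a*b) = ofReal a * ofReal b := fun a b h => ofReal_mul h
          rw [E (1352 * (130000000 * 16^j)) _ (by positivity), E (L^η) _ (by positivity), E (16 * 2^j / (L * c1)) _ (by positivity)]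
          ring
      _ ≤ _ := by
          refine mul_le_mul_left (ofReal_le_ofReal ?_) _
          rw [Real.rpow_sub hL0, Real.rpow_one]
          have : (1352 * (130000000 * 16^j)) * (L^η * ((16 * 2^j / (L * c1)) * (3/2^j))) = 8436480000000 * (16^j * (L^η/L) / c1) := by field_simp; norm_num
          rw [this]
          have h0 : 0 ≤ 16^j * (L^η/L) / c1 := by positivity
          have e9 : 10000000000000 * 16 ^ j * (L ^ η / L) / c1 = 10000000000000 * (16^j * (L^η/L) / c1) := by ring
          rw [e9]; linarith

end Op
end MS
namespace MS

noncomputable def clamp (v : ℝ) : ℝ := max (1/2) (min v 2)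

theorem clamp_mem (v : ℝ) : clamp v ∈ Icc (1/2:ℝ) 2 := by
  unfold clamp
  exact ⟨le_max_left _ _, max_le (by norm_num) (min_le_right _ _)⟩

theorem clamp_self {v : ℝ} (h : v ∈ Icc (1/2:ℝ) 2) : clamp v = v := by
  unfold clamp; rw [min_eq_left h.2, max_eq_right h.1]

theorem clamp_cont : Continuous clamp := by unfold clamp; fun_prop

theorem clamp_lip (v w : ℝ) : |clamp v - clamp w| ≤ |v - w| := by
  unfold clamp
  refine (abs_max_sub_max_le_max _ _ _ _).trans (max_le (by simp) ?_)
  refine (abs_min_sub_min_le_max _ _ _ _).trans (max_le le_rfl (by simp))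

namespace Op
variable {c B : ℝ} (O : Op c B)

theorem u_loc (L : ℝ) (j n : ℕ) (f : ℝ × ℝ → ℝ) (D : Set (ℝ × ℝ)) (z : ℝ × ℝ × ℝ) (h : ∀ t, O.K L j n z t ≠ 0 → t ∈ D) :
    O.u L j n f z = O.u L j n (D.indicator f) z := by
  unfold u
  congr 1; ext t
  by_cases ht : t ∈ D
  · rw [indicator_of_mem ht]
  · have : O.K L j n z t = 0 := by by_contra hc; exact ht (h t hc)
    simp [this]

def DD (x y r ρ : ℝ) : Set (ℝ × ℝ) := {t | |x - t.1| ≤ 6 ∧ |(y - O.G (clamp (x - t.1)) r) - t.2| ≤ ρ}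

theorem DD_meas (x y r ρ : ℝ) : MeasurableSet (O.DD x y r ρ) := by
  have := O.cG
  have hc := clamp_cont
  have h1 : Continuous fun t : ℝ × ℝ => O.G (clamp (x - t.1)) r :=
    O.cG.comp ((clamp_cont.comp (continuous_const.sub continuous_fst)).prodMk continuous_const)
  have h2 : Measurable fun t : ℝ × ℝ => |x - t.1| := by fun_prop
  have h3 : Measurable fun t : ℝ × ℝ => |(y - O.G (clamp (x - t.1)) r) - t.2| := by fun_prop
  exact (measurableSet_le h2 measurable_const).inter (measurableSet_le h3 measurable_const)

theorem DD_vol (x y r ρ : ℝ) (hρ : 0 ≤ ρ) : volume (O.DD x y r ρ) ≤ ofReal (24 * ρ) := by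
  rw [Measure.volume_eq_prod, Measure.prod_apply (O.DD_meas x y r ρ)]
  have : ∀ p : ℝ, volume (Prod.mk p ⁻¹' O.DD x y r ρ) ≤ (Icc (x-6) (x+6)).indicator (fun _ => ofReal (2*ρ)) p := by
    intro p
    by_cases hp : p ∈ Icc (x-6) (x+6)
    · rw [indicator_of_mem hp]
      have h1 : Prod.mk p ⁻¹' O.DD x y r ρ ⊆ Icc ((y - O.G (clamp (x - p)) r) - ρ) ((y - O.G (clamp (x - p)) r) + ρ) := by
        intro q hq
        have := abs_le.1 hq.2
        simp only at this
        exact ⟨by linarith [this.2], by linarith [this.1]⟩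
      refine (measure_mono h1).trans ?_
      rw [Real.volume_Icc]; exact ofReal_le_ofReal (by linarith)
    · have : Prod.mk p ⁻¹' O.DD x y r ρ = ∅ := by
        ext q; simp only [mem_preimage, mem_empty_iff_false, iff_false]
        intro hq
        have := abs_le.1 hq.1
        simp only at this
        exact hp ⟨by linarith [this.2], by linarith [this.1]⟩
      rw [this]; simp
  refine (lintegral_mono this).trans ?_
  rw [lintegral_indicator_const measurableSet_Icc, Real.volume_Icc, ← ofReal_mul (by linarith)]
  exact ofReal_le_ofReal (by linarith)

theorem G_lip {v w r r' : ℝ} (hv : v ∈ Icc (1/2:ℝ) 2) (hw : w ∈ Icc (1/2:ℝ) 2) (hr : |r| ≤ c) (hr' : |r'| ≤ c) :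
    |O.G w r' - O.G v r| ≤ 13 * |w - v| + 13 * |r' - r| := by
  obtain ⟨ξ, k1, h1⟩ := mv _ _ (fun v => O.dGv v r') v w
  obtain ⟨ρ, k2, h2⟩ := mv _ _ (fun r => O.dGr v r) r r'
  have b1 := O.bGv ξ r' (mem_uIcc_conv hv hw k1) hr'
  have b2 := O.bGr v ρ hv (abs_conv hr hr' k2)
  have : O.G w r' - O.G v r = O.Gv ξ r' * (w - v) + O.Gr v ρ * (r' - r) := by linarith
  rw [this]
  refine (abs_add_le _ _).trans ?_
  rw [abs_mul, abs_mul]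
  gcongr

theorem DD_mem {L : ℝ} (hL : 1 ≤ L) {j n : ℕ} (hn : adm j n) {x y r ρ : ℝ} (hr : |r| ≤ c) (hρ : ρ ≤ 4) {z : ℝ × ℝ × ℝ}
    (hz : |z.2.2| ≤ c) (h1 : |x - z.1| ≤ ρ) (h2 : |r - z.2.2| ≤ ρ) (h3 : |y - z.2.1| ≤ 26 * ρ)
    {t : ℝ × ℝ} (ht : O.K L j n z t ≠ 0) : t ∈ O.DD x y r (52 * ρ + 1 / L) := by
  obtain ⟨k1, k2⟩ := O.K_supp ht
  have kI := Sn_sub hn k1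
  have hL0 : 0 < L := by linarith
  constructor
  · have : x - t.1 = (x - z.1) + (z.1 - t.1) := by ring
    rw [this]
    refine (abs_add_le _ _).trans ?_
    have : |z.1 - t.1| ≤ 2 := abs_le.2 ⟨by linarith [kI.1], kI.2⟩
    linarith
  · have e1 := clamp_lip (x - t.1) (z.1 - t.1)
    rw [clamp_self kI, show x - t.1 - (z.1 - t.1) = x - z.1 by ring] at e1
    have e2 := O.G_lip kI (clamp_mem (x - t.1)) hz hr
    have e3 : |z.2.1 - t.2 - O.G (z.1 - t.1) z.2.2| ≤ 1 / L := by
      rw [abs_mul, abs_of_pos hL0] at k2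
      rw [le_div_iff₀ hL0]; linarith
    have : y - O.G (clamp (x - t.1)) r - t.2 = (y - z.2.1) - (O.G (clamp (x - t.1)) r - O.G (z.1 - t.1) z.2.2) + (z.2.1 - t.2 - O.G (z.1 - t.1) z.2.2) := by ring
    rw [this]
    refine (abs_add_le _ _).trans ?_
    have := abs_sub (y - z.2.1) (O.G (clamp (x - t.1)) r - O.G (z.1 - t.1) z.2.2)
    linarith

/-- localized flux bound -/
theorem flux_loc {L η : ℝ} (hL : 1 ≤ L) (hη : 0 < η) (hη1 : η < 1) {j n n' : ℕ} (hn : adm j n) (hn' : adm j n') (hf : far n n')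
    (Q : Set (ℝ × ℝ)) (hQ : MeasurableSet Q) (x y w : ℝ × ℝ → ℝ) (hx : Measurable x) (hy : Measurable y)
    (hQ1 : ∀ ω ∈ Q, |ω.2| ≤ c ∧ w ω ∈ Sn j n) {e c1 : ℝ} (hc1 : 0 < c1) (he : e ≤ 1 / 4^j / 1798)
    (H : ∀ ω ∈ Q, ∀ ω' ∈ Q, B * (|x ω - x ω'| + |ω.2 - ω'.2|) ≤ e ∧
      |y ω - y ω' - (O.Gv (w ω) ω.2 * (x ω - x ω') + O.Gr (w ω) ω.2 * (ω.2 - ω'.2))| ≤ e * (|x ω - x ω'| + |ω.2 - ω'.2|) ∧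
      c1 * |ω.1 - ω'.1| ≤ |x ω - x ω'| + |ω.2 - ω'.2|)
    {x0 y0 r0 ρ : ℝ} (hr0 : |r0| ≤ c) (hρ0 : 0 ≤ ρ) (hρ : ρ ≤ 4) (hloc : ∀ ω ∈ Q, |x0 - x ω| ≤ ρ ∧ |r0 - ω.2| ≤ ρ ∧ |y0 - y ω| ≤ 26 * ρ)
    (f : ℝ × ℝ → ℝ) (hfm : Measurable f) (hF : ∀ t, |f t| ≤ 1) :
    ∫⁻ ω in Q, ofReal ((O.u L j n' f (x ω, y ω, ω.2))^2) ≤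
      ofReal (24 * (52 * ρ + 1 / L)) * (ofReal (10000000000000 * 16^j * L^(η-1) / c1) * Il η) := by
  have hL0 : 0 < L := by linarith
  set D := O.DD x0 y0 r0 (52 * ρ + 1 / L) with hD
  have hDm : MeasurableSet D := O.DD_meas _ _ _ _
  have hfD : ∀ t, |D.indicator f t| ≤ 1 := by
    intro t
    by_cases ht : t ∈ D
    · rw [indicator_of_mem ht]; exact hF t
    · rw [indicator_of_notMem ht]; simp
  have key := O.flux hL hη hη1 hn hn' hf Q hQ x y w hx hy hQ1 hc1 he H (D.indicator f) (hfm.indicator hDm) hfD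
  have e1 : ∫⁻ ω in Q, ofReal ((O.u L j n' f (x ω, y ω, ω.2))^2) = ∫⁻ ω in Q, ofReal ((O.u L j n' (D.indicator f) (x ω, y ω, ω.2))^2) := by
    refine setLIntegral_congr_fun hQ fun ω hω => ?_
    rw [← O.u_loc L j n' f D]
    intro t ht
    obtain ⟨a1, a2, a3⟩ := hloc ω hω
    exact O.DD_mem hL hn' hr0 hρ (hQ1 ω hω).1 a1 a2 a3 ht
  rw [e1]
  refine key.trans (mul_le_mul_left ?_ _)
  have e2 : ∫⁻ t, ofReal (D.indicator f t ^ 2) ≤ ∫⁻ t, D.indicator (fun _ => 1) t := by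
    refine lintegral_mono fun t => ?_
    by_cases ht : t ∈ D
    · rw [indicator_of_mem ht, indicator_of_mem ht]
      rw [← ENNReal.ofReal_one]
      refine ofReal_le_ofReal ?_
      rw [← sq_abs]; exact pow_le_one₀ (abs_nonneg _) (hF t)
    · rw [indicator_of_notMem ht, indicator_of_notMem ht]; simp
  refine e2.trans ?_
  rw [lintegral_indicator_const hDm, one_mul]
  exact O.DD_vol _ _ _ _ (by positivity)

/-- type I patch : `v` fixed -/
theorem patch1 {L η : ℝ} (hL : 1 ≤ L) (hη : 0 < η) (hη1 : η < 1) {j n n' : ℕ} (hn : adm j n) (hn' : adm j n') (hf : far n n')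
    (Q : Set (ℝ × ℝ)) (hQ : MeasurableSet Q) {x y r v : ℝ} (hr : |r| ≤ c) (hv : v ∈ Sn j n)
    (hQ1 : ∀ ω ∈ Q, |ω.2| ≤ c ∧ ω.1 ∈ Sn j n)
    (hQ2 : ∀ ω ∈ Q, ∀ ω' ∈ Q, B * (|ω.1 - ω'.1| + |ω.2 - ω'.2|) ≤ 1 / 4^j / 1798)
    {ρ : ℝ} (hρ0 : 0 ≤ ρ) (hρ : ρ ≤ 4) (hloc : ∀ ω ∈ Q, |ω.1 - v| ≤ ρ ∧ |r - ω.2| ≤ ρ)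
    (f : ℝ × ℝ → ℝ) (hfm : Measurable f) (hF : ∀ t, |f t| ≤ 1) :
    ∫⁻ ω in Q, ofReal ((O.u L j n' f (x - v + ω.1, y - O.G v r + O.G ω.1 ω.2, ω.2))^2) ≤
      ofReal (24 * (52 * ρ + 1 / L)) * (ofReal (10000000000000 * 16^j * L^(η-1)) * Il η) := by
  have hB := O.hB
  have hm : Measurable fun ω : ℝ × ℝ => O.G ω.1 ω.2 := O.cG.measurable
  have hvI := Sn_sub hn hv
  have := O.flux_loc hL hη hη1 hn hn' hf Q hQ (fun ω => x - v + ω.1) (fun ω => y - O.G v r + O.G ω.1 ω.2) (fun ω => ω.1)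
    (by fun_prop) (by fun_prop) hQ1 (e := 1 / 4^j / 1798) (c1 := 1) one_pos le_rfl ?_ (x0 := x) (y0 := y) (r0 := r) hr hρ0 hρ ?_ f hfm hF
  · rw [div_one] at this; exact this
  · intro ω hω ω' hω'
    have h0 := hQ2 ω hω ω' hω'
    have hwI := Sn_sub hn (hQ1 ω hω).2
    have e1 : x - v + ω.1 - (x - v + ω'.1) = ω.1 - ω'.1 := by ring
    simp only [e1]
    refine ⟨h0, ?_, ?_⟩
    · have h1 := O.tayG (X := ω.1 - ω'.1) hwI (hQ1 ω hω).1 (hQ1 ω' hω').1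
      rw [show ω.1 - (ω.1 - ω'.1) = ω'.1 by ring] at h1
      rw [← abs_neg]
      refine le_trans (le_of_eq ?_) (h1.trans ?_)
      · congr 1; ring
      · rw [pow_two, ← mul_assoc]
        exact mul_le_mul_of_nonneg_right h0 (by positivity)
    · linarith [abs_nonneg (ω.2 - ω'.2)]
  · intro ω hω
    obtain ⟨a1, a2⟩ := hloc ω hω
    have h3 := O.G_lip hvI (Sn_sub hn (hQ1 ω hω).2) hr (hQ1 ω hω).1
    refine ⟨?_, a2, ?_⟩
    · rw [show x - (x - v + ω.1) = -(ω.1 - v) by ring, abs_neg]; exact a1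
    · rw [show y - (y - O.G v r + O.G ω.1 ω.2) = -(O.G ω.1 ω.2 - O.G v r) by ring, abs_neg]
      rw [abs_sub_comm] at a2
      linarith

/-- inverse function of `Gv(·,r)` -/
theorem inv_ex {r : ℝ} (hr : |r| ≤ c) : ∃ V : ℝ → ℝ, Measurable V ∧ (∀ s, O.Gv (V s) r = s) ∧ (∀ v, V (O.Gv v r) = v) ∧
    ∀ F : ℝ → ℝ≥0∞, ∫⁻ v, F v ≤ ∫⁻ s, F (V s) := by
  have hmv : ∀ a b, |a - b| ≤ |O.Gv a r - O.Gv b r| := by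
    intro a b
    obtain ⟨ξ, -, h⟩ := mv _ _ (fun v => O.dGvv v r) b a
    rw [h, abs_mul]
    have := (O.bGvv ξ r hr).1
    rw [abs_of_nonneg (by linarith : 0 ≤ O.Gvv ξ r)]
    nlinarith [abs_nonneg (a - b)]
  have hmv2 : ∀ a b, a ≤ b → b - a ≤ O.Gv b r - O.Gv a r := by
    intro a b hab
    obtain ⟨ξ, -, h⟩ := mv _ _ (fun v => O.dGvv v r) a b
    rw [h]
    have := (O.bGvv ξ r hr).1
    nlinarith
  have hcont : Continuous fun v => O.Gv v r := continuous_iff_continuousAt.2 fun v => (O.dGvv v r).continuousAt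
  have hsurj : Function.Surjective fun v => O.Gv v r := by
    refine hcont.surjective ?_ ?_
    · refine Filter.tendsto_atTop_mono' _ ?_ (Filter.tendsto_atTop_add_const_right _ (O.Gv 0 r) Filter.tendsto_id)
      filter_upwards [Filter.eventually_ge_atTop 0] with v hv
      have := hmv2 0 v hv
      simp only [id]; linarith
    · refine Filter.tendsto_atBot_mono' _ ?_ (Filter.tendsto_atBot_add_const_right _ (O.Gv 0 r) Filter.tendsto_id)
      filter_upwards [Filter.eventually_le_atBot 0] with v hv
      have := hmv2 v 0 hv
      simp only [id]; linarith
  choose V hV using hsurj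
  have hVi : ∀ v, V (O.Gv v r) = v := by
    intro v
    have := hmv (V (O.Gv v r)) v
    have h2 := hV (O.Gv v r)
    simp only at h2
    rw [h2, sub_self, abs_zero] at this
    linarith [abs_nonpos_iff.1 this]
  have hVm : Measurable V := by
    refine (LipschitzWith.of_dist_le_mul (K := 1) fun a b => ?_).continuous.measurable
    have := hmv (V a) (V b)
    have h1 := hV a
    have h2 := hV b
    simp only at h1 h2
    rw [h1, h2] at this
    simpa [Real.dist_eq] using this
  refine ⟨V, hVm, hV, hVi, fun F => ?_⟩
  have h := lintegral_image_eq_lintegral_abs_deriv_mul (s := univ) MeasurableSet.univ (f := fun v => O.Gv v r) (f' := fun v => O.Gvv v r)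
    (fun v _ => (O.dGvv v r).hasDerivWithinAt) (fun a _ b _ hab => by
      have := congrArg V hab
      simpa [hVi] using this) (fun s => F (V s))
  have him : (fun v => O.Gv v r) '' univ = univ := by
    rw [image_univ]; exact Set.eq_univ_of_forall fun s => ⟨V s, hV s⟩
  rw [him, setLIntegral_univ, setLIntegral_univ] at h
  rw [h]
  refine lintegral_mono fun v => ?_
  simp only [hVi]
  have h1 : (1:ℝ≥0∞) ≤ ofReal |O.Gvv v r| := by
    rw [← ENNReal.ofReal_one]
    refine ofReal_le_ofReal ((O.bGvv v r hr).1.trans (le_abs_self _))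
  calc F v = 1 * F v := (one_mul _).symm
    _ ≤ _ := mul_le_mul_left h1 _

end Op
end MS
namespace MS
namespace Op
variable {c B : ℝ} (O : Op c B)

/-- algebra for the tangential patch -/
theorem tang_c1 {w w' v v' r s s' ρ r1 : ℝ} (hw : w ∈ Icc (1/2:ℝ) 2) (hw' : w' ∈ Icc (1/2:ℝ) 2) (hr : |r| ≤ c) (hs : |s| ≤ c) (hs' : |s'| ≤ c)
    (hE : O.Gv v r - O.Gv v' r = O.Gv w s - O.Gv w' s') (hd : |w - w'| + |s - s'| ≤ ρ) (hρ : ρ ≤ r1) (h1 : r1 ≤ |r - s|)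
    (h2 : |w - v| ≤ 14 * |r - s|) :
    |v - v'| ≤ 13 * (|w - w'| + |s - s'|) ∧ r1 / 10 * |w - w'| ≤ |(w - v) - (w' - v')| + |s - s'| := by
  obtain ⟨ξ, k1, e1⟩ := mv _ _ (fun v => O.dGvv v s) w' w
  obtain ⟨ζ, k2, e2⟩ := mv _ _ (fun r => O.dGvr w' r) s' s
  obtain ⟨ξ2, k3, e3⟩ := mv _ _ (fun v => O.dGvv v r) v' v
  have hξ := mem_uIcc_conv hw' hw k1
  have b1 := O.bGvv ξ s hs
  have b2 := O.bGvr w' ζ hw' (abs_conv hs' hs k2)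
  have b3 := O.bGvv ξ2 r hr
  have E : O.Gvv ξ2 r * (v - v') = O.Gvv ξ s * (w - w') + O.Gvr w' ζ * (s - s') := by linarith
  have hv : |v - v'| ≤ 13 * (|w - w'| + |s - s'|) := by
    have a1 : |O.Gvv ξ2 r * (v - v')| ≤ 3 * |w - w'| + 13 * |s - s'| := by
      rw [E]
      refine (abs_add_le _ _).trans ?_
      rw [abs_mul, abs_mul, abs_of_nonneg (by linarith : 0 ≤ O.Gvv ξ s)]
      gcongr
      exact b1.2
    rw [abs_mul, abs_of_nonneg (by linarith : 0 ≤ O.Gvv ξ2 r)] at a1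
    have a2 := mul_le_mul_of_nonneg_right b3.1 (abs_nonneg (v - v'))
    linarith [abs_nonneg (w - w')]
  refine ⟨hv, ?_⟩
  obtain ⟨ζ2, k4, e4⟩ := mv _ _ (fun r => O.dGvvr ξ r) r s
  obtain ⟨ξ3, k5, e5⟩ := mv _ _ (fun v => O.dGvvv v r) ξ2 ξ
  have b4 := O.bGvvr ξ ζ2 hξ (abs_conv hr hs k4)
  have b5 := O.bGvvv ξ3 r hr
  have D1 : |ξ - w| ≤ |w - w'| := by
    have := abs_sub_right_of_mem_uIcc k1
    rw [abs_sub_comm w ξ] at this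
    linarith
  have D2 : |ξ2 - v| ≤ |v - v'| := by
    have := abs_sub_right_of_mem_uIcc k3
    rw [abs_sub_comm v ξ2] at this
    linarith
  have D3 : |ξ - ξ2| ≤ 14 * |r - s| + 14 * ρ := by
    rw [show ξ - ξ2 = (ξ - w) + (w - v) - (ξ2 - v) by ring]
    have a1 := abs_sub ((ξ - w) + (w - v)) (ξ2 - v)
    have a2 := abs_add_le (ξ - w) (w - v)
    linarith [abs_nonneg (s - s')]
  have D4 : (13/10) * r1 ≤ |O.Gvv ξ s - O.Gvv ξ2 r| := by
    have e6 : O.Gvv ξ s - O.Gvv ξ2 r = O.Gvvr ξ ζ2 * (s - r) + O.Gvvv ξ3 r * (ξ - ξ2) := by linarith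
    have a1 : |O.Gvvr ξ ζ2 * (s - r)| - |O.Gvvv ξ3 r * (ξ - ξ2)| ≤ |O.Gvv ξ s - O.Gvv ξ2 r| := by
      rw [e6]
      have := abs_sub_abs_le_abs_sub (O.Gvvr ξ ζ2 * (s - r)) (-(O.Gvvv ξ3 r * (ξ - ξ2)))
      rw [abs_neg, sub_neg_eq_add] at this
      exact this
    rw [abs_mul, abs_mul, abs_of_nonneg (by linarith : 0 ≤ O.Gvvr ξ ζ2), abs_sub_comm s r] at a1
    have a2 := mul_le_mul_of_nonneg_right b4.1 (abs_nonneg (r - s))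
    have a3 := mul_le_mul_of_nonneg_right b5 (abs_nonneg (ξ - ξ2))
    linarith [abs_nonneg (r - s)]
  have E2 : (O.Gvv ξ s - O.Gvv ξ2 r) * (w - w') = - (O.Gvv ξ2 r * ((w - v) - (w' - v'))) - O.Gvr w' ζ * (s - s') := by linarith
  have a1 : |(O.Gvv ξ s - O.Gvv ξ2 r) * (w - w')| ≤ 13 * (|(w - v) - (w' - v')| + |s - s'|) := by
    rw [E2]
    refine (abs_sub _ _).trans ?_
    rw [abs_neg, abs_mul, abs_mul, abs_of_nonneg (by linarith : 0 ≤ O.Gvv ξ2 r)]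
    have a2 := mul_le_mul_of_nonneg_right b3.2 (abs_nonneg ((w - v) - (w' - v')))
    have a3 := mul_le_mul_of_nonneg_right b2 (abs_nonneg (s - s'))
    linarith [abs_nonneg ((w - v) - (w' - v'))]
  rw [abs_mul] at a1
  have a4 := mul_le_mul_of_nonneg_right D4 (abs_nonneg (w - w'))
  linarith

theorem tang_y {w w' v v' r s s' ρ r1 η0 Δ1 e : ℝ} (hv : v ∈ Icc (1/2:ℝ) 2) (hw : w ∈ Icc (1/2:ℝ) 2)
    (hr : |r| ≤ c) (hs : |s| ≤ c) (hs' : |s'| ≤ c)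
    (hη : O.Gv v r = O.Gv w s - η0) (hη0 : |η0| ≤ Δ1) (hd : |w - w'| + |s - s'| ≤ ρ)
    (hΔv : |v - v'| ≤ 13 * (|w - w'| + |s - s'|)) (hc1 : r1 / 10 * |w - w'| ≤ |(w - v) - (w' - v')| + |s - s'|)
    (hr10 : 0 < r1) (hr1 : r1 ≤ 1) (he1 : 4000 * B * ρ ≤ e * r1) (he2 : 300 * Δ1 ≤ e * r1) :
    |(- O.G v r + O.G w s) - (- O.G v' r + O.G w' s') - (O.Gv w s * ((w - v) - (w' - v')) + O.Gr w s * (s - s'))| ≤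
      e * (|(w - v) - (w' - v')| + |s - s'|) := by
  have hB := O.hB
  have t1 := O.tayG (X := v - v') hv hr hr
  have t2 := O.tayG (X := w - w') hw hs hs'
  rw [show v - (v - v') = v' by ring, sub_self, abs_zero, mul_zero, add_zero, add_zero] at t1
  rw [show w - (w - w') = w' by ring] at t2
  set d := |w - w'| + |s - s'| with hdd
  set D := |(w - v) - (w' - v')| + |s - s'| with hDD
  have hd0 : 0 ≤ d := by positivity
  have hD0 : 0 ≤ D := by positivity
  have e1 : (- O.G v r + O.G w s) - (- O.G v' r + O.G w' s') - (O.Gv w s * ((w - v) - (w' - v')) + O.Gr w s * (s - s')) =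
     (O.G v' r - O.G v r + O.Gv v r * (v - v')) - (O.G w' s' - O.G w s + O.Gv w s * (w - w') + O.Gr w s * (s - s')) + η0 * (v - v') := by
    have : η0 = O.Gv w s - O.Gv v r := by linarith
    rw [this]; ring
  rw [e1]
  refine (abs_add_le _ _).trans ?_
  have a1 := abs_sub (O.G v' r - O.G v r + O.Gv v r * (v - v')) (O.G w' s' - O.G w s + O.Gv w s * (w - w') + O.Gr w s * (s - s'))
  have a2 : |η0 * (v - v')| ≤ Δ1 * (13 * d) := by
    rw [abs_mul]; exact mul_le_mul hη0 hΔv (abs_nonneg _) ((abs_nonneg _).trans hη0)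
  have a3 : |v - v'|^2 ≤ 169 * (ρ * d) := by
    have : |v - v'|^2 ≤ (13 * d)^2 := by gcongr
    have h2 : d * d ≤ ρ * d := mul_le_mul_of_nonneg_right hd hd0
    linarith [show (13*d)^2 = 169 * (d * d) by ring]
  have a4 : d^2 ≤ ρ * d := by rw [pow_two]; exact mul_le_mul_of_nonneg_right hd hd0
  have a5 : B * |v - v'|^2 ≤ B * (169 * (ρ * d)) := mul_le_mul_of_nonneg_left a3 (by linarith)
  have a6 : B * d^2 ≤ B * (ρ * d) := mul_le_mul_of_nonneg_left a4 (by linarith)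
  have a7 : r1 * d ≤ 11 * D := by
    have : r1 * |s - s'| ≤ 1 * |s - s'| := mul_le_mul_of_nonneg_right hr1 (abs_nonneg _)
    have h3 : |s - s'| ≤ D := by rw [hDD]; linarith [abs_nonneg ((w - v) - (w' - v'))]
    rw [hdd, mul_add]; linarith
  have a8 : 4000 * B * ρ * d ≤ e * r1 * d := mul_le_mul_of_nonneg_right he1 hd0
  have a9 : 300 * Δ1 * d ≤ e * r1 * d := mul_le_mul_of_nonneg_right he2 hd0
  have he0 : 0 ≤ e := by
    by_contra hc; push Not at hc
    have : 0 ≤ Δ1 := (abs_nonneg _).trans hη0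
    nlinarith
  have a10 : e * (r1 * d) ≤ e * (11 * D) := mul_le_mul_of_nonneg_left a7 he0
  nlinarith

/-- type II patch -/
theorem patch2 {L η : ℝ} (hL : 1 ≤ L) (hη : 0 < η) (hη1 : η < 1) {j n n' : ℕ} (hn : adm j n) (hn' : adm j n') (hf : far n n')
    (Q : Set (ℝ × ℝ)) (hQ : MeasurableSet Q) {x y r η0 Δ1 r1 ρ : ℝ} (hr : |r| ≤ c) (V : ℝ → ℝ) (hVm : Measurable V)
    (hV : ∀ s, O.Gv (V s) r = s) (hη0 : |η0| ≤ Δ1)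
    (hQ1 : ∀ ω ∈ Q, |ω.2| ≤ c ∧ ω.1 ∈ Sn j n ∧ V (O.Gv ω.1 ω.2 - η0) ∈ Sn j n ∧ r1 ≤ |r - ω.2| ∧
      |ω.1 - V (O.Gv ω.1 ω.2 - η0)| ≤ 14 * |r - ω.2|)
    (hQ2 : ∀ ω ∈ Q, ∀ ω' ∈ Q, |ω.1 - ω'.1| + |ω.2 - ω'.2| ≤ ρ) (hr10 : 0 < r1) (hr1 : r1 ≤ 1) (hρ0 : 0 ≤ ρ)
    (he1 : 4000 * B * ρ ≤ 1 / 4^j / 1798 * r1) (he2 : 300 * Δ1 ≤ 1 / 4^j / 1798 * r1)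
    (f : ℝ × ℝ → ℝ) (hfm : Measurable f) (hF : ∀ t, |f t| ≤ 1) :
    ∫⁻ ω in Q, ofReal ((O.u L j n' f (x - V (O.Gv ω.1 ω.2 - η0) + ω.1, y - O.G (V (O.Gv ω.1 ω.2 - η0)) r + O.G ω.1 ω.2, ω.2))^2) ≤
      ofReal 2520 * (ofReal (100000000000000 * 16^j * L^(η-1) / r1) * Il η) := by
  have hB := O.hB
  have hc1 := O.hc1
  have hm : Measurable fun ω : ℝ × ℝ => O.G ω.1 ω.2 := O.cG.measurable
  have hmv : Measurable fun ω : ℝ × ℝ => O.Gv ω.1 ω.2 := O.cGv.measurable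
  have hmG : Measurable fun v : ℝ => O.G v r := (O.cG.comp (continuous_id.prodMk continuous_const)).measurable
  have hmV : Measurable fun ω : ℝ × ℝ => V (O.Gv ω.1 ω.2 - η0) := hVm.comp (hmv.sub_const η0)
  have hmGV : Measurable fun ω : ℝ × ℝ => O.G (V (O.Gv ω.1 ω.2 - η0)) r := hmG.comp hmV
  have hE0 : (1:ℝ) / 4^j / 1798 ≤ 1 := by
    rw [div_div, div_le_one (by positivity)]
    have : (1:ℝ) ≤ 4^j := one_le_pow₀ (by norm_num)
    linarith
  have hρ1 : ρ ≤ r1 := by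
    have : 1 / 4^j / 1798 * r1 ≤ 1 * r1 := mul_le_mul_of_nonneg_right hE0 hr10.le
    nlinarith
  have := O.flux_loc hL hη hη1 hn hn' hf Q hQ (fun ω => x - V (O.Gv ω.1 ω.2 - η0) + ω.1)
    (fun ω => y - O.G (V (O.Gv ω.1 ω.2 - η0)) r + O.G ω.1 ω.2) (fun ω => ω.1)
    (by fun_prop) (by fun_prop) (fun ω hω => ⟨(hQ1 ω hω).1, (hQ1 ω hω).2.1⟩) (e := 1 / 4^j / 1798) (c1 := r1/10) (by positivity) le_rfl ?_
    (x0 := x) (y0 := y) (r0 := r) (ρ := 2) hr (by norm_num) (by norm_num) ?_ f hfm hF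
  · refine this.trans ?_
    have hL0 : 0 < L := by linarith
    have hL1 : 1 / L ≤ 1 := by rw [div_le_one hL0]; exact hL
    refine mul_le_mul' (ofReal_le_ofReal (by linarith)) (mul_le_mul' (ofReal_le_ofReal (le_of_eq ?_)) le_rfl)
    field_simp; norm_num
  · intro ω hω ω' hω'
    obtain ⟨p1, p2, p3, p4, p5⟩ := hQ1 ω hω
    obtain ⟨q1, q2, q3, q4, q5⟩ := hQ1 ω' hω'
    have hd := hQ2 ω hω ω' hω'
    set v := V (O.Gv ω.1 ω.2 - η0) with hvd
    set v' := V (O.Gv ω'.1 ω'.2 - η0) with hvd'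
    have g1 : O.Gv v r = O.Gv ω.1 ω.2 - η0 := hV _
    have g2 : O.Gv v' r = O.Gv ω'.1 ω'.2 - η0 := hV _
    obtain ⟨b1, b2⟩ := O.tang_c1 (v := v) (v' := v') (Sn_sub hn p2) (Sn_sub hn q2) hr p1 q1 (by rw [g1, g2]; ring) hd hρ1 p4 p5
    have b3 := O.tang_y (Sn_sub hn p3) (Sn_sub hn p2) hr p1 q1 g1 hη0 hd b1 b2 hr10 hr1 he1 he2
    have e1 : x - v + ω.1 - (x - v' + ω'.1) = (ω.1 - v) - (ω'.1 - v') := by ring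
    have e2 : y - O.G v r + O.G ω.1 ω.2 - (y - O.G v' r + O.G ω'.1 ω'.2) = (- O.G v r + O.G ω.1 ω.2) - (- O.G v' r + O.G ω'.1 ω'.2) := by ring
    simp only [e1, e2]
    refine ⟨?_, b3, b2⟩
    have a1 : |(ω.1 - v) - (ω'.1 - v')| ≤ |ω.1 - ω'.1| + |v - v'| := by
      rw [show (ω.1 - v) - (ω'.1 - v') = (ω.1 - ω'.1) - (v - v') by ring]; exact abs_sub _ _
    have a2 : |(ω.1 - v) - (ω'.1 - v')| + |ω.2 - ω'.2| ≤ 14 * ρ := by linarith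
    have a3 : B * (|(ω.1 - v) - (ω'.1 - v')| + |ω.2 - ω'.2|) ≤ B * (14 * ρ) := mul_le_mul_of_nonneg_left a2 (by linarith)
    have a4 : (1:ℝ) / 4^j / 1798 * r1 ≤ 1 / 4^j / 1798 * 1 := mul_le_mul_of_nonneg_left hr1 (by positivity)
    have a5 : 0 ≤ B * ρ := mul_nonneg (by linarith) hρ0
    linarith
  · intro ω hω
    obtain ⟨p1, p2, p3, p4, p5⟩ := hQ1 ω hω
    have s1 := Sn_sub hn p2
    have s2 := Sn_sub hn p3
    set v := V (O.Gv ω.1 ω.2 - η0) with hvd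
    have h3 := O.G_lip s2 s1 hr p1
    have h4 : |ω.1 - v| ≤ 2 := abs_le.2 ⟨by linarith [s1.1, s2.2], by linarith [s1.2, s2.1]⟩
    have h5 : |r - ω.2| ≤ 2 := (abs_sub _ _).trans (by linarith)
    refine ⟨?_, h5, ?_⟩
    · rw [show x - (x - v + ω.1) = -(ω.1 - v) by ring, abs_neg]; exact h4
    · rw [show y - (y - O.G v r + O.G ω.1 ω.2) = -(O.G ω.1 ω.2 - O.G v r) by ring, abs_neg]
      rw [abs_sub_comm] at h5
      linarith

end Op
end MS
namespace MS

theorem grid (P : Set (ℝ × ℝ)) (hP : MeasurableSet P) (hP1 : ∀ ω ∈ P, |ω.1| ≤ 2 ∧ |ω.2| ≤ 2) (F : ℝ × ℝ → ℝ≥0∞) (hF : Measurable F)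
    (ρ : ℝ) (hρ : 0 < ρ) (hρ1 : ρ ≤ 1) (M : ℝ≥0∞)
    (h : ∀ Q : Set (ℝ × ℝ), MeasurableSet Q → Q ⊆ P → (∀ ω ∈ Q, ∀ ω' ∈ Q, |ω.1 - ω'.1| + |ω.2 - ω'.2| ≤ ρ) → ∫⁻ ω in Q, F ω ≤ M) :
    ∫⁻ ω in P, F ω ≤ ofReal (169 / ρ^2) * M := by
  classical
  set N : ℤ := ⌈4/ρ⌉ + 1 with hN
  set T := (Finset.Icc (-N) N) ×ˢ (Finset.Icc (-N) N) with hT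
  set Q : ℤ × ℤ → Set (ℝ × ℝ) := fun p => P ∩ {ω | ⌊2/ρ * ω.1⌋ = p.1 ∧ ⌊2/ρ * ω.2⌋ = p.2} with hQ
  have hQm : ∀ p, MeasurableSet (Q p) := by
    intro p
    refine hP.inter (MeasurableSet.inter ?_ ?_)
    · exact (Int.measurable_floor.comp (measurable_fst.const_mul (2/ρ))) (MeasurableSet.singleton p.1)
    · exact (Int.measurable_floor.comp (measurable_snd.const_mul (2/ρ))) (MeasurableSet.singleton p.2)
  have hcov : ∀ x : ℝ, |x| ≤ 2 → ⌊2/ρ * x⌋ ∈ Finset.Icc (-N) N := by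
    intro x hx
    rw [abs_le] at hx
    have h2 : 0 < 2/ρ := by positivity
    have h3 : (4/ρ) = 2/ρ*2 := by ring
    have h4 := Int.le_ceil (4/ρ)
    rw [Finset.mem_Icc]
    constructor
    · rw [Int.le_floor, hN]; push_cast
      nlinarith
    · have : ⌊2/ρ * x⌋ ≤ ⌈4/ρ⌉ := by
        have h5 := Int.floor_le (2/ρ*x)
        have : ((⌊2/ρ * x⌋ : ℤ) : ℝ) ≤ (⌈4/ρ⌉ : ℤ) := by nlinarith
        exact_mod_cast this
      omega
  have hfl : ∀ a b : ℝ, ⌊2/ρ * a⌋ = ⌊2/ρ * b⌋ → |a - b| ≤ ρ/2 := by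
    intro a b hab
    have := Int.abs_sub_lt_one_of_floor_eq_floor hab
    rw [← mul_sub, abs_mul, abs_of_pos (by positivity : 0 < 2/ρ), div_mul_eq_mul_div, div_lt_one hρ] at this
    linarith
  have h1 : ∀ p, ∫⁻ ω in Q p, F ω ≤ M := by
    intro p
    refine h (Q p) (hQm p) inter_subset_left fun ω hω ω' hω' => ?_
    have a1 := hfl ω.1 ω'.1 (hω.2.1.trans hω'.2.1.symm)
    have a2 := hfl ω.2 ω'.2 (hω.2.2.trans hω'.2.2.symm)
    linarith
  calc ∫⁻ ω in P, F ω = ∫⁻ ω, P.indicator F ω := (lintegral_indicator hP _).symm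
    _ ≤ ∫⁻ ω, ∑ p ∈ T, (Q p).indicator F ω := by
        refine lintegral_mono fun ω => ?_
        by_cases hω : ω ∈ P
        · have hm : (⌊2/ρ * ω.1⌋, ⌊2/ρ * ω.2⌋) ∈ T := Finset.mem_product.2 ⟨hcov _ (hP1 ω hω).1, hcov _ (hP1 ω hω).2⟩
          have hq : ω ∈ Q (⌊2/ρ * ω.1⌋, ⌊2/ρ * ω.2⌋) := ⟨hω, rfl, rfl⟩
          have := Finset.single_le_sum (f := fun p => (Q p).indicator F ω) (fun p _ => zero_le) hm
          rw [indicator_of_mem hω]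
          refine le_trans (le_of_eq ?_) this
          simp only [indicator_of_mem hq]
        · rw [indicator_of_notMem hω]; exact zero_le
    _ = ∑ p ∈ T, ∫⁻ ω in Q p, F ω := by
        rw [lintegral_finsetSum _ fun p _ => hF.indicator (hQm p)]
        exact Finset.sum_congr rfl fun p _ => lintegral_indicator (hQm p) _
    _ ≤ ∑ p ∈ T, M := Finset.sum_le_sum fun p _ => h1 p
    _ = (T.card : ℝ≥0∞) * M := by rw [Finset.sum_const, nsmul_eq_mul]
    _ ≤ _ := by
        refine mul_le_mul_left ?_ _
        have hN0 : 0 ≤ N := by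
          have : 0 ≤ ⌈4/ρ⌉ := Int.ceil_nonneg (by positivity)
          omega
        have hc : (T.card : ℝ) = (2*N+1)^2 := by
          rw [hT, Finset.card_product, Int.card_Icc]
          push_cast
          have : (((N + 1 - -N).toNat : ℕ) : ℝ) = 2*N+1 := by
            have h2 : (((N + 1 - -N).toNat : ℕ) : ℤ) = 2*N+1 := by
              rw [Int.toNat_of_nonneg (by omega)]; ring
            exact_mod_cast h2
          rw [this]; ring
        have hN2 : (2*(N:ℝ)+1) ≤ 13/ρ := by
          have h3 := Int.ceil_lt_add_one (4/ρ)
          have : (N:ℝ) ≤ 4/ρ + 2 := by rw [hN]; push_cast; linarith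
          have h5 : 5 ≤ 5/ρ := by rw [le_div_iff₀ hρ]; linarith
          calc 2*(N:ℝ)+1 ≤ 8/ρ + 5 := by
                have : 8/ρ = 2 * (4/ρ) := by ring
                linarith
            _ ≤ 8/ρ + 5/ρ := by linarith
            _ = 13/ρ := by ring
        rw [← ENNReal.ofReal_natCast]
        refine ofReal_le_ofReal ?_
        rw [hc]
        have hN0' : (0:ℝ) ≤ N := by exact_mod_cast hN0
        calc (2*(N:ℝ)+1)^2 ≤ (13/ρ)^2 := by gcongr
          _ = _ := by rw [div_pow]; norm_num

theorem lint3 (g : ℝ × ℝ × ℝ → ℝ≥0∞) (hg : Measurable g) :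
    ∫⁻ z, g z = ∫⁻ x, ∫⁻ r, ∫⁻ y, g (x, y, r) := by
  rw [Measure.volume_eq_prod, lintegral_prod _ hg.aemeasurable]
  refine lintegral_congr fun x => ?_
  rw [Measure.volume_eq_prod, lintegral_prod_symm (fun p : ℝ × ℝ => g (x, p)) (hg.comp measurable_prodMk_left).aemeasurable]

namespace Op
variable {c B : ℝ} (O : Op c B)

theorem Wcoord {L : ℝ} (hL : 0 < L) (x y r : ℝ) (E : ℝ × ℝ × ℝ → ℝ≥0∞) (hE : Measurable E)
    (Φ : ℝ × ℝ × ℝ → ℝ≥0∞) (hΦ : Measurable Φ) (M : ℝ≥0∞)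
    (hM : ∀ y, ∫⁻ v, ∫⁻ ω : ℝ × ℝ, Φ (v, ω.1, ω.2) * E (x - v + ω.1, y - O.G v r + O.G ω.1 ω.2, ω.2) ≤ M) :
    ∫⁻ z', E z' * ∫⁻ v, ({v | |L * O.h (x, y, r) z' v| ≤ 2} : Set ℝ).indicator (fun v => Φ (v, v - (x - z'.1), z'.2.2)) v ≤
      ofReal (4 / L) * M := by
  have cG : Continuous fun p : ℝ × ℝ => O.G p.1 p.2 := O.cG
  -- joint measurability
  set g : ℝ × (ℝ × ℝ × ℝ) → ℝ≥0∞ := fun q => E q.2 * ({q : ℝ × (ℝ × ℝ × ℝ) | |L * O.h (x, y, r) q.2 q.1| ≤ 2}).indicator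
    (fun q => Φ (q.1, q.1 - (x - q.2.1), q.2.2.2)) q with hg
  have hcm : Continuous fun q : ℝ × (ℝ × ℝ × ℝ) => |L * O.h (x, y, r) q.2 q.1| := by
    have c1 : Continuous fun q : ℝ × (ℝ × ℝ × ℝ) => O.G q.1 r := cG.comp (continuous_fst.prodMk continuous_const)
    have c2 : Continuous fun q : ℝ × (ℝ × ℝ × ℝ) => O.G (q.1 - (x - q.2.1)) q.2.2.2 := cG.comp (Continuous.prodMk (by fun_prop) (by fun_prop))
    unfold Op.h; fun_prop
  have hgm : Measurable g := (hE.comp measurable_snd).mul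
    ((hΦ.comp (by fun_prop)).indicator (measurableSet_le hcm.measurable measurable_const))
  set k : ℝ × ℝ → ℝ × ℝ → ℝ≥0∞ := fun p ω => Φ (p.1, ω.1, ω.2) * E (x - p.1 + ω.1, (y - p.2) - O.G p.1 r + O.G ω.1 ω.2, ω.2) with hk
  have hkm : Measurable (fun q : (ℝ × ℝ) × (ℝ × ℝ) => k q.1 q.2) := by
    have m1 : Measurable fun q : (ℝ × ℝ) × (ℝ × ℝ) => O.G q.1.1 r := (cG.comp ((continuous_fst.comp continuous_fst).prodMk continuous_const)).measurable
    have m2 : Measurable fun q : (ℝ × ℝ) × (ℝ × ℝ) => O.G q.2.1 q.2.2 := (cG.comp continuous_snd).measurable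
    refine (hΦ.comp (by fun_prop)).mul (hE.comp (by fun_prop))
  set I : Set ℝ := {t | |L * t| ≤ 2} with hI
  have hIm : MeasurableSet I := measurableSet_le (by fun_prop) measurable_const
  have hIv : volume I ≤ ofReal (4 / L) := by
    have := vol_abs_le L 2 0 hL
    refine le_trans (le_of_eq ?_) (this.trans (le_of_eq (by norm_num)))
    congr 1; ext t; simp [hI, abs_mul]
  calc _ ≤ ∫⁻ z', ∫⁻ v, g (v, z') := by
        refine lintegral_mono fun z' => ?_
        refine (lintegral_const_mul_le _ _).trans (le_of_eq ?_)
        rfl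
    _ = ∫⁻ v, ∫⁻ z', g (v, z') := by
        rw [lintegral_lintegral_swap]
        exact (hgm.comp measurable_swap).aemeasurable
    _ = ∫⁻ v, ∫⁻ w, ∫⁻ r', ∫⁻ t, I.indicator (fun t => k (v, t) (w, r')) t := by
        refine lintegral_congr fun v => ?_
        rw [lint3 (fun z' => g (v, z')) (hgm.comp measurable_prodMk_left)]
        rw [← lintegral_add_left_eq_self (fun x' => ∫⁻ r, ∫⁻ y, g (v, x', y, r)) (x - v)]
        refine lintegral_congr fun w => lintegral_congr fun r' => ?_
        rw [← lintegral_sub_left_eq_self (fun y' => g (v, x - v + w, y', r')) (y - O.G v r + O.G w r')]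
        refine lintegral_congr fun t => ?_
        have e1 : O.h (x, y, r) (x - v + w, y - O.G v r + O.G w r' - t, r') v = t := by
          unfold Op.h
          simp only
          rw [show v - (x - (x - v + w)) = w by ring]; ring
        by_cases ht : t ∈ I
        · rw [indicator_of_mem ht]
          have : (v, (x - v + w, y - O.G v r + O.G w r' - t, r')) ∈ {q : ℝ × (ℝ × ℝ × ℝ) | |L * O.h (x, y, r) q.2 q.1| ≤ 2} := by
            simp only [mem_setOf_eq, e1]; exact ht
          simp only [hg, hk]
          rw [indicator_of_mem this, mul_comm]
          simp only
          rw [show v - (x - (x - v + w)) = w by ring, show y - O.G v r + O.G w r' - t = y - t - O.G v r + O.G w r' by ring]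
        · rw [indicator_of_notMem ht]
          have : (v, (x - v + w, y - O.G v r + O.G w r' - t, r')) ∉ {q : ℝ × (ℝ × ℝ × ℝ) | |L * O.h (x, y, r) q.2 q.1| ≤ 2} := by
            simp only [mem_setOf_eq, e1]; exact ht
          simp only [hg]
          rw [indicator_of_notMem this, mul_zero]
    _ = ∫⁻ v, ∫⁻ ω : ℝ × ℝ, ∫⁻ t, I.indicator (fun t => k (v, t) ω) t := by
        refine lintegral_congr fun v => ?_
        have hm : Measurable fun ω : ℝ × ℝ => ∫⁻ t, I.indicator (fun t => k (v, t) ω) t := by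
          refine Measurable.lintegral_prod_right' (f := fun q : (ℝ × ℝ) × ℝ => I.indicator (fun t => k (v, t) q.1) q.2) ?_
          have : (fun q : (ℝ × ℝ) × ℝ => I.indicator (fun t => k (v, t) q.1) q.2) = (Prod.snd ⁻¹' I).indicator (fun q : (ℝ × ℝ) × ℝ => k (v, q.2) q.1) := by
            ext q; rfl
          rw [this]
          exact Measurable.indicator (hkm.comp (f := fun q : (ℝ × ℝ) × ℝ => ((v, q.2), q.1)) (by fun_prop)) (measurable_snd hIm)
        rw [Measure.volume_eq_prod, lintegral_prod _ hm.aemeasurable]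
    _ = ∫⁻ v, ∫⁻ t, ∫⁻ ω : ℝ × ℝ, I.indicator (fun t => k (v, t) ω) t := by
        refine lintegral_congr fun v => ?_
        rw [lintegral_lintegral_swap]
        have : (Function.uncurry fun (ω : ℝ × ℝ) t => I.indicator (fun t => k (v, t) ω) t) = (Prod.snd ⁻¹' I).indicator (fun q : (ℝ × ℝ) × ℝ => k (v, q.2) q.1) := by
          ext q; rfl
        rw [this]
        exact (Measurable.indicator (hkm.comp (f := fun q : (ℝ × ℝ) × ℝ => ((v, q.2), q.1)) (by fun_prop)) (measurable_snd hIm)).aemeasurable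
    _ = ∫⁻ v, ∫⁻ t, I.indicator (fun t => ∫⁻ ω : ℝ × ℝ, k (v, t) ω) t := by
        refine lintegral_congr fun v => lintegral_congr fun t => ?_
        by_cases ht : t ∈ I
        · simp only [indicator_of_mem ht]
        · simp only [indicator_of_notMem ht]; simp
    _ = ∫⁻ t, ∫⁻ v, I.indicator (fun t => ∫⁻ ω : ℝ × ℝ, k (v, t) ω) t := by
        rw [lintegral_lintegral_swap]
        have h1 : Measurable fun p : ℝ × ℝ => ∫⁻ ω : ℝ × ℝ, k p ω := hkm.lintegral_prod_right'
        have : (Function.uncurry fun (v : ℝ) t => I.indicator (fun t => ∫⁻ ω : ℝ × ℝ, k (v, t) ω) t) = (Prod.snd ⁻¹' I).indicator (fun p : ℝ × ℝ => ∫⁻ ω : ℝ × ℝ, k p ω) := by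
          ext q; rfl
        rw [this]
        exact (h1.indicator (measurable_snd hIm)).aemeasurable
    _ ≤ ∫⁻ t, I.indicator (fun _ => M) t := by
        refine lintegral_mono fun t => ?_
        by_cases ht : t ∈ I
        · simp only [indicator_of_mem ht]
          exact hM (y - t)
        · simp only [indicator_of_notMem ht]; simp
    _ = M * volume I := by rw [lintegral_indicator_const hIm]
    _ ≤ _ := by rw [mul_comm]; exact mul_le_mul_left hIv _

end Op
end MS
namespace MS
namespace Op
variable {c B : ℝ} (O : Op c B)

def Hs (c : ℝ) (j n : ℕ) : Set (ℝ × ℝ × ℝ) := {p | p.1 ∈ Sn j n ∧ p.2.1 ∈ Sn j n ∧ |p.2.2| ≤ c}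
def Ns (c : ℝ) (j n : ℕ) (r r0 : ℝ) : Set (ℝ × ℝ × ℝ) := {p | p ∈ Hs c j n ∧ |p.2.1 - p.1| ≤ r0 ∧ |r - p.2.2| ≤ r0}
def Ts (j n : ℕ) (r Δ1 r1 : ℝ) : Set (ℝ × ℝ × ℝ) := {p | p ∈ Hs c j n ∧ |O.Gv p.2.1 p.2.2 - O.Gv p.1 r| ≤ Δ1 ∧
  r1 ≤ |r - p.2.2| ∧ |p.2.1 - p.1| ≤ 14 * |r - p.2.2|}

theorem Hs_meas (c : ℝ) (j n : ℕ) : MeasurableSet (Hs c j n) :=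
  (measurable_fst (Sn_meas j n)).inter (((measurable_fst.comp measurable_snd) (Sn_meas j n)).inter
    (measurableSet_le (show Measurable fun p : ℝ × ℝ × ℝ => |p.2.2| by fun_prop) measurable_const))

theorem Ns_meas (c : ℝ) (j n : ℕ) (r r0 : ℝ) : MeasurableSet (Ns c j n r r0) :=
  (Hs_meas c j n).inter ((measurableSet_le (show Measurable fun p : ℝ × ℝ × ℝ => |p.2.1 - p.1| by fun_prop) measurable_const).inter
    (measurableSet_le (show Measurable fun p : ℝ × ℝ × ℝ => |r - p.2.2| by fun_prop) measurable_const))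

theorem Ts_meas (j n : ℕ) (r Δ1 r1 : ℝ) : MeasurableSet (O.Ts j n r Δ1 r1) := by
  have cGv : Continuous fun p : ℝ × ℝ => O.Gv p.1 p.2 := O.cGv
  have c1 : Continuous fun p : ℝ × ℝ × ℝ => O.Gv p.2.1 p.2.2 := cGv.comp continuous_snd
  have c2 : Continuous fun p : ℝ × ℝ × ℝ => O.Gv p.1 r := cGv.comp (continuous_fst.prodMk continuous_const)
  have c3 : Measurable fun p : ℝ × ℝ × ℝ => |O.Gv p.2.1 p.2.2 - O.Gv p.1 r| := by fun_prop
  exact (Hs_meas c j n).inter ((measurableSet_le c3 measurable_const).inter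
    ((measurableSet_le measurable_const (show Measurable fun p : ℝ × ℝ × ℝ => |r - p.2.2| by fun_prop)).inter
      (measurableSet_le (show Measurable fun p : ℝ × ℝ × ℝ => |p.2.1 - p.1| by fun_prop)
        (show Measurable fun p : ℝ × ℝ × ℝ => 14 * |r - p.2.2| by fun_prop))))

/-- evaluation of `E` along the surface -/
def zz (x y r v : ℝ) (ω : ℝ × ℝ) : ℝ × ℝ × ℝ := (x - v + ω.1, y - O.G v r + O.G ω.1 ω.2, ω.2)

theorem zz_meas (x y r : ℝ) : Measurable (fun p : ℝ × ℝ × ℝ => O.zz x y r p.1 p.2) := by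
  have cG : Continuous fun p : ℝ × ℝ => O.G p.1 p.2 := O.cG
  have c1 : Continuous fun p : ℝ × ℝ × ℝ => O.G p.2.1 p.2.2 := cG.comp continuous_snd
  have c2 : Continuous fun p : ℝ × ℝ × ℝ => O.G p.1 r := cG.comp (continuous_fst.prodMk continuous_const)
  unfold zz; fun_prop

theorem piece1 (j n : ℕ) (S : Set (ℝ × ℝ × ℝ)) (hS : MeasurableSet S) (hSH : S ⊆ Hs c j n) (F : ℝ × ℝ × ℝ → ℝ≥0∞) (M : ℝ≥0∞)
    (h : ∀ v ∈ Sn j n, ∫⁻ ω in {ω : ℝ × ℝ | (v, ω) ∈ S}, F (v, ω) ≤ M) :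
    ∫⁻ v, ∫⁻ ω : ℝ × ℝ, S.indicator F (v, ω) ≤ ofReal 3 * M := by
  have h1 : ∀ v, ∫⁻ ω : ℝ × ℝ, S.indicator F (v, ω) ≤ (Sn j n).indicator (fun _ => M) v := by
    intro v
    by_cases hv : v ∈ Sn j n
    · rw [indicator_of_mem hv]
      refine le_trans (le_of_eq ?_) (h v hv)
      have hm : MeasurableSet {ω : ℝ × ℝ | (v, ω) ∈ S} := measurable_prodMk_left hS
      rw [← lintegral_indicator hm]
      rfl
    · rw [indicator_of_notMem hv]
      have : ∀ ω : ℝ × ℝ, S.indicator F (v, ω) = 0 := fun ω => indicator_of_notMem (fun hc => hv (hSH hc).1) _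
      simp [this]
  refine (lintegral_mono h1).trans ?_
  rw [lintegral_indicator_const (Sn_meas j n), Sn_vol, mul_comm]
  refine mul_le_mul_left (ofReal_le_ofReal ?_) _
  exact div_le_self (by norm_num) (one_le_pow₀ (by norm_num))

theorem near_piece {L η : ℝ} (hL : 1 ≤ L) (hη : 0 < η) (hη1 : η < 1) {j n n' : ℕ} (hn : adm j n) (hn' : adm j n') (hf : far n n')
    {x y r r0 : ℝ} (hr : |r| ≤ c) (hr00 : 0 ≤ r0) (hr0 : 4 * B * r0 ≤ 1 / 4^j / 1798)
    (f : ℝ × ℝ → ℝ) (hfm : Measurable f) (hF : ∀ t, |f t| ≤ 1) :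
    ∫⁻ v, ∫⁻ ω : ℝ × ℝ, (Ns c j n r r0).indicator (fun p => ofReal ((O.u L j n' f (O.zz x y r p.1 p.2))^2)) (v, ω) ≤
      ofReal 3 * (ofReal (24 * (52 * r0 + 1 / L)) * (ofReal (10000000000000 * 16^j * L^(η-1)) * Il η)) := by
  have hB := O.hB
  refine piece1 j n _ (Ns_meas c j n r r0) (fun p hp => hp.1) _ _ fun v hv => ?_
  have h4 : (1:ℝ) ≤ 4^j := one_le_pow₀ (by norm_num)
  have e0 : (1:ℝ) / 4^j / 1798 ≤ 1 := by
    rw [div_div, div_le_one (by positivity)]; linarith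
  have hr4 : r0 ≤ 4 := by nlinarith
  refine O.patch1 hL hη hη1 hn hn' hf _ (measurable_prodMk_left (Ns_meas c j n r r0)) hr hv
    (fun ω hω => ⟨hω.1.2.2, hω.1.2.1⟩) ?_ hr00 hr4 (fun ω hω => ⟨hω.2.1, hω.2.2⟩) f hfm hF
  intro ω hω ω' hω'
  have a1 : |ω.1 - ω'.1| ≤ 2 * r0 := by
    rw [show ω.1 - ω'.1 = (ω.1 - v) - (ω'.1 - v) by ring]
    exact (abs_sub _ _).trans (by linarith [show |ω.1 - v| ≤ r0 from hω.2.1, show |ω'.1 - v| ≤ r0 from hω'.2.1])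
  have a2 : |ω.2 - ω'.2| ≤ 2 * r0 := by
    rw [show ω.2 - ω'.2 = (r - ω'.2) - (r - ω.2) by ring]
    exact (abs_sub _ _).trans (by linarith [show |r - ω.2| ≤ r0 from hω.2.2, show |r - ω'.2| ≤ r0 from hω'.2.2])
  have a3 : B * (|ω.1 - ω'.1| + |ω.2 - ω'.2|) ≤ B * (4 * r0) := mul_le_mul_of_nonneg_left (by linarith) (by linarith)
  linarith

theorem Sn_abs {j n : ℕ} (hn : adm j n) {v : ℝ} (hv : v ∈ Sn j n) : |v| ≤ 2 := by
  have := Sn_sub hn hv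
  exact abs_le.2 ⟨by linarith [this.1], this.2⟩

theorem half_piece {L η : ℝ} (hL : 1 ≤ L) (hη : 0 < η) (hη1 : η < 1) {j n n' : ℕ} (hn : adm j n) (hn' : adm j n') (hf : far n n')
    {x y r : ℝ} (hr : |r| ≤ c) (f : ℝ × ℝ → ℝ) (hfm : Measurable f) (hF : ∀ t, |f t| ≤ 1) :
    ∫⁻ v, ∫⁻ ω : ℝ × ℝ, (Hs c j n).indicator (fun p => ofReal ((O.u L j n' f (O.zz x y r p.1 p.2))^2)) (v, ω) ≤
      ofReal 3 * (ofReal (169 / (1 / (4^j * 1798 * B))^2) *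
        (ofReal 2520 * (ofReal (10000000000000 * 16^j * L^(η-1)) * Il η))) := by
  have hB := O.hB
  have hc1 := O.hc1
  have h4 : (1:ℝ) ≤ 4^j := one_le_pow₀ (by norm_num)
  have hL0 : 0 < L := by linarith
  have hL1 : 1 / L ≤ 1 := by rw [div_le_one hL0]; exact hL
  refine piece1 j n _ (Hs_meas c j n) le_rfl _ _ fun v hv => ?_
  refine grid _ (measurable_prodMk_left (Hs_meas c j n)) (fun ω hω => ⟨Sn_abs hn hω.2.1, hω.2.2.trans (by linarith)⟩) _ ?_ _ (by positivity) ?_ _ ?_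
  · exact (((O.u_meas L j n' f hfm).comp ((O.zz_meas x y r).comp measurable_prodMk_left)).pow_const 2).ennreal_ofReal
  · rw [div_le_one (by positivity)]; nlinarith
  · intro Q hQ hQP hQ2
    refine (O.patch1 hL hη hη1 hn hn' hf Q hQ hr hv (fun ω hω => ⟨(hQP hω).2.2, (hQP hω).2.1⟩) ?_ (ρ := 2) (by norm_num) (by norm_num) ?_ f hfm hF).trans ?_
    · intro ω hω ω' hω'
      have := mul_le_mul_of_nonneg_left (hQ2 ω hω ω' hω') (by linarith : 0 ≤ B)
      refine this.trans (le_of_eq ?_)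
      field_simp
    · intro ω hω
      have s1 := Sn_sub hn (hQP hω).2.1
      have s2 := Sn_sub hn hv
      have s3 := (hQP hω).2.2
      simp only at s1 s3
      refine ⟨abs_le.2 ⟨by linarith [s1.1, s2.2], by linarith [s1.2, s2.1]⟩, (abs_sub _ _).trans (by linarith)⟩
    · exact mul_le_mul_left (ofReal_le_ofReal (by linarith)) _

set_option maxHeartbeats 1000000 in
theorem tan_piece {L η : ℝ} (hL : 1 ≤ L) (hη : 0 < η) (hη1 : η < 1) {j n n' : ℕ} (hn : adm j n) (hn' : adm j n') (hf : far n n')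
    {x y r Δ1 r1 : ℝ} (hr : |r| ≤ c) (hr10 : 0 < r1) (hr1 : r1 ≤ 1) (hΔ0 : 0 ≤ Δ1) (he2 : 300 * Δ1 ≤ 1 / 4^j / 1798 * r1)
    (f : ℝ × ℝ → ℝ) (hfm : Measurable f) (hF : ∀ t, |f t| ≤ 1) :
    ∫⁻ v, ∫⁻ ω : ℝ × ℝ, (O.Ts j n r Δ1 r1).indicator (fun p => ofReal ((O.u L j n' f (O.zz x y r p.1 p.2))^2)) (v, ω) ≤
      ofReal (2 * Δ1) * (ofReal (169 / (r1 / (4^j * 1798 * 4000 * B))^2) *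
        (ofReal 2520 * (ofReal (100000000000000 * 16^j * L^(η-1) / r1) * Il η))) := by
  have hB := O.hB
  have hc1 := O.hc1
  have h4 : (1:ℝ) ≤ 4^j := one_le_pow₀ (by norm_num)
  obtain ⟨V, hVm, hV, hVi, hVl⟩ := O.inv_ex hr
  set M := (ofReal (169 / (r1 / (4^j * 1798 * 4000 * B))^2) *
        (ofReal 2520 * (ofReal (100000000000000 * 16^j * L^(η-1) / r1) * Il η))) with hM
  set F : ℝ × ℝ × ℝ → ℝ≥0∞ := fun p => ofReal ((O.u L j n' f (O.zz x y r p.1 p.2))^2) with hFd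
  have hFm : Measurable F := (((O.u_meas L j n' f hfm).comp (O.zz_meas x y r)).pow_const 2).ennreal_ofReal
  set S := O.Ts j n r Δ1 r1 with hS
  have hSm : MeasurableSet S := O.Ts_meas j n r Δ1 r1
  have hIm : Measurable (S.indicator F) := hFm.indicator hSm
  have hGm : Measurable fun ω : ℝ × ℝ => O.Gv ω.1 ω.2 := O.cGv.measurable
  have hρ0 : 0 < r1 / (4^j * 1798 * 4000 * B) := by positivity
  have key : ∀ η0, ∫⁻ ω : ℝ × ℝ, S.indicator F (V (O.Gv ω.1 ω.2 - η0), ω) ≤ (Icc (-Δ1) Δ1).indicator (fun _ => M) η0 := by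
    intro η0
    by_cases h0 : η0 ∈ Icc (-Δ1) Δ1
    · rw [indicator_of_mem h0]
      have hmap : Measurable fun ω : ℝ × ℝ => (V (O.Gv ω.1 ω.2 - η0), ω) := (hVm.comp (hGm.sub_const η0)).prodMk measurable_id
      set P : Set (ℝ × ℝ) := (fun ω : ℝ × ℝ => (V (O.Gv ω.1 ω.2 - η0), ω)) ⁻¹' S with hP
      have hPm : MeasurableSet P := hmap hSm
      have e1 : ∫⁻ ω : ℝ × ℝ, S.indicator F (V (O.Gv ω.1 ω.2 - η0), ω) = ∫⁻ ω in P, F (V (O.Gv ω.1 ω.2 - η0), ω) := by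
        rw [← lintegral_indicator hPm]; rfl
      rw [e1]
      refine grid P hPm (fun ω hω => ⟨Sn_abs hn hω.1.2.1, hω.1.2.2.trans (by linarith)⟩) _ (hFm.comp hmap) _ hρ0 ?_ _ ?_
      · rw [div_le_one (by positivity)]; nlinarith
      · intro Q hQ hQP hQ2
        refine O.patch2 hL hη hη1 hn hn' hf Q hQ hr V hVm hV (abs_le.2 h0) ?_ hQ2 hr10 hr1 hρ0.le (le_of_eq ?_) he2 f hfm hF
        · intro ω hω
          have := hQP hω
          exact ⟨this.1.2.2, this.1.2.1, this.1.1, this.2.2.1, this.2.2.2⟩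
        · field_simp
    · rw [indicator_of_notMem h0]
      have : ∀ ω : ℝ × ℝ, S.indicator F (V (O.Gv ω.1 ω.2 - η0), ω) = 0 := by
        intro ω
        refine indicator_of_notMem (fun hc => h0 ?_) _
        have := hc.2.1
        simp only [hV] at this
        rw [show O.Gv ω.1 ω.2 - (O.Gv ω.1 ω.2 - η0) = η0 by ring] at this
        exact abs_le.1 this
      simp [this]
  calc ∫⁻ v, ∫⁻ ω : ℝ × ℝ, S.indicator F (v, ω) = ∫⁻ ω : ℝ × ℝ, ∫⁻ v, S.indicator F (v, ω) :=
        lintegral_lintegral_swap hIm.aemeasurable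
    _ ≤ ∫⁻ ω : ℝ × ℝ, ∫⁻ s, S.indicator F (V s, ω) := lintegral_mono fun ω => hVl fun v => S.indicator F (v, ω)
    _ = ∫⁻ ω : ℝ × ℝ, ∫⁻ η0, S.indicator F (V (O.Gv ω.1 ω.2 - η0), ω) := by
        refine lintegral_congr fun ω => ?_
        rw [lintegral_sub_left_eq_self (fun s => S.indicator F (V s, ω)) (O.Gv ω.1 ω.2)]
    _ = ∫⁻ η0, ∫⁻ ω : ℝ × ℝ, S.indicator F (V (O.Gv ω.1 ω.2 - η0), ω) := by
        refine lintegral_lintegral_swap (Measurable.aemeasurable ?_)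
        refine hIm.comp (f := fun q : (ℝ × ℝ) × ℝ => (V (O.Gv q.1.1 q.1.2 - q.2), q.1)) ?_
        exact (hVm.comp ((hGm.comp measurable_fst).sub measurable_snd)).prodMk measurable_fst
    _ ≤ ∫⁻ η0, (Icc (-Δ1) Δ1).indicator (fun _ => M) η0 := lintegral_mono key
    _ = _ := by
        rw [lintegral_indicator_const measurableSet_Icc, Real.volume_Icc, mul_comm]
        congr 2; ring

end Op
end MS
namespace MS

theorem lin3 (g1 g2 g3 : ℝ × (ℝ × ℝ) → ℝ≥0∞) (h1 : Measurable g1) (h2 : Measurable g2) (h3 : Measurable g3) (k a b : ℝ≥0∞) :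
    ∫⁻ v, ∫⁻ ω : ℝ × ℝ, k * (a * g1 (v, ω) + a * g2 (v, ω) + b * g3 (v, ω)) =
      k * (a * (∫⁻ v, ∫⁻ ω : ℝ × ℝ, g1 (v, ω)) + a * (∫⁻ v, ∫⁻ ω : ℝ × ℝ, g2 (v, ω)) + b * (∫⁻ v, ∫⁻ ω : ℝ × ℝ, g3 (v, ω))) := by
  have e : ∀ g : ℝ × (ℝ × ℝ) → ℝ≥0∞, Measurable g → ∫⁻ v, ∫⁻ ω : ℝ × ℝ, g (v, ω) = ∫⁻ p : ℝ × (ℝ × ℝ), g p := by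
    intro g hg
    exact (lintegral_prod (μ := (volume : Measure ℝ)) (ν := (volume : Measure (ℝ × ℝ))) g hg.aemeasurable).symm
  rw [e g1 h1, e g2 h2, e g3 h3, e (fun p => k * (a * g1 p + a * g2 p + b * g3 p)) (by fun_prop),
    lintegral_const_mul _ (by fun_prop), lintegral_add_left (by fun_prop), lintegral_add_left (by fun_prop),
    lintegral_const_mul _ h1, lintegral_const_mul _ h2, lintegral_const_mul _ h3]

theorem comb {k m l l' a1 a2 a3 b1 b2 b3 b4 c1 c2 c3 c4 : ℝ} (hk : 0 ≤ k) (hm : 0 ≤ m) (hl : 0 ≤ l) (hl' : 0 ≤ l')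
    (ha1 : 0 ≤ a1) (ha2 : 0 ≤ a2) (ha3 : 0 ≤ a3) (hb1 : 0 ≤ b1) (hb2 : 0 ≤ b2) (hb3 : 0 ≤ b3) (hb4 : 0 ≤ b4)
    (hc1 : 0 ≤ c1) (hc2 : 0 ≤ c2) (hc3 : 0 ≤ c3) (hc4 : 0 ≤ c4) (T : ℝ≥0∞) :
    ofReal k * (ofReal m * (ofReal l * (ofReal a1 * (ofReal a2 * (ofReal a3 * T))) +
      ofReal l * (ofReal b1 * (ofReal b2 * (ofReal b3 * (ofReal b4 * T)))) +
      ofReal l' * (ofReal c1 * (ofReal c2 * (ofReal c3 * (ofReal c4 * T)))))) =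
    ofReal (k * (m * (l * (a1 * (a2 * a3)) + l * (b1 * (b2 * (b3 * b4))) + l' * (c1 * (c2 * (c3 * c4)))))) * T := by
  rw [ofReal_mul hk, ofReal_mul hm, ENNReal.ofReal_add (by positivity) (by positivity),
    ENNReal.ofReal_add (by positivity) (by positivity), ofReal_mul hl, ofReal_mul ha1, ofReal_mul ha2,
    ofReal_mul hl, ofReal_mul hb1, ofReal_mul hb2, ofReal_mul hb3,
    ofReal_mul hl', ofReal_mul hc1, ofReal_mul hc2, ofReal_mul hc3]
  ring

theorem wt_split {L a k h1 h2 : ℝ} (hL : 1 ≤ L) (ha : 0 < a) (haL : L * a^16 = 1) (hk : 1 ≤ k) (b1 : |h1| ≤ 32) (b2 : |h2| ≤ 27) :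
    2 * 676 * wt L (a^8) k h1 h2 ≤ 81120 * k * L ∧ (a^4 ≤ |h1| → 2 * 676 * wt L (a^8) k h1 h2 ≤ 81120 * k * (L * a^8)) := by
  have hL0 : 0 < L := by linarith
  have e : (a^8)^2 = 1 / L := by field_simp; linarith [show (a^8)^2 * L = L * a^16 by ring]
  have hk0 : 0 < k := by linarith
  have num : 1 + (k * |h1| + |h2|) ≤ 60 * k := by nlinarith
  have hd : 0 < 1 / L + h1^2 := by positivity
  have hw : wt L (a^8) k h1 h2 = (1 + (k * |h1| + |h2|)) / (1 / L + h1^2) := by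
    unfold wt; rw [e]; field_simp
  rw [hw]
  constructor
  · have : (1 + (k * |h1| + |h2|)) / (1 / L + h1^2) ≤ 60 * k * L := by
      rw [div_le_iff₀ hd]
      have : 60 * k * L * (1 / L + h1^2) = 60 * k + 60 * k * L * h1^2 := by field_simp
      rw [this]
      have : 0 ≤ 60 * k * L * h1^2 := by positivity
      linarith
    linarith
  · intro h
    have h8 : a^8 ≤ h1^2 := by
      rw [← sq_abs h1]; calc a^8 = (a^4)^2 := by ring
        _ ≤ _ := pow_le_pow_left₀ (by positivity) h 2
    have : (1 + (k * |h1| + |h2|)) / (1 / L + h1^2) ≤ 60 * k * (L * a^8) := by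
      rw [div_le_iff₀ hd]
      have h9 : 1 ≤ (L * a^8) * h1^2 := by
        calc (1:ℝ) = L * a^8 * a^8 := by linarith [show L * a^8 * a^8 = L * a^16 by ring]
          _ ≤ _ := mul_le_mul_of_nonneg_left h8 (by positivity)
      have h10 : 0 ≤ 60 * k * (L * a^8) * (1 / L) := by positivity
      have h11 : 60 * k * 1 ≤ 60 * k * ((L * a^8) * h1^2) := mul_le_mul_of_nonneg_left h9 (by positivity)
      linarith [show 60 * k * (L * a^8) * (1 / L + h1^2) = 60 * k * (L * a^8) * (1 / L) + 60 * k * ((L * a^8) * h1^2) by ring]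
    linarith

namespace Op
variable {c B : ℝ} (O : Op c B)

theorem Ns_sub {j n : ℕ} {r r0 : ℝ} {p : ℝ × ℝ × ℝ} (h : p ∈ Ns c j n r r0) : p ∈ Hs c j n := h.1

/-- the majorant of the weight -/
noncomputable def Ph (L a : ℝ) (j n : ℕ) (r r0 : ℝ) (p : ℝ × ℝ × ℝ) : ℝ≥0∞ :=
  ofReal (81120 * 2^j) * (ofReal L * (Ns c j n r r0).indicator (fun _ => 1) p +
    ofReal L * (O.Ts j n r (a^4) (r0/20)).indicator (fun _ => 1) p +
    ofReal (L * a^8) * (Hs c j n).indicator (fun _ => 1) p)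

theorem Ph_meas (L a : ℝ) (j n : ℕ) (r r0 : ℝ) : Measurable (O.Ph L a j n r r0) := by
  have h1 := (show Measurable fun _ : ℝ × ℝ × ℝ => (1:ℝ≥0∞) from measurable_const).indicator (Ns_meas c j n r r0)
  have h2 := (show Measurable fun _ : ℝ × ℝ × ℝ => (1:ℝ≥0∞) from measurable_const).indicator (O.Ts_meas j n r (a^4) (r0/20))
  have h3 := (show Measurable fun _ : ℝ × ℝ × ℝ => (1:ℝ≥0∞) from measurable_const).indicator (Hs_meas c j n)
  unfold Ph
  fun_prop

theorem Ph_bound {L a : ℝ} (hL : 1 ≤ L) (ha : 0 < a) (haL : L * a^16 = 1) {j n : ℕ} (hn : adm j n)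
    {z z' : ℝ × ℝ × ℝ} (hz : |z.2.2| ≤ c) (hz' : |z'.2.2| ≤ c) {r0 : ℝ} (hr0 : 0 ≤ r0) (hΔ : a^4 ≤ r0/20) {v : ℝ}
    (hv : v ∈ V j n n z z') :
    ofReal (2 * 676 * wt L (a^8) (2^j) (O.h1 z z' v) (O.h2 z z' v)) ≤
      O.Ph L a j n z.2.2 r0 (v, v - (z.1 - z'.1), z'.2.2) := by
  have hc1 := O.hc1
  have hv1 := Sn_sub hn hv.1
  have hv2 := Sn_sub hn hv.2
  have hL0 : 0 < L := by linarith
  have h2j : (1:ℝ) ≤ 2^j := one_le_pow₀ (by norm_num)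
  have hX : |z.1 - z'.1| ≤ 3/2 := abs_le.2 ⟨by linarith [hv1.1, hv1.2, hv2.1, hv2.2], by linarith [hv1.1, hv1.2, hv2.1, hv2.2]⟩
  have hσ : |z.2.2 - z'.2.2| ≤ 2 := (abs_sub _ _).trans (by linarith)
  obtain ⟨u1, u2⟩ := O.h1_up hz hz' hv1
  have u3 := O.h2_up hz hz' hv1
  obtain ⟨w1, w2⟩ := wt_split (h1 := O.h1 z z' v) (h2 := O.h2 z z' v) hL ha haL h2j (by linarith) (by linarith)
  have hH : (v, v - (z.1 - z'.1), z'.2.2) ∈ Hs c j n := ⟨hv.1, hv.2, hz'⟩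
  have k0 : (0:ℝ) ≤ 81120 * 2^j := by positivity
  by_cases hh : a^4 ≤ |O.h1 z z' v|
  · refine (ofReal_le_ofReal (w2 hh)).trans ?_
    rw [ofReal_mul k0]
    unfold Ph
    refine mul_le_mul_right ?_ _
    rw [indicator_of_mem hH, mul_one]
    exact le_add_self
  · refine (ofReal_le_ofReal w1).trans ?_
    rw [ofReal_mul k0]
    unfold Ph
    refine mul_le_mul_right ?_ _
    push Not at hh
    by_cases hN : (v, v - (z.1 - z'.1), z'.2.2) ∈ Ns c j n z.2.2 r0
    · rw [indicator_of_mem hN, mul_one, add_assoc]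
      exact le_self_add
    · have hs : r0 / 20 ≤ |z.2.2 - z'.2.2| := by
        by_contra hc
        push Not at hc
        apply hN
        refine ⟨hH, ?_, by simp only; linarith⟩
        simp only
        rw [show v - (z.1 - z'.1) - v = -(z.1 - z'.1) by ring, abs_neg]
        linarith
      have hT : (v, v - (z.1 - z'.1), z'.2.2) ∈ O.Ts j n z.2.2 (a^4) (r0/20) := by
        refine ⟨hH, ?_, hs, ?_⟩
        · simp only
          rw [show O.Gv (v - (z.1 - z'.1)) z'.2.2 - O.Gv v z.2.2 = O.h1 z z' v by unfold Op.h1; ring]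
          exact hh.le
        · simp only
          rw [show v - (z.1 - z'.1) - v = -(z.1 - z'.1) by ring, abs_neg]
          linarith
      rw [indicator_of_mem hT, mul_one, add_right_comm]
      exact le_add_self

theorem A_W {L η a : ℝ} (hL : 1 ≤ L) (hη : 0 < η) (hη1 : η < 1) (ha : 0 < a) (haL : L * a^16 = 1) {j n n' : ℕ}
    (hn : adm j n) (hn' : adm j n') (hf : far n n')
    (ha3 : 300 * 1798 * 20 * 7192 * B * 16^j * a^3 ≤ 1) (f : ℝ × ℝ → ℝ) (hfm : Measurable f) (hF : ∀ t, |f t| ≤ 1)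
    {z : ℝ × ℝ × ℝ} (hz : z ∈ Sl c) :
    ∫⁻ z' in Sl c, ofReal ((O.u L j n' f z')^2 * |∫ t, O.K L j n z t * O.K L j n z' t|) ≤
      ofReal (10^100 * B^5 * 4^(8*j) * a * L^(η-1)) * Il η := by
  have hB := O.hB
  have hB0 : 0 < B := by linarith
  have hL0 : 0 < L := by linarith
  have h4 : (1:ℝ) ≤ 4^j := one_le_pow₀ (by norm_num)
  have h16 : (16:ℝ)^j = 4^j * 4^j := by rw [← mul_pow]; norm_num
  have h2j : (1:ℝ) ≤ 2^j := one_le_pow₀ (by norm_num)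
  have h24 : (2:ℝ)^j ≤ 4^j := pow_le_pow_left₀ (by norm_num) (by norm_num) j
  have ha1 : a ≤ 1 := by
    by_contra hc
    push Not at hc
    have : 1 < a^16 := one_lt_pow₀ hc (by norm_num)
    nlinarith
  set r0 := a / (7192 * B * 4^j) with hr0
  have hr00 : 0 < r0 := by positivity
  have hr0a : r0 ≤ a := by rw [hr0, div_le_iff₀ (by positivity)]; nlinarith [mul_le_mul hB h4 (by norm_num) hB0.le]
  have hr04 : 4 * B * r0 ≤ 1 / 4^j / 1798 := by
    have : 4 * B * r0 = a / 4^j / 1798 := by rw [hr0]; field_simp; norm_num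
    rw [this]; gcongr
  have he2 : 300 * a^4 ≤ 1 / 4^j / 1798 * (r0/20) := by
    have e : 1 / 4^j / 1798 * (r0/20) = a / (1798 * 20 * 7192 * B * (4^j * 4^j)) := by rw [hr0]; field_simp
    rw [e, ← h16, le_div_iff₀ (by positivity)]
    calc _ = (300 * 1798 * 20 * 7192 * B * 16^j * a^3) * a := by ring
      _ ≤ 1 * a := by gcongr
      _ = a := one_mul a
  have hΔ : a^4 ≤ r0/20 := by
    have : 1 / 4^j / 1798 * (r0/20) ≤ r0/20 := by
      have : (1:ℝ) / 4^j / 1798 ≤ 1 := by rw [div_div, div_le_one (by positivity)]; linarith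
      nlinarith
    have : 0 < a^4 := by positivity
    linarith
  set E : ℝ × ℝ × ℝ → ℝ≥0∞ := fun z' => ofReal ((O.u L j n' f z')^2) with hE
  have hEm : Measurable E := ((O.u_meas L j n' f hfm).pow_const 2).ennreal_ofReal
  obtain ⟨x, y, r⟩ := z
  have hr : |r| ≤ c := hz
  have step1 : ∫⁻ z' in Sl c, ofReal ((O.u L j n' f z')^2 * |∫ t, O.K L j n (x, y, r) t * O.K L j n z' t|) ≤
      ∫⁻ z', E z' * ∫⁻ v, ({v | |L * O.h (x, y, r) z' v| ≤ 2} : Set ℝ).indicator (fun v => O.Ph L a j n r r0 (v, v - (x - z'.1), z'.2.2)) v := by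
    refine (setLIntegral_mono' (Sl_meas c) fun z' hz' => ?_).trans (setLIntegral_le_lintegral _ _)
    rw [ofReal_mul (sq_nonneg _)]
    refine mul_le_mul_right ?_ _
    refine (O.kap_ibp hL (by positivity : 0 < a^8) hn hn (z := (x, y, r)) hr hz').trans (lintegral_mono fun v => ?_)
    by_cases hv : v ∈ {v | v ∈ V j n n (x, y, r) z' ∧ |L * O.h (x, y, r) z' v| ≤ 2}
    · rw [indicator_of_mem hv, indicator_of_mem (by exact hv.2)]
      exact O.Ph_bound hL ha haL hn (z := (x, y, r)) hr hz' hr00.le hΔ hv.1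
    · rw [indicator_of_notMem hv]; exact zero_le
  refine step1.trans ?_
  set T : ℝ≥0∞ := Il η with hT
  have cL : (0:ℝ) ≤ L^(η-1) := by positivity
  refine (O.Wcoord hL0 x y r E hEm _ (O.Ph_meas L a j n r r0)
    (ofReal (81120 * 2^j) * (ofReal L * (ofReal 3 * (ofReal (24 * (52 * r0 + 1 / L)) * (ofReal (10000000000000 * 16^j * L^(η-1)) * Il η)))
     + ofReal L * (ofReal (2 * a^4) * (ofReal (169 / ((r0/20) / (4^j * 1798 * 4000 * B))^2) *
        (ofReal 2520 * (ofReal (100000000000000 * 16^j * L^(η-1) / (r0/20)) * Il η))))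
     + ofReal (L * a^8) * (ofReal 3 * (ofReal (169 / (1 / (4^j * 1798 * B))^2) *
        (ofReal 2520 * (ofReal (10000000000000 * 16^j * L^(η-1)) * Il η)))))) ?_).trans ?_
  · intro y
    set F : ℝ × ℝ × ℝ → ℝ≥0∞ := fun p => ofReal ((O.u L j n' f (O.zz x y r p.1 p.2))^2) with hFd
    have hFm : Measurable F := (((O.u_meas L j n' f hfm).comp (O.zz_meas x y r)).pow_const 2).ennreal_ofReal
    have e1 : ∀ v (ω : ℝ × ℝ), O.Ph L a j n r r0 (v, ω.1, ω.2) * E (x - v + ω.1, y - O.G v r + O.G ω.1 ω.2, ω.2) =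
        ofReal (81120 * 2^j) * (ofReal L * (Ns c j n r r0).indicator F (v, ω) +
          ofReal L * (O.Ts j n r (a^4) (r0/20)).indicator F (v, ω) +
          ofReal (L * a^8) * (Hs c j n).indicator F (v, ω)) := by
      intro v ω
      have i1 : ∀ S : Set (ℝ × ℝ × ℝ), S.indicator F (v, ω) = S.indicator (fun _ => 1) (v, ω) * F (v, ω) := by
        intro S
        by_cases h : (v, ω) ∈ S
        · rw [indicator_of_mem h, indicator_of_mem h, one_mul]
        · rw [indicator_of_notMem h, indicator_of_notMem h, zero_mul]
      rw [i1, i1, i1]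
      unfold Ph
      show _ * F (v, ω) = _
      ring
    simp_rw [e1]
    rw [lin3 _ _ _ (hFm.indicator (Ns_meas c j n r r0)) (hFm.indicator (O.Ts_meas j n r _ _)) (hFm.indicator (Hs_meas c j n))]
    have n1 := O.near_piece hL hη hη1 hn hn' hf (x := x) (y := y) hr hr00.le hr04 f hfm hF
    have n2 := O.half_piece hL hη hη1 hn hn' hf (x := x) (y := y) hr f hfm hF
    have n3 := O.tan_piece hL hη hη1 hn hn' hf (x := x) (y := y) hr (by positivity : 0 < r0/20) (by linarith) (by positivity) he2 f hfm hF
    gcongr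
  · have e2 : ofReal (4 / L) * (ofReal (81120 * 2^j) * (ofReal L * (ofReal 3 * (ofReal (24 * (52 * r0 + 1 / L)) * (ofReal (10000000000000 * 16^j * L^(η-1)) * Il η)))
     + ofReal L * (ofReal (2 * a^4) * (ofReal (169 / ((r0/20) / (4^j * 1798 * 4000 * B))^2) *
        (ofReal 2520 * (ofReal (100000000000000 * 16^j * L^(η-1) / (r0/20)) * Il η))))
     + ofReal (L * a^8) * (ofReal 3 * (ofReal (169 / (1 / (4^j * 1798 * B))^2) *
        (ofReal 2520 * (ofReal (10000000000000 * 16^j * L^(η-1)) * Il η)))))) =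
      ofReal ((4 / L) * ((81120 * 2^j) * (L * (3 * ((24 * (52 * r0 + 1 / L)) * (10000000000000 * 16^j * L^(η-1))))
     + L * ((2 * a^4) * ((169 / ((r0/20) / (4^j * 1798 * 4000 * B))^2) * (2520 * (100000000000000 * 16^j * L^(η-1) / (r0/20)))))
     + (L * a^8) * (3 * ((169 / (1 / (4^j * 1798 * B))^2) * (2520 * (10000000000000 * 16^j * L^(η-1)))))))) * Il η := by
      refine comb ?_ ?_ ?_ ?_ ?_ ?_ ?_ ?_ ?_ ?_ ?_ ?_ ?_ ?_ ?_ _ <;> positivity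
    rw [e2]
    refine mul_le_mul_left (ofReal_le_ofReal ?_) _
    have p1 : 52 * r0 + 1 / L ≤ 53 * a := by
      have : 1 / L = a^16 := by field_simp; linarith
      rw [this]
      have : a^16 ≤ a := pow_le_of_le_one ha.le ha1 (by norm_num)
      linarith
    have p2 : a^8 ≤ a := pow_le_of_le_one ha.le ha1 (by norm_num)
    set P := (4:ℝ)^j with hP
    set T := L^(η-1) with hTT
    have hP0 : 0 < P := by linarith
    have q1 : 3 * ((24 * (52 * r0 + 1 / L)) * (10000000000000 * 16^j * T)) ≤ 10^20 * (a * P^2 * T) := by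
      rw [h16]
      calc _ ≤ 3 * ((24 * (53 * a)) * (10000000000000 * (P * P) * T)) := by gcongr
        _ = 38160000000000000 * (a * P^2 * T) := by ring
        _ ≤ _ := by gcongr; norm_num
    have q2 : (2 * a^4) * ((169 / ((r0/20) / (P * 1798 * 4000 * B))^2) * (2520 * (100000000000000 * 16^j * T / (r0/20)))) ≤ 10^70 * (B^5 * P^7 * a * T) := by
      have : (2 * a^4) * ((169 / ((r0/20) / (P * 1798 * 4000 * B))^2) * (2520 * (100000000000000 * 16^j * T / (r0/20)))) =
        (2 * 169 * (1798*4000)^2 * 2520 * 100000000000000 * (20 * 7192)^3) * (B^5 * P^7 * a * T) := by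
        rw [h16, hr0]; field_simp
      rw [this]
      gcongr
      norm_num
    have q3 : a^8 * (3 * ((169 / (1 / (P * 1798 * B))^2) * (2520 * (10000000000000 * 16^j * T)))) ≤ 10^40 * (B^2 * P^4 * a * T) := by
      have : a^8 * (3 * ((169 / (1 / (P * 1798 * B))^2) * (2520 * (10000000000000 * 16^j * T)))) =
        (3 * 169 * 1798^2 * 2520 * 10000000000000) * (B^2 * P^4 * a^8 * T) := by
        rw [h16]; field_simp
      rw [this]
      gcongr
      norm_num
    have B1 : 1 ≤ B := by linarith
    have q1' : a * P^2 * T ≤ B^5 * P^7 * a * T := by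
      have : 1 * P^2 ≤ B^5 * P^7 := mul_le_mul (one_le_pow₀ B1) (pow_le_pow_right₀ h4 (by norm_num)) (by positivity) (by positivity)
      calc a * P^2 * T = (1 * P^2) * (a * T) := by ring
        _ ≤ (B^5 * P^7) * (a * T) := by gcongr
        _ = _ := by ring
    have q3' : B^2 * P^4 * a * T ≤ B^5 * P^7 * a * T := by
      gcongr <;> first | exact B1 | exact h4 | norm_num
    have q0 : 0 ≤ B^5 * P^7 * a * T := by positivity
    calc _ = 4 * (81120 * 2^j) * (3 * ((24 * (52 * r0 + 1 / L)) * (10000000000000 * 16^j * T)) + (2 * a^4) * ((169 / ((r0/20) / (P * 1798 * 4000 * B))^2) * (2520 * (100000000000000 * 16^j * T / (r0/20))))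
          + a^8 * (3 * ((169 / (1 / (P * 1798 * B))^2) * (2520 * (10000000000000 * 16^j * T))))) := by
            generalize 3 * ((24 * (52 * r0 + 1 / L)) * (10000000000000 * 16^j * T)) = X1
            generalize (2 * a^4) * ((169 / ((r0/20) / (P * 1798 * 4000 * B))^2) * (2520 * (100000000000000 * 16^j * T / (r0/20)))) = X2
            generalize (3 * ((169 / (1 / (P * 1798 * B))^2) * (2520 * (10000000000000 * 16^j * T)))) = X3
            field_simp
      _ ≤ 4 * (81120 * P) * (10^20 * (B^5 * P^7 * a * T) + 10^70 * (B^5 * P^7 * a * T) + 10^40 * (B^5 * P^7 * a * T)) := by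
          have k1 : 3 * ((24 * (52 * r0 + 1 / L)) * (10000000000000 * 16^j * T)) ≤ 10^20 * (B^5 * P^7 * a * T) := q1.trans (by gcongr)
          have k3 : a^8 * (3 * ((169 / (1 / (P * 1798 * B))^2) * (2520 * (10000000000000 * 16^j * T)))) ≤ 10^40 * (B^5 * P^7 * a * T) := q3.trans (by gcongr)
          refine mul_le_mul (by linarith) (add_le_add (add_le_add k1 q2) k3) (by positivity) (by positivity)
      _ = (4 * 81120 * (10^20 + 10^70 + 10^40)) * (B^5 * P^8 * a * T) := by ring
      _ ≤ 10^100 * (B^5 * P^8 * a * T) := by gcongr; norm_num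
      _ = _ := by rw [hP, ← pow_mul, mul_comm j 8]; ring

theorem u_bd {L : ℝ} (hL : 1 ≤ L) {j n : ℕ} (hn : adm j n) {z : ℝ × ℝ × ℝ} (hz : z ∈ Sl c) (f : ℝ × ℝ → ℝ) (hF : ∀ t, |f t| ≤ 1) :
    |O.u L j n f z| ≤ 78 / 2^j := by
  have := tt_u_bound (Ω := Unit) volume (fun _ => O.K L j n z) (78/2^j) (by positivity) (fun _ => O.K_lint hL hn hz) f 1 zero_le_one hF ()
  rwa [mul_one] at this

theorem A_far : ∃ C : ℝ, 0 < C ∧ ∀ (L η : ℝ), 1 ≤ L → 0 < η → η < 1 → ∀ (j n n' : ℕ), adm j n → adm j n' → far n n' →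
    ∀ (f : ℝ × ℝ → ℝ), Measurable f → (∀ t, |f t| ≤ 1) →
    ∫⁻ z in Sl c, ofReal ((O.u L j n f z * O.u L j n' f z)^2) ≤
      (∫⁻ t, ofReal (f t ^ 2)) * (ofReal (C * 4^(4*j) * L^(η-1-1/32)) * Il η) := by
  have hB := O.hB
  have hB0 : 0 < B := by linarith
  refine ⟨10^60 * B^3, by positivity, ?_⟩
  intro L η hL hη hη1 j n n' hn hn' hf f hfm hF
  have hL0 : 0 < L := by linarith
  set N2 := ∫⁻ t, ofReal (f t ^ 2) with hN2
  set a := L^(-(1/16:ℝ)) with ha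
  have ha0 : 0 < a := by positivity
  have haL : L * a^16 = 1 := by
    rw [ha, ← Real.rpow_natCast, ← Real.rpow_mul hL0.le]
    norm_num
    rw [Real.rpow_neg_one]; field_simp
  set b := L^(-(1/32:ℝ)) with hb
  have hb0 : 0 < b := by positivity
  have hab : a = b^2 := by
    rw [hb, ← Real.rpow_natCast, ← Real.rpow_mul hL0.le, ha]; norm_num
  have hb1 : b ≤ 1 := Real.rpow_le_one_of_one_le_of_nonpos hL (by norm_num)
  have eL : L^(η-1-1/32) = b * L^(η-1) := by
    rw [hb, ← Real.rpow_add hL0]; congr 1; ring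
  have hj2 : ∫⁻ z in Sl c, ofReal ((O.u L j n' f z)^2) ≤ N2 * (ofReal (24000000*L^(η-1)) * Il η) := by
    have := O.J2 hL hη hη1 {n'} (by simpa using hn') f hfm hF
    simpa using this
  set P := (4:ℝ)^(4*j) with hP
  have hP1 : 1 ≤ P := one_le_pow₀ (by norm_num)
  have hu : ∀ z ∈ Sl c, (O.u L j n f z)^2 ≤ 78^2 := by
    intro z hz
    have := O.u_bd hL hn hz f hF
    have h2 : (78:ℝ)/2^j ≤ 78 := div_le_self (by norm_num) (one_le_pow₀ (by norm_num))
    rw [← sq_abs]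
    exact pow_le_pow_left₀ (abs_nonneg _) (this.trans h2) 2
  by_cases hc : 300 * 1798 * 20 * 7192 * B * 16^j * a^3 ≤ 1
  · have h1 := bilin_on volume volume (Sl c) (Sl_meas c) (O.K L j n) (O.K_meas L j n) (13 * L) 78 (by positivity) (by norm_num)
      (fun z hz t => O.K_abs hL0 hn hz t)
      (fun z hz => (O.K_lint hL hn hz).trans (ofReal_le_ofReal (div_le_self (by norm_num) (one_le_pow₀ (by norm_num)))))
      f hfm hF (fun z => (O.u L j n' f z)^2) ((O.u_meas L j n' f hfm).pow_const 2) (fun z => sq_nonneg _) (78^2) ?_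
      _ (fun z hz => O.A_W hL hη hη1 ha0 haL hn hn' hf hc f hfm hF hz)
    · have e1 : ∫⁻ z in Sl c, ofReal ((O.u L j n f z * O.u L j n' f z)^2) =
          ∫⁻ z in Sl c, ofReal ((O.u L j n' f z)^2 * (∫ t, O.K L j n z t * f t)^2) := by
        refine lintegral_congr fun z => ?_
        congr 1
        show _ = _ * (O.u L j n f z)^2
        ring
      rw [e1]
      have h2 : ∀ x y : ℝ≥0∞, x^2 ≤ y^2 → x ≤ y := fun x y h => (ENNReal.pow_le_pow_left_iff (by norm_num)).1 h
      apply h2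
      refine h1.trans ?_
      calc _ ≤ N2 * (ofReal (78^2) * (N2 * (ofReal (24000000*L^(η-1)) * Il η)) * (ofReal (10^100 * B^5 * 4^(8*j) * a * L^(η-1)) * Il η)) := by
            gcongr
        _ = (N2 * Il η)^2 * ofReal (78^2 * ((24000000*L^(η-1)) * (10^100 * B^5 * 4^(8*j) * a * L^(η-1)))) := by
            rw [ofReal_mul (p := 78^2) (by positivity), ofReal_mul (p := 24000000*L^(η-1)) (by positivity)]
            ring
        _ ≤ (N2 * Il η)^2 * ofReal ((10^60 * B^3 * P * L^(η-1-1/32))^2) := by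
            gcongr
            rw [eL, hab, show (4:ℝ)^(8*j) = P^2 by rw [hP, ← pow_mul]; congr 1; ring]
            calc _ = 78^2 * 24000000 * 10^100 * (B^5 * (P * b * L^(η-1))^2) := by ring
              _ ≤ 10^120 * (B^6 * (P * b * L^(η-1))^2) := by
                  gcongr <;> first | linarith | norm_num
              _ = _ := by ring
        _ = _ := by rw [ENNReal.ofReal_pow (by positivity)]; ring
    · intro z hz
      have := O.u_bd hL hn' hz f hF
      have h2 : (78:ℝ)/2^j ≤ 78 := div_le_self (by norm_num) (one_le_pow₀ (by norm_num))
      rw [← sq_abs]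
      exact pow_le_pow_left₀ (abs_nonneg _) (this.trans h2) 2
  · push Not at hc
    calc _ ≤ ∫⁻ z in Sl c, ofReal (78^2) * ofReal ((O.u L j n' f z)^2) := by
          refine setLIntegral_mono' (Sl_meas c) fun z hz => ?_
          rw [← ofReal_mul (by norm_num)]
          refine ofReal_le_ofReal ?_
          rw [mul_pow]
          exact mul_le_mul_of_nonneg_right (hu z hz) (sq_nonneg _)
      _ = ofReal (78^2) * ∫⁻ z in Sl c, ofReal ((O.u L j n' f z)^2) :=
          lintegral_const_mul _ ((O.u_meas L j n' f hfm).pow_const 2).ennreal_ofReal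
      _ ≤ ofReal (78^2) * (N2 * (ofReal (24000000*L^(η-1)) * Il η)) := by gcongr
      _ = N2 * (ofReal (78^2 * (24000000*L^(η-1))) * Il η) := by
          rw [ofReal_mul (p := 78^2) (by positivity)]; ring
      _ ≤ _ := by
          refine mul_le_mul_right (mul_le_mul_left (ofReal_le_ofReal ?_) _) _
          rw [eL]
          have h16 : (16:ℝ)^j ≤ P := by
            rw [hP, pow_mul]; exact pow_le_pow_left₀ (by norm_num) (by norm_num) j
          have ha3 : a^3 ≤ b := by
            rw [hab, ← pow_mul]; exact pow_le_of_le_one hb0.le hb1 (by norm_num)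
          have hh : 1 ≤ 300 * 1798 * 20 * 7192 * B * P * b := by
            refine hc.le.trans ?_
            gcongr
          have B2 : B ≤ B^3 := le_self_pow₀ (by linarith) (by norm_num)
          calc 78^2 * (24000000*L^(η-1)) = 1 * (78^2 * (24000000*L^(η-1))) := by ring
            _ ≤ (300 * 1798 * 20 * 7192 * B^3 * P * b) * (78^2 * (24000000*L^(η-1))) := by
                gcongr; exact hh.trans (by gcongr)
            _ = (300 * 1798 * 20 * 7192 * 78^2 * 24000000) * (B^3 * P * b * L^(η-1)) := by ring
            _ ≤ 10^60 * (B^3 * P * b * L^(η-1)) := by gcongr; norm_num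
            _ = _ := by ring

end Op
end MS
namespace MS

theorem sum_le_k {α β : Type*} [DecidableEq β] (D : Finset α) (T : Finset β) (φ : α → β) (hφ : ∀ a ∈ D, φ a ∈ T) (g : β → ℝ≥0∞) (k : ℕ)
    (hk : ∀ b ∈ T, (D.filter (fun a => φ a = b)).card ≤ k) : ∑ a ∈ D, g (φ a) ≤ k * ∑ b ∈ T, g b := by
  rw [← Finset.sum_fiberwise_of_maps_to hφ, Finset.mul_sum]
  refine Finset.sum_le_sum fun b hb => ?_
  rw [Finset.sum_congr rfl (g := fun _ => g b) (fun a ha => by rw [(Finset.mem_filter.1 ha).2]), Finset.sum_const, nsmul_eq_mul]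
  exact mul_le_mul_left (by exact_mod_cast hk b hb) _

theorem parents {α : Type*} [DecidableEq α] (D : Finset (ℕ × α)) (K k n' : ℕ) (hK : 0 < K) (i : α → ℕ)
    (hi : ∀ p ∈ D, i p.2 < 3 * K ∧ K * p.1 + i p.2 = n') (hinj : ∀ p ∈ D, ∀ p' ∈ D, p.1 = p'.1 → p = p') : D.card ≤ 3 := by
  have : D.card ≤ (Finset.Icc (n'/K - 2) (n'/K)).card := by
    refine Finset.card_le_card_of_injOn (fun p => p.1) (fun p hp => ?_) (fun p hp p' hp' h => hinj p hp p' hp' h)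
    obtain ⟨h1, h2⟩ := hi p hp
    simp only [Finset.coe_Icc, mem_Icc]
    constructor
    · have : n'/K < p.1 + 3 := by rw [Nat.div_lt_iff_lt_mul hK, ← h2]; nlinarith
      omega
    · rw [Nat.le_div_iff_mul_le hK, ← h2]; nlinarith
  refine this.trans ?_
  rw [Nat.card_Icc]; omega

namespace Op
variable {c B : ℝ} (O : Op c B)

theorem adm_child {j n m i : ℕ} (h : adm j n) (hi : i < 3*2^m-2) : adm (j+m) (2^m*n+i) := by
  obtain ⟨h1, h2⟩ := h
  have hp : 1 ≤ 2^m := Nat.one_le_two_pow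
  have h3 := Nat.mul_le_mul_left (2^m) h1
  have h4 := Nat.mul_le_mul_left (2^m) h2
  constructor
  · rw [pow_add]; nlinarith
  · rw [pow_add]
    have : i + 3 ≤ 3 * 2^m := by omega
    nlinarith

theorem u_dec (m : ℕ) : ∃ w : ℕ → ℝ, (∀ i, |w i| ≤ 1) ∧ ∀ {L : ℝ} (_ : 1 ≤ L) {j n : ℕ} (_ : adm j n) (f : ℝ × ℝ → ℝ) (_ : Measurable f)
    (_ : ∀ t, |f t| ≤ 1) {z : ℝ × ℝ × ℝ} (_ : z ∈ Sl c),
    O.u L j n f z = ∑ i ∈ Finset.range (3*2^m-2), w i * O.u L (j+m) (2^m*n+i) f z := by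
  obtain ⟨w, hw, hb⟩ := bs_multi m
  refine ⟨w, fun i => abs_le.2 ⟨by linarith [(hw i).1], (hw i).2⟩, ?_⟩
  intro L hL j n hn f hf hF z hz
  have e : ∀ t, O.K L j n z t * f t = ∑ i ∈ Finset.range (3*2^m-2), w i * (O.K L (j+m) (2^m*n+i) z t * f t) := by
    intro t
    unfold K chi
    rw [hb]
    simp only [Finset.sum_mul, Finset.mul_sum]
    refine Finset.sum_congr rfl fun i _ => ?_
    rw [show (2:ℝ)^m * (2^j * (z.1 - t.1) - n) - i = 2^(j+m) * (z.1 - t.1) - ((2^m*n+i : ℕ):ℝ) by push_cast; ring]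
    ring
  unfold u
  simp_rw [e]
  rw [integral_finsetSum]
  · refine Finset.sum_congr rfl fun i _ => ?_
    rw [integral_const_mul]
  · intro i hi
    refine Integrable.const_mul ?_ _
    have := O.K_int hL (adm_child hn (Finset.mem_range.1 hi)) hz
    exact this.mul_bdd (c := 1) hf.aestronglyMeasurable (Filter.Eventually.of_forall hF)

/-- far pairs of children -/
def fp (m : ℕ) : Finset (ℕ × ℕ) := (Finset.range (3*2^m-2) ×ˢ Finset.range (3*2^m-2)).filter (fun p => far p.1 p.2)

theorem bnL4 (m : ℕ) {L : ℝ} (hL : 1 ≤ L) {j n : ℕ} (hn : adm j n) (f : ℝ × ℝ → ℝ) (hf : Measurable f) (hF : ∀ t, |f t| ≤ 1) :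
    ∫⁻ z in Sl c, ofReal (|O.u L j n f z|^4) ≤
      ofReal (8^4) * (∑ i ∈ Finset.range (3*2^m-2), ∫⁻ z in Sl c, ofReal (|O.u L (j+m) (2^m*n+i) f z|^4)) +
      ofReal (((3*2^m-2:ℕ):ℝ)^6) * ∑ p ∈ fp m, ∫⁻ z in Sl c, ofReal ((O.u L (j+m) (2^m*n+p.1) f z * O.u L (j+m) (2^m*n+p.2) f z)^2) := by
  obtain ⟨w, hw, hd⟩ := O.u_dec m
  have hm : ∀ i, Measurable (O.u L (j+m) i f) := fun i => O.u_meas L (j+m) i f hf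
  have hm1 : ∀ i, Measurable fun z => ofReal (|O.u L (j+m) i f z|^4) := fun i => ((hm i).abs.pow_const 4).ennreal_ofReal
  have hm2 : ∀ i i', Measurable fun z => ofReal ((O.u L (j+m) i f z * O.u L (j+m) i' f z)^2) :=
    fun i i' => (((hm i).mul (hm i')).pow_const 2).ennreal_ofReal
  rw [← lintegral_finsetSum _ (fun i _ => hm1 _), ← lintegral_finsetSum _ (fun p _ => hm2 _ _),
    ← lintegral_const_mul _ (Finset.measurable_sum _ fun i _ => hm1 _), ← lintegral_const_mul _ (Finset.measurable_sum _ fun p _ => hm2 _ _),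
    ← lintegral_add_left ((Finset.measurable_sum _ fun i _ => hm1 _).const_mul _)]
  refine setLIntegral_mono' (Sl_meas c) fun z hz => ?_
  have b := bn4 (3*2^m-2) (fun i => O.u L (j+m) (2^m*n+i) f z) w hw
  rw [← hd hL hn f hf hF hz, ← Finset.sum_product', ← Finset.sum_filter] at b
  refine (ofReal_le_ofReal b).trans (le_of_eq ?_)
  rw [ENNReal.ofReal_add (mul_nonneg (by norm_num) (Finset.sum_nonneg fun i _ => by positivity)) (mul_nonneg (by positivity) (Finset.sum_nonneg fun i _ => by positivity)), ofReal_mul (by norm_num), ofReal_mul (by positivity),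
    ENNReal.ofReal_sum_of_nonneg (fun i _ => by positivity), ENNReal.ofReal_sum_of_nonneg (fun i _ => by positivity)]
  rfl

theorem bnL5 (m : ℕ) {L : ℝ} (hL : 1 ≤ L) {j n : ℕ} (hn : adm j n) (f : ℝ × ℝ → ℝ) (hf : Measurable f) (hF : ∀ t, |f t| ≤ 1) :
    ∫⁻ z in Sl c, ofReal (|O.u L j n f z|^5) ≤
      ofReal (8^5) * (∑ i ∈ Finset.range (3*2^m-2), ∫⁻ z in Sl c, ofReal (|O.u L (j+m) (2^m*n+i) f z|^5)) +
      ofReal (((3*2^m-2:ℕ):ℝ)^7 * (78/2^(j+m))) * ∑ p ∈ fp m, ∫⁻ z in Sl c, ofReal ((O.u L (j+m) (2^m*n+p.1) f z * O.u L (j+m) (2^m*n+p.2) f z)^2) := by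
  obtain ⟨w, hw, hd⟩ := O.u_dec m
  have hm : ∀ i, Measurable (O.u L (j+m) i f) := fun i => O.u_meas L (j+m) i f hf
  have hm1 : ∀ i, Measurable fun z => ofReal (|O.u L (j+m) i f z|^5) := fun i => ((hm i).abs.pow_const 5).ennreal_ofReal
  have hm2 : ∀ i i', Measurable fun z => ofReal ((O.u L (j+m) i f z * O.u L (j+m) i' f z)^2) :=
    fun i i' => (((hm i).mul (hm i')).pow_const 2).ennreal_ofReal
  rw [← lintegral_finsetSum _ (fun i _ => hm1 _), ← lintegral_finsetSum _ (fun p _ => hm2 _ _),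
    ← lintegral_const_mul _ (Finset.measurable_sum _ fun i _ => hm1 _), ← lintegral_const_mul _ (Finset.measurable_sum _ fun p _ => hm2 _ _),
    ← lintegral_add_left ((Finset.measurable_sum _ fun i _ => hm1 _).const_mul _)]
  refine setLIntegral_mono' (Sl_meas c) fun z hz => ?_
  set U : ℕ → ℝ := fun i => if i < 3*2^m-2 then O.u L (j+m) (2^m*n+i) f z else 0 with hU
  have hUe : ∀ i ∈ Finset.range (3*2^m-2), U i = O.u L (j+m) (2^m*n+i) f z := fun i hi => if_pos (Finset.mem_range.1 hi)
  have b := bn5 (3*2^m-2) U w hw (78/2^(j+m)) (by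
    intro i
    simp only [hU]
    split_ifs with h
    · exact O.u_bd hL (adm_child hn h) hz f hF
    · simp; positivity)
  rw [← Finset.sum_product', ← Finset.sum_filter] at b
  rw [Finset.sum_congr rfl (g := fun i => w i * O.u L (j+m) (2^m*n+i) f z) (fun i hi => by rw [hUe i hi]), ← hd hL hn f hf hF hz,
    Finset.sum_congr rfl (g := fun i => |O.u L (j+m) (2^m*n+i) f z|^5) (fun i hi => by rw [hUe i hi]),
    Finset.sum_congr rfl (g := fun p : ℕ × ℕ => (O.u L (j+m) (2^m*n+p.1) f z * O.u L (j+m) (2^m*n+p.2) f z)^2) (fun p hp => by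
      have := Finset.mem_product.1 (Finset.mem_filter.1 hp).1
      rw [hUe _ this.1, hUe _ this.2])] at b
  refine (ofReal_le_ofReal b).trans (le_of_eq ?_)
  rw [ENNReal.ofReal_add (mul_nonneg (by norm_num) (Finset.sum_nonneg fun i _ => by positivity)) (mul_nonneg (by positivity) (Finset.sum_nonneg fun i _ => by positivity)), ofReal_mul (p := 8^5) (by norm_num), ofReal_mul (p := _ * _) (by positivity),
    ENNReal.ofReal_sum_of_nonneg (fun i _ => by positivity), ENNReal.ofReal_sum_of_nonneg (fun i _ => by positivity)]
  rfl

theorem adm11 : adm 1 1 := by unfold adm; norm_num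

theorem fp_card (m : ℕ) : (fp m).card ≤ (3*2^m-2)^2 := by
  refine (Finset.card_filter_le _ _).trans ?_
  rw [Finset.card_product, Finset.card_range, sq]

/-- fourth power estimate with gain -/
theorem J4 : ∃ C : ℝ, 0 < C ∧ ∀ (L : ℝ), 1 ≤ L → ∀ (f : ℝ × ℝ → ℝ), Measurable f → (∀ t, |f t| ≤ 1) →
    ∫⁻ z in Sl c, ofReal (|O.u L 1 1 f z|^4) ≤
      (∫⁻ t, ofReal (f t ^ 2)) * ofReal (C * L^(-(1001/1000):ℝ)) := by
  obtain ⟨C, hC, hA⟩ := O.A_far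
  set I0 := Il (1/1000) with hI0
  have hI : I0 ≠ ∞ := Il_ne_top (by norm_num)
  refine ⟨(10^20 + 10^20 * C) * (I0.toReal + 1), by positivity, ?_⟩
  intro L hL f hf hF
  have hL0 : 0 < L := by linarith
  set N2 := ∫⁻ t, ofReal (f t ^ 2) with hN2
  set η : ℝ := 1/1000 with hη
  obtain ⟨m, hm1, hm2⟩ := exists_nat_pow_near (Real.one_le_rpow hL (by norm_num : (0:ℝ) ≤ 1/1000)) (by norm_num : (1:ℝ) < 2)
  have hPm : (1:ℝ) ≤ 2^m := one_le_pow₀ (by norm_num)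
  set P := (2:ℝ)^m with hP
  have hN : ((3*2^m-2:ℕ):ℝ) ≤ 3 * P := by
    have : 3*2^m-2 ≤ 3 * 2^m := Nat.sub_le _ _
    calc ((3*2^m-2:ℕ):ℝ) ≤ ((3*2^m : ℕ):ℝ) := by exact_mod_cast this
      _ = 3 * P := by push_cast; rfl
  refine (O.bnL4 m hL adm11 f hf hF).trans ?_
  have n1 : ∑ i ∈ Finset.range (3*2^m-2), ∫⁻ z in Sl c, ofReal (|O.u L (1+m) (2^m*1+i) f z|^4) ≤
      ofReal ((78/2^(1+m))^2) * (N2 * (ofReal (24000000 * L^(η-1)) * Il η)) := by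
    have hinj : Function.Injective fun i : ℕ => 2^m*1+i := fun a b h => by simpa using h
    have j2 := O.J2 hL (by norm_num : (0:ℝ) < η) (by norm_num) (j := 1+m) ((Finset.range (3*2^m-2)).image (fun i => 2^m*1+i)) (by
      intro n hn
      obtain ⟨i, hi, rfl⟩ := Finset.mem_image.1 hn
      exact adm_child adm11 (Finset.mem_range.1 hi)) f hf hF
    rw [Finset.sum_image (fun a _ b _ h => hinj h)] at j2
    refine le_trans ?_ (mul_le_mul_right j2 _)
    rw [Finset.mul_sum]
    refine Finset.sum_le_sum fun i hi => ?_
    rw [← lintegral_const_mul _ ((O.u_meas L _ _ f hf).pow_const 2).ennreal_ofReal]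
    refine setLIntegral_mono' (Sl_meas c) fun z hz => ?_
    rw [← ofReal_mul (by positivity)]
    refine ofReal_le_ofReal ?_
    have := O.u_bd hL (adm_child adm11 (Finset.mem_range.1 hi)) hz f hF
    calc _ = |O.u L (1+m) (2^m*1+i) f z|^2 * (O.u L (1+m) (2^m*1+i) f z)^2 := by rw [← sq_abs (O.u L (1+m) (2^m*1+i) f z)]; ring
      _ ≤ _ := by gcongr
  have n2 : ∑ p ∈ fp m, ∫⁻ z in Sl c, ofReal ((O.u L (1+m) (2^m*1+p.1) f z * O.u L (1+m) (2^m*1+p.2) f z)^2) ≤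
      ofReal (9 * P^2) * (N2 * (ofReal (C * 4^(4*(1+m)) * L^(η-1-1/32)) * Il η)) := by
    refine (Finset.sum_le_card_nsmul _ _ (N2 * (ofReal (C * 4^(4*(1+m)) * L^(η-1-1/32)) * Il η)) (fun p hp => ?_)).trans ?_
    · obtain ⟨h1, h2⟩ := Finset.mem_filter.1 hp
      obtain ⟨h3, h4⟩ := Finset.mem_product.1 h1
      refine hA L η hL (by norm_num) (by norm_num) _ _ _ (adm_child adm11 (Finset.mem_range.1 h3)) (adm_child adm11 (Finset.mem_range.1 h4)) ?_ f hf hF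
      unfold far at h2 ⊢; omega
    · rw [nsmul_eq_mul]
      refine mul_le_mul_left ?_ _
      rw [← ENNReal.ofReal_natCast]
      refine ofReal_le_ofReal ?_
      calc ((fp m).card : ℝ) ≤ (((3*2^m-2)^2 : ℕ) : ℝ) := by exact_mod_cast fp_card m
        _ = ((3*2^m-2:ℕ):ℝ)^2 := by push_cast; rfl
        _ ≤ (3*P)^2 := by gcongr
        _ = _ := by ring
  have hIr : I0 = ofReal I0.toReal := (ENNReal.ofReal_toReal hI).symm
  calc _ ≤ ofReal (8^4) * (ofReal ((78/2^(1+m))^2) * (N2 * (ofReal (24000000 * L^(η-1)) * I0))) +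
        ofReal ((3*P)^6) * (ofReal (9 * P^2) * (N2 * (ofReal (C * 4^(4*(1+m)) * L^(η-1-1/32)) * I0))) := by
        gcongr
    _ = N2 * ofReal ((8^4 * ((78/2^(1+m))^2 * (24000000 * L^(η-1))) + (3*P)^6 * ((9*P^2) * (C * 4^(4*(1+m)) * L^(η-1-1/32)))) * I0.toReal) := by
        conv_lhs => rw [hIr]
        rw [ofReal_mul (q := I0.toReal) (by positivity), ENNReal.ofReal_add (by positivity) (by positivity),
          ofReal_mul (p := 8^4) (by positivity), ofReal_mul (p := (78/2^(1+m))^2) (by positivity),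
          ofReal_mul (p := (3*P)^6) (by positivity), ofReal_mul (p := 9*P^2) (by positivity)]
        ring
    _ ≤ _ := by
        refine mul_le_mul_right (ofReal_le_ofReal ?_) _
        set Q := L^(1/1000:ℝ) with hQ
        have hQ0 : 0 < Q := by positivity
        have e1 : L^(η-1) = Q^2 * L^(-(1001/1000):ℝ) := by
          rw [hQ, ← Real.rpow_natCast, ← Real.rpow_mul hL0.le, ← Real.rpow_add hL0, hη]; norm_num
        have hQ1 : 1 ≤ Q := Real.one_le_rpow hL (by norm_num)
        have e2 : L^(η-1-1/32) * P^16 ≤ L^(-(1001/1000):ℝ) := by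
          calc _ ≤ L^(η-1-1/32) * Q^16 := by gcongr
            _ = L^((η-1-1/32) + 16/1000) := by
              rw [hQ, ← Real.rpow_natCast, ← Real.rpow_mul hL0.le, ← Real.rpow_add hL0]; norm_num
            _ ≤ _ := Real.rpow_le_rpow_of_exponent_le hL (by rw [hη]; norm_num)
        set T := L^(-(1001/1000):ℝ) with hT
        have hT0 : 0 < T := by positivity
        have t1 : 8^4 * ((78/2^(1+m))^2 * (24000000 * L^(η-1))) ≤ 10^20 * T := by
          rw [e1, pow_add, ← hP]
          have : Q / P ≤ 2 := by rw [div_le_iff₀ (by positivity)]; rw [pow_succ] at hm2; linarith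
          calc _ = (8^4 * 39^2 * 24000000) * (Q/P)^2 * T := by field_simp; ring
            _ ≤ (8^4 * 39^2 * 24000000) * 2^2 * T := by gcongr
            _ ≤ _ := by gcongr; norm_num
        have t2 : (3*P)^6 * ((9*P^2) * (C * 4^(4*(1+m)) * L^(η-1-1/32))) ≤ 10^20 * C * T := by
          have : (4:ℝ)^(4*(1+m)) = 256 * P^8 := by
            rw [hP, ← pow_mul, show (4:ℝ)^(4*(1+m)) = 2^(2*(4*(1+m))) by rw [pow_mul (2:ℝ) 2]; norm_num, show 2*(4*(1+m)) = 8 + m*8 by ring, pow_add]; norm_num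
          rw [this]
          calc _ = 3^6 * 9 * 256 * C * (L^(η-1-1/32) * P^16) := by ring
            _ ≤ 3^6 * 9 * 256 * C * T := by gcongr
            _ ≤ _ := by gcongr; norm_num
        calc _ ≤ (10^20 * T + 10^20 * C * T) * (I0.toReal + 1) := by
              gcongr; linarith
          _ = _ := by ring

/-- all admissible indices at a given level -/
def al (j : ℕ) : Finset ℕ := (Finset.range (2*2^j)).filter (fun n => 2^j ≤ 2*n ∧ n+3 ≤ 2*2^j)

theorem mem_al {j n : ℕ} : n ∈ al j ↔ adm j n := by
  unfold al
  rw [Finset.mem_filter, Finset.mem_range]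
  constructor
  · exact fun h => h.2
  · intro h; refine ⟨?_, h.1, h.2⟩; have := h.2; omega

noncomputable def S5 (L : ℝ) (f : ℝ × ℝ → ℝ) (j : ℕ) : ℝ≥0∞ := ∑ n ∈ al j, ∫⁻ z in Sl c, ofReal (|O.u L j n f z|^5)

theorem S5_step (m : ℕ) {L : ℝ} (hL : 1 ≤ L) (j : ℕ) (f : ℝ × ℝ → ℝ) (hf : Measurable f) (hF : ∀ t, |f t| ≤ 1) :
    O.S5 L f j ≤ 2^17 * O.S5 L f (j+m) + (∫⁻ t, ofReal (f t ^ 2))^2 * ofReal (((3*2^m-2:ℕ):ℝ)^7 * 10^20 / L) := by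
  classical
  set N2 := ∫⁻ t, ofReal (f t ^ 2) with hN2
  have hL0 : 0 < L := by linarith
  have hK : 0 < 2^m := Nat.two_pow_pos m
  set g : ℕ → ℝ≥0∞ := fun n => ∫⁻ z in Sl c, ofReal (|O.u L (j+m) n f z|^5) with hg
  set g2 : ℕ × ℕ → ℝ≥0∞ := fun p => ∫⁻ z in Sl c, ofReal ((O.u L (j+m) p.1 f z * O.u L (j+m) p.2 f z)^2) with hg2
  have a1 : ∑ n ∈ al j, ∑ i ∈ Finset.range (3*2^m-2), g (2^m*n+i) ≤ (3:ℕ) * ∑ n ∈ al (j+m), g n := by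
    rw [← Finset.sum_product']
    refine sum_le_k (al j ×ˢ Finset.range (3*2^m-2)) (al (j+m)) (fun p => 2^m*p.1+p.2) ?_ g 3 ?_
    · intro p hp
      obtain ⟨h1, h2⟩ := Finset.mem_product.1 hp
      exact mem_al.2 (adm_child (mem_al.1 h1) (Finset.mem_range.1 h2))
    · intro b _
      refine parents _ (2^m) 3 b hK (fun i => i) ?_ ?_
      · intro p hp
        obtain ⟨h1, h2⟩ := Finset.mem_filter.1 hp
        have := Finset.mem_range.1 (Finset.mem_product.1 h1).2
        exact ⟨by omega, h2⟩
      · intro p hp p' hp' h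
        have h1 := (Finset.mem_filter.1 hp).2
        have h2 := (Finset.mem_filter.1 hp').2
        rw [← h2, h] at h1
        exact Prod.ext h (by simpa using h1)
  have a2 : ∑ n ∈ al j, ∑ p ∈ fp m, g2 (2^m*n+p.1, 2^m*n+p.2) ≤ (3:ℕ) * ∑ p ∈ (al (j+m) ×ˢ al (j+m)).filter (fun p => far p.1 p.2), g2 p := by
    rw [← Finset.sum_product']
    refine sum_le_k (al j ×ˢ fp m) _ (fun p : ℕ × ℕ × ℕ => (2^m*p.1+p.2.1, 2^m*p.1+p.2.2)) ?_ g2 3 ?_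
    · intro p hp
      obtain ⟨h1, h2⟩ := Finset.mem_product.1 hp
      obtain ⟨h3, h4⟩ := Finset.mem_filter.1 h2
      obtain ⟨h5, h6⟩ := Finset.mem_product.1 h3
      refine Finset.mem_filter.2 ⟨Finset.mem_product.2 ⟨mem_al.2 (adm_child (mem_al.1 h1) (Finset.mem_range.1 h5)), mem_al.2 (adm_child (mem_al.1 h1) (Finset.mem_range.1 h6))⟩, ?_⟩
      unfold far at h4 ⊢; simp only; omega
    · intro b _
      refine parents _ (2^m) 3 b.1 hK (fun i => i.1) ?_ ?_
      · intro p hp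
        obtain ⟨h1, h2⟩ := Finset.mem_filter.1 hp
        have h3 := (Finset.mem_product.1 h1).2
        have := Finset.mem_range.1 (Finset.mem_product.1 (Finset.mem_filter.1 h3).1).1
        exact ⟨by omega, by rw [← h2]⟩
      · intro p hp p' hp' h
        have h1 := (Finset.mem_filter.1 hp).2
        have h2 := (Finset.mem_filter.1 hp').2
        rw [← h2, h, Prod.mk.injEq] at h1
        exact Prod.ext h (Prod.ext (by simpa using h1.1) (by simpa using h1.2))
  have a3 := O.J4far hL (j := j+m) (al (j+m)) (fun n hn => mem_al.1 hn) f hf hF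
  calc O.S5 L f j ≤ ∑ n ∈ al j, (ofReal (8^5) * (∑ i ∈ Finset.range (3*2^m-2), g (2^m*n+i)) +
          ofReal (((3*2^m-2:ℕ):ℝ)^7 * (78/2^(j+m))) * ∑ p ∈ fp m, g2 (2^m*n+p.1, 2^m*n+p.2)) :=
        Finset.sum_le_sum fun n hn => O.bnL5 m hL (mem_al.1 hn) f hf hF
    _ = ofReal (8^5) * (∑ n ∈ al j, ∑ i ∈ Finset.range (3*2^m-2), g (2^m*n+i)) +
          ofReal (((3*2^m-2:ℕ):ℝ)^7 * (78/2^(j+m))) * ∑ n ∈ al j, ∑ p ∈ fp m, g2 (2^m*n+p.1, 2^m*n+p.2) := by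
        rw [Finset.sum_add_distrib, Finset.mul_sum, Finset.mul_sum]
    _ ≤ ofReal (8^5) * ((3:ℕ) * O.S5 L f (j+m)) +
          ofReal (((3*2^m-2:ℕ):ℝ)^7 * (78/2^(j+m))) * ((3:ℕ) * (N2^2 * ofReal (30000000000000 * 2^(j+m) / L))) := by
        gcongr
        · exact a1
        · exact a2.trans (mul_le_mul_right a3 _)
    _ ≤ _ := by
        gcongr ?_ + ?_
        · rw [← mul_assoc, ← ENNReal.ofReal_natCast, ← ofReal_mul (by norm_num)]
          refine mul_le_mul_left ?_ _
          rw [show (2:ℝ≥0∞)^17 = ofReal (2^17) by rw [ENNReal.ofReal_pow (by norm_num)]; norm_num]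
          exact ofReal_le_ofReal (by norm_num)
        · rw [← ENNReal.ofReal_natCast]
          calc _ = N2^2 * ofReal ((((3*2^m-2:ℕ):ℝ)^7 * (78/2^(j+m))) * ((3:ℕ) * (30000000000000 * 2^(j+m) / L))) := by
                rw [ofReal_mul (p := _ * _) (by positivity), ofReal_mul (p := ((3:ℕ):ℝ)) (by positivity)]; ring
            _ ≤ _ := by
                refine mul_le_mul_right (ofReal_le_ofReal ?_) _
                have hN0 : (0:ℝ) ≤ ((3*2^m-2:ℕ):ℝ) := Nat.cast_nonneg _
                generalize ((3*2^m-2:ℕ):ℝ) = N at *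
                have : N^7 * (78/2^(j+m)) * ((3:ℕ) * (30000000000000 * 2^(j+m) / L)) = (78 * 3 * 30000000000000) * N^7 / L := by
                  field_simp; norm_num
                rw [this]
                gcongr ?_ / L
                nlinarith [pow_nonneg hN0 7]

end Op
end MS
namespace MS
theorem hol3 {α : Type*} [MeasurableSpace α] (μ : Measure α) (f1 f2 f3 : α → ℝ≥0∞) (h1 : Measurable f1) (h2 : Measurable f2) (h3 : Measurable f3)
    {w1 w2 w3 : ℝ} (hw1 : 0 ≤ w1) (hw2 : 0 ≤ w2) (hw3 : 0 ≤ w3) (hw : w1 + w2 + w3 = 1) :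
    ∫⁻ z, f1 z ^ w1 * f2 z ^ w2 * f3 z ^ w3 ∂μ ≤ (∫⁻ z, f1 z ∂μ)^w1 * (∫⁻ z, f2 z ∂μ)^w2 * (∫⁻ z, f3 z ∂μ)^w3 := by
  have h := ENNReal.lintegral_prod_norm_pow_le (μ := μ) (Finset.univ : Finset (Fin 3))
    (f := ![f1, f2, f3]) (fun i _ => by fin_cases i <;> simp [h1.aemeasurable, h2.aemeasurable, h3.aemeasurable]) (p := ![w1, w2, w3])
    (by rw [Fin.sum_univ_three]; simpa using hw) (by intro i _; fin_cases i <;> simp [hw1, hw2, hw3])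
  simpa [Fin.prod_univ_three] using h

namespace Op
variable {c B : ℝ} (O : Op c B)

theorem u_cs {L : ℝ} (hL : 1 ≤ L) {j n : ℕ} (hn : adm j n) {z : ℝ × ℝ × ℝ} (hz : z ∈ Sl c) (f : ℝ × ℝ → ℝ) (hf : Measurable f) :
    ofReal ((O.u L j n f z)^2) ≤ ofReal (13 * L * (78/2^j)) * ∫⁻ t, ofReal (f t ^ 2) := by
  have hL0 : 0 < L := by linarith
  refine (cs_lintegral volume (O.K L j n z) f (O.K_cont2 L j n z).aemeasurable hf.aemeasurable).trans ?_
  refine mul_le_mul_left ?_ _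
  rw [ofReal_mul (by positivity)]
  refine le_trans ?_ (mul_le_mul_right (O.K_lint hL hn hz) _)
  rw [← lintegral_const_mul _ (O.K_cont2 L j n z).measurable.abs.ennreal_ofReal]
  refine lintegral_mono fun t => ?_
  rw [← ofReal_mul (by positivity)]
  refine ofReal_le_ofReal ?_
  rw [← sq_abs, sq]
  exact mul_le_mul_of_nonneg_right (O.K_abs hL0 hn hz t) (abs_nonneg _)

theorem S5_iter (m : ℕ) {L : ℝ} (hL : 1 ≤ L) (f : ℝ × ℝ → ℝ) (hf : Measurable f) (hF : ∀ t, |f t| ≤ 1) (k : ℕ) :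
    O.S5 L f 1 ≤ 2^(17*k) * O.S5 L f (1+m*k) + (k * 2^(17*k)) * ((∫⁻ t, ofReal (f t ^ 2))^2 * ofReal (((3*2^m-2:ℕ):ℝ)^7 * 10^20 / L)) := by
  induction k with
  | zero => simp
  | succ k ih =>
    set E := ((∫⁻ t, ofReal (f t ^ 2))^2 * ofReal (((3*2^m-2:ℕ):ℝ)^7 * 10^20 / L)) with hE
    have h := O.S5_step m hL (1+m*k) f hf hF
    rw [← hE] at h
    refine ih.trans ?_
    calc _ ≤ 2^(17*k) * (2^17 * O.S5 L f (1+m*k+m) + E) + (k * 2^(17*k)) * E := by gcongr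
      _ = 2^(17*(k+1)) * O.S5 L f (1+m*(k+1)) + ((k+1) * 2^(17*k)) * E := by
        rw [show 17*(k+1) = 17*k+17 by ring, pow_add, show 1+m*(k+1) = 1+m*k+m by ring]; ring
      _ ≤ _ := by
        push_cast
        gcongr
        · norm_num
        · omega

theorem S5_last {L η : ℝ} (hL : 1 ≤ L) (hη : 0 < η) (hη1 : η < 1) (j : ℕ) (f : ℝ × ℝ → ℝ) (hf : Measurable f) (hF : ∀ t, |f t| ≤ 1) :
    O.S5 L f j ≤ (ofReal ((78/2^j) * (13 * L * (78/2^j))) * ∫⁻ t, ofReal (f t ^ 2)) *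
      ((∫⁻ t, ofReal (f t ^ 2)) * (ofReal (24000000 * L^(η-1)) * Il η)) := by
  refine le_trans ?_ (mul_le_mul_right (O.J2 hL hη hη1 (j := j) (al j) (fun n hn => mem_al.1 hn) f hf hF) _)
  unfold S5
  rw [Finset.mul_sum]
  refine Finset.sum_le_sum fun n hn => ?_
  rw [← lintegral_const_mul _ ((O.u_meas L j n f hf).pow_const 2).ennreal_ofReal]
  refine setLIntegral_mono' (Sl_meas c) fun z hz => ?_
  have h1 := O.u_bd hL (mem_al.1 hn) hz f hF
  have h2 := O.u_cs hL (mem_al.1 hn) hz f hf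
  calc _ = ofReal |O.u L j n f z| * ofReal ((O.u L j n f z)^2) * ofReal ((O.u L j n f z)^2) := by
        rw [← ofReal_mul (abs_nonneg _), ← ofReal_mul (by positivity), ← sq_abs]; congr 1; ring
    _ ≤ ofReal (78/2^j) * (ofReal (13 * L * (78/2^j)) * ∫⁻ t, ofReal (f t ^ 2)) * ofReal ((O.u L j n f z)^2) := by
        gcongr
    _ = _ := by rw [ofReal_mul (p := 78/2^j) (by positivity)]; ring

theorem J5 {η : ℝ} (hη : 0 < η) (hη1 : η < 1) : ∃ C : ℝ, 0 < C ∧ ∀ (L : ℝ), 1 ≤ L → ∀ (f : ℝ × ℝ → ℝ), Measurable f → (∀ t, |f t| ≤ 1) →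
    ∫⁻ z in Sl c, ofReal (|O.u L 1 1 f z|^5) ≤
      (∫⁻ t, ofReal (f t ^ 2))^2 * ofReal (C * L^(η-1)) := by
  obtain ⟨m, hm⟩ := exists_nat_ge (18/η)
  rw [div_le_iff₀ hη] at hm
  have hm0 : m ≠ 0 := by rintro rfl; norm_num at hm
  set I0 := Il (η/2) with hI0
  have hI : I0 ≠ ∞ := Il_ne_top (by positivity)
  have hIr : I0 = ofReal I0.toReal := (ENNReal.ofReal_toReal hI).symm
  set N := ((3*2^m-2:ℕ):ℝ) with hN
  have hN0 : 0 ≤ N := Nat.cast_nonneg _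
  refine ⟨10^20 * 4^m * (I0.toReal+1) + N^7 * 10^20, by positivity, ?_⟩
  intro L hL f hf hF
  have hL0 : 0 < L := by linarith
  set N2 := ∫⁻ t, ofReal (f t ^ 2) with hN2
  have h0 : ∫⁻ z in Sl c, ofReal (|O.u L 1 1 f z|^5) ≤ O.S5 L f 1 :=
    Finset.single_le_sum (f := fun n => ∫⁻ z in Sl c, ofReal (|O.u L 1 n f z|^5)) (fun _ _ => zero_le) (mem_al.2 adm11)
  obtain ⟨k, hk1, hk2⟩ := exists_nat_pow_near hL (one_lt_pow₀ (by norm_num : (1:ℝ) < 4) hm0)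
  refine h0.trans ((O.S5_iter m hL f hf hF k).trans ?_)
  have hl := O.S5_last hL (half_pos hη) (by linarith) (1+m*k) f hf hF
  have hkp : (2:ℝ)^(18*k) ≤ L^(η/2) := by
    calc (2:ℝ)^(18*k) = (2:ℝ)^(18*(k:ℝ)) := by rw [← Real.rpow_natCast]; push_cast; rfl
      _ ≤ (2:ℝ)^((m*η)*(k:ℝ)) := Real.rpow_le_rpow_of_exponent_le (by norm_num) (mul_le_mul_of_nonneg_right hm (Nat.cast_nonneg _))
      _ = (((4:ℝ)^m)^k)^(η/2) := by
        rw [show (4:ℝ) = 2^(2:ℝ) by norm_num, ← Real.rpow_natCast, ← Real.rpow_natCast, ← Real.rpow_mul (by norm_num), ← Real.rpow_mul (by norm_num), ← Real.rpow_mul (by norm_num)]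
        congr 1; ring
      _ ≤ _ := Real.rpow_le_rpow (by positivity) hk1 (by positivity)
  have hkn : (k:ℝ) * 2^(17*k) ≤ 2^(18*k) := by
    rw [show 18*k = k + 17*k by ring, pow_add]
    gcongr
    exact_mod_cast Nat.lt_two_pow_self.le
  have hk0 : (2:ℝ)^(17*k) ≤ 2^(18*k) := pow_le_pow_right₀ (by norm_num) (by omega)
  have hj : (78/2^(1+m*k)) * (13 * L * (78/2^(1+m*k))) ≤ 78^2 * 13 * (4:ℝ)^m := by
    have e : ((2:ℝ)^(1+m*k))^2 = 4 * (4^m)^k := by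
      rw [← pow_mul, ← pow_mul, show (4:ℝ)^(m*k) = 2^(2*(m*k)) by rw [pow_mul (2:ℝ) 2]; norm_num, show (1+m*k)*2 = 2 + 2*(m*k) by ring, pow_add]; norm_num
    have e2 : (78/2^(1+m*k)) * (13 * L * (78/2^(1+m*k))) = 78^2 * 13 * L / ((2:ℝ)^(1+m*k))^2 := by field_simp
    rw [e2, e, div_le_iff₀ (by positivity)]
    rw [pow_succ] at hk2
    have : (0:ℝ) < (4^m)^k * 4^m := by positivity
    nlinarith
  calc _ ≤ ofReal (2^(18*k)) * ((ofReal (78^2 * 13 * (4:ℝ)^m) * N2) * (N2 * (ofReal (24000000 * L^(η/2-1)) * I0))) +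
        ofReal (2^(18*k)) * (N2^2 * ofReal (N^7 * 10^20 / L)) := by
        have e1 : (2:ℝ≥0∞)^(17*k) ≤ ofReal (2^(18*k)) := by
          rw [show (2:ℝ≥0∞)^(17*k) = ofReal (2^(17*k)) by rw [ENNReal.ofReal_pow (by norm_num)]; norm_num]
          exact ofReal_le_ofReal hk0
        have e2 : (k:ℝ≥0∞) * (2:ℝ≥0∞)^(17*k) ≤ ofReal (2^(18*k)) := by
          rw [show (2:ℝ≥0∞)^(17*k) = ofReal (2^(17*k)) by rw [ENNReal.ofReal_pow (by norm_num)]; norm_num, ← ENNReal.ofReal_natCast, ← ofReal_mul (by positivity)]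
          exact ofReal_le_ofReal hkn
        refine add_le_add (mul_le_mul' e1 (hl.trans ?_)) (mul_le_mul' e2 le_rfl)
        exact mul_le_mul_left (mul_le_mul_left (ofReal_le_ofReal hj) _) _
    _ = N2^2 * ofReal (2^(18*k) * (78^2 * 13 * (4:ℝ)^m * ((24000000 * L^(η/2-1)) * I0.toReal)) + 2^(18*k) * (N^7 * 10^20 / L)) := by
        rw [ENNReal.ofReal_add (by positivity) (by positivity), ofReal_mul (p := 2^(18*k)) (by positivity),
          ofReal_mul (p := 2^(18*k)) (by positivity), ofReal_mul (p := 78^2 * 13 * (4:ℝ)^m) (by positivity),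
          ofReal_mul (p := 24000000 * L^(η/2-1)) (by positivity), ← hIr]
        ring
    _ ≤ _ := by
        refine mul_le_mul_right (ofReal_le_ofReal ?_) _
        have e1 : L^(η/2) * L^(η/2-1) = L^(η-1) := by rw [← Real.rpow_add hL0]; congr 1; ring
        have e2 : L^(η/2) / L ≤ L^(η-1) := by
          rw [← Real.rpow_sub_one hL0.ne']
          exact Real.rpow_le_rpow_of_exponent_le hL (by linarith)
        calc _ ≤ L^(η/2) * (78^2 * 13 * (4:ℝ)^m * ((24000000 * L^(η/2-1)) * I0.toReal)) + L^(η/2) * (N^7 * 10^20 / L) := by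
              gcongr
          _ = (78^2 * 13 * 24000000 * 4^m * I0.toReal) * (L^(η/2) * L^(η/2-1)) + N^7 * 10^20 * (L^(η/2)/L) := by ring
          _ ≤ (10^20 * 4^m * (I0.toReal + 1)) * L^(η-1) + N^7 * 10^20 * L^(η-1) := by
              rw [e1]
              gcongr
              · norm_num
              · linarith
          _ = _ := by ring

theorem J2' {η : ℝ} (hη : 0 < η) (hη1 : η < 1) : ∃ C : ℝ, 0 < C ∧ ∀ (L : ℝ), 1 ≤ L → ∀ (f : ℝ × ℝ → ℝ), Measurable f → (∀ t, |f t| ≤ 1) →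
    ∫⁻ z in Sl c, ofReal (|O.u L 1 1 f z|^2) ≤
      (∫⁻ t, ofReal (f t ^ 2)) * ofReal (C * L^(η-1)) := by
  have hI : Il η ≠ ∞ := Il_ne_top hη
  refine ⟨24000000 * ((Il η).toReal + 1), by positivity, ?_⟩
  intro L hL f hf hF
  have hL0 : 0 < L := by linarith
  have := O.J2 hL hη hη1 (j := 1) {1} (fun n hn => by rw [Finset.mem_singleton.1 hn]; exact adm11) f hf hF
  rw [Finset.sum_singleton] at this
  simp only [sq_abs]
  refine this.trans (mul_le_mul_right ?_ _)
  rw [← ENNReal.ofReal_toReal hI, ← ofReal_mul (by positivity), ENNReal.ofReal_toReal hI]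
  refine ofReal_le_ofReal ?_
  have : 0 ≤ L^(η-1) := by positivity
  nlinarith

set_option maxHeartbeats 1000000 in
/-- interpolated core estimate -/
theorem core {q m : ℝ} (hm : 1 ≤ m) (hm2 : m < 2) (hq : 3*m-1 < q) : ∃ C δ : ℝ, 0 < C ∧ 0 < δ ∧ ∀ (L : ℝ), 1 ≤ L → ∀ (f : ℝ × ℝ → ℝ), Measurable f → (∀ t, |f t| ≤ 1) →
    ∫⁻ z in Sl c, ofReal (|O.u L 1 1 f z|^q) ≤
      (∫⁻ t, ofReal (f t ^ 2))^m * ofReal (C * L^(-1-δ)) := by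
  set b := m - 1 with hb
  obtain ⟨s, hs0, hs1, hsq⟩ : ∃ s : ℝ, 0 < s ∧ s ≤ 1 ∧ (1-b)*(2+2*s)+5*b ≤ q := by
    have : 0 < q - (2 + 3*b) := by rw [hb]; linarith
    refine ⟨min 1 ((q-(2+3*b))/2), by positivity, min_le_left _ _, ?_⟩
    set s := min 1 ((q-(2+3*b))/2)
    have h1 : s ≤ (q-(2+3*b))/2 := min_le_right _ _
    have h0 : 0 < s := by positivity
    have hb0 : 0 ≤ b := by rw [hb]; linarith
    nlinarith [mul_nonneg hb0 h0.le]
  have hb0 : 0 ≤ b := by rw [hb]; linarith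
  have hb1 : 0 < 1 - b := by rw [hb]; linarith
  set w1 := (1-s)*(1-b) with hw1
  set w2 := s*(1-b) with hw2
  have hw10 : 0 ≤ w1 := mul_nonneg (by linarith) hb1.le
  have hw20 : 0 < w2 := mul_pos hs0 hb1
  have hw21 : w2 ≤ 1 := by nlinarith
  have hws : w1 + w2 + b = 1 := by rw [hw1, hw2]; ring
  set η := w2/2000 with hη
  have hη0 : 0 < η := by positivity
  have hη1 : η < 1 := by rw [hη]; linarith
  obtain ⟨C2, hC2, k2⟩ := O.J2' hη0 hη1
  obtain ⟨C4, hC4, k4⟩ := O.J4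
  obtain ⟨C5, hC5, k5⟩ := O.J5 hη0 hη1
  have hq1 : 2*w1+4*w2+5*b ≤ q := by rw [hw1, hw2]; linarith
  set e := q - (2*w1+4*w2+5*b) with he
  have he0 : 0 ≤ e := by rw [he]; linarith
  refine ⟨39^e * (C2^w1 * C4^w2 * C5^b), w2/2000, by positivity, by positivity, ?_⟩
  intro L hL f hf hF
  have hL0 : 0 < L := by linarith
  set N2 := ∫⁻ t, ofReal (f t ^ 2) with hN2
  have hum := (O.u_meas L 1 1 f hf).abs
  calc ∫⁻ z in Sl c, ofReal (|O.u L 1 1 f z|^q)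
      ≤ ∫⁻ z in Sl c, ofReal (39^e) * (ofReal (|O.u L 1 1 f z|^2) ^ w1 * ofReal (|O.u L 1 1 f z|^4) ^ w2 * ofReal (|O.u L 1 1 f z|^5) ^ b) := by
        refine setLIntegral_mono' (Sl_meas c) fun z hz => ?_
        have h1 := O.u_bd hL adm11 hz f hF
        set a := |O.u L 1 1 f z| with ha
        have ha0 : 0 ≤ a := abs_nonneg _
        rw [ENNReal.ofReal_rpow_of_nonneg (by positivity) hw10, ENNReal.ofReal_rpow_of_nonneg (by positivity) hw20.le, ENNReal.ofReal_rpow_of_nonneg (by positivity) hb0,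
          ← ofReal_mul (by positivity), ← ofReal_mul (by positivity), ← ofReal_mul (by positivity)]
        refine ofReal_le_ofReal ?_
        have e1 : a^q = a^e * ((a^2)^w1 * (a^4)^w2 * (a^5)^b) := by
          rw [← Real.rpow_natCast, ← Real.rpow_natCast, ← Real.rpow_natCast, ← Real.rpow_mul ha0, ← Real.rpow_mul ha0, ← Real.rpow_mul ha0,
            ← Real.rpow_add_of_nonneg ha0 (by positivity) (by positivity), ← Real.rpow_add_of_nonneg ha0 (by positivity) (by positivity), ← Real.rpow_add_of_nonneg ha0 (by positivity) (by positivity)]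
          congr 1; rw [he]; push_cast; ring
        rw [e1]
        refine mul_le_mul_of_nonneg_right (Real.rpow_le_rpow ha0 (h1.trans (by norm_num)) he0) (by positivity)
    _ = ofReal (39^e) * ∫⁻ z in Sl c, (ofReal (|O.u L 1 1 f z|^2) ^ w1 * ofReal (|O.u L 1 1 f z|^4) ^ w2 * ofReal (|O.u L 1 1 f z|^5) ^ b) := by
        rw [lintegral_const_mul' _ _ ofReal_ne_top]
    _ ≤ ofReal (39^e) * ((∫⁻ z in Sl c, ofReal (|O.u L 1 1 f z|^2))^w1 * (∫⁻ z in Sl c, ofReal (|O.u L 1 1 f z|^4))^w2 * (∫⁻ z in Sl c, ofReal (|O.u L 1 1 f z|^5))^b) := by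
        refine mul_le_mul_right ?_ _
        exact hol3 (volume.restrict (Sl c)) _ _ _ (hum.pow_const _).ennreal_ofReal (hum.pow_const _).ennreal_ofReal (hum.pow_const _).ennreal_ofReal hw10 hw20.le hb0 hws
    _ ≤ ofReal (39^e) * ((N2 * ofReal (C2 * L^(η-1)))^w1 * (N2 * ofReal (C4 * L^(-(1001/1000):ℝ)))^w2 * (N2^2 * ofReal (C5 * L^(η-1)))^b) := by
        refine mul_le_mul_right (mul_le_mul' (mul_le_mul' (ENNReal.rpow_le_rpow (k2 L hL f hf hF) hw10) (ENNReal.rpow_le_rpow (k4 L hL f hf hF) hw20.le)) (ENNReal.rpow_le_rpow (k5 L hL f hf hF) hb0)) _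
    _ = N2^m * ofReal (39^e * ((C2 * L^(η-1))^w1 * (C4 * L^(-(1001/1000):ℝ))^w2 * (C5 * L^(η-1))^b)) := by
        rw [ENNReal.mul_rpow_of_nonneg _ _ hw10, ENNReal.mul_rpow_of_nonneg _ _ hw20.le, ENNReal.mul_rpow_of_nonneg _ _ hb0,
          ENNReal.ofReal_rpow_of_nonneg (by positivity) hw10, ENNReal.ofReal_rpow_of_nonneg (by positivity) hw20.le, ENNReal.ofReal_rpow_of_nonneg (by positivity) hb0,
          ofReal_mul (p := 39^e) (by positivity), ofReal_mul (p := (C2 * L^(η-1))^w1 * (C4 * L^(-(1001/1000):ℝ))^w2) (by positivity), ofReal_mul (p := (C2 * L^(η-1))^w1) (by positivity),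
          ← ENNReal.rpow_natCast, ← ENNReal.rpow_mul, show m = w1 + w2 + (2:ℕ) * b by push_cast; linarith,
          ENNReal.rpow_add_of_nonneg _ _ (by positivity) (by positivity), ENNReal.rpow_add_of_nonneg _ _ (by positivity) (by positivity)]
        ring
    _ ≤ _ := by
        refine mul_le_mul_right (ofReal_le_ofReal ?_) _
        rw [mul_assoc (39^e) (C2^w1 * C4^w2 * C5^b)]
        refine mul_le_mul_of_nonneg_left ?_ (by positivity)
        rw [Real.mul_rpow hC2.le (by positivity), Real.mul_rpow hC4.le (by positivity), Real.mul_rpow hC5.le (by positivity), ← Real.rpow_mul hL0.le, ← Real.rpow_mul hL0.le, ← Real.rpow_mul hL0.le]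
        calc _ = (C2^w1 * C4^w2 * C5^b) * (L^((η-1)*w1) * L^((-(1001/1000))*w2) * L^((η-1)*b)) := by ring
          _ ≤ _ := by
            rw [← Real.rpow_add hL0, ← Real.rpow_add hL0]
            refine mul_le_mul_of_nonneg_left (Real.rpow_le_rpow_of_exponent_le hL ?_) (by positivity)
            have : η * w1 + η * b ≤ η := by nlinarith
            rw [hη] at this ⊢
            nlinarith

end Op
end MS
namespace MS

theorem jensen {α : Type*} [MeasurableSpace α] (μ : Measure α) (V : α → ℝ≥0∞) (hV : Measurable V) {q : ℝ} (hq : 1 ≤ q) :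
    (∫⁻ z, V z ∂μ)^q ≤ μ univ ^ (q-1) * ∫⁻ z, V z ^ q ∂μ := by
  have hq0 : 0 < q := by linarith
  have h := hol3 μ (fun z => V z ^ q) (fun _ => 1) (fun _ => 1) (hV.pow_const q) measurable_const measurable_const
    (w1 := 1/q) (w2 := 1 - 1/q) (w3 := 0) (by positivity) (by rw [sub_nonneg, div_le_iff₀ hq0]; linarith) le_rfl (by ring)
  simp only [ENNReal.one_rpow, mul_one, ENNReal.rpow_zero, lintegral_const, one_mul] at h
  have e : ∀ z, (V z ^ q)^(1/q) = V z := fun z => by rw [← ENNReal.rpow_mul, mul_one_div_cancel hq0.ne', ENNReal.rpow_one]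
  simp only [e] at h
  calc _ ≤ _ := ENNReal.rpow_le_rpow h hq0.le
    _ = _ := by
      rw [ENNReal.mul_rpow_of_nonneg _ _ hq0.le, ← ENNReal.rpow_mul, ← ENNReal.rpow_mul, one_div_mul_cancel hq0.ne', ENNReal.rpow_one, mul_comm]
      congr 2; field_simp

namespace Op
variable {c B : ℝ} (O P : Op c B)

/-- `P` is the operator arising by differentiating `O` in the parameter `r`. -/
structure Sharp : Prop where
  hG : P.G = O.G
  ham : O.am = fun _ _ => 1
  hPa : P.am = O.Gr
  hψ : ∀ t, HasDerivAt O.ψ (P.ψ t) t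

variable {O P}

theorem Sharp.K_diff (S : Sharp O P) (L x y r0 r1 : ℝ) (t : ℝ × ℝ) :
    O.K L 1 1 (x,y,r1) t - O.K L 1 1 (x,y,r0) t = -L * ∫ r in r0..r1, P.K L 1 1 (x,y,r) t := by
  rw [← intervalIntegral.integral_const_mul]
  symm
  refine intervalIntegral.integral_eq_sub_of_hasDerivAt (f := fun r => O.K L 1 1 (x,y,r) t) ?_ ?_
  · intro r _
    unfold Op.K
    have h1 := O.dGr (x - t.1) r
    have h2 : HasDerivAt (fun r => L * (y - t.2 - O.G (x - t.1) r)) (L * (-O.Gr (x - t.1) r)) r := (h1.const_sub _).const_mul L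
    have h3 := ((S.hψ _).comp r h2).const_mul L
    have h4 := h3.mul_const (chi 1 1 (x - t.1))
    simp only [S.ham, S.hPa, S.hG, mul_one]
    refine HasDerivAt.congr_deriv h4 ?_
    ring
  · refine Continuous.intervalIntegrable ?_ _ _
    exact continuous_const.mul ((P.K_cont L 1 1).comp (f := fun r : ℝ => (((x,y,r),t) : (ℝ×ℝ×ℝ)×(ℝ×ℝ))) (by fun_prop))

theorem Sharp.u_diff (S : Sharp O P) {L : ℝ} (hL : 1 ≤ L) (x y : ℝ) {r0 r1 : ℝ} (h0 : |r0| ≤ c) (h1 : |r1| ≤ c) (f : ℝ × ℝ → ℝ) (hf : Measurable f) (hF : ∀ t, |f t| ≤ 1) :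
    ofReal |O.u L 1 1 f (x,y,r1)| ≤ ofReal |O.u L 1 1 f (x,y,r0)| +
      ofReal L * ∫⁻ r in uIcc r0 r1, ofReal |P.u L 1 1 f (x,y,r)| := by
  have hL0 : 0 < L := by linarith
  have hsub : ∀ r ∈ uIoc r0 r1, |r| ≤ c := by
    intro r hr
    rw [mem_uIoc] at hr
    rw [abs_le] at h0 h1 ⊢
    rcases hr with hr | hr <;> constructor <;> linarith
  have int1 : ∀ (Q : Op c B) r, |r| ≤ c → Integrable (fun t => Q.K L 1 1 (x,y,r) t * f t) := fun Q r hr =>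
    (Q.K_int hL adm11 (z := (x,y,r)) hr).mul_bdd (c := 1) hf.aestronglyMeasurable (Filter.Eventually.of_forall hF)
  have hKm : Measurable (fun w : ℝ × (ℝ × ℝ) => P.K L 1 1 (x,y,w.1) w.2 * f w.2) :=
    ((P.K_cont L 1 1).comp (f := fun w : ℝ × (ℝ×ℝ) => (((x,y,w.1),w.2) : (ℝ×ℝ×ℝ)×(ℝ×ℝ))) (by fun_prop)).measurable.mul (hf.comp measurable_snd)
  have hintg : Integrable (Function.uncurry fun r t => P.K L 1 1 (x,y,r) t * f t) ((volume.restrict (uIoc r0 r1)).prod volume) := by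
    refine (integrable_prod_iff hKm.aestronglyMeasurable).2 ⟨?_, ?_⟩
    · exact (ae_restrict_iff' measurableSet_uIoc).2 (Filter.Eventually.of_forall fun r hr => int1 P r (hsub r hr))
    · refine Measure.integrableOn_of_bounded (M := 78/2^1) (by simp) ?_ ?_
      · exact (hKm.norm.stronglyMeasurable.integral_prod_right (ν := volume)).aestronglyMeasurable
      · refine (ae_restrict_iff' measurableSet_uIoc).2 (Filter.Eventually.of_forall fun r hr => ?_)
        rw [Real.norm_of_nonneg (integral_nonneg fun _ => norm_nonneg _)]
        have := P.K_lint hL adm11 (z := (x,y,r)) (hsub r hr)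
        rw [integral_eq_lintegral_of_nonneg_ae (Filter.Eventually.of_forall fun _ => norm_nonneg _) (hKm.norm.comp measurable_prodMk_left).aestronglyMeasurable]
        refine ENNReal.toReal_le_of_le_ofReal (by positivity) (le_trans (lintegral_mono fun t => ofReal_le_ofReal ?_) this)
        simp only [norm_mul, Real.norm_eq_abs]
        exact mul_le_of_le_one_right (abs_nonneg _) (hF t)
  have e : O.u L 1 1 f (x,y,r1) - O.u L 1 1 f (x,y,r0) = -L * ∫ r in r0..r1, P.u L 1 1 f (x,y,r) := by
    have e1 : O.u L 1 1 f (x,y,r1) - O.u L 1 1 f (x,y,r0) = ∫ t, -L * ∫ r in r0..r1, P.K L 1 1 (x,y,r) t * f t := by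
      unfold Op.u
      rw [← integral_sub (int1 O r1 h1) (int1 O r0 h0)]
      refine integral_congr_ae (Filter.Eventually.of_forall fun t => ?_)
      simp only
      rw [← sub_mul, S.K_diff, intervalIntegral.integral_mul_const]; ring
    rw [e1, integral_const_mul]
    congr 1
    unfold Op.u
    rw [intervalIntegral_integral_swap hintg]
  have h2 : |O.u L 1 1 f (x,y,r1)| ≤ |O.u L 1 1 f (x,y,r0)| + L * |∫ r in r0..r1, P.u L 1 1 f (x,y,r)| := by
    have : O.u L 1 1 f (x,y,r1) = O.u L 1 1 f (x,y,r0) + -L * ∫ r in r0..r1, P.u L 1 1 f (x,y,r) := by linarith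
    rw [this]
    refine (abs_add_le _ _).trans ?_
    rw [abs_mul, abs_neg, abs_of_pos hL0]
  refine (ofReal_le_ofReal h2).trans ?_
  rw [ENNReal.ofReal_add (abs_nonneg _) (by positivity), ofReal_mul hL0.le]
  refine add_le_add_right (mul_le_mul_right ?_ _) _
  rw [intervalIntegral.abs_integral_eq_abs_integral_uIoc, ← Real.norm_eq_abs, ofReal_norm]
  refine (enorm_integral_le_lintegral_enorm _).trans ?_
  refine (lintegral_mono_set uIoc_subset_uIcc).trans (le_of_eq ?_)
  simp only [Real.enorm_eq_ofReal_abs]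

/-- measurable majorant of the maximal function -/
noncomputable def T (O P : Op c B) (q L : ℝ) (f : ℝ × ℝ → ℝ) (ω : ℝ × ℝ) : ℝ≥0∞ :=
  ∫⁻ r in Icc (-c) c, (ofReal (|O.u L 1 1 f (ω.1,ω.2,r)|^q) + ofReal (|P.u L 1 1 f (ω.1,ω.2,r)|^q))

theorem T_meas0 (q L : ℝ) (f : ℝ × ℝ → ℝ) (hf : Measurable f) : Measurable (fun z => ofReal (|O.u L 1 1 f z|^q)) :=
  ((O.u_meas L 1 1 f hf).abs.pow_const q).ennreal_ofReal

theorem T_meas (q L : ℝ) (f : ℝ × ℝ → ℝ) (hf : Measurable f) : Measurable (T O P q L f) := by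
  refine Measurable.lintegral_prod_right' (f := fun w : (ℝ × ℝ) × ℝ => ofReal (|O.u L 1 1 f (w.1.1,w.1.2,w.2)|^q) + ofReal (|P.u L 1 1 f (w.1.1,w.1.2,w.2)|^q)) ?_
  have := ((T_meas0 (O := O) q L f hf).add (T_meas0 (O := P) q L f hf))
  exact this.comp (g := _) (f := fun w : (ℝ × ℝ) × ℝ => (w.1.1,w.1.2,w.2)) (by fun_prop)

theorem T_int (q L : ℝ) (f : ℝ × ℝ → ℝ) (hf : Measurable f) : ∫⁻ ω, T O P q L f ω =
    (∫⁻ z in Sl c, ofReal (|O.u L 1 1 f z|^q)) + ∫⁻ z in Sl c, ofReal (|P.u L 1 1 f z|^q) := by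
  rw [← lintegral_add_left (T_meas0 (O := O) q L f hf), slab_lint c (fun z => ofReal (|O.u L 1 1 f z|^q) + ofReal (|P.u L 1 1 f z|^q)) ((T_meas0 (O := O) q L f hf).add (T_meas0 (O := P) q L f hf))]
  unfold T
  rw [lintegral_lintegral_swap]
  have := ((T_meas0 (O := O) q L f hf).add (T_meas0 (O := P) q L f hf))
  exact (this.comp (g := _) (f := fun w : (ℝ × ℝ) × ℝ => (w.1.1,w.1.2,w.2)) (by fun_prop)).aemeasurable

theorem Sharp.sup_bd (S : Sharp O P) {q : ℝ} (hq : 1 ≤ q) {L : ℝ} (hL : 1 ≤ L) (ω : ℝ × ℝ) {r : ℝ} (hr : |r| ≤ c) (f : ℝ × ℝ → ℝ) (hf : Measurable f) (hF : ∀ t, |f t| ≤ 1) :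
    ofReal |O.u L 1 1 f (ω.1,ω.2,r)| ^ q ≤ ofReal (2^(q-1)/c*L) * T O P q L f ω := by
  have hL0 : 0 < L := by linarith
  have hc := O.hc
  have hq0 : 0 < q := by linarith
  set ℓ := c / L with hℓ
  have hℓ0 : 0 < ℓ := by positivity
  have hℓc : ℓ ≤ c := div_le_self hc.le hL
  obtain ⟨s, hs, hs1, hs2⟩ : ∃ s, r ∈ Icc s (s+ℓ) ∧ -c ≤ s ∧ s + ℓ ≤ c := by
    rw [abs_le] at hr
    rcases le_total r 0 with h | h
    · exact ⟨r, ⟨le_rfl, by linarith⟩, hr.1, by linarith⟩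
    · exact ⟨r-ℓ, ⟨by linarith, by linarith⟩, by linarith, by linarith⟩
  set J := Icc s (s+ℓ) with hJ
  have hJs : J ⊆ Icc (-c) c := Icc_subset_Icc hs1 hs2
  have hvJ : volume J = ofReal ℓ := by rw [hJ, Real.volume_Icc]; congr 1; ring
  set a := ofReal |O.u L 1 1 f (ω.1,ω.2,r)| with ha
  set U : ℝ → ℝ≥0∞ := fun r => ofReal |O.u L 1 1 f (ω.1,ω.2,r)| with hU
  set V : ℝ → ℝ≥0∞ := fun r => ofReal |P.u L 1 1 f (ω.1,ω.2,r)| with hV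
  have hg : Measurable (fun r : ℝ => ((ω.1,ω.2,r) : ℝ × ℝ × ℝ)) := by fun_prop
  have hUm : Measurable U := ((O.u_meas L 1 1 f hf).comp hg).abs.ennreal_ofReal
  have hVm : Measurable V := ((P.u_meas L 1 1 f hf).comp hg).abs.ennreal_ofReal
  have h1 : ∀ r0 ∈ J, a ^ q ≤ 2^(q-1) * (U r0 ^ q + (ofReal L * ∫⁻ r in J, V r)^q) := by
    intro r0 h0
    have := S.u_diff hL ω.1 ω.2 (r0 := r0) (r1 := r) (abs_le.2 (hJs h0)) hr f hf hF
    refine le_trans (ENNReal.rpow_le_rpow (this.trans ?_) hq0.le) (ENNReal.rpow_add_le_mul_rpow_add_rpow _ _ hq)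
    refine add_le_add_right (mul_le_mul_right (lintegral_mono_set ?_) _) _
    exact ordConnected_Icc.uIcc_subset h0 hs
  have h2 : a^q * ofReal ℓ ≤ 2^(q-1) * (∫⁻ r in J, (U r ^ q + V r ^ q)) := by
    calc a^q * ofReal ℓ = ∫⁻ r0 in J, a^q := by rw [setLIntegral_const, hvJ]
      _ ≤ ∫⁻ r0 in J, 2^(q-1) * (U r0 ^ q + (ofReal L * ∫⁻ r in J, V r)^q) := setLIntegral_mono' measurableSet_Icc h1
      _ = 2^(q-1) * ((∫⁻ r in J, U r ^ q) + (ofReal L * ∫⁻ r in J, V r)^q * ofReal ℓ) := by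
        rw [lintegral_const_mul _ ((hUm.pow_const q).add_const _), lintegral_add_right _ measurable_const, setLIntegral_const, hvJ]
      _ ≤ _ := by
        rw [lintegral_add_left (hUm.pow_const q)]
        refine mul_le_mul_right (add_le_add_right ?_ _) _
        have j := jensen (volume.restrict J) V hVm hq
        rw [Measure.restrict_apply_univ, hvJ] at j
        rw [ENNReal.mul_rpow_of_nonneg _ _ hq0.le]
        calc _ ≤ ofReal L ^ q * (ofReal ℓ ^ (q-1) * ∫⁻ r in J, V r ^ q) * ofReal ℓ := by gcongr
          _ = (ofReal L * ofReal ℓ)^q * ∫⁻ r in J, V r ^ q := by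
            rw [ENNReal.mul_rpow_of_nonneg _ _ hq0.le, show ofReal ℓ ^ q = ofReal ℓ ^ (q-1) * ofReal ℓ by
              nth_rewrite 3 [← ENNReal.rpow_one (ofReal ℓ)]; rw [← ENNReal.rpow_add _ _ (by simpa using hℓ0) ofReal_ne_top]; congr 1; ring]
            ring
          _ ≤ 1 * ∫⁻ r in J, V r ^ q := by
            refine mul_le_mul_left ?_ _
            rw [← ofReal_mul hL0.le, hℓ, mul_div_cancel₀ _ hL0.ne']
            refine ENNReal.rpow_le_one ?_ hq0.le
            rw [ENNReal.ofReal_le_one]; exact O.hc1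
          _ = _ := one_mul _
  have h3 : ∫⁻ r in J, (U r ^ q + V r ^ q) ≤ T O P q L f ω := by
    unfold T
    refine (lintegral_mono_set hJs).trans (le_of_eq ?_)
    refine lintegral_congr fun r => ?_
    rw [← ENNReal.ofReal_rpow_of_nonneg (abs_nonneg _) hq0.le, ← ENNReal.ofReal_rpow_of_nonneg (abs_nonneg _) hq0.le]
  calc a^q = (a^q * ofReal ℓ) * ofReal (L/c) := by
        rw [mul_assoc, ← ofReal_mul hℓ0.le, hℓ, div_mul_div_cancel₀' (by positivity), div_self (by positivity), ENNReal.ofReal_one, mul_one]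
    _ ≤ (2^(q-1) * T O P q L f ω) * ofReal (L/c) := mul_le_mul_left (h2.trans (mul_le_mul_right h3 _)) _
    _ = _ := by
        rw [show 2^(q-1)/c*L = 2^(q-1) * (L/c) by ring, ofReal_mul (p := 2^(q-1)) (by positivity), ← ENNReal.ofReal_rpow_of_pos (by norm_num)]
        norm_num; ring

end Op
end MS
namespace MS

/-- normalised dyadic level pieces -/
noncomputable def pc (N : ℝ) (F : ℝ × ℝ → ℝ) (i : ℕ) (t : ℝ × ℝ) : ℝ :=
  if (i = 0 ∨ 2^i * N < 2 * F t) ∧ F t ≤ 2^i * N then F t / (2^i * N) else 0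

theorem pc_meas (N : ℝ) (F : ℝ × ℝ → ℝ) (hF : Measurable F) (i : ℕ) : Measurable (pc N F i) := by
  refine Measurable.ite ?_ (hF.div_const _) measurable_const
  refine MeasurableSet.inter (MeasurableSet.union (MeasurableSet.const _) (measurableSet_lt measurable_const (hF.const_mul 2))) (measurableSet_le hF measurable_const)

theorem pc_nonneg {N : ℝ} (hN : 0 < N) {F : ℝ × ℝ → ℝ} (hF : ∀ t, 0 ≤ F t) (i : ℕ) (t : ℝ × ℝ) : 0 ≤ pc N F i t := by
  unfold pc; split_ifs
  · have := hF t; positivity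
  · exact le_rfl

theorem pc_abs {N : ℝ} (hN : 0 < N) {F : ℝ × ℝ → ℝ} (hF : ∀ t, 0 ≤ F t) (i : ℕ) (t : ℝ × ℝ) : |pc N F i t| ≤ 1 := by
  rw [abs_of_nonneg (pc_nonneg hN hF i t)]
  unfold pc; split_ifs with h
  · rw [div_le_one (by positivity)]; exact h.2
  · exact zero_le_one

theorem pc_sum {N : ℝ} (hN : 0 < N) {F : ℝ × ℝ → ℝ} (hF : ∀ t, 0 ≤ F t) {I : ℕ} (hI : ∀ t, F t ≤ 2^I * N) (t : ℝ × ℝ) :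
    F t = ∑ i ∈ Finset.range (I+1), 2^i * N * pc N F i t := by
  classical
  have hex : ∃ i, F t ≤ 2^i * N := ⟨I, hI t⟩
  set k := Nat.find hex with hk
  have h1 : F t ≤ 2^k * N := Nat.find_spec hex
  have h2 : ∀ i < k, 2^i * N < F t := fun i hi => not_le.1 (Nat.find_min hex hi)
  have h3 : k ≤ I := Nat.find_min' hex (hI t)
  rw [Finset.sum_eq_single k]
  · unfold pc
    rw [if_pos, mul_div_cancel₀ _ (by positivity)]
    refine ⟨?_, h1⟩
    rcases Nat.eq_zero_or_pos k with h | h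
    · exact Or.inl h
    · right
      have := h2 (k-1) (by omega)
      obtain ⟨l, hl⟩ : ∃ l, k = l+1 := ⟨k-1, by omega⟩
      rw [hl] at this ⊢
      simp only [Nat.add_sub_cancel] at this
      rw [pow_succ]; linarith
  · intro i _ hik
    unfold pc
    rw [if_neg, mul_zero]
    rintro ⟨h4, h5⟩
    rcases lt_or_gt_of_ne hik with h | h
    · linarith [h2 i h]
    · rcases h4 with h4 | h4
      · omega
      · have : (2:ℝ)^(k+1) ≤ 2^i := pow_le_pow_right₀ (by norm_num) h
        rw [pow_succ] at this
        nlinarith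
  · intro h; exact absurd (Finset.mem_range.2 (by omega)) h

theorem pc_N2 {N V p : ℝ} (hN : 0 < N) (hV : 0 < V) (hp : 0 < p) {F : ℝ × ℝ → ℝ} (hFm : Measurable F) (hF : ∀ t, 0 ≤ F t) {S : Set (ℝ × ℝ)} (hS : MeasurableSet S)
    (hSV : volume S ≤ ofReal V) (hFS : ∀ t ∉ S, F t = 0) (hA : ∫⁻ t, ofReal (F t ^ p) = ofReal (N^p)) (i : ℕ) :
    ∫⁻ t, ofReal (pc N F i t ^ 2) ≤ ofReal ((V + 2^p) * 2^(-(p*i))) := by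
  have h1 : ∀ t, ofReal (pc N F i t ^ 2) ≤ ofReal (2^(-(p*i))) * (S.indicator (fun _ => 1) t + ofReal (2^p * (N^p)⁻¹) * ofReal (F t ^ p)) := by
    intro t
    have ha := abs_le.1 (pc_abs hN hF i t)
    have h0 := pc_nonneg hN hF i t
    by_cases hz : pc N F i t = 0
    · rw [hz]; simp
    have hle : ofReal (pc N F i t ^ 2) ≤ 1 := by
      rw [ENNReal.ofReal_le_one]; nlinarith
    have hcond : (i = 0 ∨ 2^i * N < 2 * F t) ∧ F t ≤ 2^i * N := by
      by_contra h; apply hz; unfold pc; rw [if_neg h]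
    have htS : t ∈ S := by
      by_contra h; apply hz; unfold pc; rw [hFS t h]; simp
    rcases hcond.1 with hi | hi
    · subst hi
      rw [indicator_of_mem htS]
      simp only [Nat.cast_zero, mul_zero, neg_zero, Real.rpow_zero, ENNReal.ofReal_one, one_mul]
      exact hle.trans le_self_add
    · refine hle.trans ?_
      refine le_trans ?_ (mul_le_mul_right le_add_self _)
      rw [← ofReal_mul (by positivity), ← ofReal_mul (by positivity), ← ENNReal.ofReal_one]
      refine ofReal_le_ofReal ?_
      have h2 : 1 ≤ (2 * F t / (2^i * N))^p := by
        refine Real.one_le_rpow ?_ hp.le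
        rw [one_le_div (by positivity)]; exact hi.le
      rw [Real.div_rpow (by have := hF t; positivity) (by positivity), Real.mul_rpow (by norm_num) (hF t), Real.mul_rpow (by positivity) hN.le] at h2
      refine h2.trans (le_of_eq ?_)
      rw [Real.rpow_neg (by norm_num), mul_comm p, Real.rpow_mul (by norm_num), Real.rpow_natCast]
      field_simp
  refine (lintegral_mono h1).trans ?_
  rw [lintegral_const_mul' _ _ ofReal_ne_top, lintegral_add_left ((show Measurable fun _ : ℝ × ℝ => (1:ℝ≥0∞) from measurable_const).indicator hS), lintegral_const_mul' _ _ ofReal_ne_top, hA, lintegral_indicator hS, setLIntegral_one, ← ofReal_mul (by positivity)]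
  rw [mul_comm (V + 2^p), ofReal_mul (p := 2^(-(p*i))) (by positivity)]
  refine mul_le_mul_right ?_ _
  rw [ENNReal.ofReal_add hV.le (by positivity)]
  refine add_le_add hSV (ofReal_le_ofReal (le_of_eq ?_))
  field_simp

namespace Op
variable {c B : ℝ} {O P : Op c B}

theorem T_core {q m : ℝ} (hm : 1 ≤ m) (hm2 : m < 2) (hq : 3*m-1 < q) : ∃ C δ : ℝ, 0 < C ∧ 0 < δ ∧ ∀ (L : ℝ), 1 ≤ L → ∀ (f : ℝ × ℝ → ℝ), Measurable f → (∀ t, |f t| ≤ 1) →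
    ∫⁻ ω, T O P q L f ω ≤ (∫⁻ t, ofReal (f t ^ 2))^m * ofReal (C * L^(-1-δ)) := by
  obtain ⟨C1, d1, hC1, hd1, k1⟩ := O.core hm hm2 hq
  obtain ⟨C2, d2, hC2, hd2, k2⟩ := P.core hm hm2 hq
  refine ⟨C1 + C2, min d1 d2, by positivity, by positivity, ?_⟩
  intro L hL f hf hF
  have hL0 : 0 < L := by linarith
  rw [T_int q L f hf]
  refine (add_le_add (k1 L hL f hf hF) (k2 L hL f hf hF)).trans ?_
  rw [← mul_add, ← ENNReal.ofReal_add (by positivity) (by positivity)]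
  refine mul_le_mul_right (ofReal_le_ofReal ?_) _
  rw [add_mul]
  have := min_le_left d1 d2
  have := min_le_right d1 d2
  gcongr <;> linarith

theorem u_int {L : ℝ} (hL : 1 ≤ L) {z : ℝ × ℝ × ℝ} (hz : |z.2.2| ≤ c) (f : ℝ × ℝ → ℝ) (hf : Measurable f) {M : ℝ} (hF : ∀ t, |f t| ≤ M) :
    Integrable (fun t => O.K L 1 1 z t * f t) :=
  (O.K_int hL adm11 hz).mul_bdd (c := M) hf.aestronglyMeasurable (Filter.Eventually.of_forall hF)

set_option maxHeartbeats 1000000 in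
theorem Sharp.locest (S : Sharp O P) {p q V : ℝ} (hp : 1 < p) (hpq : p ≤ q) (h2 : q < 2*p) (h3 : 3*(q/p)-1 < q) (hV : 0 < V) :
    ∃ C δ : ℝ, 0 < C ∧ 0 < δ ∧ ∀ (L : ℝ), 1 ≤ L → ∀ (F : ℝ × ℝ → ℝ), Measurable F → (∀ t, 0 ≤ F t) → ∀ M : ℝ, (∀ t, F t ≤ M) →
      ∀ E : Set (ℝ × ℝ), MeasurableSet E → volume E ≤ ofReal V → (∀ t ∉ E, F t = 0) →
      ∃ W : ℝ × ℝ → ℝ≥0∞, Measurable W ∧ (∀ (ω : ℝ × ℝ) r, |r| ≤ c → ofReal |O.u L 1 1 F (ω.1,ω.2,r)| ^ q ≤ W ω) ∧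
        ∫⁻ ω, W ω ≤ ofReal (C * L^(-δ)) * (∫⁻ t, ofReal (F t ^ p))^(q/p) := by
  have hp0 : 0 < p := by linarith
  have hq1 : 1 ≤ q := by linarith
  have hq0 : 0 < q := by linarith
  have hc := O.hc
  obtain ⟨m, hm1, hm2⟩ : ∃ m, q/p < m ∧ m < min 2 ((q+1)/3) := by
    refine exists_between (lt_min ?_ ?_)
    · rw [div_lt_iff₀ hp0]; exact h2
    · linarith
  have hm2' : m < 2 := hm2.trans_le (min_le_left _ _)
  have hm3 : 3*m - 1 < q := by have := hm2.trans_le (min_le_right _ _); linarith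
  have hm1' : 1 ≤ m := by
    have : 1 ≤ q/p := by rw [one_le_div hp0]; exact hpq
    linarith
  have hpm : 0 < p*m - q := by rw [div_lt_iff₀ hp0] at hm1; linarith
  obtain ⟨C, δ, hC, hδ, hT⟩ := T_core (O := O) (P := P) hm1' hm2' hm3
  set γ := (p*m-q)/2 with hγ
  obtain ⟨Cs, hCs, hs⟩ := sumL q γ hq0 (by positivity)
  set ρ : ℝ := 2^(-γ) with hρ
  have hρ0 : 0 < ρ := by positivity
  have hρ1 : ρ < 1 := Real.rpow_lt_one_of_one_lt_of_neg (by norm_num) (by have : 0 < γ := by positivity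
                                                                          linarith)
  set C0 := (Cs.toReal + 1) * (2^(q-1)/c) * C * (V+2^p)^m * (1-ρ)⁻¹ with hC0
  have h1ρ : 0 < 1 - ρ := by linarith
  refine ⟨C0, δ, by positivity, hδ, ?_⟩
  intro L hL F hFm hF M hM E hE hEV hFE
  have hL0 : 0 < L := by linarith
  set A := ∫⁻ t, ofReal (F t ^ p) with hA
  have hFpm : Measurable fun t => ofReal (F t ^ p) := (hFm.pow_const p).ennreal_ofReal
  by_cases hA0 : A = 0
  · refine ⟨fun _ => 0, measurable_const, ?_, by simp⟩
    intro ω r hr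
    rw [hA, lintegral_eq_zero_iff hFpm] at hA0
    have : O.u L 1 1 F (ω.1,ω.2,r) = 0 := by
      unfold Op.u
      refine integral_eq_zero_of_ae ?_
      filter_upwards [hA0] with t ht
      simp only [Pi.zero_apply, ENNReal.ofReal_eq_zero] at ht ⊢
      have : F t = 0 := by
        by_contra h
        have := Real.rpow_pos_of_pos (lt_of_le_of_ne (hF t) (Ne.symm h)) p
        linarith
      rw [this, mul_zero]
    rw [this]; simp [hq0]
  have hAt : A ≠ ∞ := by
    have : A ≤ ∫⁻ t, E.indicator (fun _ => ofReal (M^p)) t := by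
      refine lintegral_mono fun t => ?_
      by_cases ht : t ∈ E
      · rw [indicator_of_mem ht]
        exact ofReal_le_ofReal (Real.rpow_le_rpow (hF t) (hM t) hp0.le)
      · simp [hFE t ht, Real.zero_rpow hp0.ne']
    refine ne_top_of_le_ne_top ?_ this
    rw [lintegral_indicator hE, setLIntegral_const]
    exact ENNReal.mul_ne_top ofReal_ne_top (ne_top_of_le_ne_top ofReal_ne_top hEV)
  set N := A.toReal^(1/p) with hN
  have hAr : 0 < A.toReal := ENNReal.toReal_pos hA0 hAt
  have hN0 : 0 < N := by positivity
  have hNp : A = ofReal (N^p) := by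
    rw [hN, ← Real.rpow_mul hAr.le, one_div_mul_cancel hp0.ne', Real.rpow_one, ENNReal.ofReal_toReal hAt]
  obtain ⟨I, hI⟩ := pow_unbounded_of_one_lt (M/N) (by norm_num : (1:ℝ) < 2)
  have hI' : ∀ t, F t ≤ 2^I * N := fun t => (hM t).trans (by rw [div_lt_iff₀ hN0] at hI; exact hI.le)
  have hpm' := pc_meas N F hFm
  have hpa := pc_abs hN0 hF
  refine ⟨fun ω => Cs * ∑' i : ℕ, ofReal (2^(γ*i)) * (ofReal ((2^i*N)^q) * (ofReal (2^(q-1)/c*L) * T O P q L (pc N F i) ω)), ?_, ?_, ?_⟩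
  · refine Measurable.const_mul (Measurable.ennreal_tsum fun i => ?_) _
    exact (((T_meas q L _ (hpm' i)).const_mul _).const_mul _).const_mul _
  · intro ω r hr
    have e1 : O.u L 1 1 F (ω.1,ω.2,r) = ∑ i ∈ Finset.range (I+1), 2^i*N * O.u L 1 1 (pc N F i) (ω.1,ω.2,r) := by
      unfold Op.u
      simp_rw [← integral_const_mul]
      rw [← integral_finsetSum _ (fun i _ => (O.u_int hL (z := (ω.1,ω.2,r)) hr _ (hpm' i) (hpa i)).const_mul _)]
      refine integral_congr_ae (Filter.Eventually.of_forall fun t => ?_)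
      simp only
      rw [pc_sum hN0 hF hI' t, Finset.mul_sum]
      exact Finset.sum_congr rfl fun i _ => by ring
    set a : ℕ → ℝ≥0∞ := fun i => ofReal (2^i*N) * ofReal |O.u L 1 1 (pc N F i) (ω.1,ω.2,r)| with ha
    have e2 : ofReal |O.u L 1 1 F (ω.1,ω.2,r)| ≤ ∑' i, a i := by
      rw [e1]
      refine (ofReal_le_ofReal (Finset.abs_sum_le_sum_abs _ _)).trans ?_
      rw [ENNReal.ofReal_sum_of_nonneg (fun i _ => abs_nonneg _)]
      refine le_trans (Finset.sum_le_sum fun i _ => ?_) (ENNReal.sum_le_tsum (f := a) (Finset.range (I+1)))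
      rw [abs_mul, abs_of_nonneg (by positivity : 0 ≤ 2^i*N), ofReal_mul (by positivity)]
    refine (ENNReal.rpow_le_rpow e2 hq0.le).trans ((hs a).trans ?_)
    refine mul_le_mul_right (ENNReal.tsum_le_tsum fun i => mul_le_mul_right ?_ _) _
    rw [ha]
    simp only
    rw [ENNReal.mul_rpow_of_nonneg _ _ hq0.le, ENNReal.ofReal_rpow_of_nonneg (by positivity) hq0.le]
    exact mul_le_mul_right (S.sup_bd hq1 hL ω hr _ (hpm' i) (hpa i)) _
  · rw [lintegral_const_mul' _ _ hCs, lintegral_tsum (fun i => ((((T_meas q L _ (hpm' i)).const_mul _).const_mul _).const_mul _).aemeasurable)]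
    have e3 : ∀ i : ℕ, ∫⁻ ω, ofReal (2^(γ*i)) * (ofReal ((2^i*N)^q) * (ofReal (2^(q-1)/c*L) * T O P q L (pc N F i) ω)) ≤
        ofReal (2^(q-1)/c * C * (V+2^p)^m * L^(-δ) * N^q) * ofReal (ρ^i) := by
      intro i
      rw [lintegral_const_mul' _ _ ofReal_ne_top, lintegral_const_mul' _ _ ofReal_ne_top, lintegral_const_mul' _ _ ofReal_ne_top]
      have k1 := hT L hL _ (hpm' i) (hpa i)
      have k2 := ENNReal.rpow_le_rpow (pc_N2 hN0 hV hp0 hFm hF hE hEV hFE hNp i) (by linarith : 0 ≤ m)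
      rw [ENNReal.ofReal_rpow_of_nonneg (by positivity) (by linarith)] at k2
      calc _ ≤ ofReal (2^(γ*i)) * (ofReal ((2^i*N)^q) * (ofReal (2^(q-1)/c*L) * (ofReal (((V + 2^p) * 2^(-(p*i)))^m) * ofReal (C * L^(-1-δ))))) := by
            refine mul_le_mul_right (mul_le_mul_right (mul_le_mul_right (k1.trans (mul_le_mul_left k2 _)) _) _) _
        _ = _ := by
            rw [← ofReal_mul (by positivity), ← ofReal_mul (by positivity), ← ofReal_mul (by positivity), ← ofReal_mul (by positivity), ← ofReal_mul (by positivity)]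
            congr 1
            have x1 : L^(-1-δ) = L^(-δ) / L := by rw [show -1-δ = -δ-1 by ring, Real.rpow_sub_one hL0.ne']
            have x2 : (2:ℝ)^(γ*i) * (((2:ℝ)^i)^q * ((2:ℝ)^(-(p*i)))^m) = ρ^i := by
              rw [hρ, ← Real.rpow_natCast, ← Real.rpow_natCast, ← Real.rpow_mul (by norm_num), ← Real.rpow_mul (by norm_num), ← Real.rpow_mul (by norm_num), ← Real.rpow_add (by norm_num), ← Real.rpow_add (by norm_num)]
              congr 1; rw [hγ]; ring
            rw [x1, ← x2, Real.mul_rpow (by positivity) hN0.le, Real.mul_rpow (by positivity) (by positivity)]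
            field_simp
    refine (mul_le_mul_right (ENNReal.tsum_le_tsum e3) _).trans ?_
    rw [ENNReal.tsum_mul_left, ← ENNReal.ofReal_tsum_of_nonneg (fun i => by positivity) (summable_geometric_of_lt_one hρ0.le hρ1), tsum_geometric_of_lt_one hρ0.le hρ1,
      hNp, ENNReal.ofReal_rpow_of_nonneg (by positivity) (by positivity), ← Real.rpow_mul hN0.le, mul_div_cancel₀ _ hp0.ne', ← ENNReal.ofReal_toReal hCs,
      ← ofReal_mul (by positivity), ← ofReal_mul (by positivity), ← ofReal_mul (by positivity)]
    refine ofReal_le_ofReal ?_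
    rw [hC0]
    calc _ ≤ (Cs.toReal + 1) * (2^(q-1)/c * C * (V+2^p)^m * L^(-δ) * N^q * (1-ρ)⁻¹) := by
          gcongr; linarith
      _ = _ := by ring

end Op
/-- a nonnegative bump with integral one -/
structure Bump (Φ : ℝ → ℝ) (M : ℝ) : Prop where
  cont : Continuous Φ
  nn : ∀ t, 0 ≤ Φ t
  le : ∀ t, Φ t ≤ M
  supp : ∀ t, 1 < |t| → Φ t = 0
  one : ∫ t, Φ t = 1

namespace Op
variable {c B : ℝ} (O : Op c B)

noncomputable def KΦ (Φ : ℝ → ℝ) (L : ℝ) (z : ℝ × ℝ × ℝ) (t : ℝ × ℝ) : ℝ :=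
  L * Φ (L * (z.2.1 - t.2 - O.G (z.1 - t.1) z.2.2)) * chi 1 1 (z.1 - t.1)

noncomputable def UΦ (Φ : ℝ → ℝ) (L : ℝ) (g : ℝ × ℝ → ℝ) (z : ℝ × ℝ × ℝ) : ℝ := ∫ t, O.KΦ Φ L z t * g t

/-- averages along the curves -/
noncomputable def Av (g : ℝ × ℝ → ℝ) (z : ℝ × ℝ × ℝ) : ℝ := ∫ v, chi 1 1 v * g (z.1 - v, z.2.1 - O.G v z.2.2)

theorem chi_cs : HasCompactSupport (chi 1 1) := by
  refine HasCompactSupport.intro (isCompact_Icc (a := (1/2:ℝ)) (b := 2)) fun v hv => (chi_zero fun h => hv (Sn_sub adm11 h)).1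

theorem cGs (r : ℝ) : Continuous (fun v => O.G v r) := O.cG.comp (f := fun v : ℝ => (v, r)) (by fun_prop)

variable {Φ : ℝ → ℝ} {M : ℝ} (b : Bump Φ M) {g : ℝ × ℝ → ℝ} (hg : Continuous g) (hs : HasCompactSupport g)

include b hg hs in
theorem KΦ_int (L : ℝ) (z : ℝ × ℝ × ℝ) : Integrable (fun t => O.KΦ Φ L z t * g t) := by
  have h1 := b.cont
  have h2 := O.cGs z.2.2
  refine Continuous.integrable_of_hasCompactSupport ?_ hs.mul_left
  unfold Op.KΦ
  fun_prop

include b in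
theorem b_int : Integrable Φ := b.cont.integrable_of_hasCompactSupport
  (HasCompactSupport.intro (isCompact_Icc (a := (-1:ℝ)) (b := 1)) fun v hv => b.supp v (by
    by_contra h; exact hv (abs_le.1 (not_lt.1 h))))

include b hg hs in
theorem UΦ_lim (z : ℝ × ℝ × ℝ) : Filter.Tendsto (fun J : ℕ => O.UΦ Φ (2^J) g z) Filter.atTop (nhds (O.Av g z)) := by
  have h1 := b.cont
  have h2 := O.cGs z.2.2
  have hΦ := b_int b
  obtain ⟨Mg, hMg⟩ := hg.bounded_above_of_compact_support hs
  have hI : Integrable (fun w : ℝ × ℝ => chi 1 1 w.1 * Φ w.2) := ((chi_cont 1 1).integrable_of_hasCompactSupport chi_cs).mul_prod hΦ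
  have e : ∀ J : ℕ, O.UΦ Φ (2^J) g z = ∫ w : ℝ × ℝ, (chi 1 1 w.1 * Φ w.2) * g (z.1 - w.1, z.2.1 - O.G w.1 z.2.2 - w.2 / 2^J) := by
    intro J
    have hJ : (0:ℝ) < 2^J := by positivity
    have hi : Integrable (fun w : ℝ × ℝ => (chi 1 1 w.1 * Φ w.2) * g (z.1 - w.1, z.2.1 - O.G w.1 z.2.2 - w.2 / 2^J)) :=
      hI.mul_bdd (c := Mg) (Continuous.aestronglyMeasurable (by fun_prop)) (Filter.Eventually.of_forall fun w => hMg _)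
    unfold Op.UΦ
    have i1 := O.KΦ_int b hg hs (2^J) z
    rw [Measure.volume_eq_prod] at i1 hi ⊢
    rw [integral_prod _ i1, integral_prod _ hi, ← integral_sub_left_eq_self _ _ z.1]
    refine integral_congr_ae (Filter.Eventually.of_forall fun v => ?_)
    simp only
    rw [← integral_sub_left_eq_self _ _ (z.2.1 - O.G v z.2.2)]
    have := Measure.integral_comp_mul_left (fun s => (chi 1 1 v * Φ s) * g (z.1 - v, z.2.1 - O.G v z.2.2 - s / 2^J)) ((2:ℝ)^J)
    rw [abs_of_pos (by positivity), smul_eq_mul, inv_mul_eq_div, eq_div_iff hJ.ne', ← integral_mul_const] at this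
    rw [← this]
    refine integral_congr_ae (Filter.Eventually.of_forall fun s => ?_)
    simp only [Op.KΦ]
    rw [show z.1 - (z.1 - v) = v by ring, show z.2.1 - (z.2.1 - O.G v z.2.2 - s) - O.G v z.2.2 = s by ring, mul_div_cancel_left₀ _ hJ.ne']
    ring
  have e2 : O.Av g z = ∫ w : ℝ × ℝ, (chi 1 1 w.1 * Φ w.2) * g (z.1 - w.1, z.2.1 - O.G w.1 z.2.2 - 0) := by
    have := integral_prod_mul (μ := (volume : Measure ℝ)) (ν := (volume : Measure ℝ)) (fun v => chi 1 1 v * g (z.1 - v, z.2.1 - O.G v z.2.2)) Φ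
    rw [b.one, mul_one, ← Measure.volume_eq_prod] at this
    unfold Op.Av
    rw [← this]
    refine integral_congr_ae (Filter.Eventually.of_forall fun w => ?_)
    simp only [sub_zero]; ring
  simp_rw [e]
  rw [e2]
  refine tendsto_integral_of_dominated_convergence (fun w => Mg * ‖chi 1 1 w.1 * Φ w.2‖) (fun J => Continuous.aestronglyMeasurable (by fun_prop)) (hI.norm.const_mul _) ?_ ?_
  · intro J
    refine Filter.Eventually.of_forall fun w => ?_
    rw [norm_mul, mul_comm]
    exact mul_le_mul_of_nonneg_right (hMg _) (norm_nonneg _)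
  · refine Filter.Eventually.of_forall fun w => ?_
    refine Filter.Tendsto.const_mul _ ((hg.tendsto _).comp ?_)
    refine Filter.Tendsto.prodMk_nhds tendsto_const_nhds (Filter.Tendsto.sub tendsto_const_nhds ?_)
    have := (tendsto_pow_atTop_nhds_zero_of_lt_one (r := (1/2:ℝ)) (by norm_num) (by norm_num)).const_mul w.2
    simpa [div_eq_mul_inv] using this

variable {P : Op c B} (S : Sharp O P) {κ : ℝ} (hκ : 0 < κ) (hψ : ∀ t, O.ψ t = κ * (2 * Φ (2*t) - Φ t))

include b hg hs S hκ hψ in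
theorem Av_le (z : ℝ × ℝ × ℝ) : ofReal (O.Av g z) ≤ ofReal |O.UΦ Φ 1 g z| +
    ofReal κ⁻¹ * ∑' j : ℕ, ofReal |O.u (2^j) 1 1 g z| := by
  have h1 : ∀ L, O.UΦ Φ (2*L) g z - O.UΦ Φ L g z = κ⁻¹ * O.u L 1 1 g z := by
    intro L
    unfold Op.UΦ Op.u
    rw [← integral_sub (O.KΦ_int b hg hs _ z) (O.KΦ_int b hg hs _ z), ← integral_const_mul]
    refine integral_congr_ae (Filter.Eventually.of_forall fun t => ?_)
    simp only [Op.KΦ, Op.K, hψ, S.ham]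
    rw [mul_assoc 2 L]
    field_simp
    try ring
  have h2 : ∀ J : ℕ, ofReal |O.UΦ Φ (2^J) g z| ≤ ofReal |O.UΦ Φ 1 g z| +
      ofReal κ⁻¹ * ∑ j ∈ Finset.range J, ofReal |O.u (2^j) 1 1 g z| := by
    intro J
    induction J with
    | zero => simp
    | succ J ih =>
      have e : O.UΦ Φ (2^(J+1)) g z = O.UΦ Φ (2^J) g z + κ⁻¹ * O.u (2^J) 1 1 g z := by rw [← h1, pow_succ']; ring
      rw [Finset.sum_range_succ, mul_add, ← add_assoc, e]
      refine (ofReal_le_ofReal (abs_add_le _ _)).trans (ENNReal.ofReal_add_le.trans (add_le_add ih ?_))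
      rw [abs_mul, abs_of_pos (inv_pos.2 hκ), ofReal_mul (by positivity)]
  refine le_of_tendsto (ENNReal.tendsto_ofReal (O.UΦ_lim b hg hs z)) (Filter.Eventually.of_forall fun J => ?_)
  refine (ofReal_le_ofReal (le_abs_self _)).trans ((h2 J).trans ?_)
  exact add_le_add_right (mul_le_mul_right (ENNReal.sum_le_tsum _) _) _

end Op
end MS

namespace MS
namespace Op
variable {c B : ℝ} {O P : Op c B}

def tile (a : ℤ × ℤ) : Set (ℝ × ℝ) := {ω | ⌊ω.1⌋ = a.1 ∧ ⌊ω.2⌋ = a.2}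
def bx (a : ℤ × ℤ) : Set (ℝ × ℝ) := {t | |⌊t.1⌋ - a.1| ≤ 20 ∧ |⌊t.2⌋ - a.2| ≤ 20}

theorem tile_meas (a : ℤ × ℤ) : MeasurableSet (tile a) :=
  ((Int.measurable_floor.comp measurable_fst) (measurableSet_singleton a.1)).inter ((Int.measurable_floor.comp measurable_snd) (measurableSet_singleton a.2))

theorem bx_meas (a : ℤ × ℤ) : MeasurableSet (bx a) := by
  have h : ∀ k : ℤ, MeasurableSet {x : ℝ | |⌊x⌋ - k| ≤ 20} := fun k => Int.measurable_floor (MeasurableSet.of_discrete (s := {n : ℤ | |n - k| ≤ 20}))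
  exact (measurable_fst (h a.1)).inter (measurable_snd (h a.2))

theorem bx_vol (a : ℤ × ℤ) : volume (bx a) ≤ ofReal 1681 := by
  have h : ∀ (x : ℝ) (k : ℤ), |⌊x⌋ - k| ≤ 20 → x ∈ Icc ((k:ℝ) - 20) (k + 21) := by
    intro x k hk
    rw [abs_le] at hk
    have h1 : (-20:ℝ) ≤ ⌊x⌋ - k := by exact_mod_cast hk.1
    have h2 : (⌊x⌋:ℝ) - k ≤ 20 := by exact_mod_cast hk.2
    have := Int.floor_le x
    have := Int.lt_floor_add_one x
    constructor <;> linarith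
  refine (measure_mono (t := Icc ((a.1:ℝ) - 20) (a.1 + 21) ×ˢ Icc ((a.2:ℝ) - 20) (a.2 + 21)) fun t ht => ⟨h _ _ ht.1, h _ _ ht.2⟩).trans ?_
  rw [Measure.volume_eq_prod, Measure.prod_prod, Real.volume_Icc, Real.volume_Icc, ← ofReal_mul (by linarith)]
  refine ofReal_le_ofReal ?_
  ring_nf; norm_num

theorem tile_bx (a : ℤ × ℤ) : tile a ⊆ bx a := fun ω h => by
  refine ⟨?_, ?_⟩
  · rw [h.1]; simp
  · rw [h.2]; simp

theorem fl_near {x y : ℝ} (h : |x - y| ≤ 15) : |⌊y⌋ - ⌊x⌋| ≤ 20 := by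
  rw [abs_le] at h ⊢
  have h1 := Int.floor_le x
  have h2 := Int.lt_floor_add_one x
  have h3 := Int.floor_le y
  have h4 := Int.lt_floor_add_one y
  have h5 : (-20:ℝ) ≤ ⌊y⌋ - ⌊x⌋ := by linarith
  have h6 : (⌊y⌋:ℝ) - ⌊x⌋ ≤ 20 := by linarith
  exact ⟨by exact_mod_cast h5, by exact_mod_cast h6⟩

theorem near (O : Op c B) {L : ℝ} (hL : 1 ≤ L) {a : ℤ × ℤ} {z : ℝ × ℝ × ℝ} {t : ℝ × ℝ} (hz : (z.1,z.2.1) ∈ tile a) (hr : |z.2.2| ≤ c) (h1 : z.1 - t.1 ∈ Sn 1 1)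
    (h2 : |L * (z.2.1 - t.2 - O.G (z.1 - t.1) z.2.2)| ≤ 1) : t ∈ bx a := by
  have h3 := Sn_sub adm11 h1
  have h4 := O.bG _ _ h3 hr
  have h5 : |z.2.1 - t.2 - O.G (z.1 - t.1) z.2.2| ≤ 1 := by
    rw [abs_mul, abs_of_pos (by linarith)] at h2
    nlinarith [abs_nonneg (z.2.1 - t.2 - O.G (z.1 - t.1) z.2.2)]
  rw [abs_le] at h4 h5
  refine ⟨?_, ?_⟩
  · rw [← hz.1]; exact fl_near (abs_le.2 ⟨by linarith [h3.1], by linarith [h3.2]⟩)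
  · rw [← hz.2]; exact fl_near (abs_le.2 ⟨by linarith, by linarith⟩)

variable {Φ : ℝ → ℝ} {M : ℝ} (b : Bump Φ M) (S : Sharp O P) {κ : ℝ} (hκ : 0 < κ) (hψ : ∀ t, O.ψ t = κ * (2 * Φ (2*t) - Φ t))

theorem bx_sum {g : ℝ × ℝ → ℝ} (hg : Measurable g) {p : ℝ} (hp : 0 < p) :
    ∑' a, ∫⁻ t, ofReal ((bx a).indicator g t ^ p) ≤ 1681 * ∫⁻ t, ofReal (g t ^ p) := by
  rw [← lintegral_tsum (fun a => (((hg.indicator (bx_meas a)).pow_const p).ennreal_ofReal).aemeasurable), ← lintegral_const_mul' _ _ (by norm_num)]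
  refine lintegral_mono fun t => ?_
  set T : Finset (ℤ × ℤ) := Finset.Icc (⌊t.1⌋ - 20) (⌊t.1⌋ + 20) ×ˢ Finset.Icc (⌊t.2⌋ - 20) (⌊t.2⌋ + 20) with hT
  have hc : T.card = 1681 := by
    rw [hT, Finset.card_product, Int.card_Icc, Int.card_Icc]
    rw [show ⌊t.1⌋ + 20 + 1 - (⌊t.1⌋ - 20) = 41 by ring, show ⌊t.2⌋ + 20 + 1 - (⌊t.2⌋ - 20) = 41 by ring]; rfl
  simp only
  rw [tsum_eq_sum (s := T)]
  · refine (Finset.sum_le_card_nsmul _ _ (ofReal (g t ^ p)) fun a _ => ?_).trans ?_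
    · by_cases h : t ∈ bx a
      · rw [indicator_of_mem h]
      · rw [indicator_of_notMem h, Real.zero_rpow hp.ne', ENNReal.ofReal_zero]; exact zero_le
    · rw [hc, nsmul_eq_mul]; norm_num
  · intro a ha
    rw [indicator_of_notMem, Real.zero_rpow hp.ne', ENNReal.ofReal_zero]
    intro h
    apply ha
    obtain ⟨h1, h2⟩ := h
    rw [abs_le] at h1 h2
    simp only [hT, Finset.mem_product, Finset.mem_Icc]
    omega

include b in
theorem U1_bd {g : ℝ × ℝ → ℝ} (hg0 : ∀ t, 0 ≤ g t) {p q : ℝ} (hp : 1 < p) (hpq : p ≤ q) (hg : Measurable g) {a : ℤ × ℤ} {z : ℝ × ℝ × ℝ} (hz : (z.1,z.2.1) ∈ tile a) (hr : |z.2.2| ≤ c) :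
    ofReal |O.UΦ Φ 1 g z| ^ q ≤ ofReal M ^ q * (ofReal 1681 ^ (p-1)) ^ (q/p) * (∫⁻ t, ofReal ((bx a).indicator g t ^ p)) ^ (q/p) := by
  have hp0 : 0 < p := by linarith
  have hq0 : 0 < q := by linarith
  have hF0 : ∀ t, 0 ≤ (bx a).indicator g t := fun t => indicator_nonneg (fun t _ => hg0 t) t
  have hM : 0 ≤ M := (b.nn 0).trans (b.le 0)
  have h1 : ofReal |O.UΦ Φ 1 g z| ≤ ofReal M * ∫⁻ t in bx a, ofReal ((bx a).indicator g t) := by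
    rw [← lintegral_const_mul' _ _ ofReal_ne_top, ← Real.norm_eq_abs, ofReal_norm]
    unfold Op.UΦ
    refine (enorm_integral_le_lintegral_enorm _).trans ?_
    rw [← lintegral_indicator (bx_meas a)]
    refine lintegral_mono fun t => ?_
    by_cases h : t ∈ bx a
    · rw [indicator_of_mem h, indicator_of_mem h, ← ofReal_mul hM, ← ofReal_norm, Real.norm_eq_abs, abs_mul, abs_of_nonneg (hg0 t)]
      refine ofReal_le_ofReal (mul_le_mul_of_nonneg_right ?_ (hg0 t))
      unfold Op.KΦ
      rw [one_mul, abs_mul, abs_of_nonneg (b.nn _)]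
      calc _ ≤ M * 1 := mul_le_mul (b.le _) (chi_abs _ _ _) (abs_nonneg _) hM
        _ = M := mul_one M
    · have : O.KΦ Φ 1 z t = 0 := by
        unfold Op.KΦ
        by_cases h1 : z.1 - t.1 ∈ Sn 1 1
        · by_cases h2 : |1 * (z.2.1 - t.2 - O.G (z.1 - t.1) z.2.2)| ≤ 1
          · exact absurd (O.near le_rfl hz hr h1 h2) h
          · rw [b.supp _ (not_le.1 h2)]; ring
        · rw [(chi_zero h1).1, mul_zero]
      simp only [this, zero_mul, enorm_zero]; exact zero_le
  refine (ENNReal.rpow_le_rpow h1 (by linarith)).trans ?_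
  rw [ENNReal.mul_rpow_of_nonneg _ _ (by linarith), mul_assoc]
  refine mul_le_mul_right ?_ _
  rw [← ENNReal.mul_rpow_of_nonneg _ _ (by positivity), show q = p * (q/p) by field_simp, ENNReal.rpow_mul, ← show q = p * (q/p) by field_simp]
  refine ENNReal.rpow_le_rpow ?_ (by positivity)
  refine (jensen (volume.restrict (bx a)) _ ((hg.indicator (bx_meas a)).ennreal_ofReal) hp.le).trans ?_
  refine mul_le_mul' (ENNReal.rpow_le_rpow ?_ (by linarith)) ((setLIntegral_le_lintegral _ _).trans (lintegral_mono fun t => ?_))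
  · rw [Measure.restrict_apply_univ]; exact bx_vol a
  · rw [ENNReal.ofReal_rpow_of_nonneg (hF0 t) hp0.le]

include b S hκ hψ in
theorem thm2 {p q : ℝ} (hp : 1 < p) (hpq : p ≤ q) (h2 : q < 2*p) (h3 : 3*(q/p)-1 < q) : ∃ C : ℝ≥0∞, C ≠ ∞ ∧
    ∀ g : ℝ × ℝ → ℝ, Continuous g → HasCompactSupport g → (∀ t, 0 ≤ g t) → ∃ W : ℝ × ℝ → ℝ≥0∞, Measurable W ∧
      (∀ (ω : ℝ × ℝ) r, |r| ≤ c → ofReal (O.Av g (ω.1,ω.2,r)) ^ q ≤ W ω) ∧ ∫⁻ ω, W ω ≤ C * (∫⁻ t, ofReal (g t ^ p))^(q/p) := by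
  have hp0 : 0 < p := by linarith
  have hq0 : 0 < q := by linarith
  have hm1 : 1 ≤ q/p := (one_le_div hp0).2 hpq
  obtain ⟨C, δ, hC, hδ, hloc⟩ := S.locest hp hpq h2 h3 (V := 1681) (by norm_num)
  obtain ⟨Cs, hCs, hsum⟩ := sumL q (δ/2) hq0 (by linarith)
  set m := q/p with hm
  set ρ : ℝ := 2^(-(δ/2)) with hρ
  have hρ0 : 0 < ρ := by positivity
  have hρ1 : ρ < 1 := Real.rpow_lt_one_of_one_lt_of_neg (by norm_num) (by linarith)
  set D1 : ℝ≥0∞ := ofReal M ^ q * (ofReal 1681 ^ (p-1)) ^ m with hD1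
  set D2 : ℝ≥0∞ := ofReal κ⁻¹ ^ q * Cs with hD2
  have hD1t : D1 ≠ ∞ := by finiteness
  have hD2t : D2 ≠ ∞ := by finiteness
  set D : ℝ≥0∞ := 2^(q-1) * (D1 * ofReal 1681 + D2 * (ofReal C * ofReal (1-ρ)⁻¹)) with hD
  have hDt : D ≠ ∞ := by finiteness
  refine ⟨D * 1681, by finiteness, fun g hg hs hg0 => ?_⟩
  obtain ⟨Mg, hMg⟩ := hg.bounded_above_of_compact_support hs
  have hFm : ∀ a, Measurable ((bx a).indicator g) := fun a => hg.measurable.indicator (bx_meas a)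
  have hF0 : ∀ a t, 0 ≤ (bx a).indicator g t := fun a t => indicator_nonneg (fun t _ => hg0 t) t
  have hFM : ∀ a t, (bx a).indicator g t ≤ Mg := fun a t => (indicator_le_self' (fun x _ => hg0 x) t).trans ((le_abs_self _).trans (hMg t))
  have hex := fun (j : ℕ) (a : ℤ × ℤ) => hloc (2^j) (one_le_pow₀ (by norm_num)) _ (hFm a) (hF0 a) Mg (hFM a) (bx a) (bx_meas a) (bx_vol a) (fun t ht => indicator_of_notMem ht g)
  choose W hWm hWle hWint using hex
  set Y : ℤ × ℤ → ℝ≥0∞ := fun a => ∫⁻ t, ofReal ((bx a).indicator g t ^ p) with hY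
  set Z : ℤ × ℤ → ℝ × ℝ → ℝ≥0∞ := fun a ω => 2^(q-1) * (D1 * Y a ^ m + D2 * ∑' j : ℕ, ofReal (2^(δ/2*j)) * W j a ω) with hZ
  have hSm : ∀ a, Measurable (fun ω => ∑' j : ℕ, ofReal (2^(δ/2*j)) * W j a ω) := fun a => Measurable.tsum (fun j => (hWm j a).const_mul _)
  have hZm : ∀ a, Measurable (Z a) := fun a => ((hSm a).const_mul _).const_add _ |>.const_mul _
  refine ⟨fun ω => ∑' a, (tile a).indicator (Z a) ω, Measurable.tsum (fun a => (hZm a).indicator (tile_meas a)), ?_, ?_⟩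
  · intro ω r hr
    set a : ℤ × ℤ := (⌊ω.1⌋, ⌊ω.2⌋) with ha
    have hω : ω ∈ tile a := ⟨rfl, rfl⟩
    refine le_trans ?_ (ENNReal.le_tsum a)
    rw [indicator_of_mem hω]
    refine (ENNReal.rpow_le_rpow (O.Av_le b hg hs S hκ hψ (ω.1,ω.2,r)) hq0.le).trans ((ENNReal.rpow_add_le_mul_rpow_add_rpow _ _ (by linarith)).trans ?_)
    refine mul_le_mul_right (add_le_add (U1_bd b hg0 hp hpq hg.measurable (z := (ω.1,ω.2,r)) hω hr) ?_) _
    rw [ENNReal.mul_rpow_of_nonneg _ _ hq0.le, hD2, mul_assoc]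
    refine mul_le_mul_right ((hsum _).trans (mul_le_mul_right (ENNReal.tsum_le_tsum fun j => mul_le_mul_right ?_ _) _)) _
    have : O.u (2^j) 1 1 g (ω.1,ω.2,r) = O.u (2^j) 1 1 ((bx a).indicator g) (ω.1,ω.2,r) := by
      unfold Op.u
      refine integral_congr_ae (Filter.Eventually.of_forall fun t => ?_)
      simp only
      by_cases hk : O.K (2^j) 1 1 (ω.1,ω.2,r) t = 0
      · rw [hk]; ring
      · have := O.K_supp hk
        rw [indicator_of_mem (O.near (one_le_pow₀ (by norm_num)) (z := (ω.1,ω.2,r)) hω hr this.1 this.2)]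
    rw [this]
    exact hWle j a ω r hr
  · rw [lintegral_tsum (fun a => ((hZm a).indicator (tile_meas a)).aemeasurable)]
    have k1 : ∀ a, ∫⁻ ω, (tile a).indicator (Z a) ω ≤ D * Y a ^ m := by
      intro a
      rw [lintegral_indicator (tile_meas a)]
      simp only [hZ]
      rw [lintegral_const_mul' _ _ (by finiteness), lintegral_add_left measurable_const, lintegral_const, Measure.restrict_apply_univ, lintegral_const_mul' _ _ hD2t, hD, mul_assoc (2^(q-1) : ℝ≥0∞)]
      refine mul_le_mul_right ?_ _
      rw [add_mul, mul_right_comm]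
      refine add_le_add (mul_le_mul_left (mul_le_mul_right ((measure_mono (tile_bx a)).trans (bx_vol a)) _) _) ?_
      rw [mul_assoc D2 (ofReal C * _)]
      refine mul_le_mul_right ((setLIntegral_le_lintegral _ _).trans ?_) _
      rw [lintegral_tsum (fun j => ((hWm j a).const_mul _).aemeasurable)]
      have k2 : ∀ j : ℕ, ∫⁻ ω, ofReal (2^(δ/2*j)) * W j a ω ≤ ofReal (ρ^j) * (ofReal C * Y a ^ m) := by
        intro j
        rw [lintegral_const_mul' _ _ ofReal_ne_top]
        refine (mul_le_mul_right (hWint j a) _).trans ?_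
        rw [← mul_assoc, ← mul_assoc, ← ofReal_mul (by positivity), ← ofReal_mul (by positivity)]
        refine le_of_eq ?_
        congr 2
        have : (2:ℝ)^(δ/2*j) * ((2:ℝ)^j)^(-δ) = ρ^j := by
          rw [hρ, ← Real.rpow_natCast, ← Real.rpow_natCast, ← Real.rpow_mul (by norm_num), ← Real.rpow_mul (by norm_num), ← Real.rpow_add (by norm_num)]
          congr 1; ring
        rw [← this]; ring
      refine (ENNReal.tsum_le_tsum k2).trans ?_
      rw [ENNReal.tsum_mul_right, ← ENNReal.ofReal_tsum_of_nonneg (fun i => by positivity) (summable_geometric_of_lt_one hρ0.le hρ1), tsum_geometric_of_lt_one hρ0.le hρ1]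
      refine le_of_eq (by ring)
    refine (ENNReal.tsum_le_tsum k1).trans ?_
    rw [ENNReal.tsum_mul_left, mul_assoc D 1681]
    refine mul_le_mul_right ?_ _
    set Y0 := ∫⁻ t, ofReal (g t ^ p) with hY0
    have k3 : ∀ a, Y a ≤ Y0 := fun a => lintegral_mono fun t => ofReal_le_ofReal (Real.rpow_le_rpow (hF0 a t) (indicator_le_self' (fun x _ => hg0 x) t) hp0.le)
    have k4 : ∀ x : ℝ≥0∞, x^m = x^(m-1) * x := fun x => by
      conv_lhs => rw [show m = (m-1) + 1 by ring, ENNReal.rpow_add_of_nonneg _ _ (by linarith) zero_le_one, ENNReal.rpow_one]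
    calc ∑' a, Y a ^ m ≤ ∑' a, Y0^(m-1) * Y a := ENNReal.tsum_le_tsum fun a => by rw [k4]; exact mul_le_mul_left (ENNReal.rpow_le_rpow (k3 a) (by linarith)) _
      _ = Y0^(m-1) * ∑' a, Y a := ENNReal.tsum_mul_left
      _ ≤ Y0^(m-1) * (1681 * Y0) := mul_le_mul_right (bx_sum hg.measurable hp0) _
      _ = _ := by rw [k4]; ring

end Op
theorem smooth_d {f : ℝ → ℝ} (h : ContDiff ℝ (⊤ : ℕ∞) f) : (∀ x, HasDerivAt f (deriv f x) x) ∧ ContDiff ℝ (⊤ : ℕ∞) (deriv f) := by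
  rw [contDiff_infty_iff_deriv] at h
  exact ⟨fun x => (h.1 x).hasDerivAt, h.2⟩

theorem bdd1 {f : ℝ → ℝ} (h : Continuous f) (hs : ∀ t, 1 < |t| → f t = 0) : ∃ M, 0 ≤ M ∧ ∀ t, |f t| ≤ M := by
  obtain ⟨M, hM⟩ := (isCompact_Icc (a := (-1:ℝ)) (b := 1)).exists_bound_of_continuousOn h.continuousOn
  refine ⟨|M|, abs_nonneg _, fun t => ?_⟩
  by_cases ht : 1 < |t|
  · rw [hs t ht, abs_zero]; exact abs_nonneg _
  · exact (hM t (abs_le.1 (not_lt.1 ht))).trans (le_abs_self _)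

theorem ev {F : ℝ → ℝ → ℝ} (hF : Continuous (Function.uncurry F)) {S : Set ℝ} (hS : IsCompact S) {lo hi : ℝ} (h : ∀ v ∈ S, lo < F v 0 ∧ F v 0 < hi) :
    ∀ᶠ r in nhds (0:ℝ), ∀ v ∈ S, lo < F v r ∧ F v r < hi := by
  refine hS.eventually_forall_of_forall_eventually (P := fun r v => lo < F v r ∧ F v r < hi) fun v hv => ?_
  have hc : Continuous (fun z : ℝ × ℝ => F z.2 z.1) := hF.comp continuous_swap
  exact (hc.tendsto (0, v)).eventually (Ioo_mem_nhds (h v hv).1 (h v hv).2)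

theorem bump_exists : ∃ (Φ Ψ0 ψ1 : ℝ → ℝ) (M κ : ℝ), Bump Φ M ∧ 0 < κ ∧ (∀ t, HasDerivAt Ψ0 (κ * (2 * Φ (2*t) - Φ t)) t) ∧
    (∀ t, HasDerivAt (fun t => κ * (2 * Φ (2*t) - Φ t)) (ψ1 t) t) ∧ Continuous ψ1 ∧ (∀ t, |Ψ0 t| ≤ 1) ∧ (∀ t, |κ * (2 * Φ (2*t) - Φ t)| ≤ 1) ∧ (∀ t, |ψ1 t| ≤ 1) ∧
    (∀ t, 1 < |t| → Ψ0 t = 0) ∧ (∀ t, 1 < |t| → κ * (2 * Φ (2*t) - Φ t) = 0) ∧ (∀ t, 1 < |t| → ψ1 t = 0) := by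
  set f : ContDiffBump (0:ℝ) := ⟨1/2, 1, by norm_num, by norm_num⟩
  set Φ : ℝ → ℝ := f.normed volume with hΦ
  obtain ⟨d1, c1⟩ := smooth_d (f := Φ) f.contDiff_normed
  have cΦ : Continuous Φ := f.continuous_normed
  have cΦ' := c1.continuous
  have s0 : ∀ t, 1 < |t| → Φ t = 0 := by
    intro t ht
    by_contra h
    have : t ∈ Function.support (f.normed volume) := h
    rw [f.support_normed_eq, mem_ball_zero_iff, Real.norm_eq_abs] at this
    linarith
  have s1 : ∀ t, 1 < |t| → deriv Φ t = 0 := by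
    intro t ht
    have : Φ =ᶠ[nhds t] fun _ => 0 := by
      filter_upwards [(isOpen_lt continuous_const continuous_abs).mem_nhds (show t ∈ {t : ℝ | 1 < |t|} from ht)] with s hs using s0 s hs
    rw [this.deriv_eq, deriv_const]
  have h2 : ∀ t : ℝ, 1 < |t| → 1 < |2*t| := fun t ht => by rw [abs_mul, abs_two]; linarith
  have sA : ∀ t, 1 < |t| → (∫ x in (0:ℝ)..(2*t), Φ x) - ∫ x in (0:ℝ)..t, Φ x = 0 := by
    intro t ht
    rw [intervalIntegral.integral_interval_sub_left (cΦ.intervalIntegrable _ _) (cΦ.intervalIntegrable _ _)]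
    refine intervalIntegral.integral_zero_ae (Filter.Eventually.of_forall fun x hx => s0 x ?_)
    rcases lt_abs.1 ht with h | h
    · rw [uIoc_of_le (by linarith)] at hx; exact lt_abs.2 (Or.inl (by linarith [hx.1]))
    · rw [uIoc_of_ge (by linarith)] at hx
      rcases hx.2.lt_or_eq with h' | h'
      · exact lt_abs.2 (Or.inr (by linarith))
      · rw [h']; exact ht
  have dA : ∀ t, HasDerivAt (fun t => (∫ x in (0:ℝ)..(2*t), Φ x) - ∫ x in (0:ℝ)..t, Φ x) (2 * Φ (2*t) - Φ t) t := by
    intro t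
    have i1 := (cΦ.integral_hasStrictDerivAt 0 (2*t)).hasDerivAt.comp t ((hasDerivAt_id t).const_mul 2)
    have i2 := (cΦ.integral_hasStrictDerivAt 0 t).hasDerivAt
    exact (i1.fun_sub i2).congr_deriv (by simp; ring)
  have dB : ∀ t, HasDerivAt (fun t => 2 * Φ (2*t) - Φ t) (4 * deriv Φ (2*t) - deriv Φ t) t := by
    intro t
    have i1 := ((d1 (2*t)).comp t ((hasDerivAt_id t).const_mul 2)).const_mul 2
    exact (i1.fun_sub (d1 t)).congr_deriv (by simp; ring)
  obtain ⟨M, hM0, hM⟩ := bdd1 cΦ s0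
  obtain ⟨M0, h00, h0⟩ := bdd1 (continuous_iff_continuousAt.2 fun t => (dA t).continuousAt) sA
  obtain ⟨M1, h10, h1⟩ := bdd1 (f := fun t => 2 * Φ (2*t) - Φ t) (by fun_prop) (fun t ht => by rw [s0 t ht, s0 _ (h2 t ht)]; ring)
  obtain ⟨M2, h20, h2'⟩ := bdd1 (f := fun t => 4 * deriv Φ (2*t) - deriv Φ t) (by fun_prop) (fun t ht => by rw [s1 t ht, s1 _ (h2 t ht)]; ring)
  set κ := 1/(1+M0+M1+M2) with hκ
  have hκ0 : 0 < κ := by positivity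
  have hb : ∀ x N, |x| ≤ N → N ≤ 1+M0+M1+M2 → |κ*x| ≤ 1 := by
    intro x N hx hN
    rw [abs_mul, abs_of_pos hκ0, hκ, one_div, inv_mul_le_one₀ (by positivity)]
    linarith
  refine ⟨Φ, fun t => κ * ((∫ x in (0:ℝ)..(2*t), Φ x) - ∫ x in (0:ℝ)..t, Φ x), fun t => κ * (4 * deriv Φ (2*t) - deriv Φ t), M, κ,
    ⟨cΦ, fun t => f.nonneg_normed t, fun t => (le_abs_self _).trans (hM t), s0, f.integral_normed⟩, hκ0, fun t => (dA t).const_mul κ, fun t => (dB t).const_mul κ,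
    by fun_prop, fun t => hb _ _ (h0 t) (by linarith), fun t => hb _ _ (h1 t) (by linarith), fun t => hb _ _ (h2' t) (by linarith),
    fun t ht => by simp only [sA t ht, mul_zero], fun t ht => by rw [s0 t ht, s0 _ (h2 t ht)]; ring, fun t ht => by simp only [s1 t ht, s1 _ (h2 t ht)]; ring⟩

theorem cut_exists : ∃ k k1 k2 k3 : ℝ → ℝ, (∀ v, HasDerivAt k (k1 v) v) ∧ (∀ v, HasDerivAt k1 (k2 v) v) ∧ (∀ v, HasDerivAt k2 (k3 v) v) ∧ Continuous k3 ∧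
    (∀ v ∈ Icc (1/2:ℝ) 2, k v = v^2 ∧ k1 v = 2*v ∧ k2 v = 2) ∧ ∀ v, v ∉ Icc (-4:ℝ) 4 → k v = 0 ∧ k1 v = 0 ∧ k2 v = 0 ∧ k3 v = 0 := by
  set f : ContDiffBump (0:ℝ) := ⟨3, 4, by norm_num, by norm_num⟩ with hf
  set k : ℝ → ℝ := fun v => f v * v^2 with hk
  have hks : ContDiff ℝ (⊤:ℕ∞) k := f.contDiff.mul (contDiff_id.pow 2)
  obtain ⟨d1, c1⟩ := smooth_d hks
  obtain ⟨d2, c2⟩ := smooth_d c1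
  obtain ⟨d3, c3⟩ := smooth_d c2
  refine ⟨k, deriv k, deriv (deriv k), deriv (deriv (deriv k)), d1, d2, d3, c3.continuous, fun v hv => ?_, fun v hv => ?_⟩
  · have e : k =ᶠ[nhds v] fun v => v^2 := by
      filter_upwards [Ioo_mem_nhds (show -3 < v by linarith [hv.1]) (show v < 3 by linarith [hv.2])] with x hx
      simp only [hk]
      rw [f.one_of_mem_closedBall (by rw [mem_closedBall_zero_iff, Real.norm_eq_abs]; exact abs_le.2 ⟨hx.1.le, hx.2.le⟩), one_mul]
    have e1 : deriv k =ᶠ[nhds v] fun v => 2*v := e.deriv.trans (Filter.Eventually.of_forall fun x => by simp)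
    refine ⟨e.eq_of_nhds, e1.eq_of_nhds, ?_⟩
    rw [e1.deriv_eq]; exact ((hasDerivAt_id v).const_mul 2).deriv.trans (mul_one 2)
  · have e : k =ᶠ[nhds v] fun _ => 0 := by
      filter_upwards [(isClosed_Icc.isOpen_compl).mem_nhds hv] with x hx
      simp only [hk]
      rw [f.zero_of_le_dist, zero_mul]
      rw [Real.dist_eq, sub_zero]
      by_contra h
      exact hx (abs_le.1 (le_of_lt (not_le.1 h)))
    have e1 : deriv k =ᶠ[nhds v] fun _ => 0 := e.deriv.trans (Filter.Eventually.of_forall fun x => by simp)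
    have e2 : deriv (deriv k) =ᶠ[nhds v] fun _ => 0 := e1.deriv.trans (Filter.Eventually.of_forall fun x => by simp)
    refine ⟨e.eq_of_nhds, e1.eq_of_nhds, e2.eq_of_nhds, ?_⟩
    rw [e2.deriv_eq]; simp

set_option maxHeartbeats 1000000 in
theorem op_exists {ρ : ℝ → ℝ} (hρ : ContDiff ℝ (⊤:ℕ∞) ρ) (h0 : ρ 0 = 0) (h1 : deriv ρ 0 = 1) : ∃ (c B : ℝ) (O P : Op c B) (Φ : ℝ → ℝ) (M κ : ℝ),
    Bump Φ M ∧ Op.Sharp O P ∧ 0 < κ ∧ (∀ t, O.ψ t = κ * (2 * Φ (2*t) - Φ t)) ∧ ∀ v ∈ Icc (1/2:ℝ) 2, ∀ r, O.G v r = v^2 * (1 + ρ (r*v)) := by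
  obtain ⟨Φ, Ψ0, ψ1, M, κ, bb, hκ, b1, b2, b3, b4, b5, b6, b7, b8, b9⟩ := bump_exists
  obtain ⟨k, k1, k2, k3, dk, dk1, dk2, ck3, kin, kout⟩ := cut_exists
  obtain ⟨d0, s1⟩ := smooth_d hρ
  obtain ⟨d1, s2⟩ := smooth_d s1
  obtain ⟨d2, s3⟩ := smooth_d s2
  set ρ1 := deriv ρ
  set ρ2 := deriv ρ1
  set ρ3 := deriv ρ2
  have cρ := hρ.continuous
  have cρ1 := s1.continuous
  have cρ2 := s2.continuous
  have cρ3 := s3.continuous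
  have ck : Continuous k := continuous_iff_continuousAt.2 fun v => (dk v).continuousAt
  have ck1 : Continuous k1 := continuous_iff_continuousAt.2 fun v => (dk1 v).continuousAt
  have ck2 : Continuous k2 := continuous_iff_continuousAt.2 fun v => (dk2 v).continuousAt
  have Rv : ∀ {f f' : ℝ → ℝ}, (∀ x, HasDerivAt f (f' x) x) → ∀ v r, HasDerivAt (fun v => f (r*v)) (r * f' (r*v)) v := fun hf v r =>
    ((hf (r*v)).comp v ((hasDerivAt_id v).const_mul r)).congr_deriv (by simp; ring)
  have Rr : ∀ {f f' : ℝ → ℝ}, (∀ x, HasDerivAt f (f' x) x) → ∀ v r, HasDerivAt (fun r => f (r*v)) (v * f' (r*v)) r := fun hf v r =>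
    ((hf (r*v)).comp r ((hasDerivAt_id r).mul_const v)).congr_deriv (by simp; ring)
  set G : ℝ → ℝ → ℝ := fun v r => v^2 + k v * ρ (r*v) with hG
  set Gv : ℝ → ℝ → ℝ := fun v r => 2*v + (k1 v * ρ (r*v) + k v * (r * ρ1 (r*v))) with hGv
  set Gr : ℝ → ℝ → ℝ := fun v r => k v * (v * ρ1 (r*v)) with hGr
  set Gvv : ℝ → ℝ → ℝ := fun v r => 2 + (k2 v * ρ (r*v) + 2 * (k1 v * (r * ρ1 (r*v))) + k v * (r * (r * ρ2 (r*v)))) with hGvv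
  set Gvr : ℝ → ℝ → ℝ := fun v r => k1 v * (v * ρ1 (r*v)) + k v * (ρ1 (r*v) + r * (v * ρ2 (r*v))) with hGvr
  set Grr : ℝ → ℝ → ℝ := fun v r => k v * (v * (v * ρ2 (r*v))) with hGrr
  set Gvvv : ℝ → ℝ → ℝ := fun v r => k3 v * ρ (r*v) + 3 * (k2 v * (r * ρ1 (r*v))) + 3 * (k1 v * (r * (r * ρ2 (r*v)))) + k v * (r * (r * (r * ρ3 (r*v)))) with hGvvv
  set Gvvr : ℝ → ℝ → ℝ := fun v r => k2 v * (v * ρ1 (r*v)) + 2 * (k1 v * (ρ1 (r*v) + r * (v * ρ2 (r*v)))) + k v * (2 * (r * ρ2 (r*v)) + r * (r * (v * ρ3 (r*v)))) with hGvvr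
  set Gvrr : ℝ → ℝ → ℝ := fun v r => k1 v * (v * (v * ρ2 (r*v))) + k v * (2 * (v * ρ2 (r*v)) + r * (v * (v * ρ3 (r*v)))) with hGvrr
  have cG : Continuous (Function.uncurry G) := by simp only [hG, Function.uncurry_def]; fun_prop
  have cGv : Continuous (Function.uncurry Gv) := by simp only [hGv, Function.uncurry_def]; fun_prop
  have cGr : Continuous (Function.uncurry Gr) := by simp only [hGr, Function.uncurry_def]; fun_prop
  have cGvv : Continuous (Function.uncurry Gvv) := by simp only [hGvv, Function.uncurry_def]; fun_prop
  have cGvr : Continuous (Function.uncurry Gvr) := by simp only [hGvr, Function.uncurry_def]; fun_prop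
  have cGrr : Continuous (Function.uncurry Grr) := by simp only [hGrr, Function.uncurry_def]; fun_prop
  have cGvvv : Continuous (Function.uncurry Gvvv) := by simp only [hGvvv, Function.uncurry_def]; fun_prop
  have cGvvr : Continuous (Function.uncurry Gvvr) := by simp only [hGvvr, Function.uncurry_def]; fun_prop
  have cGvrr : Continuous (Function.uncurry Gvrr) := by simp only [hGvrr, Function.uncurry_def]; fun_prop
  have hI := isCompact_Icc (a := (1/2:ℝ)) (b := 2)
  have hJ := isCompact_Icc (a := (-4:ℝ)) (b := 4)
  have e1 := ev cGvv hJ (lo := 1) (hi := 3) (fun v _ => by simp [hGvv, h0]; norm_num)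
  have e2 := ev cGvvv hJ (lo := -(1/100)) (hi := 1/100) (fun v _ => by simp [hGvvv, h0])
  have e3 := ev cG hI (lo := -13) (hi := 13) (fun v hv => by simp only [hG, zero_mul, h0, mul_zero, add_zero]; constructor <;> nlinarith [hv.1, hv.2])
  have e4 := ev cGv hI (lo := -13) (hi := 13) (fun v hv => by simp only [hGv, zero_mul, h0, mul_zero, add_zero]; constructor <;> linarith [hv.1, hv.2])
  have v3 : ∀ v ∈ Icc (1/2:ℝ) 2, 0 ≤ v^2 ∧ v^2 ≤ 4 ∧ 0 ≤ v^2*v ∧ v^2*v ≤ 8 := fun v hv => by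
    have : 0 ≤ v := by linarith [hv.1]
    have h4 : v^2 ≤ 4 := by nlinarith [hv.2]
    exact ⟨by positivity, h4, by positivity, by nlinarith [hv.2]⟩
  have e5 := ev cGr hI (lo := -13) (hi := 13) (fun v hv => by
    obtain ⟨i1, i2, i3⟩ := kin v hv; obtain ⟨j1, j2, j3, j4⟩ := v3 v hv
    simp only [hGr, zero_mul, i1, h1, mul_one]; constructor <;> linarith)
  have e6 := ev cGvr hI (lo := -13) (hi := 13) (fun v hv => by
    obtain ⟨i1, i2, i3⟩ := kin v hv; obtain ⟨j1, j2, j3, j4⟩ := v3 v hv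
    simp only [hGvr, zero_mul, i1, i2, h1, mul_one, add_zero]; constructor <;> nlinarith)
  have e7 := ev cGvvr hI (lo := 2) (hi := 13) (fun v hv => by
    obtain ⟨i1, i2, i3⟩ := kin v hv
    simp only [hGvvr, zero_mul, mul_zero, i2, i3, h1, mul_one, add_zero]; constructor <;> linarith [hv.1, hv.2])
  obtain ⟨ε, hε, he⟩ := Metric.eventually_nhds_iff.1 (e1.and (e2.and (e3.and (e4.and (e5.and (e6.and e7))))))
  set c := min (ε/2) 1 with hc
  have hc0 : 0 < c := by positivity
  have hc1 : c ≤ 1 := min_le_right _ _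
  have he' : ∀ r, |r| ≤ c → _ := fun r hr => he (y := r) (by rw [Real.dist_eq, sub_zero]; exact lt_of_le_of_lt (hr.trans (min_le_left _ _)) (by linarith))
  obtain ⟨B1, hB1⟩ := (hI.prod (isCompact_Icc (a := (-1:ℝ)) (b := 1))).exists_bound_of_continuousOn cGrr.continuousOn
  obtain ⟨B2, hB2⟩ := (hI.prod (isCompact_Icc (a := (-1:ℝ)) (b := 1))).exists_bound_of_continuousOn cGvrr.continuousOn
  have ab : ∀ {x : ℝ}, -13 < x ∧ x < 13 → |x| ≤ 13 := fun h => abs_le.2 ⟨h.1.le, h.2.le⟩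
  have pm : ∀ v r, v ∈ Icc (1/2:ℝ) 2 → |r| ≤ c → (v, r) ∈ Icc (1/2:ℝ) 2 ×ˢ Icc (-1:ℝ) 1 := fun v r hv hr => ⟨hv, abs_le.1 (hr.trans hc1)⟩
  have dGrv : ∀ v r, HasDerivAt (fun v => Gr v r) (Gvr v r) v := fun v r => ((dk v).fun_mul ((hasDerivAt_id' v).fun_mul (Rv d1 v r))).congr_deriv (by simp only [hGvr]; ring)
  let O : Op c (max 13 (max B1 B2)) := {
    G := G, Gv := Gv, Gr := Gr, Gvv := Gvv, Gvr := Gvr, Grr := Grr, Gvvv := Gvvv, Gvvr := Gvvr, Gvrr := Gvrr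
    am := fun _ _ => 1, am' := fun _ _ => 0, ψ := fun t => κ * (2 * Φ (2*t) - Φ t), Ψ := Ψ0
    hc := hc0, hc1 := hc1, hB := le_max_left _ _
    dGv := fun v r => ((hasDerivAt_pow 2 v).fun_add ((dk v).fun_mul (Rv d0 v r))).congr_deriv (by simp only [hGv]; push_cast; ring)
    dGr := fun v r => (((Rr d0 v r).const_mul (k v)).const_add (v^2)).congr_deriv (by simp only [hGr])
    dGvv := fun v r => (((hasDerivAt_id' v).const_mul 2).fun_add (((dk1 v).fun_mul (Rv d0 v r)).fun_add ((dk v).fun_mul ((Rv d1 v r).const_mul r)))).congr_deriv (by simp only [hGvv]; ring)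
    dGvr := fun v r => ((((Rr d0 v r).const_mul (k1 v)).fun_add (((hasDerivAt_id' r).fun_mul (Rr d1 v r)).const_mul (k v))).const_add (2*v)).congr_deriv (by simp only [hGvr]; ring)
    dGrv := dGrv
    dGrr := fun v r => (((Rr d1 v r).const_mul v).const_mul (k v)).congr_deriv (by simp only [hGrr])
    dGvvv := fun v r => (((((dk2 v).fun_mul (Rv d0 v r)).fun_add (((dk1 v).fun_mul ((Rv d1 v r).const_mul r)).const_mul 2)).fun_add ((dk v).fun_mul (((Rv d2 v r).const_mul r).const_mul r))).const_add 2).congr_deriv (by simp only [hGvvv]; ring)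
    dGvvr := fun v r => (((((Rr d0 v r).const_mul (k2 v)).fun_add ((((hasDerivAt_id' r).fun_mul (Rr d1 v r)).const_mul (k1 v)).const_mul 2)).fun_add (((hasDerivAt_id' r).fun_mul ((hasDerivAt_id' r).fun_mul (Rr d2 v r))).const_mul (k v))).const_add 2).congr_deriv (by simp only [hGvvr]; ring)
    dGvrv := fun v r => (((dk1 v).fun_mul ((hasDerivAt_id' v).fun_mul (Rv d1 v r))).fun_add ((dk v).fun_mul ((Rv d1 v r).fun_add (((hasDerivAt_id' v).fun_mul (Rv d2 v r)).const_mul r)))).congr_deriv (by simp only [hGvvr]; ring)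
    dGvrr := fun v r => ((((Rr d1 v r).const_mul v).const_mul (k1 v)).fun_add (((Rr d1 v r).fun_add ((hasDerivAt_id' r).fun_mul ((Rr d2 v r).const_mul v))).const_mul (k v))).congr_deriv (by simp only [hGvrr]; ring)
    cG := cG, cGv := cGv, cGvv := cGvv, cam := continuous_const, cam' := fun _ => continuous_const, dam := fun v _ => hasDerivAt_const v 1
    bGvv := fun v r hr => by
      by_cases hv : v ∈ Icc (-4:ℝ) 4
      · have := (he' r hr).1 v hv; exact ⟨this.1.le, this.2.le⟩
      · obtain ⟨i1, i2, i3, i4⟩ := kout v hv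
        simp only [hGvv, i1, i2, i3, zero_mul, mul_zero, add_zero]; norm_num
    bGvvv := fun v r hr => by
      by_cases hv : v ∈ Icc (-4:ℝ) 4
      · have := (he' r hr).2.1 v hv; exact abs_le.2 ⟨this.1.le, this.2.le⟩
      · obtain ⟨i1, i2, i3, i4⟩ := kout v hv
        simp only [hGvvv, i1, i2, i3, i4, zero_mul, mul_zero, add_zero]; norm_num
    bG := fun v r hv hr => ab ((he' r hr).2.2.1 v hv)
    bGv := fun v r hv hr => ab ((he' r hr).2.2.2.1 v hv)
    bGr := fun v r hv hr => ab ((he' r hr).2.2.2.2.1 v hv)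
    bGvr := fun v r hv hr => ab ((he' r hr).2.2.2.2.2.1 v hv)
    bGvvr := fun v r hv hr => ⟨((he' r hr).2.2.2.2.2.2 v hv).1.le, ((he' r hr).2.2.2.2.2.2 v hv).2.le⟩
    bGrr := fun v r hv hr => (hB1 _ (pm v r hv hr)).trans ((le_max_left _ _).trans (le_max_right _ _))
    bGvrr := fun v r hv hr => (hB2 _ (pm v r hv hr)).trans ((le_max_right _ _).trans (le_max_right _ _))
    bam := fun _ _ _ _ => by norm_num
    bam' := fun _ _ _ _ => by norm_num
    dΨ := b1, cψ := by have := bb.cont; fun_prop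
    bψ := b5, bΨ := b4, sψ := b8, sΨ := b7 }
  let P : Op c (max 13 (max B1 B2)) := { O with
    am := Gr, am' := Gvr, ψ := ψ1, Ψ := fun t => κ * (2 * Φ (2*t) - Φ t), cam := cGr
    cam' := fun r => cGvr.comp (f := fun v : ℝ => (v, r)) (by fun_prop)
    dam := dGrv, bam := O.bGr, bam' := O.bGvr, dΨ := b2, cψ := b3, bψ := b6, bΨ := b5, sψ := b9, sΨ := b8 }
  refine ⟨c, _, O, P, Φ, M, κ, bb, ⟨rfl, rfl, rfl, b2⟩, hκ, fun t => rfl, fun v hv r => ?_⟩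
  change v^2 + k v * ρ (r*v) = _
  rw [(kin v hv).1]; ring

theorem ext_phi {a b : ℝ} (ha : a < 0) (hb : 0 < b) {φ : ℝ → ℝ} (hφ : ContDiffOn ℝ (⊤ : ℕ∞) φ (Ioo a b)) (h0 : φ 0 ≠ 0) (h1 : deriv φ 0 ≠ 0) :
    ∃ (ρ : ℝ → ℝ) (A β δ : ℝ), ContDiff ℝ (⊤:ℕ∞) ρ ∧ ρ 0 = 0 ∧ deriv ρ 0 = 1 ∧ A ≠ 0 ∧ β ≠ 0 ∧ 0 < δ ∧ ∀ x, |x| < δ → φ x = A * (1 + ρ (β*x)) := by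
  set d := min (-a) b with hd
  have hd0 : 0 < d := lt_min (by linarith) hb
  have hda : d ≤ -a := min_le_left _ _
  have hdb : d ≤ b := min_le_right _ _
  set f : ContDiffBump (0:ℝ) := ⟨d/3, d/2, by linarith, by linarith⟩ with hf
  have s1 : ContDiff ℝ (⊤:ℕ∞) (fun x => f x * φ x) := by
    rw [contDiff_iff_contDiffAt]
    intro x
    by_cases hx : x ∈ Ioo a b
    · exact f.contDiffAt.mul (hφ.contDiffAt (Ioo_mem_nhds hx.1 hx.2))
    · have : (fun x => f x * φ x) =ᶠ[nhds x] fun _ => 0 := by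
        have hm : x ∈ {x : ℝ | d/2 < |x|} := by
          show d/2 < |x|
          by_contra h
          rw [not_lt, abs_le] at h
          exact hx ⟨by linarith, by linarith⟩
        filter_upwards [(isOpen_lt continuous_const continuous_abs).mem_nhds hm] with s hs
        rw [f.zero_of_le_dist (by rw [Real.dist_eq, sub_zero]; exact le_of_lt hs), zero_mul]
      exact contDiffAt_const.congr_of_eventuallyEq this
  have e : ∀ x, |x| < d/3 → f x * φ x = φ x := fun x hx => by
    rw [f.one_of_mem_closedBall (by rw [mem_closedBall_zero_iff, Real.norm_eq_abs]; exact hx.le), one_mul]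
  set A := φ 0 with hA
  set β := deriv φ 0 / A with hβ
  have hβ0 : β ≠ 0 := div_ne_zero h1 h0
  have e0 : f 0 * φ 0 = A := e 0 (by simp; linarith)
  refine ⟨fun w => f (w/β) * φ (w/β) / A - 1, A, β, d/3, ?_, ?_, ?_, h0, hβ0, by linarith, fun x hx => ?_⟩
  · exact ((s1.comp (contDiff_id.div_const β)).div_const A).sub contDiff_const
  · simp only [zero_div, e0]; rw [div_self h0, sub_self]
  · have e1 : (fun x => f x * φ x) =ᶠ[nhds 0] φ := by
      filter_upwards [(isOpen_lt continuous_abs continuous_const).mem_nhds (show (0:ℝ) ∈ {x : ℝ | |x| < d/3} by simp; linarith)] with s hs using e s hs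
    have d1 : HasDerivAt (fun x => f x * φ x) (deriv φ 0) (0/β) := by
      rw [zero_div, ← e1.deriv_eq]; exact (smooth_d s1).1 0
    have d2 := ((d1.comp (0:ℝ) ((hasDerivAt_id (0:ℝ)).div_const β)).div_const A).sub_const 1
    refine d2.deriv.trans ?_
    rw [hβ]; field_simp
  · simp only
    rw [mul_div_cancel_left₀ _ hβ0, e x hx]; field_simp; ring

theorem lcv {k : ℝ} (hk : k ≠ 0) (F : ℝ → ℝ≥0∞) (hF : Measurable F) : ∫⁻ x, F x = ofReal |k| * ∫⁻ x, F (k*x) := by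
  have h := lintegral_map (μ := volume) hF (measurable_const_mul k)
  rw [← h, Real.map_volume_mul_left hk, lintegral_smul_measure, smul_eq_mul, ← mul_assoc, ← ofReal_mul (abs_nonneg _), abs_inv,
    mul_inv_cancel₀ (abs_ne_zero.2 hk), ENNReal.ofReal_one, one_mul]

theorem lcv2 {k l : ℝ} (hk : k ≠ 0) (hl : l ≠ 0) (F : ℝ × ℝ → ℝ≥0∞) (hF : Measurable F) :
    ∫⁻ x, F x = ofReal (|k| * |l|) * ∫⁻ x : ℝ × ℝ, F (k*x.1, l*x.2) := by
  rw [Measure.volume_eq_prod, lintegral_prod _ hF.aemeasurable, lintegral_prod _ (by fun_prop), lcv hk _ hF.lintegral_prod_right', ofReal_mul (abs_nonneg _), mul_assoc]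
  congr 1
  rw [← lintegral_const_mul' _ _ ofReal_ne_top]
  exact lintegral_congr fun x => lcv hl _ (by fun_prop)

theorem split0 (F : ℝ → ℝ≥0∞) (hF : Measurable F) {s : ℝ} : ∫⁻ u in {u | |u| < s}, F u ≤ (∫⁻ u in Ioo 0 s, F u) + ∫⁻ u in Ioo 0 s, F (-u) := by
  have hm : MeasurableSet {u : ℝ | |u| < s} := measurableSet_lt measurable_norm measurable_const
  rw [← lintegral_indicator hm, ← lintegral_indicator measurableSet_Ioo, ← lintegral_indicator measurableSet_Ioo,
    ← lintegral_neg_eq_self (μ := volume) (fun u => (Ioo 0 s).indicator (fun u => F (-u)) u), ← lintegral_add_left (hF.indicator measurableSet_Ioo)]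
  refine lintegral_mono_ae ?_
  filter_upwards [compl_mem_ae_iff.2 (measure_singleton (μ := (volume : Measure ℝ)) 0)] with u hu
  have hu : u ≠ 0 := hu
  by_cases h : |u| < s
  · rw [indicator_of_mem (show u ∈ {u : ℝ | |u| < s} from h)]
    rw [abs_lt] at h
    rcases lt_or_gt_of_ne hu with h' | h'
    · rw [indicator_of_mem (s := Ioo 0 s) (a := -u) ⟨by linarith, by linarith⟩, neg_neg]; exact le_add_self
    · rw [indicator_of_mem (s := Ioo 0 s) (a := u) ⟨by linarith, by linarith⟩]; exact le_self_add
  · rw [indicator_of_notMem (show u ∉ {u : ℝ | |u| < s} from h)]; exact zero_le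

theorem piece {c B : ℝ} (O : Op c B) {g : ℝ × ℝ → ℝ} (hg : Continuous g) (hg0 : ∀ t, 0 ≤ g t) (z1 z2 r : ℝ) :
    ∫⁻ v in Ioc (3/4) (3/2), ofReal (g (z1 - v, z2 - O.G v r)) ≤ 8 * ofReal (O.Av g (z1, z2, r)) := by
  have hG : Continuous fun v => g (z1 - v, z2 - O.G v r) := hg.comp ((continuous_const.sub continuous_id).prodMk (continuous_const.sub (O.cGs r)))
  have h0 : ∀ v, 0 ≤ Op.chi 1 1 v := fun v => bs_nonneg _
  rw [show (8:ℝ≥0∞) = ofReal 8 by norm_num]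
  rw [show O.Av g (z1, z2, r) = ∫ v, (Op.chi 1 1 * fun v => g (z1 - v, z2 - O.G v r)) v from rfl]
  rw [ofReal_integral_eq_lintegral_ofReal (((Op.chi_cont 1 1).mul hG).integrable_of_hasCompactSupport Op.chi_cs.mul_right) (Filter.Eventually.of_forall fun v => mul_nonneg (h0 v) (hg0 _)),
    ← lintegral_const_mul' _ _ ofReal_ne_top]
  refine le_trans (setLIntegral_mono' measurableSet_Ioc fun v hv => ?_) (setLIntegral_le_lintegral _ _)
  rw [← ofReal_mul (by norm_num)]
  refine ofReal_le_ofReal ?_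
  have : 1/8 ≤ Op.chi 1 1 v := by
    unfold Op.chi
    refine bs_lower _ ?_ ?_ <;> norm_num <;> linarith [hv.1, hv.2]
  have h1 := hg0 (z1 - v, z2 - O.G v r)
  simp only [Pi.mul_apply]
  nlinarith

theorem dyad (N : ℝ → ℝ≥0∞) (hN : Measurable N) :
    ∫⁻ u in Ioo 0 (3/2), N u ≤ ∑' k : ℕ, ofReal ((1/2)^k) * ∫⁻ v in Ioc (3/4) (3/2), N ((1/2)^k * v) := by
  refine le_trans (lintegral_mono_set (t := ⋃ k : ℕ, Ioc ((1/2)^k * (3/4)) ((1/2)^k * (3/2))) fun u hu => ?_) (le_trans (lintegral_iUnion_le _ _) (ENNReal.tsum_le_tsum fun k => le_of_eq ?_))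
  · obtain ⟨k, h1, h2⟩ := exists_nat_pow_near_of_lt_one (x := u/(3/2)) (y := (1/2:ℝ)) (div_pos hu.1 (by norm_num)) (by rw [div_le_one (by norm_num)]; exact hu.2.le) (by norm_num) (by norm_num)
    rw [lt_div_iff₀ (by norm_num), pow_succ] at h1
    rw [div_le_iff₀ (by norm_num)] at h2
    exact mem_iUnion.2 ⟨k, by linarith, h2⟩
  · have hb : (0:ℝ) < (1/2)^k := by positivity
    rw [← lintegral_indicator measurableSet_Ioc, ← lintegral_indicator measurableSet_Ioc, lcv hb.ne' _ (hN.indicator measurableSet_Ioc), abs_of_pos hb]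
    congr 1
    refine lintegral_congr fun v => ?_
    simp only [indicator, mem_Ioc, mul_lt_mul_iff_right₀ hb, mul_le_mul_iff_right₀ hb]

theorem half {c B : ℝ} {O P : Op c B} {Φ ρ : ℝ → ℝ} {M κ : ℝ} (b : Bump Φ M) (S : Op.Sharp O P) (hκ : 0 < κ) (hψ : ∀ t, O.ψ t = κ * (2 * Φ (2*t) - Φ t))
    (hG : ∀ v ∈ Icc (1/2:ℝ) 2, ∀ r, O.G v r = v^2 * (1 + ρ (r*v))) (hρ : Continuous ρ) {p q : ℝ} (hp : 1 < p) (hpq : p ≤ q) (h2 : q < 2*p) (h3 : 3*(q/p)-1 < q)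
    {A β e : ℝ} (hA : A ≠ 0) (he : e ≠ 0) (hbe : |β| * |e| ≤ c) : ∃ C : ℝ≥0∞, C ≠ ∞ ∧
    ∀ h : ℝ × ℝ → ℝ, Continuous h → HasCompactSupport h → (∀ t, 0 ≤ h t) → ∃ W : ℝ × ℝ → ℝ≥0∞, Measurable W ∧
      (∀ (ω : ℝ × ℝ) τ, 1 ≤ τ → (∫⁻ u in Ioo 0 (3/2), ofReal (h (ω.1 - e*u, ω.2 - A*(e*u)^2*(1+ρ (β*(e*u/τ))))))^q ≤ W ω) ∧
      ∫⁻ ω, W ω ≤ C * (∫⁻ t, ofReal (h t ^ p))^(q/p) := by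
  have hq0 : 0 < q := by linarith
  have hm0 : 0 ≤ q/p := by positivity
  obtain ⟨C, hC, H⟩ := Op.thm2 b S hκ hψ hp hpq h2 h3
  obtain ⟨Cs, hCs, HS⟩ := sumL q 1 hq0 one_pos
  set m := q/p with hm
  set D := |A| * |e|^3 with hD
  have hD0 : 0 < D := by positivity
  set bb : ℕ → ℝ := fun k => (1/2)^k with hbb
  have hb0 : ∀ k, 0 < bb k := fun k => by positivity
  set θ : ℝ := 2^(3*m-2-q) with hθ
  have hθ1 : θ < 1 := Real.rpow_lt_one_of_one_lt_of_neg (by norm_num) (by linarith)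
  have hid : ∀ k : ℕ, 2^((1:ℝ)*k) * (8*bb k)^q * (D * bb k^3) * ((D * bb k^3)⁻¹)^m = (8^q * D * (D⁻¹)^m) * θ^k := by
    intro k
    have e1 : bb k = 2^(-(k:ℝ)) := by rw [Real.rpow_neg (by norm_num), Real.rpow_natCast, ← inv_pow]; norm_num [hbb]
    have e2 : bb k^3 = 2^(-(k:ℝ)*3) := by rw [e1]; exact_mod_cast (Real.rpow_mul_natCast (by norm_num : (0:ℝ) ≤ 2) (-(k:ℝ)) 3).symm
    have e3 : ((bb k^3)⁻¹)^m = 2^((k:ℝ)*3*m) := by rw [e2, ← Real.rpow_neg (by norm_num), ← Real.rpow_mul (by norm_num)]; congr 1; ring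
    have e4 : θ^k = 2^((3*m-2-q)*k) := (Real.rpow_mul_natCast (by norm_num) _ _).symm
    have e5 : (bb k)^q = 2^(-(k:ℝ)*q) := by rw [e1, ← Real.rpow_mul (by norm_num)]
    rw [Real.mul_rpow (by norm_num) (hb0 k).le, mul_inv, Real.mul_rpow (by positivity) (by have := hb0 k; positivity), e3, e2, e4, e5,
      show (3*m-2-q)*(k:ℝ) = 1*k + (-k*q) + (-k*3) + k*3*m by ring, Real.rpow_add (by norm_num), Real.rpow_add (by norm_num), Real.rpow_add (by norm_num)]
    ring
  have hsum : Summable fun k : ℕ => (8^q * D * (D⁻¹)^m) * θ^k := (summable_geometric_of_lt_one (by positivity) hθ1).mul_left _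
  refine ⟨Cs * C * ∑' k : ℕ, ofReal ((8^q * D * (D⁻¹)^m) * θ^k), ENNReal.mul_ne_top (ENNReal.mul_ne_top hCs hC) hsum.tsum_ofReal_ne_top, fun h hh hhs hh0 => ?_⟩
  set ε : ℕ → ℝ := fun k => e * bb k with hε
  have hε0 : ∀ k, ε k ≠ 0 := fun k => mul_ne_zero he (hb0 k).ne'
  set l : ℕ → ℝ := fun k => A * ε k^2 with hl
  have hl0 : ∀ k, l k ≠ 0 := fun k => mul_ne_zero hA (pow_ne_zero _ (hε0 k))
  have hDk : ∀ k, |ε k| * |l k| = D * bb k^3 := fun k => by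
    simp only [hl, hε, abs_mul, abs_pow, abs_of_pos (hb0 k), hD]; ring
  set g : ℕ → ℝ × ℝ → ℝ := fun k t => h (ε k * t.1, l k * t.2) with hg
  have hgc : ∀ k, Continuous (g k) := fun k => by simp only [hg]; fun_prop
  have hgs : ∀ k, HasCompactSupport (g k) := fun k => by
    have := hhs.comp_homeomorph ((Homeomorph.mulLeft₀ _ (hε0 k)).prodCongr (Homeomorph.mulLeft₀ _ (hl0 k)))
    exact this
  choose W hWm hW1 hW2 using fun k => H (g k) (hgc k) (hgs k) fun t => hh0 _
  refine ⟨fun ω => Cs * ∑' k : ℕ, ofReal (2^((1:ℝ)*k)) * (ofReal (8*bb k)^q * W k (ω.1/ε k, ω.2/l k)), ?_, fun ω τ hτ => ?_, ?_⟩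
  · refine Measurable.const_mul (Measurable.tsum fun k => ?_) _
    have := hWm k
    fun_prop
  · have hN : Measurable fun u => ofReal (h (ω.1 - e*u, ω.2 - A*(e*u)^2*(1+ρ (β*(e*u/τ))))) := by
      have : Continuous fun u => h (ω.1 - e*u, ω.2 - A*(e*u)^2*(1+ρ (β*(e*u/τ)))) := by fun_prop
      exact this.measurable.ennreal_ofReal
    refine le_trans (ENNReal.rpow_le_rpow (dyad _ hN) hq0.le) (le_trans (HS _) (mul_le_mul_right (ENNReal.tsum_le_tsum fun k => mul_le_mul_right ?_ _) _))
    set r := β * ε k / τ with hr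
    have hτ0 : 0 < τ := by linarith
    have hrc : |r| ≤ c := by
      rw [hr, abs_div, abs_of_pos hτ0, abs_mul, div_le_iff₀ hτ0]
      have : |ε k| ≤ |e| := by
        simp only [hε, abs_mul, abs_of_pos (hb0 k)]
        exact mul_le_of_le_one_right (abs_nonneg _) (pow_le_one₀ (by norm_num) (by norm_num))
      nlinarith [mul_le_mul_of_nonneg_left this (abs_nonneg β), mul_nonneg (abs_nonneg β) (abs_nonneg e)]
    have h1 := hW1 k (ω.1/ε k, ω.2/l k) r hrc
    have h4 := piece O (hgc k) (fun t => hh0 _) (ω.1/ε k) (ω.2/l k) r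
    refine le_trans (ENNReal.rpow_le_rpow (z := q) (y := ofReal (8*bb k) * ofReal (O.Av (g k) (ω.1/ε k, ω.2/l k, r))) ?_ hq0.le) ?_
    · rw [mul_comm 8, ofReal_mul (hb0 k).le, mul_assoc, show ofReal 8 = 8 by norm_num]
      refine mul_le_mul_right (le_trans (le_of_eq (setLIntegral_congr_fun measurableSet_Ioc fun v hv => ?_)) h4) _
      simp only [hg]
      rw [hG v ⟨by linarith [hv.1], by linarith [hv.2]⟩ r, mul_sub, mul_sub, mul_div_cancel₀ _ (hε0 k), mul_div_cancel₀ _ (hl0 k)]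
      congr 3
      · simp only [hε]; ring
      · simp only [hl, hr, hε]
        rw [show β * (e * ((1/2)^k * v) / τ) = β * (e * bb k) / τ * v by simp only [hbb]; ring]; ring
    · rw [ENNReal.mul_rpow_of_nonneg _ _ hq0.le]
      exact mul_le_mul_right h1 _
  · have hm1 : ∀ k : ℕ, Measurable fun ω : ℝ × ℝ => W k (ω.1/ε k, ω.2/l k) := fun k => by have := hWm k; fun_prop
    rw [lintegral_const_mul' _ _ hCs, lintegral_tsum fun k => (((hm1 k).const_mul _).const_mul _).aemeasurable, mul_assoc, mul_assoc]
    refine mul_le_mul_right ?_ _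
    rw [← ENNReal.tsum_mul_right, ← ENNReal.tsum_mul_left]
    refine ENNReal.tsum_le_tsum fun k => ?_
    have hDp : 0 < D * bb k^3 := by have := hb0 k; positivity
    have hb8 : 0 ≤ 8 * bb k := by linarith [hb0 k]
    have e1 : ∫⁻ ω : ℝ × ℝ, W k (ω.1/ε k, ω.2/l k) = ofReal (D * bb k^3) * ∫⁻ ω, W k ω := by
      rw [lcv2 (hε0 k) (hl0 k) _ (hm1 k), hDk]
      congr 1
      refine lintegral_congr fun x => ?_
      simp only [mul_div_cancel_left₀ _ (hε0 k), mul_div_cancel_left₀ _ (hl0 k)]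
    have e2 : ∫⁻ t, ofReal (g k t ^ p) = ofReal ((D * bb k^3)⁻¹) * ∫⁻ t, ofReal (h t ^ p) := by
      rw [lcv2 (hε0 k) (hl0 k) (fun t => ofReal (h t ^ p)) (hh.measurable.pow_const p).ennreal_ofReal, hDk, ← mul_assoc, ← ofReal_mul (by positivity), inv_mul_cancel₀ hDp.ne', ENNReal.ofReal_one, one_mul]
    rw [lintegral_const_mul' _ _ ofReal_ne_top, lintegral_const_mul' _ _ (by finiteness), e1]
    have e3 := hW2 k
    rw [e2, ENNReal.mul_rpow_of_nonneg _ _ hm0, ENNReal.ofReal_rpow_of_nonneg (by positivity) hm0] at e3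
    rw [ENNReal.ofReal_rpow_of_nonneg hb8 hq0.le, ← hid k, ofReal_mul (p := _ * (D * bb k^3)) (by positivity), ofReal_mul (p := _ * _) (q := D * bb k^3) (by positivity), ofReal_mul (p := 2^((1:ℝ)*k)) (by positivity)]
    refine le_trans (mul_le_mul_right (mul_le_mul_right (mul_le_mul_right e3 _) _) _) (le_of_eq ?_)
    ring

noncomputable def hf (f : ℝ × ℝ × ℝ → ℝ) (R y1 : ℝ) (w : ℝ × ℝ) : ℝ := ∫ s in (-R)..R, |f (y1 - s, w)|

theorem hf_prop {f : ℝ × ℝ × ℝ → ℝ} (hf1 : Continuous f) (hf2 : HasCompactSupport f) {R : ℝ} (hR : 0 < R) (y1 : ℝ) :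
    Continuous (hf f R y1) ∧ HasCompactSupport (hf f R y1) ∧ (∀ w, 0 ≤ hf f R y1 w) ∧
    ∀ w, ofReal (hf f R y1 w) = ∫⁻ s in Icc (-R) R, ‖f (y1 - s, w)‖ₑ := by
  refine ⟨?_, ?_, fun w => ?_, fun w => ?_⟩
  · unfold hf
    exact intervalIntegral.continuous_parametric_intervalIntegral_of_continuous' (f := fun w s => |f (y1 - s, w)|) (by fun_prop) _ _
  · refine HasCompactSupport.intro (hf2.isCompact.image continuous_snd) fun w hw => ?_
    have : ∀ s, f (y1 - s, w) = 0 := fun s => by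
      by_contra h
      exact hw ⟨(y1 - s, w), subset_tsupport _ h, rfl⟩
    simp [hf, this]
  · exact intervalIntegral.integral_nonneg (by linarith) fun s _ => abs_nonneg _
  · have hc : Continuous fun s => |f (y1 - s, w)| := by fun_prop
    unfold hf
    rw [intervalIntegral.integral_of_le (by linarith), ← integral_Icc_eq_integral_Ioc, ofReal_integral_eq_lintegral_ofReal (hc.integrableOn_Icc) (Filter.Eventually.of_forall fun s => abs_nonneg _)]
    exact lintegral_congr fun s => by rw [← Real.norm_eq_abs, ofReal_norm]

theorem fin_est {f : ℝ × ℝ × ℝ → ℝ} (hf1 : Continuous f) (hf2 : HasCompactSupport f) {R p m : ℝ} (hR : 0 < R) (hp : 1 < p) (hm : 1 ≤ m) :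
    ∫⁻ y, (∫⁻ w, ofReal (hf f R y w ^ p))^m ≤ (ofReal (R - -R)^(p-1))^m * ofReal (R - -R) * (∫⁻ x, ‖f x‖ₑ^p)^m := by
  set N : ℝ × ℝ × ℝ → ℝ≥0∞ := fun x => ‖f x‖ₑ^p with hN
  have hNm : Measurable N := hf1.enorm.measurable.pow_const p
  set F : ℝ → ℝ≥0∞ := fun x => ∫⁻ w, N (x, w) with hF
  have hFm : Measurable F := hNm.lintegral_prod_right'
  set Y := ∫⁻ x, N x with hY
  have hYF : ∫⁻ x, F x = Y := by rw [hY, Measure.volume_eq_prod, lintegral_prod _ hNm.aemeasurable]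
  set D := ofReal (R - -R) with hD
  set J : ℝ → ℝ≥0∞ := fun y => ∫⁻ s in Icc (-R) R, F (y - s) with hJ
  have h1 : ∀ y, ∫⁻ w, ofReal (hf f R y w ^ p) ≤ D^(p-1) * J y := by
    intro y
    obtain ⟨_, _, h0, he⟩ := hf_prop hf1 hf2 hR y
    have hm1 : Measurable fun z : (ℝ × ℝ) × ℝ => N (y - z.2, z.1) := by fun_prop
    calc _ ≤ ∫⁻ w, D^(p-1) * ∫⁻ s in Icc (-R) R, N (y - s, w) := lintegral_mono fun w => by
            rw [← ENNReal.ofReal_rpow_of_nonneg (h0 w) (by linarith), he w]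
            refine (jensen _ _ (Continuous.measurable (by fun_prop)) hp.le).trans (le_of_eq ?_)
            rw [Measure.restrict_apply_univ, Real.volume_Icc]
      _ = D^(p-1) * J y := by
            rw [lintegral_const_mul' _ _ (by simp only [hD]; exact ENNReal.rpow_ne_top_of_nonneg (by linarith) ofReal_ne_top), lintegral_lintegral_swap hm1.aemeasurable]
  have h2 : ∀ y, J y ^ m ≤ Y^(m-1) * J y := by
    intro y
    have : J y ≤ Y := by
      refine (setLIntegral_le_lintegral _ _).trans (le_of_eq ?_)
      rw [lintegral_sub_left_eq_self F y, hYF]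
    calc J y ^ m = J y ^ (m-1) * J y := by
          conv_lhs => rw [show m = (m-1)+1 by ring]
          rw [ENNReal.rpow_add_of_nonneg _ _ (by linarith) zero_le_one, ENNReal.rpow_one]
      _ ≤ _ := mul_le_mul_left (ENNReal.rpow_le_rpow this (by linarith)) _
  have hJm : Measurable J := (show Measurable fun z : ℝ × ℝ => F (z.1 - z.2) by fun_prop).lintegral_prod_right'
  have h3 : ∫⁻ y, J y = D * Y := by
    rw [hJ, lintegral_lintegral_swap (show Measurable fun z : ℝ × ℝ => F (z.1 - z.2) by fun_prop).aemeasurable]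
    simp only [lintegral_sub_right_eq_self F, hYF]
    rw [setLIntegral_const, Real.volume_Icc, mul_comm]
  calc _ ≤ ∫⁻ y, (D^(p-1))^m * (Y^(m-1) * J y) := lintegral_mono fun y => by
          refine (ENNReal.rpow_le_rpow (h1 y) (by linarith)).trans ?_
          rw [ENNReal.mul_rpow_of_nonneg _ _ (by linarith)]
          exact mul_le_mul_right (h2 y) _
    _ = (D^(p-1))^m * D * (Y^(m-1) * Y) := by
          rw [lintegral_const_mul _ (hJm.const_mul _), lintegral_const_mul _ hJm, h3]; ring
    _ = _ := by
          congr 1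
          conv_rhs => rw [show m = (m-1)+1 by ring]
          rw [ENNReal.rpow_add_of_nonneg _ _ (by linarith) zero_le_one, ENNReal.rpow_one]

theorem first_step {f : ℝ × ℝ × ℝ → ℝ} (hf1 : Continuous f) (hf2 : HasCompactSupport f) {φ ρ : ℝ → ℝ} (hρ : Continuous ρ) {η : ℝ × ℝ → ℝ} {A β e T R δ H σ τ κ : ℝ}
    (he : 0 < e) (h1σ : 1 ≤ σ) (hσR : σ ≤ R) (h1τ : 1 ≤ τ) (hτT : τ ≤ T) (hκ : κ = τ^2) (hH : ∀ x, ‖η x‖ ≤ H) (hδ : δ = 3*e/(2*T))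
    (hη : ∀ x, η x ≠ 0 → |x.1| < 1 ∧ |x.2| < δ) (hφ : ∀ x, |x| < δ → φ x = A * (1 + ρ (β*x))) (y : ℝ × ℝ × ℝ) :
    ‖∫ x : ℝ × ℝ, f (y.1 - σ * x.1, y.2.1 - τ * x.2, y.2.2 - κ * (x.2^2 * φ x.2)) * η x‖ₑ ≤ ofReal H * (ofReal e *
      ((∫⁻ u in Ioo 0 (3/2), ofReal (hf f R y.1 (y.2.1 - e*u, y.2.2 - A*(e*u)^2*(1+ρ (β*(e*u/τ)))))) +
       ∫⁻ u in Ioo 0 (3/2), ofReal (hf f R y.1 (y.2.1 - (-e)*u, y.2.2 - A*((-e)*u)^2*(1+ρ (β*((-e)*u/τ))))))) := by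
  have hR : 0 < R := by linarith
  have hτ0 : 0 < τ := by linarith
  obtain ⟨hc, -, -, hh⟩ := hf_prop hf1 hf2 hR y.1
  set S : Set ℝ := {x | |x| < δ} with hS
  have hSm : MeasurableSet S := measurableSet_lt measurable_norm measurable_const
  set γ : ℝ → ℝ × ℝ := fun x => (y.2.1 - τ*x, y.2.2 - A*(τ*x)^2*(1+ρ (β*x))) with hγ
  have hγc : Continuous γ := by simp only [hγ]; fun_prop
  have hin : ∀ w, ∫⁻ x in Icc (-1) 1, ‖f (y.1 - σ*x, w)‖ₑ ≤ ofReal (hf f R y.1 w) := by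
    intro w
    rw [hh, ← lintegral_indicator measurableSet_Icc, ← lintegral_indicator measurableSet_Icc, lcv (k := σ) (by linarith) ((Icc (-R) R).indicator _) (Measurable.indicator (Continuous.measurable (by fun_prop)) measurableSet_Icc)]
    refine le_trans (lintegral_mono fun x => ?_) (le_mul_of_one_le_left zero_le (by rw [ENNReal.one_le_ofReal, abs_of_pos (by linarith)]; exact h1σ))
    by_cases hx : x ∈ Icc (-1:ℝ) 1
    swap
    · rw [indicator_of_notMem hx]; exact zero_le
    rw [indicator_of_mem hx, indicator_of_mem]
    exact ⟨by nlinarith [hx.1, hx.2], by nlinarith [hx.1, hx.2]⟩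
  have hK : Measurable fun u => S.indicator (fun x => ofReal (hf f R y.1 (γ x))) u := Measurable.indicator (hc.comp hγc).measurable.ennreal_ofReal hSm
  have hout : ∫⁻ x in S, ofReal (hf f R y.1 (γ x)) ≤ ofReal e * ∫⁻ u in {u | |u| < 3/2}, ofReal (hf f R y.1 (y.2.1 - e*u, y.2.2 - A*(e*u)^2*(1+ρ (β*(e*u/τ))))) := by
    have hk : 0 < e/τ := by positivity
    rw [← lintegral_indicator hSm, ← lintegral_indicator (s := {u : ℝ | |u| < 3/2}) (measurableSet_lt measurable_norm measurable_const), lcv hk.ne' _ hK, abs_of_pos hk]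
    refine mul_le_mul' (ofReal_le_ofReal (div_le_self he.le h1τ)) (lintegral_mono fun u => ?_)
    by_cases hu : e/τ*u ∈ S
    · have hu' : |u| < 3/2 := by
        have hu : |e/τ*u| < δ := hu
        rw [abs_mul, abs_of_pos hk, hδ, lt_div_iff₀ (by linarith), div_mul_eq_mul_div, div_mul_eq_mul_div, div_lt_iff₀ hτ0] at hu
        by_contra hcon
        nlinarith [mul_le_mul (not_lt.1 hcon) hτT (by linarith) (abs_nonneg u)]
      rw [indicator_of_mem hu, indicator_of_mem (show u ∈ {u : ℝ | |u| < 3/2} from hu')]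
      simp only [hγ]
      rw [show τ*(e/τ*u) = e*u by field_simp, show e/τ*u = e*u/τ by ring]
    · rw [indicator_of_notMem hu]; exact zero_le
  have hsp := split0 (s := 3/2) (fun u => ofReal (hf f R y.1 (y.2.1 - e*u, y.2.2 - A*(e*u)^2*(1+ρ (β*(e*u/τ)))))) (Continuous.measurable (by fun_prop)).ennreal_ofReal
  simp only [mul_neg, ← neg_mul] at hsp ⊢
  refine le_trans ?_ (mul_le_mul_right (hout.trans (mul_le_mul_right hsp _)) _)
  have hG : Measurable fun x : ℝ × ℝ => ‖f (y.1 - σ*x.1, γ x.2)‖ₑ := Continuous.measurable (by fun_prop)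
  calc _ ≤ ∫⁻ x : ℝ × ℝ, ‖f (y.1 - σ * x.1, y.2.1 - τ * x.2, y.2.2 - κ * (x.2^2 * φ x.2)) * η x‖ₑ := enorm_integral_le_lintegral_enorm _
    _ ≤ ∫⁻ x in Icc (-1) 1 ×ˢ S, ofReal H * ‖f (y.1 - σ*x.1, γ x.2)‖ₑ := by
        rw [← lintegral_indicator (measurableSet_Icc.prod hSm)]
        refine lintegral_mono fun x => ?_
        by_cases hx : η x = 0
        · simp [hx]
        obtain ⟨h1, h2⟩ := hη x hx
        rw [indicator_of_mem (show x ∈ Icc (-1) 1 ×ˢ S from ⟨abs_le.1 h1.le, h2⟩), enorm_mul, mul_comm, hφ _ h2, hκ]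
        simp only [hγ]
        rw [show τ^2 * (x.2^2*(A*(1+ρ (β*x.2)))) = A*(τ*x.2)^2*(1+ρ (β*x.2)) by ring]
        exact mul_le_mul_left (by rw [← ofReal_norm]; exact ofReal_le_ofReal (hH x)) _
    _ = ofReal H * ∫⁻ x in S, ∫⁻ s in Icc (-1) 1, ‖f (y.1 - σ*s, γ x)‖ₑ := by
        rw [lintegral_const_mul' _ _ ofReal_ne_top, Measure.volume_eq_prod, ← Measure.prod_restrict, lintegral_prod_symm _ hG.aemeasurable]
    _ ≤ _ := mul_le_mul_right (lintegral_mono fun x => hin _) _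

end MS
/-- **Theorem 1.6.**  Let `a₁, a₂, a₃ > 0` with `2a₂ = a₃`, let `I = (a,b)` be a bounded
interval containing `0` and let `φ ∈ C^∞(I)` with `φ(0) ≠ 0` and `φ'(0) ≠ 0`.  Let
`1 < p, q < ∞` satisfy `1/(2p) < 1/q ≤ 1/p` and `1/q > 3/p − 1`.  Then there exists a
neighborhood `U` of the origin of `ℝ²` such that for every smooth cutoff `η` supported in
`U` there is a constant `C = C(p,q,φ,η,a₁,a₂)` with `‖Mf‖_{L^q(ℝ³)} ≤ C ‖f‖_{L^p(ℝ³)}`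
for all `f ∈ C₀^∞(ℝ³)`. -/
theorem maximal_surface_degenerate_Lp_Lq
    (a₁ a₂ a₃ : ℝ) (ha₁ : 0 < a₁) (ha₂ : 0 < a₂) (ha₃ : 0 < a₃) (heq : 2 * a₂ = a₃)
    (a b : ℝ) (ha : a < 0) (hb : 0 < b)
    (φ : ℝ → ℝ) (hφ : ContDiffOn ℝ (⊤ : ℕ∞) φ (Set.Ioo a b))
    (hφ0 : φ 0 ≠ 0) (hφ' : deriv φ 0 ≠ 0)
    (p q : ℝ) (hp : 1 < p) (hq : 1 < q)
    (hpq₁ : 1 / (2 * p) < 1 / q) (hpq₂ : 1 / q ≤ 1 / p) (hpq₃ : 3 / p - 1 < 1 / q) :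
    ∃ U : Set (ℝ × ℝ), IsOpen U ∧ ((0 : ℝ), (0 : ℝ)) ∈ U ∧
      ∀ η : ℝ × ℝ → ℝ, ContDiff ℝ (⊤ : ℕ∞) η → HasCompactSupport η → tsupport η ⊆ U →
      ∃ C > 0, ∀ f : ℝ × ℝ × ℝ → ℝ, ContDiff ℝ (⊤ : ℕ∞) f → HasCompactSupport f →
        eLpNorm (maxOpSurfCurve a₁ a₂ a₃ φ η f) (ENNReal.ofReal q) volume ≤
          ENNReal.ofReal C * eLpNorm f (ENNReal.ofReal p) volume := by
  have hp0 : 0 < p := by linarith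
  have hq0 : 0 < q := by linarith
  have hpq : p ≤ q := (one_div_le_one_div hq0 hp0).1 hpq₂
  have h2 : q < 2*p := (one_div_lt_one_div (by linarith) hq0).1 hpq₁
  have h3 : 3*(q/p)-1 < q := by
    have h := mul_lt_mul_of_pos_right hpq₃ hq0
    have e : 1/q*q = 1 := by field_simp
    have e' : (3/p-1)*q = 3*(q/p)-q := by ring
    linarith
  have hm : 1 ≤ q/p := (one_le_div hp0).2 hpq
  obtain ⟨ρ, A, β, δ, hρ, hρ0, hρ1, hA, hβ, hδ, hφρ⟩ := MS.ext_phi ha hb hφ hφ0 hφ'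
  obtain ⟨c, B, O, P, Φ, M, κ, hb', hS, hκ, hψ, hG⟩ := MS.op_exists hρ hρ0 hρ1
  set T : ℝ := 2^a₂ with hT
  set R : ℝ := 2^a₁ with hR
  have hT0 : 0 < T := by positivity
  have hR0 : 0 < R := by positivity
  have hβ0 : 0 < |β| := abs_pos.2 hβ
  set e := min (c/|β|) (2*T*δ/3) with he
  have he0 : 0 < e := lt_min (div_pos O.hc hβ0) (by positivity)
  have hbe : |β| * |e| ≤ c := by
    rw [abs_of_pos he0, mul_comm, ← le_div_iff₀ hβ0]; exact min_le_left _ _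
  have hde : 3*e/(2*T) ≤ δ := by
    rw [div_le_iff₀ (by positivity)]
    have : e ≤ 2*T*δ/3 := min_le_right _ _
    linarith
  obtain ⟨C1, hC1, H1⟩ := MS.half hb' hS hκ hψ hG hρ.continuous hp hpq h2 h3 hA he0.ne' hbe
  obtain ⟨C2, hC2, H2⟩ := MS.half hb' hS hκ hψ hG hρ.continuous hp hpq h2 h3 (β := β) (e := -e) hA (neg_ne_zero.2 he0.ne') (by rwa [abs_neg])
  refine ⟨{x | |x.1| < 1 ∧ |x.2| < 3*e/(2*T)}, IsOpen.and (isOpen_lt (f := fun x : ℝ × ℝ => |x.1|) (by fun_prop) continuous_const) (isOpen_lt (f := fun x : ℝ × ℝ => |x.2|) (by fun_prop) continuous_const), ⟨by simp, by simp; positivity⟩, fun η hη hηs hηU => ?_⟩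
  obtain ⟨H, hH⟩ := hη.continuous.bounded_above_of_compact_support hηs
  set D : ℝ≥0∞ := (ENNReal.ofReal H * ENNReal.ofReal e)^q * 2^(q-1) with hD
  have hDt : D ≠ ∞ := by
    refine ENNReal.mul_ne_top (ENNReal.rpow_ne_top_of_nonneg hq0.le (by finiteness)) (ENNReal.rpow_ne_top_of_nonneg (by linarith) (by finiteness))
  set L : ℝ≥0∞ := (ENNReal.ofReal (R - -R)^(p-1))^(q/p) * ENNReal.ofReal (R - -R) with hL
  have hLt : L ≠ ∞ := ENNReal.mul_ne_top (ENNReal.rpow_ne_top_of_nonneg (by linarith) (ENNReal.rpow_ne_top_of_nonneg (by linarith) ENNReal.ofReal_ne_top)) ENNReal.ofReal_ne_top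
  set K : ℝ≥0∞ := D * (C1 + C2) * L with hK
  have hKt : K^(1/q) ≠ ∞ := ENNReal.rpow_ne_top_of_nonneg (by positivity) (ENNReal.mul_ne_top (ENNReal.mul_ne_top hDt (ENNReal.add_ne_top.2 ⟨hC1, hC2⟩)) hLt)
  refine ⟨(K^(1/q)).toReal + 1, by positivity, fun f hf hfs => ?_⟩
  have hfc := hf.continuous
  choose W1 hW1 hW1b hW1i using fun y => H1 (MS.hf f R y) (MS.hf_prop hfc hfs hR0 y).1 (MS.hf_prop hfc hfs hR0 y).2.1 (MS.hf_prop hfc hfs hR0 y).2.2.1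
  choose W2 hW2 hW2b hW2i using fun y => H2 (MS.hf f R y) (MS.hf_prop hfc hfs hR0 y).1 (MS.hf_prop hfc hfs hR0 y).2.1 (MS.hf_prop hfc hfs hR0 y).2.2.1
  have key : ∀ y : ℝ × ℝ × ℝ, ‖maxOpSurfCurve a₁ a₂ a₃ φ η f y‖ₑ^q ≤ D * (W1 y.1 y.2 + W2 y.1 y.2) := by
    intro y
    by_cases hV : D * (W1 y.1 y.2 + W2 y.1 y.2) = ∞
    · rw [hV]; exact le_top
    rw [← ENNReal.le_rpow_inv_iff hq0]
    have hVt : (D * (W1 y.1 y.2 + W2 y.1 y.2))^q⁻¹ ≠ ∞ := ENNReal.rpow_ne_top_of_nonneg (by positivity) hV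
    rw [maxOpSurfCurve, Real.enorm_of_nonneg (Real.iSup_nonneg fun t => abs_nonneg _)]
    refine ENNReal.ofReal_le_of_le_toReal (Real.iSup_le (fun t => ?_) ENNReal.toReal_nonneg)
    rw [← ENNReal.ofReal_le_iff_le_toReal hVt, ← Real.norm_eq_abs, ofReal_norm, ENNReal.le_rpow_inv_iff hq0]
    have ht0 : (0:ℝ) ≤ t := by linarith [t.2.1]
    have h1τ : 1 ≤ (t:ℝ)^a₂ := Real.one_le_rpow t.2.1 ha₂.le
    have hfs' := MS.first_step hfc hfs hρ.continuous (A := A) (β := β) (φ := φ) (κ := (t:ℝ)^a₃) he0 (Real.one_le_rpow t.2.1 ha₁.le) (Real.rpow_le_rpow ht0 t.2.2 ha₁.le) h1τ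
      (Real.rpow_le_rpow ht0 t.2.2 ha₂.le) (by rw [← heq, mul_comm]; exact_mod_cast Real.rpow_mul_natCast ht0 a₂ 2) hH rfl (fun x hx => hηU (subset_tsupport _ hx)) (fun x hx => hφρ x (hx.trans_le hde)) y
    refine (ENNReal.rpow_le_rpow hfs' hq0.le).trans ?_
    rw [← mul_assoc, ENNReal.mul_rpow_of_nonneg _ _ hq0.le, hD, mul_assoc]
    exact mul_le_mul_right ((ENNReal.rpow_add_le_mul_rpow_add_rpow _ _ hq.le).trans (mul_le_mul_right (add_le_add (hW1b _ _ _ h1τ) (hW2b _ _ _ h1τ)) _)) _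
  have hintg : ∫⁻ y, ‖maxOpSurfCurve a₁ a₂ a₃ φ η f y‖ₑ^q ≤ K * (∫⁻ x, ‖f x‖ₑ^p)^(q/p) := by
    refine (lintegral_mono key).trans ?_
    rw [lintegral_const_mul' _ _ hDt, hK, mul_assoc (D * (C1 + C2)) L, mul_assoc D (C1 + C2), Measure.volume_eq_prod]
    refine mul_le_mul_right (le_trans (lintegral_prod_le (μ := (volume : Measure ℝ)) (ν := (volume : Measure (ℝ × ℝ))) fun y => W1 y.1 y.2 + W2 y.1 y.2) ?_) _
    refine le_trans (lintegral_mono fun y => ?_) ((lintegral_const_mul' (C1+C2) _ (ENNReal.add_ne_top.2 ⟨hC1, hC2⟩)).le.trans (mul_le_mul_right (MS.fin_est hfc hfs hR0 hp hm) _))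
    rw [lintegral_add_left (hW1 y), add_mul]
    exact add_le_add (hW1i y) (hW2i y)
  rw [eLpNorm_eq_lintegral_rpow_enorm_toReal (by simpa using hq0) ENNReal.ofReal_ne_top, eLpNorm_eq_lintegral_rpow_enorm_toReal (by simpa using hp0) ENNReal.ofReal_ne_top,
    ENNReal.toReal_ofReal hq0.le, ENNReal.toReal_ofReal hp0.le]
  refine (ENNReal.rpow_le_rpow hintg (by positivity)).trans ?_
  rw [ENNReal.mul_rpow_of_nonneg _ _ (by positivity), ← ENNReal.rpow_mul, show q/p*(1/q) = 1/p by field_simp]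
  refine mul_le_mul_left ?_ _
  exact (ENNReal.ofReal_toReal hKt).symm.le.trans (ENNReal.ofReal_le_ofReal (by linarith))
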